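/- Let ρ: Γ×ℂⁿ×I → [0,∞) and S(z,τ) be C⁶, where I is an open interval in ℝ, and suppose for every τ ∈ I the function ρ^τ(z,w) = ρ(z,w,τ) satisfies condition (3) with respect to S^τ(z) = S(z,τ). Suppose there exists m ≥ 1 which for all τ ∈ I is the least positive integer such that δ_{ρ^τ_m} < δ_{ρ^τ}, and suppose for all τ ∈ I that z^m S^τ(z) is in A(Δ) but z^{m−1} S^τ(z) is not. If H(τ) denotes the solution to the H^∞ control problem for ρ^τ, then H: I → H^{1,2}(Δ)ⁿ and τ ↦ γ_{ρ^τ} are C¹ functions of τ. -/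

import Mathlib

open Complex Metric MeasureTheory Filter Set

noncomputable section

/-- The unit circle `Γ` in `ℂ`. -/
def Circ : Set ℂ := Metric.sphere (0 : ℂ) 1

/-- The closed unit disk `Δ` in `ℂ`. -/
def Disk : Set ℂ := Metric.closedBall (0 : ℂ) 1

/-- The Euclidean norm on `ℂⁿ`. -/
def euclNorm {n : ℕ} (w : Fin n → ℂ) : ℝ := Real.sqrt (∑ j, Complex.normSq (w j))

/-- The complex partial derivative `∂g/∂wⱼ` of a real-valued function `g` on `ℂⁿ`. -/
def wderiv {n : ℕ} (g : (Fin n → ℂ) → ℝ) (w : Fin n → ℂ) (j : Fin n) : ℂ :=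
  (((fderiv ℝ g w) (Pi.single j 1) : ℝ) - Complex.I * ((fderiv ℝ g w) (Pi.single j Complex.I) : ℝ)) / 2

/-- The affine complex tangent plane at `p` to the level set of `g` through `p`. -/
def TangentPlane {n : ℕ} (g : (Fin n → ℂ) → ℝ) (p : Fin n → ℂ) : Set (Fin n → ℂ) :=
  {w | ∑ j, (w j - p j) * wderiv g p j = 0}

/-- `ρ` is strictly hypoconvex on a subset `U` of `Γ × ℂⁿ`: on every compact subset
there is `𝒦 > 0` such that the real Hessian in `w` is `≥ 𝒦‖u‖²` on complex tangent
vectors `u` of the fibers. -/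
def StrictHypoconvexOn {n : ℕ} (ρ : ℂ → (Fin n → ℂ) → ℝ) (U : Set (ℂ × (Fin n → ℂ))) : Prop :=
  ∀ C : Set (ℂ × (Fin n → ℂ)), C ⊆ U → IsCompact C →
    ∃ K0 > (0:ℝ), ∀ p ∈ C, ∀ u : Fin n → ℂ,
      (∑ j, u j * wderiv (ρ p.1) p.2 j) = 0 →
      K0 * (euclNorm u)^2 ≤ iteratedFDeriv ℝ 2 (ρ p.1) p.2 ![u, u]

/-- Two subsets of real normed spaces are (C⁶-)diffeomorphic: there are C⁶ maps on
open neighborhoods carrying one onto the other, inverse to each other on the sets. -/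
def DiffeomorphicSets {E F : Type*} [NormedAddCommGroup E] [NormedSpace ℝ E]
    [NormedAddCommGroup F] [NormedSpace ℝ F] (A : Set E) (B : Set F) : Prop :=
  ∃ (U : Set E) (V : Set F) (f : E → F) (g : F → E),
    IsOpen U ∧ IsOpen V ∧ A ⊆ U ∧ B ⊆ V ∧
    ContDiffOn ℝ 6 f U ∧ ContDiffOn ℝ 6 g V ∧
    Set.MapsTo f A B ∧ Set.MapsTo g B A ∧
    (∀ x ∈ A, g (f x) = x) ∧ (∀ y ∈ B, f (g y) = y)

/-- Condition (3) of the paper, for `ρ` with respect to `R` and `S`. -/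
structure Cond3 (n : ℕ) (ρ : ℂ → (Fin n → ℂ) → ℝ) (R : ℝ) (S : ℂ → Fin n → ℂ) : Prop where
  hn : 2 ≤ n
  nonneg : ∀ z ∈ Circ, ∀ w, 0 ≤ ρ z w
  cont : ContinuousOn (fun p : ℂ × (Fin n → ℂ) => ρ p.1 p.2) {p | p.1 ∈ Circ}
  smooth : ContDiffOn ℝ 6 (fun p : ℂ × (Fin n → ℂ) => ρ p.1 p.2)
      {p | p.1 ∈ Circ ∧ ρ p.1 p.2 ≠ 0}
  hR : 1 < R
  grad_ne : ∀ z ∈ Circ, ∀ w, 0 < ρ z w → ρ z w ≤ R → fderiv ℝ (ρ z) w ≠ 0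
  hypo : StrictHypoconvexOn ρ {p | p.1 ∈ Circ ∧ ρ p.1 p.2 ≠ 0}
  levelCompact : ∀ t : ℝ, 0 < t → t ≤ R →
      IsCompact {p : ℂ × (Fin n → ℂ) | p.1 ∈ Circ ∧ ρ p.1 p.2 = t}
  fiberSphere : ∀ t : ℝ, 0 < t → t ≤ R → ∀ z ∈ Circ,
      DiffeomorphicSets {w | ρ z w = t} (Metric.sphere (0 : EuclideanSpace ℂ (Fin n)) 1)
  levelR : ∀ z ∈ Circ, ∀ w, ρ z w = R ↔ euclNorm w = R
  aboveR : ∀ z ∈ Circ, ∀ w, R < euclNorm w → R < ρ z w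
  Scont : ContinuousOn S Circ
  Ssmall : ∀ z ∈ Circ, euclNorm (S z) < R
  Szero : ∀ z ∈ Circ, ∀ w, ρ z w = 0 ↔ w = S z

/-- The `j`-th Fourier coefficient of the boundary values of `f` on the circle. -/
def bCoeff (f : ℂ → ℂ) (j : ℤ) : ℂ :=
  (1 / (2 * Real.pi) : ℂ) * ∫ θ in (0:ℝ)..(2 * Real.pi),
    f (Complex.exp (↑θ * Complex.I)) * Complex.exp (-(j : ℂ) * ↑θ * Complex.I)

/-- The Hilbert space `ℓ²(ℤ)` used to represent `W^{1,2}(Γ)`. -/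
abbrev Seq2 : Type := lp (fun _ : ℤ => ℂ) 2

/-- `a ∈ ℓ²(ℤ)` is the (weighted) Fourier coefficient representation of `f` in the
Sobolev space `W^{1,2}(Γ)`; the weight `√(1+j²)` makes the `ℓ²` norm of `a`
equivalent to the `W^{1,2}` norm of `f`. -/
def RepOf (a : Seq2) (f : ℂ → ℂ) : Prop :=
  ∀ j : ℤ, (a : ∀ _ : ℤ, ℂ) j = (Real.sqrt (1 + (j:ℝ)^2) : ℂ) * bCoeff f j

/-- Membership in `H^{1,2}(Δ) = H²(Δ) ∩ W^{1,2}(Γ)` (whose elements extend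
continuously to the closed disk). -/
def MemH12 (f : ℂ → ℂ) : Prop :=
  ContinuousOn f Disk ∧ DifferentiableOn ℂ f (Metric.ball (0:ℂ) 1) ∧ ∃ a : Seq2, RepOf a f

/-- Membership in the disk algebra `A(Δ)`. -/
def MemA (f : ℂ → ℂ) : Prop :=
  ContinuousOn f Disk ∧ DifferentiableOn ℂ f (Metric.ball (0:ℂ) 1)

/-- Membership in `H^∞(Δ)`. -/
def MemHinf (f : ℂ → ℂ) : Prop :=
  DifferentiableOn ℂ f (Metric.ball (0:ℂ) 1) ∧ ∃ M : ℝ, ∀ z ∈ Metric.ball (0:ℂ) 1, ‖f z‖ ≤ M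

/-- `f` is `C^k`-smooth on the circle `Γ`. -/
def CkCirc (k : ℕ) (f : ℂ → ℂ) : Prop :=
  ContDiff ℝ k (fun θ : ℝ => f (Complex.exp (↑θ * Complex.I)))

/-- `f` is `C⁴`-smooth on the circle `Γ`. -/
def C4Circ (f : ℂ → ℂ) : Prop := CkCirc 4 f

/-- Vector-valued versions. -/
def MemH12V {n : ℕ} (f : ℂ → Fin n → ℂ) : Prop := ∀ j, MemH12 fun z => f z j
def MemAV {n : ℕ} (f : ℂ → Fin n → ℂ) : Prop := ∀ j, MemA fun z => f z j
def MemHinfV {n : ℕ} (f : ℂ → Fin n → ℂ) : Prop := ∀ j, MemHinf fun z => f z j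
def C4CircV {n : ℕ} (f : ℂ → Fin n → ℂ) : Prop := ∀ j, C4Circ fun z => f z j

/-- The coordinates of a point of `ℂ × ℂⁿ` as a point of `ℂ^{n+1}`. -/
def pcoords {n : ℕ} (p : ℂ × (Fin n → ℂ)) : Fin (n+1) → ℂ := Fin.cons p.1 p.2

/-- The polynomial hull of a subset of `ℂ × ℂⁿ ≅ ℂ^{n+1}`. -/
def polyHull {n : ℕ} (Y : Set (ℂ × (Fin n → ℂ))) : Set (ℂ × (Fin n → ℂ)) :=
  {p | ∀ P : MvPolynomial (Fin (n+1)) ℂ, ∀ M : ℝ,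
    (∀ q ∈ Y, ‖MvPolynomial.eval (pcoords q) P‖ ≤ M) → ‖MvPolynomial.eval (pcoords p) P‖ ≤ M}

/-- The polynomial hull of a subset of `ℂⁿ`. -/
def polyHulln {n : ℕ} (Y : Set (Fin n → ℂ)) : Set (Fin n → ℂ) :=
  {w | ∀ P : MvPolynomial (Fin n) ℂ, ∀ M : ℝ,
    (∀ v ∈ Y, ‖MvPolynomial.eval v P‖ ≤ M) → ‖MvPolynomial.eval w P‖ ≤ M}

/-- The coordinates of a point of `ℂ × ℂⁿ × ℂⁿ` as a point of `ℂ^{2n+1}`. -/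
def pcoords2 {n : ℕ} (p : ℂ × ((Fin n → ℂ) × (Fin n → ℂ))) : Fin (n + n + 1) → ℂ :=
  Fin.cons p.1 (Fin.append p.2.1 p.2.2)

/-- The polynomial hull of a subset of `ℂ × ℂⁿ × ℂⁿ ≅ ℂ^{2n+1}`. -/
def polyHull2 {n : ℕ} (Y : Set (ℂ × ((Fin n → ℂ) × (Fin n → ℂ)))) :
    Set (ℂ × ((Fin n → ℂ) × (Fin n → ℂ))) :=
  {p | ∀ P : MvPolynomial (Fin (n + n + 1)) ℂ, ∀ M : ℝ,
    (∀ q ∈ Y, ‖MvPolynomial.eval (pcoords2 q) P‖ ≤ M) → ‖MvPolynomial.eval (pcoords2 p) P‖ ≤ M}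

/-- A subset of `ℂⁿ` is hypoconvex if its complement is a union of complex affine
hyperplanes. -/
def HypoconvexSet {n : ℕ} (A : Set (Fin n → ℂ)) : Prop :=
  ∀ v : Fin n → ℂ, v ∉ A → ∃ (c : Fin n → ℂ) (d : ℂ), c ≠ 0 ∧
    (∑ j, c j * v j) = d ∧ ∀ w ∈ A, (∑ j, c j * w j) ≠ d

/-- `A` has `C^k` boundary: near each boundary point the boundary is the zero set of a
`C^k` function with nonvanishing gradient. -/
def CkBoundary {E : Type*} [NormedAddCommGroup E] [NormedSpace ℝ E] (k : ℕ) (A : Set E) : Prop :=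
  ∀ p ∈ frontier A, ∃ U : Set E, IsOpen U ∧ p ∈ U ∧
    ∃ φ : E → ℝ, ContDiffOn ℝ k φ U ∧ (∀ x ∈ U, fderiv ℝ φ x ≠ 0) ∧
      frontier A ∩ U = {x | φ x = 0} ∩ U

/-- `fb` gives the a.e. radial boundary values on `Γ` of the function `f` on the open disk. -/
def IsBdryVal {n : ℕ} (f fb : ℂ → Fin n → ℂ) : Prop :=
  ∀ᵐ (θ : ℝ) ∂(volume.restrict (Set.Ioc (0:ℝ) (2 * Real.pi))),
    Filter.Tendsto (fun r : ℝ => f ((r : ℂ) * Complex.exp (↑θ * Complex.I)))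
      (nhdsWithin 1 (Set.Iio 1)) (nhds (fb (Complex.exp (↑θ * Complex.I))))

/-- The optimal control `γ_ρ = inf_{f ∈ H^∞(Δ)ⁿ} ess sup_{z ∈ Γ} ρ(z,f(z))`. -/
def gammaRho {n : ℕ} (ρ : ℂ → (Fin n → ℂ) → ℝ) : ℝ :=
  sInf {c : ℝ | ∃ f fb : ℂ → Fin n → ℂ, MemHinfV f ∧ IsBdryVal f fb ∧
    ∀ᵐ (θ : ℝ) ∂(volume.restrict (Set.Ioc (0:ℝ) (2 * Real.pi))),
      ρ (Complex.exp (↑θ * Complex.I)) (fb (Complex.exp (↑θ * Complex.I))) ≤ c}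

/-- `δ_ρ = inf_{f ∈ A(Δ)ⁿ} sup_{z ∈ Γ} ρ(z,f(z))`. -/
def deltaRho {n : ℕ} (ρ : ℂ → (Fin n → ℂ) → ℝ) : ℝ :=
  sInf {c : ℝ | ∃ f : ℂ → Fin n → ℂ, MemAV f ∧ ∀ z ∈ Circ, ρ z (f z) ≤ c}

/-- `ρ_m(z,w) = ρ(z, w/zᵐ)`. -/
def rhoShift {n : ℕ} (ρ : ℂ → (Fin n → ℂ) → ℝ) (m : ℕ) : ℂ → (Fin n → ℂ) → ℝ :=
  fun z w => ρ z (fun j => w j / z ^ m)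

/-- `q` is an `n`-tuple of harmonic polynomials. -/
def HarmPolyTuple {n : ℕ} (q : ℂ → Fin n → ℂ) : Prop :=
  ∃ (d : ℕ) (a b : ℕ → Fin n → ℂ), ∀ z : ℂ, ∀ j,
    q z j = ∑ i ∈ Finset.range (d+1), (a i j * z ^ i + b i j * (starRingEnd ℂ z) ^ i)

/-- `zᵐ q(z)` has analytic polynomial coordinates (as boundary values on `Γ`). -/
def ZmAnalytic {n : ℕ} (m : ℕ) (q : ℂ → Fin n → ℂ) : Prop :=
  ∀ j, ∃ p : Polynomial ℂ, ∀ z ∈ Circ, z ^ m * q z j = Polynomial.eval z p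

/-- The boundary function `q` on `Γ` is analytic, i.e. agrees on `Γ` with an element
of `A(Δ)ⁿ`. -/
def BoundaryAnalytic {n : ℕ} (q : ℂ → Fin n → ℂ) : Prop :=
  ∃ h : ℂ → Fin n → ℂ, MemAV h ∧ ∀ z ∈ Circ, h z = q z

/-- Finite dimensional mountain pass: two strict local minima coincide if every point is either
regular (there is a uniform descent direction) or a strict local minimum. -/
theorem mountain {E : Type*} [NormedAddCommGroup E] [NormedSpace ℝ E] (X : Set E)
    (hXo : IsOpen X) (hXc : Convex ℝ X) (g : E → ℝ) (hg : ContinuousOn g X) (R : ℝ)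
    (hR : ∀ x ∈ X, g x < R) (hcomp : ∀ s < R, IsCompact {x | x ∈ X ∧ g x ≤ s})
    (hdich : ∀ x ∈ X, (∃ e : E, ∃ η > (0:ℝ), ∀ y ∈ ball x η, ∀ s ∈ Ioc (0:ℝ) η, g (y + s • e) < g y) ∨
      (∀ᶠ y in nhdsWithin x {x}ᶜ, g x < g y)) {a b : E} (ha : a ∈ X) (hb : b ∈ X)
    (hamin : ∀ᶠ y in nhdsWithin a {a}ᶜ, g a < g y)
    (hbmin : ∀ᶠ y in nhdsWithin b {b}ᶜ, g b < g y) : a = b := by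
  by_contra hab
  set U : ℝ → Set E := fun s => {x | x ∈ X ∧ g x < s} with hU
  have hUo : ∀ s, IsOpen (U s) := by
    intro s
    exact hg.isOpen_inter_preimage hXo isOpen_Iio
  set J : Set ℝ := {s | ∃ C : Set E, C ⊆ U s ∧ IsPreconnected C ∧ a ∈ C ∧ b ∈ C} with hJ
  have hJmono : ∀ s t, s ∈ J → s ≤ t → t ∈ J := by
    rintro s t ⟨C, h1, h2, h3, h4⟩ hst
    exact ⟨C, fun x hx => ⟨(h1 hx).1, (h1 hx).2.trans_le hst⟩, h2, h3, h4⟩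
  have hJlow : ∀ s ∈ J, g a ≤ s := by
    rintro s ⟨C, h1, h2, h3, h4⟩
    exact (h1 h3).2.le
  have hJbdd : BddBelow J := ⟨g a, hJlow⟩
  -- connected compact sets inside give elements of J
  have hJmk : ∀ (C : Set E) (s : ℝ), IsCompact C → IsPreconnected C → C ⊆ U s → a ∈ C → b ∈ C →
      ∃ t ∈ J, t < s := by
    intro C s hC hCc hCs haC hbC
    obtain ⟨x, hx, hmax⟩ := hC.exists_isMaxOn ⟨a, haC⟩ (hg.mono fun y hy => (hCs hy).1)
    refine ⟨(g x + s) / 2, ⟨C, fun y hy => ⟨(hCs hy).1, ?_⟩, hCc, haC, hbC⟩, ?_⟩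
    · have := hmax hy
      have h2 := (hCs hx).2
      simp only [mem_setOf_eq] at this
      linarith
    · have h2 := (hCs hx).2
      linarith
  have hseg : segment ℝ a b ⊆ U R := fun x hx => by
    have : x ∈ X := hXc.segment_subset ha hb hx
    exact ⟨this, hR x this⟩
  have hsegc : IsCompact (segment ℝ a b) := by
    rw [segment_eq_image_lineMap]
    exact isCompact_Icc.image (AffineMap.lineMap_continuous)
  obtain ⟨s₁, hs₁J, hs₁R⟩ := hJmk (segment ℝ a b) R hsegc (convex_segment a b).isPreconnected
    hseg (left_mem_segment ℝ a b) (right_mem_segment ℝ a b)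
  set σ := sInf J with hσ
  have hσa : g a ≤ σ := le_csInf ⟨s₁, hs₁J⟩ hJlow
  have hσs₁ : σ ≤ s₁ := csInf_le hJbdd hs₁J
  have hσR : σ < R := lt_of_le_of_lt hσs₁ hs₁R
  have hσJ : ∀ s, σ < s → s ∈ J := by
    intro s hs
    obtain ⟨t, ht, hts⟩ := exists_lt_of_csInf_lt ⟨s₁, hs₁J⟩ hs
    exact hJmono t s ht hts.le
  have hσmin : ∀ s ∈ J, σ ≤ s := fun s hs => csInf_le hJbdd hs
  set Ca := connectedComponentIn (U σ) a with hCa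
  have hCaU : Ca ⊆ U σ := connectedComponentIn_subset _ _
  have hCao : IsOpen Ca := (hUo σ).connectedComponentIn
  have hCapre : IsPreconnected Ca := isPreconnected_connectedComponentIn
  have hbCa : b ∉ Ca := by
    intro hbC
    have haU : a ∈ U σ := by
      by_contra h
      rw [hCa, connectedComponentIn_eq_empty h] at hbC
      exact hbC
    have haC : a ∈ Ca := mem_connectedComponentIn haU
    have hpc : IsPathConnected Ca := hCao.isConnected_iff_isPathConnected.1 ⟨⟨a, haC⟩, hCapre⟩
    obtain ⟨γ, hγ⟩ := hpc.joinedIn a haC b hbC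
    obtain ⟨t, ht, htσ⟩ := hJmk (range γ) σ (isCompact_range γ.continuous)
      (isPreconnected_range γ.continuous) (by
        rintro _ ⟨u, rfl⟩
        exact hCaU (hγ u)) ⟨0, γ.source⟩ ⟨1, γ.target⟩
    exact absurd (hσmin t ht) (not_le.2 htσ)
  have hext : ∀ (D : Set E), IsPreconnected D → D ⊆ U σ → (D ∩ Ca).Nonempty → D ⊆ Ca := by
    rintro D hD hDU ⟨x, hxD, hxC⟩
    have h1 : Ca = connectedComponentIn (U σ) x := connectedComponentIn_eq hxC
    rw [h1]
    exact hD.subset_connectedComponentIn hxD hDU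
  set L : Set E := {x | x ∈ X ∧ g x ≤ σ} with hL
  have hLc : IsCompact L := hcomp σ hσR
  have hclL : closure Ca ⊆ L := closure_minimal (fun x hx => ⟨(hCaU hx).1, (hCaU hx).2.le⟩) hLc.isClosed
  -- boundary points
  have hbd : ∀ p ∈ closure Ca, p ∉ Ca → g p = σ ∧ ∃ᶠ q in nhdsWithin p {p}ᶜ, q ∈ Ca ∧ g q < g p := by
    intro p hp hpC
    have hpL := hclL hp
    have hgp : g p = σ := by
      refine le_antisymm hpL.2 ?_
      by_contra hlt
      push Not at hlt
      have hpU : p ∈ U σ := ⟨hpL.1, hlt⟩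
      obtain ⟨η, hη, hball⟩ := Metric.isOpen_iff.1 (hUo σ) p hpU
      obtain ⟨q, hq, hqd⟩ := Metric.mem_closure_iff.1 hp η hη
      have := hext (ball p η) (convex_ball p η).isPreconnected hball
        ⟨q, by rwa [mem_ball, dist_comm], hq⟩
      exact hpC (this (mem_ball_self hη))
    refine ⟨hgp, ?_⟩
    rw [frequently_nhdsWithin_iff]
    have h1 : ∃ᶠ q in nhds p, q ∈ Ca := mem_closure_iff_frequently.1 hp
    refine h1.mono fun q hq => ⟨⟨hq, ?_⟩, ?_⟩
    · rw [hgp]; exact (hCaU hq).2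
    · rintro rfl; exact hpC hq
  set K : Set E := insert a (closure Ca) with hK
  have hKL : K ⊆ L := by
    rintro x (rfl | hx)
    · exact ⟨ha, hσa⟩
    · exact hclL hx
  have hKc : IsCompact K := (hLc.of_isClosed_subset isClosed_closure hclL).insert a
  have hbK : b ∉ K := by
    rintro (h | h)
    · exact hab h.symm
    · obtain ⟨-, h2⟩ := hbd b h hbCa
      have := h2.and_eventually hbmin
      obtain ⟨q, ⟨_, hq1⟩, hq2⟩ := this.exists
      exact absurd hq1 (not_lt.2 hq2.le)
  have hiso : ∀ p ∈ K, ∃ η > (0:ℝ), ball p η ∩ L ⊆ K := by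
    intro p hp
    by_cases hpC : p ∈ Ca
    · obtain ⟨η, hη, hball⟩ := Metric.isOpen_iff.1 hCao p hpC
      exact ⟨η, hη, fun x hx => Or.inr (subset_closure (hball hx.1))⟩
    by_cases hpcl : p ∈ closure Ca
    · obtain ⟨hgp, hfr⟩ := hbd p hpcl hpC
      have hpX := (hclL hpcl).1
      rcases hdich p hpX with ⟨e, η, hη, hdesc⟩ | hmin
      swap
      · obtain ⟨q, ⟨_, hq1⟩, hq2⟩ := (hfr.and_eventually hmin).exists
        exact absurd hq1 (not_lt.2 hq2.le)
      obtain ⟨r, hr, hball⟩ := Metric.isOpen_iff.1 hXo p hpX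
      set s₀ := min η (r / (2 * (‖e‖ + 1))) with hs₀
      have he1 : 0 < 2 * (‖e‖ + 1) := by positivity
      have hs₀pos : 0 < s₀ := lt_min hη (by positivity)
      have hs₀e : s₀ * ‖e‖ < r / 2 := by
        have h1 : s₀ ≤ r / (2 * (‖e‖ + 1)) := min_le_right _ _
        have h2 : s₀ * (2 * (‖e‖ + 1)) ≤ r := by rwa [le_div_iff₀ he1] at h1
        nlinarith [norm_nonneg e]
      have hinX : ∀ y ∈ ball p (r/2), ∀ s ∈ Icc (0:ℝ) s₀, y + s • e ∈ X := by
        intro y hy s hs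
        apply hball
        rw [mem_ball, dist_eq_norm] at *
        have : ‖s • e‖ ≤ s₀ * ‖e‖ := by
          rw [norm_smul, Real.norm_eq_abs, abs_of_nonneg hs.1]
          exact mul_le_mul_of_nonneg_right hs.2 (norm_nonneg _)
        calc ‖y + s • e - p‖ = ‖(y - p) + s • e‖ := by congr 1; abel
          _ ≤ ‖y - p‖ + ‖s • e‖ := norm_add_le _ _
          _ < r := by linarith
      have hp0 : p + s₀ • e ∈ U σ := by
        refine ⟨hinX p (mem_ball_self (by positivity)) s₀ ⟨hs₀pos.le, le_rfl⟩, ?_⟩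
        rw [← hgp]
        exact hdesc p (mem_ball_self hη) s₀ ⟨hs₀pos, min_le_left _ _⟩
      obtain ⟨η₁, hη₁, hball₁⟩ := Metric.isOpen_iff.1 (hUo σ) _ hp0
      set η' := min η₁ (min η (r/2)) with hη'
      have hη'pos : 0 < η' := lt_min hη₁ (lt_min hη (by positivity))
      -- the segment from q together with the ball is connected
      have hconn : ∀ q ∈ ball p η', IsPreconnected ((fun s : ℝ => q + s • e) '' Ioc 0 s₀ ∪ ball (p + s₀ • e) η₁) := by
        intro q hq
        refine IsPreconnected.union (q + s₀ • e) ⟨s₀, ⟨hs₀pos, le_rfl⟩, rfl⟩ ?_ ?_ ?_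
        · rw [mem_ball, dist_add_right]
          exact lt_of_lt_of_le hq (min_le_left _ _)
        · exact isPreconnected_Ioc.image _ (by fun_prop)
        · exact (convex_ball _ _).isPreconnected
      have hsub : ∀ q ∈ ball p η', q ∈ L →
          ((fun s : ℝ => q + s • e) '' Ioc 0 s₀ ∪ ball (p + s₀ • e) η₁) ⊆ U σ := by
        rintro q hq hqL x (⟨s, hs, rfl⟩ | hx)
        · refine ⟨hinX q (ball_subset_ball ((min_le_right _ _).trans (min_le_right _ _)) hq) s ⟨hs.1.le, hs.2⟩, ?_⟩
          exact lt_of_lt_of_le (hdesc q (ball_subset_ball ((min_le_right _ _).trans (min_le_left _ _)) hq) s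
            ⟨hs.1, hs.2.trans (min_le_left _ _)⟩) hqL.2
        · exact hball₁ hx
      have hclose : ∀ q : E, q ∈ closure ((fun s : ℝ => q + s • e) '' Ioc 0 s₀) := by
        intro q
        have h1 : (0:ℝ) ∈ closure (Ioc 0 s₀) := by
          rw [closure_Ioc hs₀pos.ne]; exact ⟨le_rfl, hs₀pos.le⟩
        have h2 := (map_mem_closure (f := fun s : ℝ => q + s • e) (by fun_prop) h1 (mapsTo_image _ _))
        simpa using h2
      -- some q0 in Ca near p
      obtain ⟨q₀, hq₀, hq₀d⟩ := Metric.mem_closure_iff.1 hpcl η' hη'pos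
      have hq₀b : q₀ ∈ ball p η' := by rwa [mem_ball, dist_comm]
      have hq₀L : q₀ ∈ L := hclL (subset_closure hq₀)
      have hballC : ball (p + s₀ • e) η₁ ⊆ Ca := by
        have h1 : IsPreconnected (insert q₀ ((fun s : ℝ => q₀ + s • e) '' Ioc 0 s₀ ∪ ball (p + s₀ • e) η₁)) := by
          refine (hconn q₀ hq₀b).subset_closure (subset_insert _ _) ?_
          refine insert_subset ?_ subset_closure
          exact closure_mono subset_union_left (hclose q₀)
        have h2 := hext _ h1 (insert_subset (hCaU hq₀) (hsub q₀ hq₀b hq₀L)) ⟨q₀, mem_insert _ _, hq₀⟩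
        exact fun x hx => h2 (Or.inr (Or.inr hx))
      refine ⟨η', hη'pos, ?_⟩
      rintro q ⟨hq, hqL⟩
      have h2 := hext _ (hconn q hq) (hsub q hq hqL) ⟨p + s₀ • e, Or.inr (mem_ball_self hη₁), hballC (mem_ball_self hη₁)⟩
      right
      exact closure_mono (fun x hx => h2 (Or.inl hx)) (hclose q)
    · have hpa : p = a := by
        rcases hp with h | h
        · exact h
        · exact absurd h hpcl
      subst hpa
      have hgσ : g p = σ := by
        refine le_antisymm hσa ?_
        by_contra hlt
        push Not at hlt
        exact hpC (mem_connectedComponentIn ⟨ha, hlt⟩)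
      rw [eventually_nhdsWithin_iff] at hamin
      obtain ⟨η, hη, hball⟩ := Metric.eventually_nhds_iff_ball.1 hamin
      refine ⟨η, hη, ?_⟩
      rintro x ⟨hx, hxL⟩
      by_contra hxK
      have hxa : x ≠ p := by rintro rfl; exact hxK (mem_insert _ _)
      have := hball x hx hxa
      rw [hgσ] at this
      exact absurd hxL.2 (not_le.2 this)
  choose! η hηpos hηsub using hiso
  set O : Set E := (⋃ p ∈ K, ball p (η p)) ∩ {b}ᶜ with hO
  have hOo : IsOpen O := (isOpen_biUnion fun p _ => isOpen_ball).inter isOpen_compl_singleton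
  have hKO : K ⊆ O := fun p hp => ⟨mem_biUnion hp (mem_ball_self (hηpos p hp)), by
    rintro rfl; exact hbK hp⟩
  have hOL : O ∩ L ⊆ K := by
    rintro x ⟨⟨hx, -⟩, hxL⟩
    simp only [mem_iUnion] at hx
    obtain ⟨p, hp, hx⟩ := hx
    exact hηsub p hp ⟨hx, hxL⟩
  obtain ⟨W, hWo, hKW, hWO⟩ := normal_exists_closure_subset hKc.isClosed hOo hKO
  set s₂ := (s₁ + R) / 2 with hs₂
  have hs₂R : s₂ < R := by rw [hs₂]; linarith
  set Z : Set E := {x | x ∈ X ∧ g x ≤ s₂} ∩ frontier W with hZ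
  have hZc : IsCompact Z := (hcomp s₂ hs₂R).inter_right isClosed_frontier
  have hZσ : ∀ x ∈ Z, σ < g x := by
    rintro x ⟨hx, hxf⟩
    by_contra hle
    push Not at hle
    have hxK : x ∈ K := hOL ⟨hWO hxf.1, hx.1, hle⟩
    rw [hWo.frontier_eq] at hxf
    exact hxf.2 (hKW hxK)
  obtain ⟨s, hσs, hss₂, hZs⟩ : ∃ s, σ < s ∧ s ≤ s₂ ∧ ∀ x ∈ Z, s ≤ g x := by
    rcases Z.eq_empty_or_nonempty with h | h
    · exact ⟨s₂, by rw [hs₂]; linarith, le_rfl, by simp [h]⟩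
    · obtain ⟨x, hx, hmin⟩ := hZc.exists_isMinOn h (hg.mono fun y hy => hy.1.1)
      refine ⟨min s₂ (g x), lt_min (by rw [hs₂]; linarith) (hZσ x hx), min_le_left _ _, fun y hy => ?_⟩
      exact (min_le_right _ _).trans (hmin hy)
  obtain ⟨C, hC1, hC2, hC3, hC4⟩ := hσJ s hσs
  have hbW : b ∉ W := fun h => (hWO (subset_closure h)).2 rfl
  obtain ⟨x, hxC, hxf⟩ : (C ∩ frontier W).Nonempty := by
    by_contra hne
    rw [Set.not_nonempty_iff_eq_empty] at hne
    have hcov : C ⊆ W ∪ (closure W)ᶜ := by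
      intro y hy
      by_cases hyW : y ∈ W
      · exact Or.inl hyW
      · right
        intro hyc
        have : y ∈ C ∩ frontier W := ⟨hy, by rw [hWo.frontier_eq]; exact ⟨hyc, hyW⟩⟩
        rw [hne] at this
        exact this
    have hbc : b ∈ (closure W)ᶜ := fun h => (hWO h).2 rfl
    obtain ⟨y, -, hy1, hy2⟩ := hC2 W (closure W)ᶜ hWo isClosed_closure.isOpen_compl hcov
      ⟨a, hC3, hKW (mem_insert _ _)⟩ ⟨b, hC4, hbc⟩
    exact hy2 (subset_closure hy1)
  have h1 := hC1 hxC
  have h2 := hZs x ⟨⟨h1.1, h1.2.le.trans hss₂⟩, hxf⟩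
  exact absurd h1.2 (not_lt.2 h2)

/-- bilinear dot product on `ℂⁿ` -/
def dot {n : ℕ} (a b : Fin n → ℂ) : ℂ := ∑ j, a j * b j

theorem dot_comm' {n : ℕ} (a b : Fin n → ℂ) : dot a b = dot b a := by
  simp [dot, mul_comm]
theorem dot_add {n : ℕ} (a b c : Fin n → ℂ) : dot a (b + c) = dot a b + dot a c := by
  simp [dot, mul_add, Finset.sum_add_distrib]
theorem dot_sub {n : ℕ} (a b c : Fin n → ℂ) : dot a (b - c) = dot a b - dot a c := by
  simp [dot, mul_sub, Finset.sum_sub_distrib]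
theorem add_dot {n : ℕ} (a b c : Fin n → ℂ) : dot (a + b) c = dot a c + dot b c := by
  simp [dot, add_mul, Finset.sum_add_distrib]
theorem sub_dot {n : ℕ} (a b c : Fin n → ℂ) : dot (a - b) c = dot a c - dot b c := by
  simp [dot, sub_mul, Finset.sum_sub_distrib]
theorem dot_smul {n : ℕ} (s : ℂ) (a b : Fin n → ℂ) : dot a (s • b) = s * dot a b := by
  simp [dot, Finset.mul_sum]; congr 1; ext; ring
theorem smul_dot {n : ℕ} (s : ℂ) (a b : Fin n → ℂ) : dot (s • a) b = s * dot a b := by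
  simp [dot, Finset.mul_sum]; congr 1; ext; ring
theorem dot_zero {n : ℕ} (a : Fin n → ℂ) : dot a 0 = 0 := by simp [dot]
theorem zero_dot {n : ℕ} (a : Fin n → ℂ) : dot 0 a = 0 := by simp [dot]
theorem dot_neg {n : ℕ} (a b : Fin n → ℂ) : dot a (-b) = - dot a b := by
  simp [dot]
theorem norm_dot_le {n : ℕ} (a b : Fin n → ℂ) : ‖dot a b‖ ≤ n * ‖a‖ * ‖b‖ := by
  unfold dot
  calc ‖∑ j, a j * b j‖ ≤ ∑ j : Fin n, ‖a‖ * ‖b‖ := by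
        refine norm_sum_le_of_le _ fun j _ => ?_
        rw [norm_mul]
        gcongr
        · exact norm_le_pi_norm a j
        · exact norm_le_pi_norm b j
    _ = _ := by simp; ring
theorem continuous_dot {n : ℕ} : Continuous fun p : (Fin n → ℂ) × (Fin n → ℂ) => dot p.1 p.2 := by
  unfold dot; fun_prop

/-- fibre derivative -/
def dg {n : ℕ} (g : ℂ × (Fin n → ℂ) → ℝ) (z : ℂ) (x u : Fin n → ℂ) : ℝ := fderiv ℝ g (z, x) (0, u)
/-- fibre second derivative -/
def d2 {n : ℕ} (g : ℂ × (Fin n → ℂ) → ℝ) (z : ℂ) (x u v : Fin n → ℂ) : ℝ :=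
  fderiv ℝ (fderiv ℝ g) (z, x) (0, u) (0, v)
/-- complex gradient -/
def pv {n : ℕ} (g : ℂ × (Fin n → ℂ) → ℝ) (z : ℂ) (x : Fin n → ℂ) : Fin n → ℂ := fun j =>
  (dg g z x (Pi.single j 1) : ℂ) - Complex.I * (dg g z x (Pi.single j Complex.I) : ℂ)

/-- the good domain -/
def Ud {n : ℕ} (Q : ℂ → Fin n → ℂ) : Set (ℂ × (Fin n → ℂ)) := {p | p.1 ≠ 0 ∧ p.2 ≠ Q p.1}

structure Fib {n : ℕ} (g : ℂ × (Fin n → ℂ) → ℝ) (Q : ℂ → Fin n → ℂ) (R : ℝ) : Prop where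
  Qc : ContinuousOn Q {0}ᶜ
  sm : ContDiffOn ℝ 6 g (Ud Q)
  cont : ContinuousOn g {p | p.1 ≠ 0}
  nonneg : ∀ z ∈ Circ, ∀ x, 0 ≤ g (z, x)
  zero : ∀ z ∈ Circ, ∀ x, g (z, x) = 0 ↔ x = Q z
  grad : ∀ z ∈ Circ, ∀ x, x ≠ Q z → g (z, x) ≤ R → ∃ u, dg g z x u ≠ 0
  hyp : ∀ z ∈ Circ, ∀ x, x ≠ Q z → ∀ u, u ≠ 0 → dg g z x u = 0 → dg g z x (Complex.I • u) = 0 →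
    0 < d2 g z x u u
  Rpos : 0 < R
  levelR : ∀ z ∈ Circ, ∀ x, g (z, x) = R ↔ euclNorm x = R
  aboveR : ∀ z ∈ Circ, ∀ x, R < euclNorm x → R < g (z, x)
  Qsmall : ∀ z ∈ Circ, euclNorm (Q z) < R

theorem circ_ne {z : ℂ} (hz : z ∈ Circ) : z ≠ 0 := by
  rintro rfl; simp [Circ] at hz

theorem dg_add {n : ℕ} (g : ℂ × (Fin n → ℂ) → ℝ) (z : ℂ) (x u v : Fin n → ℂ) :
    dg g z x (u + v) = dg g z x u + dg g z x v := by
  unfold dg; rw [← map_add]; simp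
theorem dg_smul {n : ℕ} (g : ℂ × (Fin n → ℂ) → ℝ) (z : ℂ) (x u : Fin n → ℂ) (s : ℝ) :
    dg g z x (s • u) = s * dg g z x u := by
  unfold dg
  rw [← smul_eq_mul, ← map_smul]; simp
theorem dg_sum {n : ℕ} (g : ℂ × (Fin n → ℂ) → ℝ) (z : ℂ) (x : Fin n → ℂ) {ι : Type*} (s : Finset ι)
    (u : ι → Fin n → ℂ) :
    dg g z x (∑ i ∈ s, u i) = ∑ i ∈ s, dg g z x (u i) := by
  classical
  induction s using Finset.induction_on with
  | empty => simpa using dg_smul g z x 0 0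
  | insert a s ha ih => rw [Finset.sum_insert ha, dg_add, ih, Finset.sum_insert ha]

theorem dot_pv {n : ℕ} (g : ℂ × (Fin n → ℂ) → ℝ) (z : ℂ) (x u : Fin n → ℂ) :
    dot (pv g z x) u = (dg g z x u : ℂ) - Complex.I * (dg g z x (Complex.I • u) : ℂ) := by
  have h : ∀ v : Fin n → ℂ, dg g z x v = ∑ j, ((v j).re * dg g z x (Pi.single j 1) +
      (v j).im * dg g z x (Pi.single j Complex.I)) := by
    intro v
    have hv : v = ∑ j, ((v j).re • (Pi.single j (1:ℂ) : Fin n → ℂ) + (v j).im • (Pi.single j Complex.I : Fin n → ℂ)) := by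
      ext i
      simp only [Finset.sum_apply, Pi.add_apply, Pi.smul_apply]
      rw [Finset.sum_eq_single i]
      · simp
      · intro b _ hb; simp [Pi.single_apply, hb.symm]
      · simp
    conv_lhs => rw [hv]
    rw [dg_sum]
    simp only [dg_add, dg_smul]
  rw [h u, h (Complex.I • u)]
  unfold dot pv
  push_cast
  rw [Finset.mul_sum, ← Finset.sum_sub_distrib]
  refine Finset.sum_congr rfl fun j _ => ?_
  have hu := (Complex.re_add_im (u j)).symm
  simp
  linear_combination ((dg g z x (Pi.single j 1)) - Complex.I * (dg g z x (Pi.single j Complex.I)) : ℂ) * hu +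
    (- (dg g z x (Pi.single j Complex.I)) * ((u j).im : ℂ)) * Complex.I_sq

theorem re_dot_pv {n : ℕ} (g : ℂ × (Fin n → ℂ) → ℝ) (z : ℂ) (x u : Fin n → ℂ) :
    (dot (pv g z x) u).re = dg g z x u := by
  rw [dot_pv]; simp

theorem dot_pv_eq_zero {n : ℕ} {g : ℂ × (Fin n → ℂ) → ℝ} {z : ℂ} {x u : Fin n → ℂ} :
    dot (pv g z x) u = 0 ↔ dg g z x u = 0 ∧ dg g z x (Complex.I • u) = 0 := by
  rw [dot_pv, Complex.ext_iff]; simp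

namespace Fib
variable {n : ℕ} {g : ℂ × (Fin n → ℂ) → ℝ} {Q : ℂ → Fin n → ℂ} {R : ℝ}

theorem Uo (hf : Fib g Q R) : IsOpen (Ud Q) := by
  have h1 : IsOpen {p : ℂ × (Fin n → ℂ) | p.1 ≠ 0} := isOpen_ne_fun continuous_fst continuous_const
  have h2 : ContinuousOn (fun p : ℂ × (Fin n → ℂ) => p.2 - Q p.1) {p | p.1 ≠ 0} :=
    continuousOn_snd.sub (hf.Qc.comp continuousOn_fst fun p hp => hp)
  have := h2.isOpen_inter_preimage h1 (isOpen_compl_singleton (x := (0 : Fin n → ℂ)))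
  convert this using 1
  ext p
  simp [Ud, sub_eq_zero]

theorem mem (_hf : Fib g Q R) {z : ℂ} (hz : z ∈ Circ) {x : Fin n → ℂ} (hx : x ≠ Q z) : (z, x) ∈ Ud Q :=
  ⟨circ_ne hz, hx⟩

theorem cda (hf : Fib g Q R) {p : ℂ × (Fin n → ℂ)} (hp : p ∈ Ud Q) : ContDiffAt ℝ 6 g p :=
  hf.sm.contDiffAt (hf.Uo.mem_nhds hp)

theorem cda1 (hf : Fib g Q R) {p : ℂ × (Fin n → ℂ)} (hp : p ∈ Ud Q) : ContDiffAt ℝ 5 (fderiv ℝ g) p :=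
  (hf.cda hp).fderiv_right (by norm_num)

theorem cda2 (hf : Fib g Q R) {p : ℂ × (Fin n → ℂ)} (hp : p ∈ Ud Q) :
    ContDiffAt ℝ 4 (fderiv ℝ (fderiv ℝ g)) p :=
  (hf.cda1 hp).fderiv_right (by norm_num)

theorem slice_cont (hf : Fib g Q R) {z : ℂ} (hz : z ∈ Circ) : Continuous fun x => g (z, x) :=
  hf.cont.comp_continuous (by fun_prop) fun _ => circ_ne hz

theorem slice_strict (hf : Fib g Q R) {z : ℂ} (hz : z ∈ Circ) {x : Fin n → ℂ} (hx : x ≠ Q z) :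
    HasStrictFDerivAt (fun x => g (z, x)) ((fderiv ℝ g (z, x)).comp (ContinuousLinearMap.inr ℝ ℂ (Fin n → ℂ))) x := by
  have h1 : HasStrictFDerivAt g (fderiv ℝ g (z, x)) (z, x) :=
    (hf.cda (hf.mem hz hx)).hasStrictFDerivAt (by norm_num)
  have h2 : HasStrictFDerivAt (fun x : Fin n → ℂ => (z, x)) (ContinuousLinearMap.inr ℝ ℂ (Fin n → ℂ)) x :=
    (hasStrictFDerivAt_const z x).prodMk (hasStrictFDerivAt_id x)
  exact h1.comp x h2

theorem g_lt (hf : Fib g Q R) {z : ℂ} (hz : z ∈ Circ) {x : Fin n → ℂ} (hx : euclNorm x < R) : g (z, x) < R := by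
  have hcv : IsPreconnected {x : Fin n → ℂ | euclNorm x < R} := by
    have : {x : Fin n → ℂ | euclNorm x < R} = (fun y : EuclideanSpace ℂ (Fin n) => (y : Fin n → ℂ)) '' ball 0 R := by
      ext y
      simp only [Set.mem_ofPred_eq, Set.mem_image, mem_ball_zero_iff]
      constructor
      · intro h
        refine ⟨WithLp.toLp 2 y, ?_, rfl⟩
        rw [EuclideanSpace.norm_eq]
        simpa [euclNorm, Complex.normSq_eq_norm_sq] using h
      · rintro ⟨w, hw, rfl⟩
        rw [EuclideanSpace.norm_eq] at hw
        simpa [euclNorm, Complex.normSq_eq_norm_sq] using hw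
    rw [this]
    exact (convex_ball _ _).isPreconnected.image _ (by fun_prop)
  by_contra hge
  push Not at hge
  obtain ⟨y, hy, hyR⟩ := hcv.intermediate_value (hf.Qsmall z hz) hx (f := fun x => g (z, x))
    (hf.slice_cont hz).continuousOn ⟨by rw [(hf.zero z hz _).2 rfl]; exact hf.Rpos.le, hge⟩
  have := (hf.levelR z hz y).1 hyR
  simp at hy
  linarith

theorem e_lt (hf : Fib g Q R) {z : ℂ} (hz : z ∈ Circ) {x : Fin n → ℂ} (hx : g (z, x) < R) : euclNorm x < R := by
  by_contra h
  push Not at h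
  rcases h.lt_or_eq with h | h
  · exact absurd (hf.aboveR z hz x h) (by linarith)
  · exact absurd ((hf.levelR z hz x).2 h.symm) (by linarith)

end Fib

theorem pos_def_bound {E : Type*} [NormedAddCommGroup E] [NormedSpace ℝ E] [FiniteDimensional ℝ E]
    (B : E →L[ℝ] E →L[ℝ] ℝ) (hB : ∀ u, u ≠ 0 → 0 < B u u) : ∃ c > (0:ℝ), ∀ u, c * ‖u‖ ^ 2 ≤ B u u := by
  have hc : Continuous fun u => B u u := by fun_prop
  rcases (sphere (0:E) 1).eq_empty_or_nonempty with he | hne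
  · refine ⟨1, one_pos, fun u => ?_⟩
    rcases eq_or_ne u 0 with rfl | hu
    · simp
    · exfalso
      have : ‖u‖⁻¹ • u ∈ sphere (0:E) 1 := by
        simp [norm_smul, inv_mul_cancel₀ (norm_ne_zero_iff.2 hu)]
      rw [he] at this
      exact this
  · obtain ⟨v, hv, hmin⟩ := (isCompact_sphere (0:E) 1).exists_isMinOn hne hc.continuousOn
    have hv1 : ‖v‖ = 1 := by simpa using hv
    have hv0 : v ≠ 0 := by rintro rfl; simp at hv1
    refine ⟨B v v, hB v hv0, fun u => ?_⟩
    rcases eq_or_ne u 0 with rfl | hu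
    · simp
    · have hs : ‖u‖⁻¹ • u ∈ sphere (0:E) 1 := by
        simp [norm_smul, inv_mul_cancel₀ (norm_ne_zero_iff.2 hu)]
      have h := hmin hs
      simp only [Set.mem_ofPred_eq, map_smul, smul_apply, smul_eq_mul] at h
      have hn : 0 < ‖u‖ := norm_pos_iff.2 hu
      have : B u u = ‖u‖ ^ 2 * (‖u‖⁻¹ * (‖u‖⁻¹ * B u u)) := by field_simp
      rw [this, mul_comm]
      gcongr

theorem strict_min {E : Type*} [NormedAddCommGroup E] [NormedSpace ℝ E] [FiniteDimensional ℝ E]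
    (f : E → ℝ) (x : E) (f' : E → E →L[ℝ] ℝ) (f'' : E →L[ℝ] E →L[ℝ] ℝ)
    (h1 : ∀ᶠ y in nhds x, HasFDerivAt f (f' y) y) (h2 : HasFDerivAt f' f'' x) (h0 : f' x = 0)
    (hpos : ∀ u, u ≠ 0 → 0 < f'' u u) : ∀ᶠ y in nhdsWithin x {x}ᶜ, f x < f y := by
  obtain ⟨c, hc, hB⟩ := pos_def_bound f'' hpos
  have h3 := h2.isLittleO.def (half_pos hc)
  obtain ⟨r, hr, hball⟩ := Metric.eventually_nhds_iff_ball.1 (h1.and h3)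
  filter_upwards [inter_mem_nhdsWithin _ (ball_mem_nhds x hr)] with y hy
  obtain ⟨hyne, hyb⟩ := hy
  set v := y - x with hv
  have hv0 : v ≠ 0 := sub_ne_zero.2 hyne
  have hvr : ‖v‖ < r := by simpa [hv, dist_eq_norm] using hyb
  have hvp : 0 < ‖v‖ := norm_pos_iff.2 hv0
  have hin : ∀ t ∈ Icc (0:ℝ) 1, x + t • v ∈ ball x r := by
    intro t ht
    simp only [mem_ball, dist_eq_norm, add_sub_cancel_left, norm_smul, Real.norm_eq_abs, abs_of_nonneg ht.1]
    calc t * ‖v‖ ≤ 1 * ‖v‖ := by gcongr; exact ht.2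
      _ < r := by simpa
  have hd : ∀ t ∈ Icc (0:ℝ) 1, HasDerivAt (fun t : ℝ => f (x + t • v)) (f' (x + t • v) v) t := by
    intro t ht
    have ha : HasDerivAt (fun t : ℝ => x + t • v) v t := by
      simpa using ((hasDerivAt_id t).smul_const v).const_add x
    exact ((hball _ (hin t ht)).1).comp_hasDerivAt t ha
  have hmono : StrictMonoOn (fun t : ℝ => f (x + t • v)) (Icc 0 1) := by
    refine strictMonoOn_of_deriv_pos (convex_Icc 0 1) (fun t ht => (hd t ht).continuousAt.continuousWithinAt) ?_
    intro t ht
    rw [interior_Icc] at ht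
    have ht' : t ∈ Icc (0:ℝ) 1 := ⟨ht.1.le, ht.2.le⟩
    rw [(hd t ht').deriv]
    have h4 := (hball _ (hin t ht')).2
    rw [h0] at h4
    simp only [sub_zero, add_sub_cancel_left, map_smul] at h4
    have h5 : ‖(f' (x + t • v) - t • f'' v) v‖ ≤ c / 2 * ‖t • v‖ * ‖v‖ :=
      (ContinuousLinearMap.le_opNorm _ _).trans (by gcongr)
    simp only [sub_apply, smul_apply, smul_eq_mul, norm_smul,
      Real.norm_eq_abs, abs_of_pos ht.1] at h5
    have h6 := hB v
    have h7 := (abs_le.1 h5).1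
    have h8 : 0 < t * (c * ‖v‖ ^ 2) := mul_pos ht.1 (by positivity)
    nlinarith [mul_le_mul_of_nonneg_left h6 ht.1.le]
  have := hmono (left_mem_Icc.2 zero_le_one) (right_mem_Icc.2 zero_le_one) one_pos
  simpa [hv] using this

theorem euclNorm_eq {n : ℕ} (x : Fin n → ℂ) : euclNorm x = ‖(WithLp.toLp 2 x : EuclideanSpace ℂ (Fin n))‖ := by
  rw [EuclideanSpace.norm_eq]
  simp [euclNorm, Complex.normSq_eq_norm_sq]

theorem continuous_euclNorm {n : ℕ} : Continuous (euclNorm : (Fin n → ℂ) → ℝ) := by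
  unfold euclNorm
  fun_prop

theorem norm_le_euclNorm {n : ℕ} (x : Fin n → ℂ) : ‖x‖ ≤ euclNorm x := by
  refine (pi_norm_le_iff_of_nonneg (Real.sqrt_nonneg _)).2 fun i => ?_
  refine Real.le_sqrt_of_sq_le ?_
  rw [← Complex.normSq_eq_norm_sq]
  exact Finset.single_le_sum (f := fun j => Complex.normSq (x j)) (fun j _ => Complex.normSq_nonneg _) (Finset.mem_univ i)

theorem convex_euclBall {n : ℕ} (R : ℝ) : Convex ℝ {x : Fin n → ℂ | euclNorm x < R} := by
  intro x hx y hy a b ha hb hab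
  simp only [Set.mem_ofPred_eq, euclNorm_eq] at *
  have h : (WithLp.toLp 2 (a • x + b • y) : EuclideanSpace ℂ (Fin n)) = a • WithLp.toLp 2 x + b • WithLp.toLp 2 y := rfl
  rw [h]
  have := convex_ball (0 : EuclideanSpace ℂ (Fin n)) R (x := WithLp.toLp 2 x) (by simpa using hx)
    (y := WithLp.toLp 2 y) (by simpa using hy) ha hb hab
  simpa using this

namespace Fib
variable {n : ℕ} {g : ℂ × (Fin n → ℂ) → ℝ} {Q : ℂ → Fin n → ℂ} {R : ℝ}

theorem linconv (hf : Fib g Q R) {z : ℂ} (hz : z ∈ Circ) {w0 w1 : Fin n → ℂ} (h0 : w0 ≠ Q z)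
    (hg0 : g (z, w0) < R) (hle : g (z, w1) ≤ g (z, w0)) (hne : w1 ≠ w0) : dot (pv g z w0) (w1 - w0) ≠ 0 := by
  intro hdot
  let E : Submodule ℝ (Fin n → ℂ) :=
    { carrier := {u | dot (pv g z w0) u = 0}
      add_mem' := by
        intro a b ha hb
        simp only [Set.mem_ofPred_eq] at *
        rw [dot_add, ha, hb, add_zero]
      zero_mem' := dot_zero _
      smul_mem' := by
        intro c x hx
        simp only [Set.mem_ofPred_eq] at *
        have : c • x = (c:ℂ) • x := by ext; simp
        rw [this, dot_smul, hx, mul_zero] }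
  have hEI : ∀ u : E, Complex.I • (u : Fin n → ℂ) ∈ E := by
    intro u
    have hu : dot (pv g z w0) u = 0 := u.2
    change dot (pv g z w0) _ = 0
    rw [dot_smul, hu, mul_zero]
  let X : Set E := {u | euclNorm (w0 + (u : Fin n → ℂ)) < R}
  let G : E → ℝ := fun u => g (z, w0 + u)
  have hGc : Continuous G := (hf.slice_cont hz).comp (by fun_prop)
  have hXo : IsOpen X := isOpen_Iio.preimage (continuous_euclNorm.comp (by fun_prop))
  have hXc : Convex ℝ X := by
    intro x hx y hy a b ha hb hab
    have := convex_euclBall R hx hy ha hb hab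
    change euclNorm _ < R
    have e : w0 + ((a • x + b • y : E) : Fin n → ℂ) = a • (w0 + (x : Fin n → ℂ)) + b • (w0 + (y : Fin n → ℂ)) := by
      have hw : a • w0 + b • w0 = w0 := by rw [← add_smul, hab, one_smul]
      simp only [Submodule.coe_add, Submodule.coe_smul, smul_add]
      nth_rewrite 1 [← hw]
      abel
    rw [e]; exact this
  have hXR : ∀ x ∈ X, G x < R := fun x hx => hf.g_lt hz hx
  have hcomp : ∀ s < R, IsCompact {x | x ∈ X ∧ G x ≤ s} := by
    intro s hs
    have : {x | x ∈ X ∧ G x ≤ s} = {x | G x ≤ s} := by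
      ext x
      simp only [Set.mem_ofPred_eq, and_iff_right_iff_imp]
      intro h
      exact hf.e_lt hz (lt_of_le_of_lt h hs)
    rw [this]
    refine Metric.isCompact_of_isClosed_isBounded (isClosed_le hGc continuous_const) ?_
    refine (Metric.isBounded_ball (x := (0:E)) (r := R + ‖w0‖)).subset fun x hx => ?_
    have hx' := hf.e_lt hz (lt_of_le_of_lt hx hs)
    have h1 := norm_le_euclNorm (w0 + (x : Fin n → ℂ))
    rw [mem_ball_zero_iff]
    have h2 : ‖(x : Fin n → ℂ)‖ ≤ ‖w0 + (x : Fin n → ℂ)‖ + ‖w0‖ := by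
      simpa using norm_sub_le (w0 + (x : Fin n → ℂ)) w0
    have h3 : ‖x‖ = ‖(x : Fin n → ℂ)‖ := rfl
    rw [h3]; linarith
  -- dichotomy
  let D : E → E →L[ℝ] ℝ := fun u => ((fderiv ℝ g (z, w0 + u)).comp (ContinuousLinearMap.inr ℝ ℂ (Fin n → ℂ))).comp E.subtypeL
  have hDs : ∀ x : E, w0 + (x : Fin n → ℂ) ≠ Q z → HasStrictFDerivAt G (D x) x := by
    intro x hx
    have h1 := hf.slice_strict hz hx
    have h2 : HasStrictFDerivAt (fun u : E => w0 + (u : Fin n → ℂ)) E.subtypeL x :=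
      (E.subtypeL.hasStrictFDerivAt).const_add w0
    exact h1.comp x h2
  have hDv : ∀ x u : E, D x u = dg g z (w0 + x) u := fun x u => rfl
  have hstrictQ : ∀ x : E, (w0 + (x : Fin n → ℂ) = Q z ∨ ∀ u : E, dg g z (w0 + x) u = 0) →
      ∀ᶠ y in nhdsWithin x {x}ᶜ, G x < G y := by
    intro x hx
    by_cases hxQ : w0 + (x : Fin n → ℂ) = Q z
    · filter_upwards [self_mem_nhdsWithin] with y hy
      have e0 : G x = 0 := (hf.zero z hz _).2 hxQ
      rw [e0]
      refine lt_of_le_of_ne (hf.nonneg z hz _) fun h => hy ?_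
      have := (hf.zero z hz _).1 h.symm
      have h2 : w0 + (x : Fin n → ℂ) = w0 + (y : Fin n → ℂ) := by rw [hxQ, this]
      exact (Subtype.ext (add_left_cancel h2)).symm
    · have hcr := hx.resolve_left hxQ
      have hop : ∀ᶠ y : E in nhds x, w0 + (y : Fin n → ℂ) ≠ Q z :=
        (isOpen_ne_fun (by fun_prop : Continuous fun y : E => w0 + (y : Fin n → ℂ)) continuous_const).mem_nhds hxQ
      have hdd : HasFDerivAt (fun u : E => fderiv ℝ g (z, w0 + (u : Fin n → ℂ)))
          ((fderiv ℝ (fderiv ℝ g) (z, w0 + x)).comp ((ContinuousLinearMap.inr ℝ ℂ (Fin n → ℂ)).comp E.subtypeL)) x := by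
        have h1 : HasFDerivAt (fderiv ℝ g) (fderiv ℝ (fderiv ℝ g) (z, w0 + x)) (z, w0 + (x : Fin n → ℂ)) :=
          ((hf.cda1 (hf.mem hz hxQ)).differentiableAt (by norm_num)).hasFDerivAt
        have h2 : HasFDerivAt (fun u : E => (z, w0 + (u : Fin n → ℂ)))
            ((ContinuousLinearMap.inr ℝ ℂ (Fin n → ℂ)).comp E.subtypeL) x := by
          have h3 : HasFDerivAt (fun u : E => w0 + (u : Fin n → ℂ)) E.subtypeL x :=
            (E.subtypeL.hasFDerivAt).const_add w0
          exact (hasFDerivAt_const z x).prodMk h3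
        exact h1.comp x h2
      have hD' := hdd.clm_comp (hasFDerivAt_const ((ContinuousLinearMap.inr ℝ ℂ (Fin n → ℂ)).comp E.subtypeL) x)
      refine strict_min G x D _ (hop.mono fun y hy => (hDs y hy).hasFDerivAt) hD' ?_ ?_
      · ext u
        rw [hDv, hcr]; rfl
      · intro u hu
        have := hf.hyp z hz _ hxQ u (fun h => hu (Subtype.ext h)) (hcr u) (hcr ⟨_, hEI u⟩)
        simpa [d2] using this
  have hdich : ∀ x ∈ X, (∃ e : E, ∃ η > (0:ℝ), ∀ y ∈ ball x η, ∀ s ∈ Ioc (0:ℝ) η, G (y + s • e) < G y) ∨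
      (∀ᶠ y in nhdsWithin x {x}ᶜ, G x < G y) := by
    intro x _
    by_cases hx : w0 + (x : Fin n → ℂ) = Q z ∨ ∀ u : E, dg g z (w0 + x) u = 0
    · exact Or.inr (hstrictQ x hx)
    · left
      push Not at hx
      obtain ⟨hxQ, u, hu⟩ := hx
      obtain ⟨e, he⟩ : ∃ e : E, D x e < 0 := by
        rcases lt_or_gt_of_ne hu with h | h
        · exact ⟨u, h⟩
        · refine ⟨-u, ?_⟩
          rw [map_neg, hDv]; linarith
      have he0 : e ≠ 0 := by rintro rfl; simp at he
      have hep : 0 < ‖e‖ := norm_pos_iff.2 he0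
      have hs := (hDs x hxQ).isLittleO.def (c := -(D x e) / (2 * ‖e‖)) (div_pos (by linarith) (by positivity))
      rw [Metric.eventually_nhds_iff_ball] at hs
      obtain ⟨r, hr, hs⟩ := hs
      refine ⟨e, min (r / 2) (r / 2 / ‖e‖), by positivity, fun y hy s hs' => ?_⟩
      have hy' : dist y x < r / 2 := lt_of_lt_of_le hy (min_le_left _ _)
      have hse : s * ‖e‖ ≤ r / 2 := by
        have := hs'.2.trans (min_le_right _ _)
        rwa [le_div_iff₀ hep] at this
      have hm : ((y + s • e, y) : E × E) ∈ ball ((x, x) : E × E) r := by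
        rw [mem_ball, Prod.dist_eq, max_lt_iff]
        constructor
        · calc dist (y + s • e) x ≤ dist (y + s • e) y + dist y x := dist_triangle _ _ _
            _ < r / 2 + r / 2 := by
              refine add_lt_add_of_le_of_lt ?_ hy'
              simpa [dist_eq_norm, norm_smul, abs_of_pos hs'.1] using hse
            _ = r := by ring
        · simpa using hy'.trans (by linarith)
      have h5 := hs _ hm
      simp only [add_sub_cancel_left, map_smul, norm_smul, smul_eq_mul, Real.norm_eq_abs, abs_of_pos hs'.1] at h5
      have h6 := (abs_le.1 h5).2
      have h7 : -(D x) e / (2 * ‖e‖) * (s * ‖e‖) = - (s * D x e) / 2 := by field_simp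
      rw [h7] at h6
      have := mul_neg_of_pos_of_neg hs'.1 he
      linarith
  have hcrit0 : ∀ᶠ y in nhdsWithin (0:E) {0}ᶜ, G 0 < G y := by
    refine hstrictQ 0 (Or.inr fun u => ?_)
    have hu : dot (pv g z w0) u = 0 := u.2
    simpa using (dot_pv_eq_zero.1 hu).1
  have h0X : (0:E) ∈ X := by
    change euclNorm (w0 + ((0:E) : Fin n → ℂ)) < R
    simpa using hf.e_lt hz hg0
  have hG0 : G 0 = g (z, w0) := by simp [G]
  -- minimizers are zero
  have hminz : ∀ m ∈ X, (∀ y ∈ X, G m ≤ G y) → m = 0 := by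
    intro m hm hmin
    have : ∀ᶠ y in nhdsWithin m {m}ᶜ, G m < G y := by
      rcases hdich m hm with ⟨e, η, hη, h⟩ | h
      · exfalso
        have hct : ContinuousAt (fun s : ℝ => m + s • e) 0 := by fun_prop
        have hX' : ∀ᶠ s in nhds (0:ℝ), m + s • e ∈ X := hct (hXo.mem_nhds (by simpa using hm))
        obtain ⟨r, hr, hX'⟩ := Metric.eventually_nhds_iff_ball.1 hX'
        have hp : 0 < min η (r / 2) := by positivity
        have h1 := h m (mem_ball_self hη) (min η (r / 2)) ⟨hp, min_le_left _ _⟩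
        have h2 := hmin _ (hX' (min η (r / 2)) (by
          rw [mem_ball_zero_iff, Real.norm_eq_abs, abs_of_pos hp]
          exact lt_of_le_of_lt (min_le_right _ _) (by linarith)))
        linarith
      · exact h
    exact mountain X hXo hXc G hGc.continuousOn R hXR hcomp hdich hm h0X this hcrit0
  obtain ⟨m, hm, hmin⟩ := (hcomp _ hg0).exists_isMinOn ⟨0, h0X, hG0.le⟩ hGc.continuousOn
  have hmin' : ∀ y ∈ X, G m ≤ G y := by
    intro y hy
    by_cases h : G y ≤ g (z, w0)
    · exact hmin ⟨hy, h⟩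
    · push Not at h
      exact hm.2.trans h.le
  have hm0 := hminz m hm.1 hmin'
  let u1 : E := ⟨w1 - w0, hdot⟩
  have hu1 : G u1 = g (z, w1) := by simp [G, u1]
  have hu1X : u1 ∈ X := by
    change euclNorm _ < R
    simpa [u1] using hf.e_lt hz (lt_of_le_of_lt hle hg0)
  have := hminz u1 hu1X (fun y hy => by
    rw [hu1]
    refine hle.trans ?_
    rw [← hG0, ← hm0]
    exact hmin' y hy)
  have h2 : w1 - w0 = 0 := congrArg Subtype.val this
  exact hne (sub_eq_zero.1 h2)

end Fib

def HasLog {Y : Type*} [TopologicalSpace Y] (f : Y → ℂ) : Prop :=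
  ∃ L : Y → ℂ, Continuous L ∧ ∀ y, Complex.exp (L y) = f y

theorem HasLog.of_slit {Y : Type*} [TopologicalSpace Y] {f : Y → ℂ} (hf : Continuous f)
    (h : ∀ y, f y ∈ Complex.slitPlane) : HasLog f :=
  ⟨fun y => Complex.log (f y), hf.clog h, fun y => Complex.exp_log (Complex.slitPlane_ne_zero (h y))⟩

theorem HasLog.of_re_pos {Y : Type*} [TopologicalSpace Y] {f : Y → ℂ} (hf : Continuous f)
    (h : ∀ y, 0 < (f y).re) : HasLog f := HasLog.of_slit hf fun y => Or.inl (h y)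

theorem HasLog.mul {Y : Type*} [TopologicalSpace Y] {f g : Y → ℂ} (hf : HasLog f) (hg : HasLog g) :
    HasLog fun y => f y * g y := by
  obtain ⟨L, h1, h2⟩ := hf
  obtain ⟨M, h3, h4⟩ := hg
  exact ⟨fun y => L y + M y, h1.add h3, fun y => by rw [Complex.exp_add, h2, h4]⟩

theorem HasLog.ne {Y : Type*} [TopologicalSpace Y] {f : Y → ℂ} (hf : HasLog f) (y : Y) : f y ≠ 0 := by
  obtain ⟨L, h1, h2⟩ := hf
  rw [← h2]; exact Complex.exp_ne_zero _

theorem HasLog.of_ratio {Y : Type*} [TopologicalSpace Y] {f g : Y → ℂ} (hf : HasLog f)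
    (hfc : Continuous f) (hgc : Continuous g) (h : ∀ y, 0 < (g y / f y).re) : HasLog g := by
  have h1 : HasLog fun y => g y / f y := HasLog.of_re_pos (hgc.div hfc hf.ne) h
  have := hf.mul h1
  convert this using 2 with y
  field_simp [hf.ne y]

theorem HasLog.of_near {Y : Type*} [TopologicalSpace Y] {f g : Y → ℂ} (hf : HasLog f)
    (hfc : Continuous f) (hgc : Continuous g) (h : ∀ y, ‖g y - f y‖ < ‖f y‖) : HasLog g := by
  refine hf.of_ratio hfc hgc fun y => ?_
  have h0 := hf.ne y
  have h1 : g y / f y = 1 + (g y - f y) / f y := by field_simp; ring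
  have h2 : ‖(g y - f y) / f y‖ < 1 := by
    rw [norm_div, div_lt_one (norm_pos_iff.2 h0)]; exact h y
  rw [h1, Complex.add_re, Complex.one_re]
  have := (abs_le.1 ((Complex.abs_re_le_norm _).trans h2.le)).1
  have h3 := (abs_lt.1 (lt_of_le_of_lt (Complex.abs_re_le_norm ((g y - f y) / f y)) h2)).1
  linarith

/-- gradient-like vector field -/
def vf {n : ℕ} (g : ℂ × (Fin n → ℂ) → ℝ) (z : ℂ) (x : Fin n → ℂ) : Fin n → ℂ := fun j =>
  (starRingEnd ℂ (pv g z x j)) / ((∑ i, Complex.normSq (pv g z x i) : ℝ) : ℂ)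

theorem dot_vf {n : ℕ} (g : ℂ × (Fin n → ℂ) → ℝ) (z : ℂ) (x : Fin n → ℂ) (h : pv g z x ≠ 0) :
    dot (pv g z x) (vf g z x) = 1 := by
  have h1 : (∑ i, Complex.normSq (pv g z x i) : ℝ) ≠ 0 := by
    obtain ⟨i, hi⟩ := Function.ne_iff.1 h
    have : 0 < ∑ i, Complex.normSq (pv g z x i) :=
      Finset.sum_pos' (fun i _ => Complex.normSq_nonneg _) ⟨i, Finset.mem_univ _, Complex.normSq_pos.2 hi⟩
    exact this.ne'
  have h2 : ((∑ i, Complex.normSq (pv g z x i) : ℝ) : ℂ) ≠ 0 := by exact_mod_cast h1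
  unfold dot vf
  simp only [mul_div_assoc']
  rw [← Finset.sum_div, div_eq_one_iff_eq h2]
  push_cast
  refine Finset.sum_congr rfl fun i _ => ?_
  rw [Complex.normSq_eq_conj_mul_self, mul_comm]

namespace Fib
variable {n : ℕ} {g : ℂ × (Fin n → ℂ) → ℝ} {Q : ℂ → Fin n → ℂ} {R : ℝ}

theorem dg_cont (hf : Fib g Q R) : ContinuousOn (fun q : (ℂ × (Fin n → ℂ)) × (Fin n → ℂ) => dg g q.1.1 q.1.2 q.2)
    {q | q.1 ∈ Ud Q} := by
  intro q hq
  have h1 : ContinuousAt (fderiv ℝ g) q.1 := (hf.cda1 hq).continuousAt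
  have h2 : ContinuousAt (fun q : (ℂ × (Fin n → ℂ)) × (Fin n → ℂ) => fderiv ℝ g q.1) q :=
    ContinuousAt.comp (f := fun q : (ℂ × (Fin n → ℂ)) × (Fin n → ℂ) => q.1) h1 continuousAt_fst
  unfold dg
  exact (h2.clm_apply (by fun_prop)).continuousWithinAt

theorem pv_cont (hf : Fib g Q R) : ContinuousOn (fun q : ℂ × (Fin n → ℂ) => pv g q.1 q.2) (Ud Q) := by
  have h : ∀ u : Fin n → ℂ, ContinuousOn (fun q : ℂ × (Fin n → ℂ) => dg g q.1 q.2 u) (Ud Q) := fun u =>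
    hf.dg_cont.comp (f := fun q : ℂ × (Fin n → ℂ) => (q, u)) (by fun_prop) fun q hq => hq
  unfold pv
  refine continuousOn_pi.2 fun j => ?_
  exact (Complex.continuous_ofReal.comp_continuousOn (h _)).sub
    (continuousOn_const.mul (Complex.continuous_ofReal.comp_continuousOn (h _)))

theorem pv_ne (hf : Fib g Q R) {z : ℂ} (hz : z ∈ Circ) {x : Fin n → ℂ} (hx : x ≠ Q z) (hg : g (z, x) ≤ R) :
    pv g z x ≠ 0 := by
  intro h
  obtain ⟨u, hu⟩ := hf.grad z hz x hx hg
  have := re_dot_pv g z x u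
  rw [h, zero_dot] at this
  exact hu this.symm

theorem vf_open (hf : Fib g Q R) : IsOpen {q : ℂ × (Fin n → ℂ) | q ∈ Ud Q ∧ pv g q.1 q.2 ≠ 0} :=
  hf.pv_cont.isOpen_inter_preimage hf.Uo (isOpen_compl_singleton (x := (0 : Fin n → ℂ)))

theorem vf_cont (hf : Fib g Q R) : ContinuousOn (fun q : ℂ × (Fin n → ℂ) => vf g q.1 q.2)
    {q | q ∈ Ud Q ∧ pv g q.1 q.2 ≠ 0} := by
  have h1 : ContinuousOn (fun q : ℂ × (Fin n → ℂ) => pv g q.1 q.2) {q | q ∈ Ud Q ∧ pv g q.1 q.2 ≠ 0} :=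
    hf.pv_cont.mono fun q hq => hq.1
  have hj : ∀ j, ContinuousOn (fun q : ℂ × (Fin n → ℂ) => pv g q.1 q.2 j) {q | q ∈ Ud Q ∧ pv g q.1 q.2 ≠ 0} :=
    fun j => continuousOn_pi.1 h1 j
  unfold vf
  refine continuousOn_pi.2 fun j => ContinuousOn.div (Complex.continuous_conj.comp_continuousOn (hj j)) ?_ ?_
  · refine Complex.continuous_ofReal.comp_continuousOn (continuousOn_finsetSum _ fun i _ => ?_)
    exact Complex.continuous_normSq.comp_continuousOn (hj i)
  · intro q hq
    have := dot_vf g q.1 q.2 hq.2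
    intro h0
    unfold dot vf at this
    rw [h0] at this
    simp at this

/-- outward derivative on the boundary sphere -/
theorem outward (hf : Fib g Q R) {z : ℂ} (hz : z ∈ Circ) {v w : Fin n → ℂ} (hv : g (z, v) = R)
    (hw : g (z, w) < R) : 0 < dg g z v (v - w) := by
  have hvQ : v ≠ Q z := by
    intro h
    rw [(hf.zero z hz v).2 h] at hv
    exact hf.Rpos.ne hv
  have hev := (hf.levelR z hz v).1 hv
  have hle : ∀ w, euclNorm w < R → dg g z v (w - v) ≤ 0 := by
    intro w hw
    have hd : HasDerivAt (fun t : ℝ => g (z, v + t • (w - v))) (dg g z v (w - v)) 0 := by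
      have ha : HasDerivAt (fun t : ℝ => v + t • (w - v)) (w - v) 0 := by
        simpa using ((hasDerivAt_id (0:ℝ)).smul_const (w - v)).const_add v
      have h1 := (hf.slice_strict hz hvQ).hasFDerivAt
      have h1' : HasFDerivAt (fun x => g (z, x)) ((fderiv ℝ g (z, v)).comp (ContinuousLinearMap.inr ℝ ℂ (Fin n → ℂ)))
        (v + (0:ℝ) • (w - v)) := by simpa using h1
      exact HasFDerivAt.comp_hasDerivAt (l := fun x => g (z, x)) 0 h1' ha
    have hlt : ∀ t ∈ Ioo (0:ℝ) 1, g (z, v + t • (w - v)) < R := by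
      intro t ht
      refine hf.g_lt hz ?_
      rw [euclNorm_eq] at *
      have e : (WithLp.toLp 2 (v + t • (w - v)) : EuclideanSpace ℂ (Fin n)) =
        (1 - t) • WithLp.toLp 2 v + t • WithLp.toLp 2 w := by
        ext i; simp; ring
      rw [e]
      calc _ ≤ ‖(1 - t) • (WithLp.toLp 2 v : EuclideanSpace ℂ (Fin n))‖ + ‖t • (WithLp.toLp 2 w : EuclideanSpace ℂ (Fin n))‖ := norm_add_le _ _
        _ = (1 - t) * R + t * ‖(WithLp.toLp 2 w : EuclideanSpace ℂ (Fin n))‖ := by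
          rw [norm_smul, norm_smul, hev, Real.norm_of_nonneg ht.1.le, Real.norm_of_nonneg (by linarith [ht.2])]
        _ < (1 - t) * R + t * R := by
          have := mul_lt_mul_of_pos_left hw ht.1
          linarith
        _ = R := by ring
    by_contra hpos
    push Not at hpos
    have hsl := hd.tendsto_slope_zero_right
    have hev2 : ∀ᶠ t in nhdsWithin (0:ℝ) (Ioi 0), t⁻¹ • (g (z, v + (0 + t) • (w - v)) - g (z, v + (0:ℝ) • (w - v))) ≤ 0 := by
      filter_upwards [Ioo_mem_nhdsGT (zero_lt_one (α := ℝ))] with t ht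
      have := hlt t ht
      simp only [zero_add, zero_smul, add_zero, smul_eq_mul, hv]
      exact mul_nonpos_of_nonneg_of_nonpos (inv_nonneg.2 ht.1.le) (by linarith)
    exact absurd (le_of_tendsto hsl hev2) (not_le.2 hpos)
  have hew := hf.e_lt hz hw
  obtain ⟨u, hu⟩ := hf.grad z hz v hvQ hv.le
  have hc : ContinuousAt (fun s : ℝ => euclNorm (w + s • u)) 0 :=
    (continuous_euclNorm.comp (by fun_prop)).continuousAt
  have hev3 : ∀ᶠ s in nhds (0:ℝ), euclNorm (w + s • u) < R := hc.eventually_lt_const (by simpa using hew)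
  obtain ⟨r, hr, hball⟩ := Metric.eventually_nhds_iff_ball.1 hev3
  have h1 := hle _ (hball (r / 2) (by rw [mem_ball_zero_iff, Real.norm_of_nonneg (by positivity)]; linarith))
  have h2 := hle _ (hball (-(r / 2)) (by rw [mem_ball_zero_iff, norm_neg, Real.norm_of_nonneg (by positivity)]; linarith))
  have e1 : ∀ s : ℝ, dg g z v (w + s • u - v) = - dg g z v (v - w) + s * dg g z v u := by
    intro s
    have : w + s • u - v = (-1 : ℝ) • (v - w) + s • u := by
      rw [neg_one_smul]; abel
    rw [this, dg_add, dg_smul, dg_smul]; ring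
  rw [e1] at h1 h2
  by_contra hneg
  push Not at hneg
  have h3 : dg g z v (v - w) = 0 := by nlinarith
  rw [h3] at h1 h2
  have : r / 2 * dg g z v u = 0 := by linarith
  rcases mul_eq_zero.1 this with h | h
  · linarith
  · exact hu h

set_option maxHeartbeats 1000000 in
/-- descent-free version of the log lemma -/
theorem haslog (hf : Fib g Q R) {Y : Type*} [TopologicalSpace Y] [CompactSpace Y] [T2Space Y] {ζ : Y → ℂ} (hζ : Continuous ζ)
    (hζc : ∀ y, ζ y ∈ Circ) {w w' : Y → Fin n → ℂ} (hw : Continuous w) (hw' : Continuous w')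
    (hlt : ∀ y, g (ζ y, w y) < R) (hle : ∀ y, g (ζ y, w' y) ≤ g (ζ y, w y)) (hne : ∀ y, w y ≠ w' y)
    (hQ : ∀ y, w y ≠ Q (ζ y)) : HasLog fun y => dot (pv g (ζ y) (w y)) (w y - w' y) := by
  have hgw : Continuous fun y => g (ζ y, w y) := hf.cont.comp_continuous (by fun_prop) fun y => circ_ne (hζc y)
  have hgq : Continuous fun q : Y × (Fin n → ℂ) => g (ζ q.1, q.2) :=
    hf.cont.comp_continuous (by fun_prop) fun q => circ_ne (hζc q.1)
  let A : Set (Y × (Fin n → ℂ)) := {q | g (ζ q.1, w q.1) ≤ g (ζ q.1, q.2) ∧ g (ζ q.1, q.2) ≤ R}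
  have hgR : ∀ z ∈ Circ, ∀ x, g (z, x) ≤ R → ‖x‖ ≤ R := by
    intro z hz x hx
    refine (norm_le_euclNorm x).trans ?_
    by_contra h
    push Not at h
    linarith [hf.aboveR z hz x h]
  have hAc : IsCompact A := by
    have hcl : IsClosed A := (isClosed_le (hgw.comp continuous_fst) hgq).inter (isClosed_le hgq continuous_const)
    refine IsCompact.of_isClosed_subset ((isCompact_univ (X := Y)).prod (isCompact_closedBall (0 : Fin n → ℂ) R)) hcl ?_
    intro q hq
    exact ⟨mem_univ _, by simpa using hgR _ (hζc q.1) _ hq.2⟩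
  have hAQ : ∀ q ∈ A, q.2 ≠ Q (ζ q.1) := by
    intro q hq h
    have h1 := (hf.zero _ (hζc q.1) _).2 h
    have h2 := hf.nonneg _ (hζc q.1) (w q.1)
    have h3 := hq.1
    have h4 : g (ζ q.1, w q.1) = 0 := by linarith
    exact hQ q.1 ((hf.zero _ (hζc q.1) _).1 h4)
  have hAU : ∀ q ∈ A, (ζ q.1, q.2) ∈ Ud Q ∧ pv g (ζ q.1) q.2 ≠ 0 := fun q hq =>
    ⟨hf.mem (hζc q.1) (hAQ q hq), hf.pv_ne (hζc q.1) (hAQ q hq) hq.2⟩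
  let V : Y × (Fin n → ℂ) → Fin n → ℂ := fun q => vf g (ζ q.1) q.2
  have hVc : ContinuousOn V A :=
    hf.vf_cont.comp (f := fun q : Y × (Fin n → ℂ) => (ζ q.1, q.2)) (by fun_prop) hAU
  have hVd : ∀ q ∈ A, dg g (ζ q.1) q.2 (V q) = 1 := by
    intro q hq
    rw [← re_dot_pv, dot_vf _ _ _ (hAU q hq).2]; simp
  obtain ⟨M, hM0, hM⟩ : ∃ M : ℝ, 0 ≤ M ∧ ∀ q ∈ A, ‖V q‖ ≤ M := by
    obtain ⟨M, hM⟩ := hAc.exists_bound_of_continuousOn hVc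
    exact ⟨max M 0, le_max_right _ _, fun q hq => (hM q hq).trans (le_max_left _ _)⟩
  let C : Set (Y × (Fin n → ℂ)) := {q | q ∈ A ∧ ‖q.2 - w q.1‖ ≤ 2 * M * (g (ζ q.1, q.2) - g (ζ q.1, w q.1))}
  have hCc : IsCompact C := hAc.inter_right (t := {q : Y × (Fin n → ℂ) | ‖q.2 - w q.1‖ ≤ 2 * M * (g (ζ q.1, q.2) - g (ζ q.1, w q.1))})
    (isClosed_le (by fun_prop) (continuous_const.mul (hgq.sub (hgw.comp continuous_fst))))
  let κ : Y × (Fin n → ℂ) → ℂ := fun q => dot (pv g (ζ q.1) q.2) (q.2 - w' q.1)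
  have hκc : ContinuousOn κ A := by
    have h1 : ContinuousOn (fun q : Y × (Fin n → ℂ) => pv g (ζ q.1) q.2) A :=
      hf.pv_cont.comp (f := fun q : Y × (Fin n → ℂ) => (ζ q.1, q.2)) (by fun_prop) fun q hq => (hAU q hq).1
    have h2 : ContinuousOn (fun q : Y × (Fin n → ℂ) => q.2 - w' q.1) A := by fun_prop
    exact continuous_dot.comp_continuousOn (h1.prodMk h2)
  have hκR : ∀ q ∈ A, g (ζ q.1, q.2) = R → 0 < (κ q).re := by
    intro q hq h
    simp only [κ]
    rw [re_dot_pv]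
    exact hf.outward (hζc _) h (lt_of_le_of_lt (hle _) (hlt _))
  have hκ0 : ∀ q ∈ C, κ q ≠ 0 := by
    intro q hq h0
    rcases hq.1.2.lt_or_eq with h | h
    · have hne' : w' q.1 ≠ q.2 := by
        intro he
        have h1 := hle q.1
        rw [he] at h1
        have h2 : ‖q.2 - w q.1‖ ≤ 0 := by
          refine hq.2.trans ?_
          rw [le_antisymm h1 hq.1.1]; simp
        have h3 : q.2 = w q.1 := sub_eq_zero.1 (norm_le_zero_iff.1 h2)
        exact hne q.1 (h3.symm.trans he.symm)
      refine hf.linconv (hζc q.1) (hAQ q hq.1) h ((hle _).trans hq.1.1) hne' ?_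
      rw [← neg_sub, dot_neg, neg_eq_zero]
      exact h0
    · have := hκR q hq.1 h
      rw [h0] at this
      simp at this
  obtain ⟨m0, hm0, hκm⟩ : ∃ m0 > 0, ∀ q ∈ C, m0 ≤ ‖κ q‖ := by
    rcases C.eq_empty_or_nonempty with h | h
    · exact ⟨1, one_pos, by simp [h]⟩
    · obtain ⟨q, hq, hmin⟩ := hCc.exists_isMinOn h (hκc.mono fun q hq => hq.1).norm
      exact ⟨‖κ q‖, norm_pos_iff.2 (hκ0 q hq), fun p hp => hmin hp⟩
  -- near the outer level
  obtain ⟨δ, hδ, hδR⟩ : ∃ δ > 0, ∀ q ∈ C, R - δ ≤ g (ζ q.1, q.2) → 0 < (κ q).re := by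
    let C' : Set (Y × (Fin n → ℂ)) := {q | q ∈ C ∧ (κ q).re ≤ 0}
    have hC'c : IsCompact C' := by
      have h1 : ContinuousOn (fun q => (κ q).re) C := Complex.continuous_re.comp_continuousOn (hκc.mono fun q hq => hq.1)
      have := h1.preimage_isClosed_of_isClosed hCc.isClosed isClosed_Iic (t := Iic 0)
      exact hCc.of_isClosed_subset this fun q hq => hq.1
    rcases C'.eq_empty_or_nonempty with h | h
    · refine ⟨1, one_pos, fun q hq _ => ?_⟩
      by_contra hn
      have : q ∈ C' := ⟨hq, not_lt.1 hn⟩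
      rw [h] at this; exact this
    · obtain ⟨q, hq, hmax⟩ := hC'c.exists_isMaxOn h hgq.continuousOn
      have hlt' : g (ζ q.1, q.2) < R := by
        refine lt_of_le_of_ne hq.1.1.2 fun h => ?_
        have := hκR q hq.1.1 h
        linarith [hq.2]
      refine ⟨(R - g (ζ q.1, q.2)) / 2, by linarith, fun p hp hp' => ?_⟩
      by_contra hn
      have hpm : p ∈ C' := ⟨hp, not_lt.1 hn⟩
      have h3 := hmax hpm
      simp only [Set.mem_ofPred_eq] at h3
      linarith
  -- uniform step
  have hVa : ∀ q ∈ A, ContinuousAt V q := fun q hq =>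
    ContinuousAt.comp (f := fun q : Y × (Fin n → ℂ) => (ζ q.1, q.2))
      (hf.vf_cont.continuousAt (hf.vf_open.mem_nhds (hAU q hq))) (by fun_prop)
  have hmove : ∀ q ∈ A, ContinuousAt (fun p : ℝ × (Y × (Fin n → ℂ)) => p.2.2 + p.1 • V p.2) (0, q) := by
    intro q hq
    have h1 : ContinuousAt (fun p : ℝ × (Y × (Fin n → ℂ)) => V p.2) (0, q) :=
      Filter.Tendsto.comp (hVa q hq) (continuousAt_snd (X := ℝ) (p := ((0:ℝ), q)))
    exact (by fun_prop : ContinuousAt (fun p : ℝ × (Y × (Fin n → ℂ)) => p.2.2) (0, q)).add (continuousAt_fst.smul h1)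
  have hmove2 : ∀ q ∈ A, ContinuousAt (fun p : ℝ × (Y × (Fin n → ℂ)) => (ζ p.2.1, p.2.2 + p.1 • V p.2)) (0, q) :=
    fun q hq => ContinuousAt.prodMk (by fun_prop) (hmove q hq)
  have hstep1 : ∀ᶠ s in nhds (0:ℝ), ∀ q ∈ A, (ζ q.1, q.2 + s • V q) ∈ Ud Q ∧
      |dg g (ζ q.1) (q.2 + s • V q) (V q) - 1| < 1 / 2 := by
    refine hAc.eventually_forall_of_forall_eventually fun q hq => ?_
    have hU : (ζ q.1, q.2 + (0:ℝ) • V q) ∈ Ud Q := by simpa using (hAU q hq).1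
    refine ((hmove2 q hq).eventually (hf.Uo.mem_nhds hU)).and ?_
    have h1 : ContinuousAt (fun p : ℝ × (Y × (Fin n → ℂ)) => V p.2) (0, q) :=
      Filter.Tendsto.comp (hVa q hq) (continuousAt_snd (X := ℝ) (p := ((0:ℝ), q)))
    have hop : IsOpen {q : (ℂ × (Fin n → ℂ)) × (Fin n → ℂ) | q.1 ∈ Ud Q} := hf.Uo.preimage continuous_fst
    have h2 : ContinuousAt (fun p : ℝ × (Y × (Fin n → ℂ)) => dg g (ζ p.2.1) (p.2.2 + p.1 • V p.2) (V p.2)) (0, q) :=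
      ContinuousAt.comp (f := fun p : ℝ × (Y × (Fin n → ℂ)) => ((ζ p.2.1, p.2.2 + p.1 • V p.2), V p.2))
        (x := ((0:ℝ), q)) (hf.dg_cont.continuousAt (hop.mem_nhds (by exact hU))) ((hmove2 q hq).prodMk h1)
    have h3 := (h2.sub (continuousAt_const (y := (1:ℝ)))).abs
    refine h3.eventually_lt_const ?_
    simp only [Pi.sub_apply, zero_smul, add_zero]
    rw [hVd q hq]; norm_num
  have hstep2 : ∀ᶠ s in nhds (0:ℝ), ∀ q ∈ A, ‖κ q - κ (q.1, q.2 + s • V q)‖ < m0 := by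
    refine hAc.eventually_forall_of_forall_eventually fun q hq => ?_
    have hpa : ∀ q ∈ A, ContinuousAt κ q := by
      intro q hq
      have h1 : ContinuousAt (fun q : Y × (Fin n → ℂ) => pv g (ζ q.1) q.2) q :=
        ContinuousAt.comp (f := fun q : Y × (Fin n → ℂ) => (ζ q.1, q.2))
          (hf.pv_cont.continuousAt (hf.Uo.mem_nhds (hAU q hq).1)) (by fun_prop)
      have h2 : ContinuousAt (fun q : Y × (Fin n → ℂ) => q.2 - w' q.1) q := by fun_prop
      exact continuous_dot.continuousAt.comp (h1.prodMk h2)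
    have h1 : ContinuousAt (fun p : ℝ × (Y × (Fin n → ℂ)) => κ p.2) (0, q) :=
      ContinuousAt.comp (g := κ) (f := fun p : ℝ × (Y × (Fin n → ℂ)) => p.2) (x := ((0:ℝ), q)) (hpa q hq) continuousAt_snd
    have h2 : ContinuousAt (fun p : ℝ × (Y × (Fin n → ℂ)) => κ (p.2.1, p.2.2 + p.1 • V p.2)) (0, q) :=
      ContinuousAt.comp (g := κ) (x := ((0:ℝ), q)) (f := fun p : ℝ × (Y × (Fin n → ℂ)) => (p.2.1, p.2.2 + p.1 • V p.2))
        (by simpa using hpa q hq) (ContinuousAt.prodMk (by fun_prop) (hmove q hq))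
    refine (h1.sub h2).norm.eventually_lt_const ?_
    simpa using hm0
  obtain ⟨ε', hε', hst⟩ := Metric.eventually_nhds_iff_ball.1 (hstep1.and hstep2)
  set ε := ε' / 2 with hε
  have hεp : 0 < ε := by positivity
  have hst' : ∀ s ∈ Icc (0:ℝ) ε, s ∈ ball (0:ℝ) ε' := by
    intro s hs
    rw [mem_ball_zero_iff, Real.norm_of_nonneg hs.1]
    have := hs.2
    linarith
  have hgrow : ∀ q ∈ A, ∀ s ∈ Icc (0:ℝ) ε, g (ζ q.1, q.2) + s / 2 ≤ g (ζ q.1, q.2 + s • V q) ∧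
      g (ζ q.1, q.2 + s • V q) ≤ g (ζ q.1, q.2) + 3 / 2 * s := by
    intro q hq s hs
    have hd : ∀ t ∈ Icc (0:ℝ) s, HasDerivAt (fun t : ℝ => g (ζ q.1, q.2 + t • V q) - t) (dg g (ζ q.1) (q.2 + t • V q) (V q) - 1) t := by
      intro t ht
      have h1 := ((hst t (hst' t ⟨ht.1, ht.2.trans hs.2⟩)).1 q hq).1
      have ha : HasDerivAt (fun t : ℝ => q.2 + t • V q) (V q) t := by
        simpa using ((hasDerivAt_id t).smul_const (V q)).const_add q.2
      exact (HasFDerivAt.comp_hasDerivAt (l := fun x => g (ζ q.1, x)) t (hf.slice_strict (hζc q.1) h1.2).hasFDerivAt ha).sub (hasDerivAt_id t)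
    have := (convex_Icc (0:ℝ) s).norm_image_sub_le_of_norm_hasDerivWithin_le (C := 1 / 2)
      (fun t ht => (hd t ht).hasDerivWithinAt)
      (fun t ht => ((hst t (hst' t ⟨ht.1, ht.2.trans hs.2⟩)).1 q hq).2.le) (left_mem_Icc.2 hs.1) (right_mem_Icc.2 hs.1)
    simp only [zero_smul, add_zero, sub_zero, Real.norm_eq_abs, abs_of_nonneg hs.1] at this
    have h3 := abs_le.1 this
    constructor <;> linarith [h3.1, h3.2]
  set β := min ε (δ / 2) / 2 with hβ
  have hβp : 0 < β := by positivity
  have main : ∀ k : ℕ, ∀ v : Y → Fin n → ℂ, Continuous v → (∀ y, (y, v y) ∈ C) → (∀ y, g (ζ y, v y) < R) →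
      (∀ y, R - g (ζ y, v y) ≤ δ + k * β) → HasLog fun y => κ (y, v y) := by
    intro k
    have hκv : ∀ v : Y → Fin n → ℂ, Continuous v → (∀ y, (y, v y) ∈ C) → Continuous fun y => κ (y, v y) :=
      fun v hv hvC => hκc.comp_continuous (f := fun y => (y, v y)) (by fun_prop) fun y => (hvC y).1
    induction k with
    | zero =>
      intro v hv hvC hvR hk
      refine HasLog.of_re_pos (hκv v hv hvC) fun y => hδR _ (hvC y) ?_
      have := hk y
      simp at this
      simp only
      linarith
    | succ k ih =>
      intro v hv hvC hvR hk
      let σ : Y → ℝ := fun y => min ε ((R - g (ζ y, v y)) / 2)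
      have hgv : Continuous fun y => g (ζ y, v y) := hgq.comp (f := fun y => (y, v y)) (by fun_prop)
      have hσc : Continuous σ := continuous_const.min ((continuous_const.sub hgv).div_const 2)
      have hσ : ∀ y, σ y ∈ Icc 0 ε := fun y => ⟨le_min hεp.le (by linarith [hvR y]), min_le_left _ _⟩
      let v' : Y → Fin n → ℂ := fun y => v y + σ y • V (y, v y)
      have hVv : Continuous fun y => V (y, v y) :=
        hVc.comp_continuous (f := fun y => (y, v y)) (by fun_prop) fun y => (hvC y).1
      have hv'c : Continuous v' := hv.add (hσc.smul hVv)
      have hgr := fun y => hgrow (y, v y) (hvC y).1 (σ y) (hσ y)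
      have hv'R : ∀ y, g (ζ y, v' y) < R := by
        intro y
        have h1 := (hgr y).2
        have h2 : σ y ≤ (R - g (ζ y, v y)) / 2 := min_le_right _ _
        have h3 := hvR y
        simp only [v'] at *
        linarith
      have hv'C : ∀ y, (y, v' y) ∈ C := by
        intro y
        have h1 := (hgr y).1
        have h0 := (hσ y).1
        refine ⟨⟨?_, (hv'R y).le⟩, ?_⟩
        · have := (hvC y).1.1
          simp only [v'] at *
          linarith
        · have h2 := (hvC y).2
          have h3 := hM _ (hvC y).1
          simp only [v'] at *
          have e : v y + σ y • V (y, v y) - w y = (v y - w y) + σ y • V (y, v y) := by abel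
          rw [e]
          refine (norm_add_le _ _).trans ?_
          rw [norm_smul, Real.norm_of_nonneg h0]
          have h4 : σ y * ‖V (y, v y)‖ ≤ σ y * M := by gcongr
          have h5 : M * (σ y / 2) ≤ M * (g (ζ y, v y + σ y • V (y, v y)) - g (ζ y, v y)) := by
            refine mul_le_mul_of_nonneg_left ?_ hM0
            linarith
          nlinarith
      have hlog := ih v' hv'c hv'C hv'R (by
        intro y
        have h1 := (hgr y).1
        have h2 := hk y
        push_cast at h2
        simp only [v'] at *
        by_cases h : R - g (ζ y, v y) ≤ δ
        · have : 0 ≤ (k:ℝ) * β := by positivity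
          linarith [(hσ y).1]
        · push Not at h
          have : 2 * β ≤ σ y := by
            rw [hβ]
            have : min ε (δ / 2) ≤ σ y := min_le_min le_rfl (by linarith)
            linarith
          linarith)
      refine hlog.of_near (hκv v' hv'c hv'C) (hκv v hv hvC) fun y => ?_
      exact lt_of_lt_of_le ((hst _ (hst' _ (hσ y))).2 (y, v y) (hvC y).1) (hκm _ (hv'C y))
  obtain ⟨k, hk⟩ := exists_nat_gt (R / β)
  refine main k w hw (fun y => ⟨⟨le_rfl, (hlt y).le⟩, by simp⟩) hlt fun y => ?_
  have h1 := hf.nonneg _ (hζc y) (w y)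
  rw [div_lt_iff₀ hβp] at hk
  linarith

end Fib

/-- the circle as an additive group -/
abbrev TT : Type := AddCircle (2 * Real.pi)

instance factTwoPi : Fact (0 < 2 * Real.pi) := ⟨Real.two_pi_pos⟩

/-- the coordinate on the circle -/
def zt (θ : TT) : ℂ := fourier 1 θ

/-- the mean of a function on the circle -/
def mean (u : TT → ℂ) : ℂ := ∫ θ, u θ ∂AddCircle.haarAddCircle

theorem zt_cont : Continuous zt := (fourier 1).continuous

theorem zt_coe (θ : ℝ) : zt (θ : TT) = Complex.exp (θ * Complex.I) := by
  unfold zt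
  rw [fourier_coe_apply]
  congr 1
  have : (Real.pi : ℂ) ≠ 0 := by exact_mod_cast Real.pi_ne_zero
  push_cast
  field_simp

theorem zt_circ (θ : TT) : zt θ ∈ Circ := by
  induction θ using QuotientAddGroup.induction_on with | _ θ =>
  rw [show zt (θ : TT) = _ from zt_coe θ]
  simp [Circ, Complex.norm_exp]

theorem zt_ne (θ : TT) : zt θ ≠ 0 := circ_ne (zt_circ θ)

theorem zt_norm (θ : TT) : ‖zt θ‖ = 1 := by
  have := zt_circ θ
  simpa [Circ] using this

theorem zt_surj {z : ℂ} (hz : z ∈ Circ) : ∃ θ, zt θ = z := by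
  refine ⟨(Complex.arg z : TT), ?_⟩
  rw [show zt ((Complex.arg z : ℝ) : TT) = _ from zt_coe _]
  have h : ‖z‖ = 1 := by simpa [Circ] using hz
  conv_rhs => rw [← Complex.norm_mul_exp_arg_mul_I z, h]
  simp

theorem fourier_zt (j : ℤ) (θ : TT) : fourier j θ = zt θ ^ j := by
  induction θ using QuotientAddGroup.induction_on with | _ θ =>
  rw [show zt (θ : TT) = _ from zt_coe θ, ← Complex.exp_int_mul]
  erw [fourier_coe_apply]
  congr 1
  have : (Real.pi : ℂ) ≠ 0 := by exact_mod_cast Real.pi_ne_zero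
  push_cast
  field_simp

theorem fourier_zt_nat (j : ℕ) (θ : TT) : fourier (j : ℤ) θ = zt θ ^ j := by
  rw [fourier_zt]; simp

theorem bCoeff_eq (f : ℂ → ℂ) (j : ℤ) : bCoeff f j = fourierCoeff (fun θ : TT => f (zt θ)) j := by
  rw [fourierCoeff_eq_intervalIntegral _ _ 0]
  unfold bCoeff
  simp only [zero_add]
  rw [real_smul]
  push_cast
  congr 1
  refine intervalIntegral.integral_congr fun θ _ => ?_
  simp only [smul_eq_mul]
  rw [fourier_zt, show zt (θ : TT) = _ from zt_coe θ, ← Complex.exp_int_mul, mul_comm]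
  congr 2
  push_cast; ring

theorem fc_def (u : TT → ℂ) (j : ℤ) : fourierCoeff u j = mean fun θ => zt θ ^ (-j) * u θ := by
  unfold fourierCoeff mean
  simp only [smul_eq_mul, fourier_zt]

theorem intg {u : TT → ℂ} (hu : Continuous u) : Integrable u AddCircle.haarAddCircle :=
  hu.integrable_of_hasCompactSupport (HasCompactSupport.of_compactSpace u)

theorem intgR {u : TT → ℝ} (hu : Continuous u) : Integrable u AddCircle.haarAddCircle :=
  hu.integrable_of_hasCompactSupport (HasCompactSupport.of_compactSpace u)

theorem memLp_of_cont {E : Type*} [NormedAddCommGroup E] {u : TT → E} (hu : Continuous u) (p : ENNReal) :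
    MemLp u p AddCircle.haarAddCircle := by
  let U : C(TT, E) := ⟨u, hu⟩
  obtain ⟨C, hC⟩ : ∃ C, ∀ θ, ‖u θ‖ ≤ C := ⟨‖U‖, fun θ => U.norm_coe_le_norm θ⟩
  exact MemLp.of_bound hu.aestronglyMeasurable_of_compactSpace C (ae_of_all _ hC)

theorem fc_zt_mul (u : TT → ℂ) (i j : ℤ) : fourierCoeff (fun θ => zt θ ^ i * u θ) j = fourierCoeff u (j - i) := by
  simp only [fc_def]
  congr 1; ext θ
  rw [← mul_assoc, ← zpow_add₀ (zt_ne θ)]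
  congr 2; ring

theorem fc_conj (u : TT → ℂ) (j : ℤ) : fourierCoeff (fun θ => (starRingEnd ℂ) (u θ)) j = (starRingEnd ℂ) (fourierCoeff u (-j)) := by
  simp only [fc_def, mean]
  rw [← integral_conj]
  congr 1; ext θ
  simp only [map_mul, map_zpow₀, neg_neg, zpow_neg, ]
  have : (starRingEnd ℂ) (zt θ) = (zt θ)⁻¹ := by
    rw [Complex.inv_def, Complex.normSq_eq_norm_sq, zt_norm]; simp
  rw [this]; simp

/-- Parseval -/
theorem hasSum_fc_mul {u v : TT → ℂ} (hu : MemLp u 2 AddCircle.haarAddCircle) (hv : MemLp v 2 AddCircle.haarAddCircle) :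
    HasSum (fun k : ℤ => fourierCoeff u k * fourierCoeff v (-k)) (mean fun θ => u θ * v θ) := by
  have hv' : MemLp (fun θ => (starRingEnd ℂ) (v θ)) 2 AddCircle.haarAddCircle := hv.star
  have h := (fourierBasis (T := 2 * Real.pi)).hasSum_inner_mul_inner hv'.toLp hu.toLp
  have h1 : ∀ k : ℤ, inner ℂ hv'.toLp (fourierBasis (T := 2 * Real.pi) k) * inner ℂ (fourierBasis (T := 2 * Real.pi) k) hu.toLp = fourierCoeff u k * fourierCoeff v (-k) := by
    intro k
    rw [← inner_conj_symm, ← fourierBasis.repr_apply_apply, ← fourierBasis.repr_apply_apply, fourierBasis_repr, fourierBasis_repr,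
      mul_comm, fourierCoeff_congr_ae hu.coeFn_toLp, fourierCoeff_congr_ae hv'.coeFn_toLp, fc_conj]
    simp
  simp only [h1] at h
  have key : (mean fun θ => u θ * v θ) = inner ℂ hv'.toLp hu.toLp := by
    rw [L2.inner_def]
    unfold mean
    refine integral_congr_ae ?_
    filter_upwards [hu.coeFn_toLp, hv'.coeFn_toLp] with θ h1 h2
    rw [h1, h2]
    simp
  rw [key]; exact h

/-- boundary values in the disk algebra, expressed by Fourier coefficients -/
def InH (u : TT → ℂ) : Prop := Continuous u ∧ ∀ j < 0, fourierCoeff u j = 0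

theorem fc_add {u v : TT → ℂ} (hu : Continuous u) (hv : Continuous v) (j : ℤ) :
    fourierCoeff (fun θ => u θ + v θ) j = fourierCoeff u j + fourierCoeff v j :=
  congrFun (fourierCoeff.add (intg hu) (intg hv)) j

theorem fc_smul (u : TT → ℂ) (c : ℂ) (j : ℤ) :
    fourierCoeff (fun θ => c * u θ) j = c * fourierCoeff u j := fourierCoeff.const_mul u c j

theorem fc_sub {u v : TT → ℂ} (hu : Continuous u) (hv : Continuous v) (j : ℤ) :
    fourierCoeff (fun θ => u θ - v θ) j = fourierCoeff u j - fourierCoeff v j := by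
  have h := fc_add hu (v := fun θ => (-1) * v θ) (by fun_prop) j
  rw [fc_smul] at h
  simpa [sub_eq_add_neg] using h

theorem fc_fourier (i j : ℤ) : fourierCoeff (fun θ : TT => zt θ ^ i) j = if j = i then 1 else 0 := by
  have h := congrFun (fourierCoeff_fourier (T := 2 * Real.pi) i) j
  have h2 : (⇑(fourier i) : TT → ℂ) = fun θ => zt θ ^ i := by ext θ; exact fourier_zt i θ
  rw [h2] at h
  rw [h, Pi.single_apply]

theorem fc_const (c : ℂ) (j : ℤ) : fourierCoeff (fun _ : TT => c) j = if j = 0 then c else 0 := by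
  have h := fc_smul (fun θ : TT => zt θ ^ (0:ℤ)) c j
  rw [fc_fourier] at h
  simpa using h

theorem fc_zero_eq (u : TT → ℂ) : fourierCoeff u 0 = mean u := by
  rw [fc_def]; simp

theorem mean_const (c : ℂ) : mean (fun _ => c) = c := by
  rw [← fc_zero_eq, fc_const]; simp

theorem norm_mean_le {u : TT → ℂ} {C : ℝ} (h : ∀ θ, ‖u θ‖ ≤ C) : ‖mean u‖ ≤ C := by
  unfold mean
  have := norm_integral_le_of_norm_le_const (μ := AddCircle.haarAddCircle (T := 2 * Real.pi)) (ae_of_all _ h)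
  simpa using this

theorem norm_fc_le {u : TT → ℂ} {C : ℝ} (h : ∀ θ, ‖u θ‖ ≤ C) (j : ℤ) : ‖fourierCoeff u j‖ ≤ C := by
  rw [fc_def]
  refine norm_mean_le fun θ => ?_
  rw [norm_mul, norm_zpow, zt_norm]; simpa using h θ

theorem eq_zero_of_fc {u : TT → ℂ} (hu : Continuous u) (h : ∀ j, fourierCoeff u j = 0) : ∀ θ, u θ = 0 := by
  intro θ
  have hs : fourierCoeff u = 0 := by ext j; exact h j
  have := has_pointwise_sum_fourier_series_of_summable (f := (⟨u, hu⟩ : C(TT, ℂ))) (by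
    show Summable (fourierCoeff u); rw [hs]; exact summable_zero) θ
  have h2 : HasSum (fun i : ℤ => fourierCoeff u i • (fourier i) θ) (u θ) := this
  simp only [h, zero_smul] at h2
  exact (h2.unique hasSum_zero)

theorem InH.fc_mul {u v : TT → ℂ} (hu : InH u) (hv : InH v) (j : ℤ) (hj : j < 0) :
    fourierCoeff (fun θ => u θ * v θ) j = 0 := by
  rw [fc_def]
  have h := hasSum_fc_mul (memLp_of_cont hu.1 2) (memLp_of_cont (u := fun θ => zt θ ^ (-j) * v θ)
    (by have := hv.1; have := zt_cont; exact (zt_cont.zpow₀ _ fun θ => Or.inl (zt_ne θ)).mul hv.1) 2)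
  have h0 : ∀ k : ℤ, fourierCoeff u k * fourierCoeff (fun θ => zt θ ^ (-j) * v θ) (-k) = 0 := by
    intro k
    rcases lt_or_ge k 0 with h | h
    · rw [hu.2 k h, zero_mul]
    · rw [fc_zt_mul, hv.2 _ (by linarith), mul_zero]
  simp only [h0] at h
  rw [← h.unique hasSum_zero]
  congr 1; ext θ; ring

theorem InH.mean_mul {u v : TT → ℂ} (hu : InH u) (hv : InH v) :
    mean (fun θ => u θ * v θ) = mean u * mean v := by
  have h := hasSum_fc_mul (memLp_of_cont hu.1 2) (memLp_of_cont hv.1 2)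
  have h2 := hasSum_single (f := fun k : ℤ => fourierCoeff u k * fourierCoeff v (-k)) 0 (by
    intro k hk
    rcases lt_or_gt_of_ne hk with h | h
    · rw [hu.2 k h, zero_mul]
    · rw [hv.2 (-k) (by linarith), mul_zero])
  rw [h.unique h2]
  simp [fc_zero_eq]

namespace InH
theorem mul {u v : TT → ℂ} (hu : InH u) (hv : InH v) : InH fun θ => u θ * v θ :=
  ⟨hu.1.mul hv.1, hu.fc_mul hv⟩
theorem add {u v : TT → ℂ} (hu : InH u) (hv : InH v) : InH fun θ => u θ + v θ :=
  ⟨hu.1.add hv.1, fun j hj => by rw [fc_add hu.1 hv.1, hu.2 j hj, hv.2 j hj, add_zero]⟩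
theorem sub {u v : TT → ℂ} (hu : InH u) (hv : InH v) : InH fun θ => u θ - v θ :=
  ⟨hu.1.sub hv.1, fun j hj => by rw [fc_sub hu.1 hv.1, hu.2 j hj, hv.2 j hj, sub_zero]⟩
theorem const (c : ℂ) : InH fun _ => c :=
  ⟨continuous_const, fun j hj => by rw [fc_const, if_neg hj.ne]⟩
theorem smul {u : TT → ℂ} (hu : InH u) (c : ℂ) : InH fun θ => c * u θ := (const c).mul hu
theorem zpow (k : ℕ) : InH fun θ => zt θ ^ k := by
  refine ⟨zt_cont.pow k, fun j hj => ?_⟩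
  have := fc_fourier k j
  simp only [zpow_natCast] at this
  rw [this, if_neg (by omega)]
theorem sum {ι : Type*} (s : Finset ι) {u : ι → TT → ℂ} (hu : ∀ i ∈ s, InH (u i)) : InH fun θ => ∑ i ∈ s, u i θ := by
  classical
  induction s using Finset.induction_on with
  | empty => simpa using const 0
  | insert a s ha ih =>
    simp only [Finset.sum_insert ha]
    exact (hu a (by simp)).add (ih fun i hi => hu i (by simp [hi]))
theorem pow {u : TT → ℂ} (hu : InH u) (k : ℕ) : InH fun θ => u θ ^ k := by
  induction k with
  | zero => simpa using const 1
  | succ k ih => simp only [pow_succ]; exact ih.mul hu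
theorem dot {n : ℕ} {u v : TT → Fin n → ℂ} (hu : ∀ i, InH fun θ => u θ i) (hv : ∀ i, InH fun θ => v θ i) :
    InH fun θ => dot (u θ) (v θ) := sum _ fun i _ => (hu i).mul (hv i)

theorem of_lim {u : TT → ℂ} (hu : Continuous u) (h : ∀ ε > 0, ∃ v, InH v ∧ ∀ θ, ‖u θ - v θ‖ ≤ ε) : InH u := by
  refine ⟨hu, fun j hj => ?_⟩
  refine norm_le_zero_iff.1 (le_of_forall_pos_le_add fun ε hε => ?_)
  obtain ⟨v, hv, hvu⟩ := h ε hε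
  have := norm_fc_le hvu j
  rw [fc_sub hu hv.1, hv.2 j hj, sub_zero] at this
  linarith

/-- power series -/
theorem of_hasSum {u : TT → ℂ} {f : ℕ → TT → ℂ} (hf : ∀ k, InH (f k)) {b : ℕ → ℝ} (hb : Summable b)
    (hfb : ∀ k θ, ‖f k θ‖ ≤ b k) (hs : ∀ θ, HasSum (fun k => f k θ) (u θ)) : InH u := by
  have hu : u = fun θ => ∑' k, f k θ := by ext θ; exact (hs θ).tsum_eq.symm
  have hc : Continuous u := by
    rw [hu]; exact continuous_tsum (fun k => (hf k).1) hb hfb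
  refine of_lim hc fun ε hε => ?_
  have ht := tendstoUniformly_tsum_nat hb hfb
  rw [Metric.tendstoUniformly_iff] at ht
  obtain ⟨N, hN⟩ := (ht ε hε).exists
  refine ⟨_, sum (Finset.range N) fun k _ => hf k, fun θ => ?_⟩
  have := (hN θ).le
  rw [dist_eq_norm] at this
  rwa [hu]

theorem bdd {u : TT → ℂ} (hu : Continuous u) : ∃ C > 0, ∀ θ, ‖u θ‖ ≤ C := by
  let U : C(TT, ℂ) := ⟨u, hu⟩
  exact ⟨‖U‖ + 1, by positivity, fun θ => (U.norm_coe_le_norm θ).trans (by linarith)⟩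

theorem exp {u : TT → ℂ} (hu : InH u) : InH fun θ => Complex.exp (u θ) := by
  obtain ⟨C, hC, hCb⟩ := bdd hu.1
  refine of_hasSum (f := fun k θ => ((k.factorial : ℂ))⁻¹ * u θ ^ k) (b := fun k => C ^ k / k.factorial)
    (fun k => (hu.pow k).smul _) (Real.summable_pow_div_factorial C) (fun k θ => ?_) fun θ => ?_
  · rw [norm_mul, norm_pow, norm_inv, Complex.norm_natCast, div_eq_inv_mul]
    gcongr; exact hCb θ
  · have := NormedSpace.exp_series_hasSum_exp' (𝕂 := ℂ) (u θ)
    rw [← Complex.exp_eq_exp_ℂ] at this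
    simpa using this

theorem log_near {u : TT → ℂ} (hu : InH u) {r : ℝ} (hr : r < 1) (h : ∀ θ, ‖u θ‖ ≤ r) : InH fun θ => Complex.log (1 + u θ) := by
  have hr0 : 0 ≤ r := (norm_nonneg _).trans (h 0)
  refine of_hasSum (f := fun k θ => ((-1) ^ (k + 1) / k : ℂ) * u θ ^ k) (b := fun k => r ^ k)
    (fun k => (hu.pow k).smul _) (summable_geometric_of_lt_one hr0 hr) (fun k θ => ?_) fun θ => ?_
  · rw [norm_mul, norm_pow, norm_div, norm_pow, norm_neg, norm_one, one_pow, Complex.norm_natCast]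
    calc 1 / (k:ℝ) * ‖u θ‖ ^ k ≤ 1 * r ^ k := by
          gcongr
          · rcases Nat.eq_zero_or_pos k with rfl | hk
            · simp
            · rw [div_le_one (by positivity)]; exact_mod_cast hk
          · exact h θ
      _ = _ := one_mul _
  · have := Complex.hasSum_taylorSeries_log ((h θ).trans_lt hr)
    convert this using 2; ring

theorem inv_near {u : TT → ℂ} (hu : InH u) {r : ℝ} (hr : r < 1) (h : ∀ θ, ‖1 - u θ‖ ≤ r) : InH fun θ => (u θ)⁻¹ := by
  have hr0 : 0 ≤ r := (norm_nonneg _).trans (h 0)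
  refine of_hasSum (f := fun k θ => (1 - u θ) ^ k) (b := fun k => r ^ k)
    (fun k => ((const 1).sub hu).pow k) (summable_geometric_of_lt_one hr0 hr) (fun k θ => ?_) fun θ => ?_
  · rw [norm_pow]; gcongr; exact h θ
  · have := hasSum_geometric_of_norm_lt_one ((h θ).trans_lt hr)
    simpa using this

theorem log_re {u : TT → ℂ} (hu : InH u) (h : ∀ θ, 0 < (u θ).re) : InH fun θ => Complex.log (u θ) := by
  obtain ⟨C, hC, hCb⟩ := bdd hu.1
  obtain ⟨θ0, -, hθ0⟩ := isCompact_univ.exists_isMinOn (univ_nonempty (α := TT)) (Complex.continuous_re.comp hu.1).continuousOn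
  set e := (u θ0).re with he
  have hep : 0 < e := h θ0
  have hmin : ∀ θ, e ≤ (u θ).re := fun θ => hθ0 (mem_univ θ)
  set A := (C ^ 2 + 1) / e with hA
  have hAp : 0 < A := by positivity
  have hAe : A * e = C ^ 2 + 1 := by rw [hA]; field_simp
  -- |u - A|^2 ≤ A^2 - 2 A e + C^2 ≤ A^2 - C^2 - 2
  have hb : ∀ θ, ‖u θ / A - 1‖ ≤ Real.sqrt (A ^ 2 - 1) / A := by
    intro θ
    have hA0 : (A : ℂ) ≠ 0 := by exact_mod_cast hAp.ne'
    have h1 : u θ / A - 1 = (u θ - A) / A := by field_simp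
    rw [h1, norm_div, Complex.norm_real, Real.norm_of_nonneg hAp.le]
    gcongr
    refine Real.le_sqrt_of_sq_le ?_
    rw [← Complex.normSq_eq_norm_sq, Complex.normSq_apply]
    have h2 : (u θ).re ^ 2 + (u θ).im ^ 2 ≤ C ^ 2 := by
      have := hCb θ
      have h3 : ‖u θ‖ ^ 2 ≤ C ^ 2 := by gcongr
      rw [← Complex.normSq_eq_norm_sq, Complex.normSq_apply] at h3
      nlinarith
    have h4 : A * e ≤ A * (u θ).re := by gcongr; exact hmin θ
    simp
    nlinarith
  have hlt : Real.sqrt (A ^ 2 - 1) / A < 1 := by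
    rw [div_lt_one hAp, Real.sqrt_lt' hAp]; linarith
  have h5 := log_near (u := fun θ => u θ / A - 1) ((by simpa [div_eq_inv_mul] using hu.smul (A:ℂ)⁻¹ : InH fun θ => u θ / A).sub (const 1)) hlt hb
  have h6 := h5.add (const (Real.log A : ℂ))
  convert h6 using 2 with θ
  have hA0 : (A : ℂ) ≠ 0 := by exact_mod_cast hAp.ne'
  rw [add_sub_cancel]
  have h7 : u θ / A ≠ 0 := by
    intro h0
    have := h θ
    rw [div_eq_zero_iff] at h0
    rcases h0 with h0 | h0
    · rw [h0] at this; simp at this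
    · exact hA0 h0
  have := Complex.log_ofReal_mul hAp h7
  rw [mul_div_cancel₀ _ hA0] at this
  rw [this, add_comm]

theorem real_const {u : TT → ℂ} (hu : InH u) (h : ∀ θ, (u θ).im = 0) : ∀ θ, u θ = mean u := by
  have hc : ∀ j, fourierCoeff u j = (starRingEnd ℂ) (fourierCoeff u (-j)) := by
    intro j
    rw [← fc_conj]; congr 1; ext θ
    exact (Complex.conj_eq_iff_im.2 (h θ)).symm
  have h0 := eq_zero_of_fc (u := fun θ => u θ - mean u) (hu.1.sub continuous_const) (by
    intro j
    rw [fc_sub hu.1 continuous_const, fc_const]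
    rcases lt_trichotomy j 0 with hj | hj | hj
    · rw [hu.2 j hj, if_neg hj.ne, sub_zero]
    · subst hj; simp [fc_zero_eq]
    · rw [hc, hu.2 (-j) (by linarith), if_neg hj.ne']; simp)
  intro θ
  exact sub_eq_zero.1 (h0 θ)
end InH

/-! disk algebra -/
theorem MemA.add {f g : ℂ → ℂ} (hf : MemA f) (hg : MemA g) : MemA fun z => f z + g z := ⟨hf.1.add hg.1, hf.2.add hg.2⟩
theorem MemA.sub {f g : ℂ → ℂ} (hf : MemA f) (hg : MemA g) : MemA fun z => f z - g z := ⟨hf.1.sub hg.1, hf.2.sub hg.2⟩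
theorem MemA.mul {f g : ℂ → ℂ} (hf : MemA f) (hg : MemA g) : MemA fun z => f z * g z := ⟨hf.1.mul hg.1, hf.2.mul hg.2⟩
theorem MemA.const (c : ℂ) : MemA fun _ => c := ⟨continuousOn_const, differentiableOn_const c⟩
theorem MemA.pow (k : ℕ) : MemA fun z => z ^ k := ⟨by fun_prop, by fun_prop⟩
theorem MemA.exp {f : ℂ → ℂ} (hf : MemA f) : MemA fun z => Complex.exp (f z) := ⟨hf.1.cexp, hf.2.cexp⟩

theorem circ_sub_disk : Circ ⊆ Disk := sphere_subset_closedBall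

theorem MemA.bd_cont {f : ℂ → ℂ} (hf : MemA f) : Continuous fun θ => f (zt θ) :=
  hf.1.comp_continuous zt_cont fun θ => circ_sub_disk (zt_circ θ)

theorem mean_interval (u : TT → ℂ) : mean u = (1 / (2 * Real.pi) : ℝ) • ∫ θ in (0:ℝ)..(2 * Real.pi), u θ := by
  rw [← fc_zero_eq, fourierCoeff_eq_intervalIntegral _ _ 0]
  simp

/-- mean value through circle integrals -/
theorem mean_circle (f : ℂ → ℂ) : (mean fun θ => zt θ * f (zt θ)) = (2 * Real.pi * Complex.I : ℂ)⁻¹ * ∮ z in C(0, 1), f z := by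
  rw [mean_interval, circleIntegral]
  rw [real_smul]
  have : (∫ (θ : ℝ) in (0:ℝ)..2 * Real.pi, deriv (circleMap 0 1) θ • f (circleMap 0 1 θ)) =
      Complex.I * ∫ θ in (0:ℝ)..(2 * Real.pi), (fun θ => zt θ * f (zt θ)) (θ : TT) := by
    rw [← intervalIntegral.integral_const_mul]
    refine intervalIntegral.integral_congr fun θ _ => ?_
    simp only [deriv_circleMap, smul_eq_mul]
    rw [show zt (θ : TT) = _ from zt_coe θ]
    simp [circleMap]; ring
  rw [this]
  push_cast
  have h1 : (Real.pi : ℂ) ≠ 0 := by exact_mod_cast Real.pi_ne_zero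
  field_simp

theorem MemA.inH {f : ℂ → ℂ} (hf : MemA f) : InH fun θ => f (zt θ) := by
  refine ⟨hf.bd_cont, fun j hj => ?_⟩
  rw [fc_def]
  obtain ⟨k, hk⟩ : ∃ k : ℕ, -j = k + 1 := ⟨(-j - 1).toNat, by omega⟩
  have h1 : (fun θ => zt θ ^ (-j) * f (zt θ)) = fun θ => zt θ * (fun z => z ^ k * f z) (zt θ) := by
    ext θ; rw [hk, zpow_add_one₀ (zt_ne θ)]; simp; ring
  have hg := (MemA.pow k).mul hf
  rw [h1, mean_circle (fun z => z ^ k * f z), Complex.circleIntegral_eq_zero_of_differentiable_on_off_countable zero_le_one countable_empty hg.1, mul_zero]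
  intro z hz
  exact hg.2.differentiableAt (isOpen_ball.mem_nhds (by simpa using hz))

theorem MemA.mean {f : ℂ → ℂ} (hf : MemA f) : mean (fun θ => f (zt θ)) = f 0 := by
  have h1 : (fun θ => f (zt θ)) = fun θ => zt θ * (fun z => (z - 0)⁻¹ • f z) (zt θ) := by
    ext θ; have := zt_ne θ; simp; field_simp
  rw [h1, mean_circle (fun z => (z - 0)⁻¹ • f z), Complex.circleIntegral_sub_inv_smul_of_differentiable_on_off_countable countable_empty (by simp) hf.1]
  · have h1 : (Real.pi : ℂ) ≠ 0 := by exact_mod_cast Real.pi_ne_zero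
    simp; field_simp; simp
  · intro z hz
    exact hf.2.differentiableAt (isOpen_ball.mem_nhds (by simpa using hz))

theorem zt_inv (θ : TT) : (starRingEnd ℂ) (zt θ) = (zt θ)⁻¹ := by
  rw [Complex.inv_def, Complex.normSq_eq_norm_sq, zt_norm]; simp

/-- density of real parts -/
theorem densityE {β : TT → ℝ} (hβ : Continuous β) {ε : ℝ} (hε : 0 < ε) :
    ∃ f : ℂ → ℂ, Differentiable ℂ f ∧ f 0 = 0 ∧ ∃ c : ℝ, ∀ θ, |β θ - c - (f (zt θ)).re| < ε := by
  have hp : ∀ P ∈ Submodule.span ℂ (range (@fourier (2 * Real.pi))), ∀ a : ℂ, ∃ f : ℂ → ℂ, Differentiable ℂ f ∧ f 0 = 0 ∧ ∃ c : ℝ,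
      ∀ θ, (a * P θ).re = c + (f (zt θ)).re := by
    intro P hP
    induction hP using Submodule.span_induction with
    | mem P hP =>
      obtain ⟨k, rfl⟩ := hP
      intro a
      simp only [fourier_zt]
      rcases lt_trichotomy k 0 with hk | hk | hk
      · obtain ⟨i, hi⟩ : ∃ i : ℕ, k = -(i + 1 : ℤ) := ⟨(-k - 1).toNat, by omega⟩
        refine ⟨fun z => (starRingEnd ℂ) a * z ^ (i + 1), by fun_prop, by simp, 0, fun θ => ?_⟩
        rw [← Complex.conj_re, map_mul, map_zpow₀, zt_inv, hi]
        simp only [zpow_neg, inv_zpow, inv_inv, zero_add]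
        norm_cast
      · refine ⟨fun _ => 0, by fun_prop, rfl, a.re, fun θ => ?_⟩
        simp [hk]
      · obtain ⟨i, hi⟩ : ∃ i : ℕ, k = (i + 1 : ℤ) := ⟨(k - 1).toNat, by omega⟩
        refine ⟨fun z => a * z ^ (i + 1), by fun_prop, by simp, 0, fun θ => ?_⟩
        rw [hi]; norm_cast; simp
    | zero => exact fun a => ⟨fun _ => 0, by fun_prop, rfl, 0, fun θ => by simp⟩
    | add P P' _ _ h1 h2 =>
      intro a
      obtain ⟨f, hf, hf0, c, hc⟩ := h1 a
      obtain ⟨f', hf', hf0', c', hc'⟩ := h2 a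
      refine ⟨fun z => f z + f' z, by fun_prop, by simp [hf0, hf0'], c + c', fun θ => ?_⟩
      simp only [ContinuousMap.add_apply, mul_add, Complex.add_re, hc, hc']; ring
    | smul s P _ h1 =>
      intro a
      obtain ⟨f, hf, hf0, c, hc⟩ := h1 (a * s)
      exact ⟨f, hf, hf0, c, fun θ => by rw [← hc]; simp [mul_assoc]⟩
  have hd : (⟨fun θ => (β θ : ℂ), by fun_prop⟩ : C(TT, ℂ)) ∈ (Submodule.span ℂ (range (@fourier (2 * Real.pi)))).topologicalClosure := by
    rw [span_fourier_closure_eq_top]; trivial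
  obtain ⟨P, hP, hPd⟩ := Metric.mem_closure_iff.1 hd ε hε
  obtain ⟨f, hf, hf0, c, hc⟩ := hp P hP 1
  refine ⟨f, hf, hf0, c, fun θ => ?_⟩
  have h1 := (ContinuousMap.dist_apply_le_dist θ).trans_lt hPd
  rw [dist_eq_norm] at h1
  have h2 := (Complex.abs_re_le_norm _).trans_lt h1
  have h3 := hc θ
  rw [one_mul] at h3
  simp only [ContinuousMap.coe_mk, Complex.sub_re, Complex.ofReal_re, h3] at h2
  rwa [sub_sub]

theorem MemA.of_entire {f : ℂ → ℂ} (hf : Differentiable ℂ f) : MemA f := ⟨hf.continuous.continuousOn, hf.differentiableOn⟩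

theorem density {β : TT → ℝ} (hβ : Continuous β) {ε : ℝ} (hε : 0 < ε) :
    ∃ f : ℂ → ℂ, MemA f ∧ f 0 = 0 ∧ ∃ c : ℝ, ∀ θ, |β θ - c - (f (zt θ)).re| < ε := by
  obtain ⟨f, hf, h⟩ := densityE hβ hε
  exact ⟨f, MemA.of_entire hf, h⟩

theorem mean_re (u : TT → ℂ) (hu : Continuous u) : (mean u).re = ∫ θ, (u θ).re ∂AddCircle.haarAddCircle := by
  unfold mean
  exact (reCLM.integral_comp_comm (intg hu)).symm

/-- density, mean zero version -/
theorem density0 {β : TT → ℝ} (hβ : Continuous β) (h0 : ∫ θ, β θ ∂AddCircle.haarAddCircle = 0) {ε : ℝ} (hε : 0 < ε) :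
    ∃ f : ℂ → ℂ, MemA f ∧ f 0 = 0 ∧ ∀ θ, |β θ - (f (zt θ)).re| < ε := by
  obtain ⟨f, hf, hf0, c, hc⟩ := density hβ (half_pos hε)
  refine ⟨f, hf, hf0, fun θ => ?_⟩
  have hrc : Continuous fun θ => (f (zt θ)).re := Complex.continuous_re.comp hf.bd_cont
  have hm : ∫ θ, (f (zt θ)).re ∂AddCircle.haarAddCircle = 0 := by
    have := mean_re _ hf.bd_cont
    rw [hf.mean, hf0] at this
    simpa using this.symm
  have h1 : ∫ θ, (β θ - c - (f (zt θ)).re) ∂AddCircle.haarAddCircle = -c := by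
    rw [integral_sub (intgR (u := fun θ => β θ - c) (hβ.sub continuous_const)) (intgR hrc), hm, integral_sub (intgR hβ) (intgR continuous_const), h0]
    simp
  have h2 : |c| ≤ ε / 2 := by
    have := norm_integral_le_of_norm_le_const (μ := AddCircle.haarAddCircle (T := 2 * Real.pi)) (f := fun θ => β θ - c - (f (zt θ)).re) (C := ε / 2) (ae_of_all _ fun θ => by exact (hc θ).le)
    rw [h1] at this
    simpa using this
  have h5 := abs_lt.1 (hc θ)
  have h6 := abs_le.1 h2
  rw [abs_lt]; constructor <;> linarith

theorem InH.log_of {f L : TT → ℂ} (hf : InH f) (hL : Continuous L) (h : ∀ θ, Complex.exp (L θ) = f θ) : InH L := by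
  obtain ⟨P, hP, hP0, c, hc⟩ := density (β := fun θ => (L θ).im) (by fun_prop) one_pos
  have hPc := hP.bd_cont
  have h1 : InH fun θ => Complex.exp ((-Complex.I) * (P (zt θ) + c)) := ((hP.inH.add (InH.const _)).smul _).exp
  have h2 := hf.mul h1
  have h3 : ∀ θ, f θ * Complex.exp ((-Complex.I) * (P (zt θ) + c)) = Complex.exp (L θ + (-Complex.I) * (P (zt θ) + c)) := by
    intro θ; rw [Complex.exp_add, h]
  have him : ∀ θ, (L θ + (-Complex.I) * (P (zt θ) + c)).im = (L θ).im - c - (P (zt θ)).re := by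
    intro θ; simp; ring
  have hpi := Real.pi_gt_three
  have h4 := h2.log_re (by
    intro θ
    rw [h3, Complex.exp_re, him]
    have := abs_lt.1 (hc θ)
    exact mul_pos (Real.exp_pos _) (Real.cos_pos_of_mem_Ioo ⟨by linarith, by linarith⟩))
  have h5 := h4.sub ((hP.inH.add (InH.const c)).smul (-Complex.I))
  convert h5 using 2 with θ
  have := abs_lt.1 (hc θ)
  rw [h3, Complex.log_exp (by rw [him]; linarith) (by rw [him]; linarith)]
  ring

theorem MemAV.bd_cont {n : ℕ} {f : ℂ → Fin n → ℂ} (hf : MemAV f) : Continuous fun θ => f (zt θ) :=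
  continuous_pi fun j => (hf j).bd_cont

theorem ContinuousOn.dot {Y : Type*} [TopologicalSpace Y] {n : ℕ} {a b : Y → Fin n → ℂ} {E : Set Y} (ha : ContinuousOn a E) (hb : ContinuousOn b E) :
    ContinuousOn (fun y => _root_.dot (a y) (b y)) E := continuous_dot.comp_continuousOn (ha.prodMk hb)

theorem Continuous.dot {Y : Type*} [TopologicalSpace Y] {n : ℕ} {a b : Y → Fin n → ℂ} (ha : Continuous a) (hb : Continuous b) :
    Continuous (fun y => _root_.dot (a y) (b y)) := continuous_dot.comp (ha.prodMk hb)

/-- the normalized gradient -/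
def psi {n : ℕ} (g : ℂ × (Fin n → ℂ) → ℝ) (Q : ℂ → Fin n → ℂ) (z : ℂ) (x : Fin n → ℂ) : Fin n → ℂ := fun j =>
  pv g z x j / dot (pv g z x) (x - Q z)

namespace Fib
variable {n : ℕ} {g : ℂ × (Fin n → ℂ) → ℝ} {Q : ℂ → Fin n → ℂ} {R : ℝ}

theorem c_ne (hf : Fib g Q R) {z : ℂ} (hz : z ∈ Circ) {x : Fin n → ℂ} (hx : x ≠ Q z) (hR : g (z, x) < R) :
    dot (pv g z x) (x - Q z) ≠ 0 := by
  intro h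
  refine hf.linconv hz hx hR (w1 := Q z) ?_ hx.symm ?_
  · rw [(hf.zero z hz (Q z)).2 rfl]; exact hf.nonneg z hz x
  · rw [← neg_sub, dot_neg, h, neg_zero]

theorem gcont (hf : Fib g Q R) {x : TT → Fin n → ℂ} (hx : Continuous x) : Continuous fun θ => g (zt θ, x θ) :=
  hf.cont.comp_continuous (zt_cont.prodMk hx) fun θ => zt_ne θ

theorem descent (hf : Fib g Q R) {X : ℂ → Fin n → ℂ} (hX : MemAV X) (hX0 : X 0 = 0) {γ : ℝ} (hγ : 0 < γ)
    (hle : ∀ z ∈ Circ, g (z, X z) ≤ γ)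
    (hmin : ∀ Y : ℂ → Fin n → ℂ, MemAV Y → Y 0 = 0 → ∀ t, (∀ z ∈ Circ, g (z, Y z) ≤ t) → γ ≤ t)
    {h : ℂ → Fin n → ℂ} (hh : MemAV h) (hh0 : h 0 = 0)
    (hneg : ∀ θ, g (zt θ, X (zt θ)) = γ → dg g (zt θ) (X (zt θ)) (h (zt θ)) < 0) : False := by
  have hxc := hX.bd_cont
  have hhc := hh.bd_cont
  set x : TT → Fin n → ℂ := fun θ => X (zt θ) with hx
  set v : TT → Fin n → ℂ := fun θ => h (zt θ) with hv
  have hmove : Continuous fun p : ℝ × TT => (zt p.2, x p.2 + p.1 • v p.2) := by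
    have := zt_cont
    fun_prop
  have key : ∀ᶠ s in nhds (0:ℝ), ∀ θ ∈ (univ : Set TT), 0 < s → g (zt θ, x θ + s • v θ) < γ := by
    refine isCompact_univ.eventually_forall_of_forall_eventually fun θ _ => ?_
    rcases (hle _ (zt_circ θ)).lt_or_eq with hlt | heq
    · have h1 : Continuous fun p : ℝ × TT => g (zt p.2, x p.2 + p.1 • v p.2) :=
        hf.cont.comp_continuous hmove fun p => zt_ne p.2
      have h2 := (h1.continuousAt (x := ((0:ℝ), θ))).eventually_lt_const (u := γ) (by simpa using hlt)
      exact h2.mono fun p hp _ => hp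
    · have hxQ : x θ ≠ Q (zt θ) := by
        intro he
        rw [show X (zt θ) = _ from he, (hf.zero _ (zt_circ θ) _).2 rfl] at heq
        exact hγ.ne heq
      have hU : (zt θ, x θ + (0:ℝ) • v θ) ∈ Ud Q := by simpa using hf.mem (zt_circ θ) hxQ
      have hop : IsOpen {q : (ℂ × (Fin n → ℂ)) × (Fin n → ℂ) | q.1 ∈ Ud Q} := hf.Uo.preimage continuous_fst
      have h2 : ContinuousAt (fun p : ℝ × TT => dg g (zt p.2) (x p.2 + p.1 • v p.2) (v p.2)) (0, θ) :=
        ContinuousAt.comp (g := fun q : (ℂ × (Fin n → ℂ)) × (Fin n → ℂ) => dg g q.1.1 q.1.2 q.2)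
          (f := fun p : ℝ × TT => ((zt p.2, x p.2 + p.1 • v p.2), v p.2)) (x := ((0:ℝ), θ))
          (hf.dg_cont.continuousAt (hop.mem_nhds (by exact hU))) (hmove.prodMk (by fun_prop)).continuousAt
      have h3 := h2.eventually_lt_const (u := 0) (by simpa using hneg θ heq)
      have h4 := (hmove.continuousAt (x := ((0:ℝ), θ))).eventually (hf.Uo.mem_nhds (by exact hU))
      obtain ⟨r, hr, hr'⟩ := Metric.eventually_nhds_iff_ball.1 (h3.and h4)
      refine Metric.eventually_nhds_iff_ball.2 ⟨r, hr, fun p hp hp0 => ?_⟩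
      have hseg : ∀ t ∈ Icc (0:ℝ) p.1, (t, p.2) ∈ ball ((0:ℝ), θ) r := by
        intro t ht
        rw [← ball_prod_same] at hp ⊢
        refine ⟨?_, hp.2⟩
        have := hp.1
        rw [mem_ball_zero_iff, Real.norm_of_nonneg hp0.le] at this
        rw [mem_ball_zero_iff, Real.norm_of_nonneg ht.1]
        linarith [ht.2]
      have hd : ∀ t ∈ Icc (0:ℝ) p.1, HasDerivAt (fun t : ℝ => g (zt p.2, x p.2 + t • v p.2)) (dg g (zt p.2) (x p.2 + t • v p.2) (v p.2)) t := by
        intro t ht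
        have h1 := (hr' _ (hseg t ht)).2
        have ha : HasDerivAt (fun t : ℝ => x p.2 + t • v p.2) (v p.2) t := by
          simpa using ((hasDerivAt_id t).smul_const (v p.2)).const_add (x p.2)
        exact HasFDerivAt.comp_hasDerivAt (l := fun y => g (zt p.2, y)) t (hf.slice_strict (zt_circ p.2) h1.2).hasFDerivAt ha
      have hanti : StrictAntiOn (fun t : ℝ => g (zt p.2, x p.2 + t • v p.2)) (Icc 0 p.1) := by
        refine strictAntiOn_of_deriv_neg (convex_Icc _ _) (fun t ht => (hd t ht).continuousAt.continuousWithinAt) fun t ht => ?_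
        rw [interior_Icc] at ht
        have ht' := Ioo_subset_Icc_self ht
        rw [(hd t ht').deriv]
        exact (hr' _ (hseg t ht')).1
      have := hanti (left_mem_Icc.2 hp0.le) (right_mem_Icc.2 hp0.le) hp0
      simp only [zero_smul, add_zero] at this
      exact this.trans_le (hle _ (zt_circ _))
  obtain ⟨r, hr, hr'⟩ := Metric.eventually_nhds_iff_ball.1 key
  have hs : 0 < r / 2 := by positivity
  have hb := hr' (r / 2) (by rw [mem_ball_zero_iff, Real.norm_of_nonneg hs.le]; linarith)
  set Y : ℂ → Fin n → ℂ := fun z => X z + (r / 2) • h z with hY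
  have hYA : MemAV Y := fun j => by
    have := (hX j).add ((MemA.const ((r / 2 : ℝ) : ℂ)).mul (hh j))
    simpa [hY] using this
  have hYc : Continuous fun θ => g (zt θ, Y (zt θ)) := hf.gcont hYA.bd_cont
  obtain ⟨θ0, -, hθ0⟩ := isCompact_univ.exists_isMaxOn (univ_nonempty (α := TT)) hYc.continuousOn
  have h1 := hmin Y hYA (by simp [hY, hX0, hh0]) (g (zt θ0, Y (zt θ0))) (by
    intro z hz
    obtain ⟨θ, rfl⟩ := zt_surj hz
    exact hθ0 (mem_univ θ))
  exact absurd (hb θ0 trivial hs) (not_lt.2 h1)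

set_option maxHeartbeats 800000 in
theorem no_dir (hf : Fib g Q R) {X : ℂ → Fin n → ℂ} (hX : MemAV X) (hX0 : X 0 = 0) {γ : ℝ} (hγ : 0 < γ) (hγR : γ < R)
    {Qa : ℂ → Fin n → ℂ} (hQa : MemAV Qa) (hQQ : ∀ z ∈ Circ, Qa z = Q z)
    (hle : ∀ z ∈ Circ, g (z, X z) ≤ γ)
    (hmin : ∀ Y : ℂ → Fin n → ℂ, MemAV Y → Y 0 = 0 → ∀ t, (∀ z ∈ Circ, g (z, Y z) ≤ t) → γ ≤ t)
    {F : ℂ → ℂ} (hF : MemA F) (hF0 : F 0 = 0) (α : ℂ) (i : ℕ) (j : Fin n)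
    (hpos : ∀ θ, g (zt θ, X (zt θ)) = γ → 1 / 2 ≤ (F (zt θ) + α * zt θ ^ (i + 1) * psi g Q (zt θ) (X (zt θ)) j).re) : False := by
  have hxc := hX.bd_cont
  set x : TT → Fin n → ℂ := fun θ => X (zt θ) with hx
  have hQc : Continuous fun θ => Q (zt θ) := by
    have := hQa.bd_cont
    convert this using 2 with θ
    rw [hQQ _ (zt_circ θ)]
  set E : Set TT := {θ | g (zt θ, x θ) = γ} with hE
  have hEc : IsClosed E := isClosed_eq (hf.gcont hxc) continuous_const
  have hEQ : ∀ θ ∈ E, x θ ≠ Q (zt θ) := by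
    intro θ hθ he
    have h1 : g (zt θ, x θ) = γ := hθ
    rw [he, (hf.zero _ (zt_circ θ) _).2 rfl] at h1
    exact hγ.ne h1
  have : CompactSpace E := isCompact_iff_compactSpace.1 hEc.isCompact
  obtain ⟨L, hL, hLe⟩ := hf.haslog (Y := E) (ζ := fun θ => zt θ) (w := fun θ => x θ) (w' := fun θ => Q (zt θ))
    (zt_cont.comp continuous_subtype_val) (fun θ => zt_circ _) (hxc.comp continuous_subtype_val)
    (hQc.comp continuous_subtype_val) (fun θ => by rw [show g (zt θ, x θ) = γ from θ.2]; exact hγR)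
    (fun θ => by rw [(hf.zero _ (zt_circ θ) _).2 rfl]; exact hf.nonneg _ (zt_circ _) _) (fun θ => hEQ θ θ.2) (fun θ => hEQ θ θ.2)
  -- the multiplier u on E
  have hpvc : ContinuousOn (fun θ => pv g (zt θ) (x θ)) E :=
    hf.pv_cont.comp (zt_cont.prodMk hxc).continuousOn fun θ hθ => hf.mem (zt_circ θ) (hEQ θ hθ)
  have hcne : ∀ θ ∈ E, dot (pv g (zt θ) (x θ)) (x θ - Q (zt θ)) ≠ 0 := fun θ hθ =>
    hf.c_ne (zt_circ θ) (hEQ θ hθ) (by rw [show g (zt θ, x θ) = γ from hθ]; exact hγR)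
  set u : TT → ℂ := fun θ => F (zt θ) + α * zt θ ^ (i + 1) * psi g Q (zt θ) (x θ) j with hu
  have huc : ContinuousOn u E := by
    have h1 : ContinuousOn (fun θ => psi g Q (zt θ) (x θ) j) E := by
      have ha : ContinuousOn (fun θ => pv g (zt θ) (x θ) j) E := (continuous_apply j).comp_continuousOn hpvc
      have hb : ContinuousOn (fun θ => dot (pv g (zt θ) (x θ)) (x θ - Q (zt θ))) E :=
        hpvc.dot (hxc.continuousOn.sub hQc.continuousOn)
      exact ha.div hb hcne
    exact hF.bd_cont.continuousOn.add ((continuous_const.mul (zt_cont.pow _)).continuousOn.mul h1)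
  obtain ⟨M, hM0, hM⟩ : ∃ M > 0, ∀ θ ∈ E, ‖u θ‖ ≤ M := by
    obtain ⟨M, hM⟩ := hEc.isCompact.exists_bound_of_continuousOn huc
    exact ⟨|M| + 1, by positivity, fun θ hθ => (hM θ hθ).trans (by linarith [le_abs_self M])⟩
  obtain ⟨β, hβ⟩ := ContinuousMap.exists_restrict_eq hEc (⟨fun θ => (L θ).im, by fun_prop⟩ : C(E, ℝ))
  have hβ' : ∀ θ : E, β θ = (L θ).im := fun θ => by
    have := DFunLike.congr_fun hβ θ
    simpa using this
  set ε := min 1 (1 / (8 * M)) with hε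
  have hε0 : 0 < ε := by positivity
  obtain ⟨P, hP, -, c0, hc0⟩ := density β.continuous hε0
  set k : ℂ → ℂ := fun z => Complex.exp (-Complex.I * (P z + c0)) with hk
  have hkA : MemA k := ((MemA.const _).mul (hP.add (MemA.const _))).exp
  set h : ℂ → Fin n → ℂ := fun z l => -k z * (F z * (X z l - Qa z l) + α * z ^ (i + 1) * (if l = j then 1 else 0)) with hh
  have hhA : MemAV h := by
    intro l
    have h1 := ((MemA.const (-1)).mul hkA).mul ((hF.mul ((hX l).sub (hQa l))).add (((MemA.const α).mul (MemA.pow (i + 1))).mul (MemA.const (if l = j then 1 else 0))))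
    simpa [hh] using h1
  refine hf.descent hX hX0 hγ hle hmin hhA (by ext l; simp [hh, hF0]) fun θ hθ => ?_
  have hθE : θ ∈ E := hθ
  rw [← re_dot_pv]
  have h1 : dot (pv g (zt θ) (X (zt θ))) (h (zt θ)) = - (k (zt θ) * dot (pv g (zt θ) (x θ)) (x θ - Q (zt θ)) * u θ) := by
    have h2 : h (zt θ) = (-k (zt θ)) • (F (zt θ) • (x θ - Q (zt θ)) + (α * zt θ ^ (i + 1)) • (Pi.single j 1 : Fin n → ℂ)) := by
      ext l
      simp [hh, hx, hQQ _ (zt_circ θ), Pi.single_apply]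
    rw [h2, dot_smul, dot_add, dot_smul, dot_smul]
    have h3 : dot (pv g (zt θ) (X (zt θ))) (Pi.single j 1) = pv g (zt θ) (x θ) j := by
      simp [dot, Pi.single_apply, hx]
    rw [h3]
    have h4 := hcne θ hθE
    simp only [hu, psi]
    rw [show X (zt θ) = x θ from rfl]
    field_simp
  have h5 : k (zt θ) * dot (pv g (zt θ) (x θ)) (x θ - Q (zt θ)) = Complex.exp (L ⟨θ, hθE⟩ + -Complex.I * (P (zt θ) + c0)) := by
    rw [Complex.exp_add, hLe ⟨θ, hθE⟩, mul_comm]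
  rw [h1, h5, Complex.neg_re, Complex.mul_re, Complex.exp_re, Complex.exp_im]
  have him : (L ⟨θ, hθE⟩ + -Complex.I * (P (zt θ) + c0)).im = β θ - c0 - (P (zt θ)).re := by
    rw [hβ' ⟨θ, hθE⟩]; simp; ring
  rw [him]
  set b := β θ - c0 - (P (zt θ)).re with hb
  have hbε : |b| < ε := hc0 θ
  set A := Real.exp (L ⟨θ, hθE⟩ + -Complex.I * (P (zt θ) + c0)).re with hA
  have hAp : 0 < A := Real.exp_pos _
  have hur : 1 / 2 ≤ (u θ).re := hpos θ hθ
  have hui : |(u θ).im| ≤ M := (Complex.abs_im_le_norm _).trans (hM θ hθE)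
  have hcos : 1 / 2 ≤ Real.cos b := by
    have h6 := Real.one_sub_sq_div_two_le_cos (x := b)
    have h7 : b ^ 2 ≤ 1 := by rw [sq_le_one_iff_abs_le_one]; exact hbε.le.trans (min_le_left _ _)
    linarith
  have hsin : |Real.sin b| ≤ 1 / (8 * M) := Real.abs_sin_le_abs.trans (hbε.le.trans (min_le_right _ _))
  have h8 : |Real.sin b * (u θ).im| ≤ 1 / 8 := by
    rw [abs_mul]
    calc |Real.sin b| * |(u θ).im| ≤ 1 / (8 * M) * M := by gcongr
      _ = 1 / 8 := by field_simp
  have h9 := abs_le.1 h8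
  have h10 : 1 / 4 ≤ Real.cos b * (u θ).re := by nlinarith
  have h11 : A * Real.cos b * (u θ).re - A * Real.sin b * (u θ).im = A * (Real.cos b * (u θ).re - Real.sin b * (u θ).im) := by ring
  rw [h11, neg_lt_zero]
  exact mul_pos hAp (by linarith [h9.2])

theorem necessity (hf : Fib g Q R) (hn : 1 ≤ n) {X : ℂ → Fin n → ℂ} (hX : MemAV X) (hX0 : X 0 = 0) {γ : ℝ} (hγ : 0 < γ) (hγR : γ < R)
    {Qa : ℂ → Fin n → ℂ} (hQa : MemAV Qa) (hQQ : ∀ z ∈ Circ, Qa z = Q z)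
    (hle : ∀ z ∈ Circ, g (z, X z) ≤ γ)
    (hmin : ∀ Y : ℂ → Fin n → ℂ, MemAV Y → Y 0 = 0 → ∀ t, (∀ z ∈ Circ, g (z, Y z) ≤ t) → γ ≤ t) :
    (∀ θ, g (zt θ, X (zt θ)) = γ) ∧ ∀ j, InH fun θ => psi g Q (zt θ) (X (zt θ)) j := by
  have hxc := hX.bd_cont
  have hgc : Continuous fun θ => g (zt θ, X (zt θ)) := hf.gcont hxc
  have hall : ∀ θ, g (zt θ, X (zt θ)) = γ := by
    by_contra hne
    push Not at hne
    obtain ⟨θ0, hθ0⟩ := hne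
    set d : TT → ℝ := fun θ => γ - g (zt θ, X (zt θ)) with hd
    have hdc : Continuous d := continuous_const.sub hgc
    have hd0 : ∀ θ, 0 ≤ d θ := fun θ => sub_nonneg.2 (hle _ (zt_circ θ))
    have hintg : 0 < ∫ θ, d θ ∂AddCircle.haarAddCircle := by
      refine (integral_pos_iff_support_of_nonneg hd0 (intgR hdc)).2 ?_
      refine hdc.isOpen_support.measure_pos _ ⟨θ0, ?_⟩
      rw [Function.mem_support]
      exact fun h => hθ0 (sub_eq_zero.1 h).symm
    set I0 := ∫ θ, d θ ∂AddCircle.haarAddCircle with hI0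
    obtain ⟨F, hF, hF0, hFb⟩ := density0 (β := fun θ => 1 - I0⁻¹ * d θ) (by fun_prop) (by
      rw [integral_sub (intgR continuous_const) (intgR (by fun_prop)), integral_const_mul, ← hI0, inv_mul_cancel₀ hintg.ne']
      simp) (half_pos one_pos)
    refine hf.no_dir hX hX0 hγ hγR hQa hQQ hle hmin hF hF0 0 0 ⟨0, hn⟩ fun θ hθ => ?_
    have h1 := abs_lt.1 (hFb θ)
    have h2 : d θ = 0 := by simp [hd, hθ]
    rw [h2] at h1
    simp only [zero_mul, add_zero]
    linarith [h1.2]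
  refine ⟨hall, fun j => ?_⟩
  have hEQ : ∀ θ, X (zt θ) ≠ Q (zt θ) := by
    intro θ he
    have h1 := hall θ
    rw [he, (hf.zero _ (zt_circ θ) _).2 rfl] at h1
    exact hγ.ne h1
  have hQc : Continuous fun θ => Q (zt θ) := by
    have := hQa.bd_cont
    convert this using 2 with θ
    rw [hQQ _ (zt_circ θ)]
  have hpvc : Continuous (fun θ => pv g (zt θ) (X (zt θ))) :=
    hf.pv_cont.comp_continuous (zt_cont.prodMk hxc) fun θ => hf.mem (zt_circ θ) (hEQ θ)
  have hpc : Continuous fun θ => psi g Q (zt θ) (X (zt θ)) j := by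
    unfold psi
    refine ((continuous_apply j).comp hpvc).div ?_ fun θ => hf.c_ne (zt_circ θ) (hEQ θ) (by rw [hall]; exact hγR)
    exact continuous_dot.comp (hpvc.prodMk (hxc.sub hQc))
  refine ⟨hpc, fun i hi => ?_⟩
  by_contra hne
  obtain ⟨i', hi'⟩ : ∃ i' : ℕ, i = -(i' + 1 : ℤ) := ⟨(-i - 1).toNat, by omega⟩
  set a := fourierCoeff (fun θ => psi g Q (zt θ) (X (zt θ)) j) i with ha
  have hm : mean (fun θ => a⁻¹ * zt θ ^ (i' + 1) * psi g Q (zt θ) (X (zt θ)) j) = 1 := by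
    have h1 := fc_smul (fun θ => zt θ ^ (-i) * psi g Q (zt θ) (X (zt θ)) j) a⁻¹ 0
    rw [fc_zt_mul, fc_zero_eq, zero_sub, neg_neg, ← ha, inv_mul_cancel₀ hne] at h1
    rw [← h1]
    congr 1; ext θ
    rw [hi', neg_neg]
    norm_cast
    ring
  set w : TT → ℂ := fun θ => a⁻¹ * zt θ ^ (i' + 1) * psi g Q (zt θ) (X (zt θ)) j with hw
  have hwc : Continuous w := (continuous_const.mul (zt_cont.pow _)).mul hpc
  obtain ⟨F, hF, hF0, hFb⟩ := density0 (β := fun θ => 1 - (w θ).re) (by fun_prop) (by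
      rw [integral_sub (intgR continuous_const) (intgR (by fun_prop)), ← mean_re w hwc, hm]
      simp) (half_pos one_pos)
  refine hf.no_dir hX hX0 hγ hγR hQa hQQ hle hmin hF hF0 a⁻¹ i' j fun θ hθ => ?_
  have h1 := abs_lt.1 (hFb θ)
  rw [Complex.add_re]
  have h2 : (a⁻¹ * zt θ ^ (i' + 1) * psi g Q (zt θ) (X (zt θ)) j).re = (w θ).re := rfl
  rw [h2]
  linarith [h1.2]
end Fib

/-- complex gradient of a real-linear functional -/
theorem lin_dot {n : ℕ} (l : (Fin n → ℂ) →ₗ[ℝ] ℝ) (u : Fin n → ℂ) :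
    dot (fun j => (l (Pi.single j 1) : ℂ) - Complex.I * (l (Pi.single j Complex.I) : ℂ)) u = (l u : ℂ) - Complex.I * (l (Complex.I • u) : ℂ) := by
  have h : ∀ v : Fin n → ℂ, l v = ∑ j, ((v j).re * l (Pi.single j 1) + (v j).im * l (Pi.single j Complex.I)) := by
    intro v
    have hv : v = ∑ j, ((v j).re • (Pi.single j (1:ℂ) : Fin n → ℂ) + (v j).im • (Pi.single j Complex.I : Fin n → ℂ)) := by
      ext i
      simp only [Finset.sum_apply, Pi.add_apply, Pi.smul_apply]
      rw [Finset.sum_eq_single i]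
      · simp
      · intro b _ hb; simp [hb.symm]
      · simp
    conv_lhs => rw [hv]
    simp only [map_sum, map_add, map_smul, smul_eq_mul]
  rw [h u, h (Complex.I • u)]
  unfold dot
  push_cast
  rw [Finset.mul_sum, ← Finset.sum_sub_distrib]
  refine Finset.sum_congr rfl fun j _ => ?_
  have hu := (Complex.re_add_im (u j)).symm
  simp
  linear_combination ((l (Pi.single j 1)) - Complex.I * (l (Pi.single j Complex.I)) : ℂ) * hu +
    (- (l (Pi.single j Complex.I)) * ((u j).im : ℂ)) * Complex.I_sq

/-- derivative of the complex gradient -/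
def hv {n : ℕ} (g : ℂ × (Fin n → ℂ) → ℝ) (z : ℂ) (x v : Fin n → ℂ) : Fin n → ℂ := fun j =>
  (d2 g z x v (Pi.single j 1) : ℂ) - Complex.I * (d2 g z x v (Pi.single j Complex.I) : ℂ)

theorem re_dot_hv {n : ℕ} (g : ℂ × (Fin n → ℂ) → ℝ) (z : ℂ) (x v u : Fin n → ℂ) : (dot (hv g z x v) u).re = d2 g z x v u := by
  have := lin_dot (((fderiv ℝ (fderiv ℝ g) (z, x) (0, v)).comp (ContinuousLinearMap.inr ℝ ℂ (Fin n → ℂ))).toLinearMap) u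
  simp only [ContinuousLinearMap.coe_coe, ContinuousLinearMap.comp_apply, ContinuousLinearMap.inr_apply] at this
  unfold hv d2
  rw [this]; simp

theorem hv_smul {n : ℕ} (g : ℂ × (Fin n → ℂ) → ℝ) (z : ℂ) (x v : Fin n → ℂ) (r : ℝ) : hv g z x (r • v) = r • hv g z x v := by
  ext j
  have : ((0:ℂ), r • v) = r • ((0:ℂ), v) := by simp
  simp only [hv, d2, this, map_smul, Pi.smul_apply, smul_apply, smul_eq_mul, real_smul]
  push_cast; ring

theorem unif_diff {Y E F : Type*} [TopologicalSpace Y] [CompactSpace Y] [NormedAddCommGroup E] [NormedSpace ℝ E]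
    [NormedAddCommGroup F] [NormedSpace ℝ F] {f : E → F} {U : Set E} (hU : IsOpen U) (hf : ContDiffOn ℝ 1 f U)
    {q : Y → E} (hq : Continuous q) (hqU : ∀ y, q y ∈ U) {η : ℝ} (hη : 0 < η) :
    ∃ δ > 0, ∀ y e, ‖e - q y‖ < δ → ‖f e - f (q y) - fderiv ℝ f (q y) (e - q y)‖ ≤ η * ‖e - q y‖ := by
  have key : ∀ᶠ v in nhds (0:E), ∀ y ∈ (univ : Set Y), ‖f (q y + v) - f (q y) - fderiv ℝ f (q y) v‖ ≤ η * ‖v‖ := by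
    refine isCompact_univ.eventually_forall_of_forall_eventually fun y _ => ?_
    have hc := hf.contDiffAt (hU.mem_nhds (hqU y))
    have h1 := (hc.hasStrictFDerivAt (by norm_num)).isLittleO.def (half_pos hη)
    have h2 : ContinuousAt (fun p : E × Y => (q p.2 + p.1, q p.2)) (0, y) := by fun_prop
    have h3 : ContinuousAt (fun e => fderiv ℝ f e) (q y) := (hc.fderiv_right (m := 0) (by norm_num)).continuousAt
    have h4 : ContinuousAt (fun p : E × Y => fderiv ℝ f (q p.2)) (0, y) :=
      ContinuousAt.comp (g := fderiv ℝ f) (f := fun p : E × Y => q p.2) (x := ((0:E), y)) h3 (by fun_prop)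
    have h5 : ∀ᶠ p : E × Y in nhds (0, y), ‖fderiv ℝ f (q p.2) - fderiv ℝ f (q y)‖ < η / 2 := by
      have := h4.eventually (Metric.ball_mem_nhds _ (half_pos hη))
      simpa [dist_eq_norm] using this
    have h6 : ∀ᶠ p : E × Y in nhds (0, y), ‖f (q p.2 + p.1) - f (q p.2) - fderiv ℝ f (q y) (q p.2 + p.1 - q p.2)‖ ≤ η / 2 * ‖q p.2 + p.1 - q p.2‖ :=
      h2.eventually (by simp only [add_zero]; exact h1)
    filter_upwards [h5, h6] with p hp5 hp6
    rw [add_sub_cancel_left] at hp6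
    have : f (q p.2 + p.1) - f (q p.2) - fderiv ℝ f (q p.2) p.1 = (f (q p.2 + p.1) - f (q p.2) - fderiv ℝ f (q y) p.1) - (fderiv ℝ f (q p.2) - fderiv ℝ f (q y)) p.1 := by
      simp
    rw [this]
    refine (norm_sub_le _ _).trans ?_
    have := (fderiv ℝ f (q p.2) - fderiv ℝ f (q y)).le_opNorm p.1
    nlinarith [norm_nonneg p.1]
  obtain ⟨δ, hδ, h⟩ := Metric.eventually_nhds_iff_ball.1 key
  refine ⟨δ, hδ, fun y e he => ?_⟩
  have := h (e - q y) (by simpa using he) y trivial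
  simpa using this

theorem quad_bound {Y : Type*} [TopologicalSpace Y] [CompactSpace Y] {n : ℕ} {F P : Y → (Fin n → ℂ) → ℝ}
    (hF : Continuous fun p : Y × (Fin n → ℂ) => F p.1 p.2) (hP : Continuous fun p : Y × (Fin n → ℂ) => P p.1 p.2)
    (hFh : ∀ y v (r : ℝ), F y (r • v) = r ^ 2 * F y v) (hPh : ∀ y v (r : ℝ), P y (r • v) = r ^ 2 * P y v) (hP0 : ∀ y v, 0 ≤ P y v)
    (hpos : ∀ y v, v ≠ 0 → P y v = 0 → 0 < F y v) :
    ∃ k > 0, ∃ C > 0, ∀ y v, k * ‖v‖ ^ 2 ≤ F y v + C * P y v := by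
  set Z : Set (Y × (Fin n → ℂ)) := univ ×ˢ sphere 0 1 with hZ
  have hZc : IsCompact Z := isCompact_univ.prod (isCompact_sphere _ _)
  have hZ0 : ∀ p ∈ Z, p.2 ≠ 0 := by
    rintro p ⟨-, hp⟩ h0
    rw [h0] at hp; simp at hp
  have hhom : ∀ k C, (∀ p ∈ Z, k ≤ F p.1 p.2 + C * P p.1 p.2) → ∀ y v, k * ‖v‖ ^ 2 ≤ F y v + C * P y v := by
    intro k C h y v
    rcases eq_or_ne v 0 with rfl | hv
    · have h1 := hFh y 0 0
      have h2 := hPh y 0 0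
      simp at h1 h2
      simp [h1, h2]
    · have hn : ‖v‖ ≠ 0 := norm_ne_zero_iff.2 hv
      have := h (y, ‖v‖⁻¹ • v) ⟨trivial, by simp [norm_smul, inv_mul_cancel₀ hn]⟩
      simp only [hFh, hPh] at this
      have h3 := mul_le_mul_of_nonneg_right this (sq_nonneg ‖v‖)
      calc k * ‖v‖ ^ 2 ≤ _ := h3
        _ = _ := by field_simp
  obtain ⟨M, hM⟩ : ∃ M, ∀ p ∈ Z, -M ≤ F p.1 p.2 := by
    obtain ⟨M, hM⟩ := hZc.exists_bound_of_continuousOn hF.continuousOn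
    exact ⟨M, fun p hp => (abs_le.1 (hM p hp)).1⟩
  set Z' := Z ∩ {p | F p.1 p.2 ≤ 0} with hZ'
  have hZ'c : IsCompact Z' := hZc.inter_right (isClosed_le hF continuous_const)
  obtain ⟨p0, hp0, hp0'⟩ : ∃ p0 > 0, ∀ p ∈ Z', p0 ≤ P p.1 p.2 := by
    rcases Z'.eq_empty_or_nonempty with he | hne
    · exact ⟨1, one_pos, by simp [he]⟩
    · obtain ⟨p, hp, hmin⟩ := hZ'c.exists_isMinOn hne hP.continuousOn
      refine ⟨_, (hP0 p.1 p.2).lt_of_ne ?_, fun q hq => hmin hq⟩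
      intro h0
      exact absurd (hpos p.1 p.2 (hZ0 p hp.1) h0.symm) (not_lt.2 hp.2)
  set C := (|M| + 1) / p0 with hC
  have hC0 : 0 < C := by positivity
  have hall : ∀ p ∈ Z, 0 < F p.1 p.2 + C * P p.1 p.2 := by
    intro p hp
    by_cases h : F p.1 p.2 ≤ 0
    · have h1 := hp0' p ⟨hp, h⟩
      have h2 : |M| + 1 ≤ C * P p.1 p.2 := by
        calc |M| + 1 = C * p0 := by rw [hC]; field_simp
          _ ≤ _ := by gcongr
      linarith [hM p hp, le_abs_self M]
    · push Not at h
      have := mul_nonneg hC0.le (hP0 p.1 p.2)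
      linarith
  obtain ⟨k, hk, hk'⟩ : ∃ k > 0, ∀ p ∈ Z, k ≤ F p.1 p.2 + C * P p.1 p.2 := by
    rcases Z.eq_empty_or_nonempty with he | hne
    · exact ⟨1, one_pos, by simp [he]⟩
    · have hc : Continuous fun p : Y × (Fin n → ℂ) => F p.1 p.2 + C * P p.1 p.2 := hF.add (hP.const_mul C)
      obtain ⟨p, hp, hmin⟩ := hZc.exists_isMinOn hne hc.continuousOn
      exact ⟨_, hall p hp, fun q hq => hmin hq⟩
  exact ⟨k, hk, C, hC0, hhom k C hk'⟩

structure Extr {n : ℕ} (g : ℂ × (Fin n → ℂ) → ℝ) (Q : ℂ → Fin n → ℂ) (R : ℝ) (x : TT → Fin n → ℂ) (γ : ℝ) : Prop where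
  fib : Fib g Q R
  gpos : 0 < γ
  gR : γ < R
  xH : ∀ i, InH fun θ => x θ i
  x0 : ∀ i, mean (fun θ => x θ i) = 0
  QH : ∀ i, InH fun θ => Q (zt θ) i
  lev : ∀ θ, g (zt θ, x θ) = γ
  psiH : ∀ i, InH fun θ => psi g Q (zt θ) (x θ) i

/-- `p·φ` -/
def cf {n : ℕ} (g : ℂ × (Fin n → ℂ) → ℝ) (Q : ℂ → Fin n → ℂ) (z : ℂ) (x : Fin n → ℂ) : ℂ := dot (pv g z x) (x - Q z)

/-- tangential projection -/
def prj {n : ℕ} (g : ℂ × (Fin n → ℂ) → ℝ) (Q : ℂ → Fin n → ℂ) (z : ℂ) (x v : Fin n → ℂ) : Fin n → ℂ :=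
  v - (dot (psi g Q z x) v) • (x - Q z)

theorem psi_eq {n : ℕ} (g : ℂ × (Fin n → ℂ) → ℝ) (Q : ℂ → Fin n → ℂ) (z : ℂ) (x : Fin n → ℂ) :
    psi g Q z x = (cf g Q z x)⁻¹ • pv g z x := by
  ext j; simp [psi, cf, div_eq_inv_mul]

theorem dot_psi {n : ℕ} (g : ℂ × (Fin n → ℂ) → ℝ) (Q : ℂ → Fin n → ℂ) (z : ℂ) (x v : Fin n → ℂ) :
    dot (psi g Q z x) v = (cf g Q z x)⁻¹ * dot (pv g z x) v := by rw [psi_eq, smul_dot]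

theorem dot_pv_prj {n : ℕ} {g : ℂ × (Fin n → ℂ) → ℝ} {Q : ℂ → Fin n → ℂ} {z : ℂ} {x : Fin n → ℂ} (h : cf g Q z x ≠ 0) (v : Fin n → ℂ) :
    dot (pv g z x) (prj g Q z x v) = 0 := by
  rw [prj, dot_sub, dot_smul, dot_psi, show dot (pv g z x) (x - Q z) = cf g Q z x from rfl]
  field_simp; ring

theorem prj_of_zero {n : ℕ} {g : ℂ × (Fin n → ℂ) → ℝ} {Q : ℂ → Fin n → ℂ} {z : ℂ} {x v : Fin n → ℂ} (h : dot (pv g z x) v = 0) :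
    prj g Q z x v = v := by simp [prj, dot_psi, h]

theorem prj_smul {n : ℕ} (g : ℂ × (Fin n → ℂ) → ℝ) (Q : ℂ → Fin n → ℂ) (z : ℂ) (x v : Fin n → ℂ) (r : ℝ) :
    prj g Q z x (r • v) = r • prj g Q z x v := by
  have : r • v = (r : ℂ) • v := by ext; simp
  rw [this, prj, dot_smul, mul_smul, ← smul_sub, prj]
  ext; simp

theorem dot_rsmul {n : ℕ} (r : ℝ) (a b : Fin n → ℂ) : dot a (r • b) = r * dot a b := by
  have : r • b = (r : ℂ) • b := by ext; simp
  rw [this, dot_smul]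

theorem rsmul_dot {n : ℕ} (r : ℝ) (a b : Fin n → ℂ) : dot (r • a) b = r * dot a b := by
  rw [dot_comm', dot_rsmul, dot_comm']

theorem Fib.hv_cont {n : ℕ} {g : ℂ × (Fin n → ℂ) → ℝ} {Q : ℂ → Fin n → ℂ} {R : ℝ} (hf : Fib g Q R) :
    ContinuousOn (fun q : (ℂ × (Fin n → ℂ)) × (Fin n → ℂ) => hv g q.1.1 q.1.2 q.2) {q | q.1 ∈ Ud Q} := by
  have h1 : ContinuousOn (fun q : (ℂ × (Fin n → ℂ)) × (Fin n → ℂ) => fderiv ℝ (fderiv ℝ g) q.1) {q | q.1 ∈ Ud Q} := by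
    intro q hq
    exact (ContinuousAt.comp (g := fderiv ℝ (fderiv ℝ g)) (f := fun q : (ℂ × (Fin n → ℂ)) × (Fin n → ℂ) => q.1) (x := q)
      (hf.cda2 hq).continuousAt continuous_fst.continuousAt).continuousWithinAt
  have h2 : ∀ w : Fin n → ℂ, ContinuousOn (fun q : (ℂ × (Fin n → ℂ)) × (Fin n → ℂ) => d2 g q.1.1 q.1.2 q.2 w) {q | q.1 ∈ Ud Q} := by
    intro w
    unfold d2
    exact ((h1.clm_apply (by fun_prop)).clm_apply continuousOn_const)
  refine continuousOn_pi.2 fun j => ?_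
  unfold hv
  exact (Complex.continuous_ofReal.comp_continuousOn (h2 _)).sub (continuousOn_const.mul (Complex.continuous_ofReal.comp_continuousOn (h2 _)))

theorem coer_alg {k M C ε a κ : ℝ} {l W P : ℂ} (hk : 0 < k) (hM0 : 0 < M) (hC : 0 < C) (hε1 : ε ≤ 1 / 2) (hε2 : ε * M ≤ k / 2)
    (hb1 : k * a ^ 2 ≤ W.re + C * Complex.normSq P) (hM1 : |W.im| ≤ M * a ^ 2) (hl : 0 < l.re) (hli : |l.im| ≤ ε * l.re)
    (hκ : 8 * C ≤ κ * l.re) : k / 2 * l.re * a ^ 2 ≤ (l * W).re + κ * (l.re * P.re * (l * P).re - 1 / 2 * ((l * P) ^ 2).re) := by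
  rw [Complex.normSq_apply] at hb1
  have e1 : (l * W).re = l.re * W.re - l.im * W.im := by simp
  have e2 : (l * P).re = l.re * P.re - l.im * P.im := by simp
  have e3 : ((l * P) ^ 2).re = (l.re * P.re - l.im * P.im) ^ 2 - (l.re * P.im + l.im * P.re) ^ 2 := by simp [sq]
  rw [e1, e2, e3]
  have a1 : l.im * W.im ≤ l.re * (k / 2 * a ^ 2) := by
    calc l.im * W.im ≤ |l.im| * |W.im| := by rw [← abs_mul]; exact le_abs_self _
      _ ≤ (ε * l.re) * (M * a ^ 2) := mul_le_mul hli hM1 (abs_nonneg _) ((abs_nonneg _).trans hli)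
      _ = (ε * M) * (l.re * a ^ 2) := by ring
      _ ≤ (k / 2) * (l.re * a ^ 2) := by gcongr
      _ = _ := by ring
  have a2 : l.re ^ 2 / 8 * (P.re * P.re + P.im * P.im) ≤ l.re * P.re * (l.re * P.re - l.im * P.im) - 1 / 2 * ((l.re * P.re - l.im * P.im) ^ 2 - (l.re * P.im + l.im * P.re) ^ 2) := by
    have hi : |l.im| ≤ l.re / 2 := hli.trans (by nlinarith)
    obtain ⟨hi1, hi2⟩ := abs_le.1 hi
    have hs : l.im ^ 2 ≤ (l.re / 2) ^ 2 := sq_le_sq' hi1 hi2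
    have hx : |l.im * (P.re * P.im)| ≤ (l.re / 2) * ((P.re * P.re + P.im * P.im) / 2) := by
      rw [abs_mul]
      gcongr
      rw [abs_le]; constructor <;> nlinarith [sq_nonneg (P.re + P.im), sq_nonneg (P.re - P.im)]
    have hx' := mul_le_mul_of_nonneg_left (abs_le.1 hx).1 hl.le
    nlinarith [mul_le_mul_of_nonneg_right hs (mul_self_nonneg P.im), mul_nonneg (sq_nonneg l.im) (mul_self_nonneg P.re)]
  have a3 : l.re * C * (P.re * P.re + P.im * P.im) ≤ κ * (l.re ^ 2 / 8 * (P.re * P.re + P.im * P.im)) := by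
    have : 0 ≤ P.re * P.re + P.im * P.im := add_nonneg (mul_self_nonneg _) (mul_self_nonneg _)
    calc l.re * C * (P.re * P.re + P.im * P.im) = (8 * C) * (l.re / 8 * (P.re * P.re + P.im * P.im)) := by ring
      _ ≤ (κ * l.re) * (l.re / 8 * (P.re * P.re + P.im * P.im)) := by gcongr
      _ = _ := by ring
  have hκ0 : 0 ≤ κ := by
    by_contra hneg
    push Not at hneg
    nlinarith [mul_neg_of_neg_of_pos hneg hl]
  have a4 := mul_le_mul_of_nonneg_left a2 hκ0
  have a5 := mul_le_mul_of_nonneg_left hb1 hl.le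
  nlinarith

namespace Extr
variable {n : ℕ} {g : ℂ × (Fin n → ℂ) → ℝ} {Q : ℂ → Fin n → ℂ} {R : ℝ} {x : TT → Fin n → ℂ} {γ : ℝ}

theorem xc (h : Extr g Q R x γ) : Continuous x := continuous_pi fun i => (h.xH i).1
theorem Qc (h : Extr g Q R x γ) : Continuous fun θ => Q (zt θ) := continuous_pi fun i => (h.QH i).1
theorem psic (h : Extr g Q R x γ) : Continuous fun θ => psi g Q (zt θ) (x θ) := continuous_pi fun i => (h.psiH i).1
theorem ne (h : Extr g Q R x γ) (θ : TT) : x θ ≠ Q (zt θ) := by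
  intro he
  have h1 := h.lev θ
  rw [he, (h.fib.zero _ (zt_circ θ) _).2 rfl] at h1
  exact h.gpos.ne h1
theorem mem (h : Extr g Q R x γ) (θ : TT) : (zt θ, x θ) ∈ Ud Q := h.fib.mem (zt_circ θ) (h.ne θ)
theorem pvc (h : Extr g Q R x γ) : Continuous fun θ => pv g (zt θ) (x θ) :=
  h.fib.pv_cont.comp_continuous (zt_cont.prodMk h.xc) h.mem
theorem cc (h : Extr g Q R x γ) : Continuous fun θ => cf g Q (zt θ) (x θ) := h.pvc.dot (h.xc.sub h.Qc)
theorem c_ne (h : Extr g Q R x γ) (θ : TT) : cf g Q (zt θ) (x θ) ≠ 0 :=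
  h.fib.c_ne (zt_circ θ) (h.ne θ) (by rw [h.lev]; exact h.gR)
theorem hvc (h : Extr g Q R x γ) : Continuous fun p : TT × (Fin n → ℂ) => hv g (zt p.1) (x p.1) p.2 := by
  have h1 := zt_cont
  have h2 := h.xc
  exact h.fib.hv_cont.comp_continuous (f := fun p : TT × (Fin n → ℂ) => ((zt p.1, x p.1), p.2)) (by fun_prop) fun p => h.mem p.1
theorem prjc (h : Extr g Q R x γ) : Continuous fun p : TT × (Fin n → ℂ) => prj g Q (zt p.1) (x p.1) p.2 := by
  unfold prj
  exact continuous_snd.sub (((h.psic.comp continuous_fst).dot continuous_snd).smul ((h.xc.sub h.Qc).comp continuous_fst))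

theorem coer (h : Extr g Q R x γ) : ∃ ε > 0, ε ≤ 1 / 2 ∧ ∃ k > 0, ∃ C > 0, ∀ θ v (l : ℂ) (κ : ℝ), 0 < l.re → |l.im| ≤ ε * l.re →
    8 * C ≤ κ * l.re → k * l.re * ‖v‖ ^ 2 ≤ (l * dot (hv g (zt θ) (x θ) v) (prj g Q (zt θ) (x θ) v)).re +
      κ * (l.re * (dot (pv g (zt θ) (x θ)) v).re * (l * dot (pv g (zt θ) (x θ)) v).re - 1 / 2 * ((l * dot (pv g (zt θ) (x θ)) v) ^ 2).re) := by
  set w : TT → (Fin n → ℂ) → ℂ := fun θ v => dot (hv g (zt θ) (x θ) v) (prj g Q (zt θ) (x θ) v) with hw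
  have hwc : Continuous fun p : TT × (Fin n → ℂ) => w p.1 p.2 := h.hvc.dot h.prjc
  have hwh : ∀ θ v (r : ℝ), w θ (r • v) = r ^ 2 * w θ v := by
    intro θ v r
    simp only [hw, hv_smul, prj_smul, rsmul_dot, dot_rsmul]; ring
  have hpc : Continuous fun p : TT × (Fin n → ℂ) => dot (pv g (zt p.1) (x p.1)) p.2 := (h.pvc.comp continuous_fst).dot continuous_snd
  obtain ⟨k, hk, C, hC, hb⟩ := quad_bound (F := fun θ v => (w θ v).re) (P := fun θ v => Complex.normSq (dot (pv g (zt θ) (x θ)) v))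
    (Complex.continuous_re.comp hwc) (Complex.continuous_normSq.comp hpc)
    (fun θ v r => by simp only [hwh]; rw [← Complex.ofReal_pow, Complex.re_ofReal_mul]) (fun θ v r => by simp only [dot_rsmul, Complex.normSq_mul, Complex.normSq_ofReal]; ring)
    (fun θ v => Complex.normSq_nonneg _) (by
      intro θ v hv0 hp
      have h1 : dot (pv g (zt θ) (x θ)) v = 0 := Complex.normSq_eq_zero.1 hp
      simp only [hw, prj_of_zero h1, re_dot_hv]
      have h2 := dot_pv_eq_zero.1 h1
      exact h.fib.hyp _ (zt_circ θ) _ (h.ne θ) v hv0 h2.1 h2.2)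
  obtain ⟨M, hM0, hM⟩ : ∃ M > 0, ∀ θ v, |(w θ v).im| ≤ M * ‖v‖ ^ 2 := by
    have hcpt : IsCompact ((univ : Set TT) ×ˢ sphere (0 : Fin n → ℂ) 1) := isCompact_univ.prod (isCompact_sphere _ _)
    obtain ⟨M, hM⟩ := hcpt.exists_bound_of_continuousOn (Complex.continuous_im.comp hwc).continuousOn
    refine ⟨|M| + 1, by positivity, fun θ v => ?_⟩
    rcases eq_or_ne v 0 with rfl | hv
    · have := hwh θ 0 0
      simp at this
      simp [this]
    · have hn : ‖v‖ ≠ 0 := norm_ne_zero_iff.2 hv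
      have := hM (θ, ‖v‖⁻¹ • v) ⟨trivial, by simp [norm_smul, inv_mul_cancel₀ hn]⟩
      simp only [Function.comp_apply, hwh] at this
      have h2 : (((‖v‖⁻¹ : ℝ) : ℂ) ^ 2 * w θ v).im = (‖v‖⁻¹) ^ 2 * (w θ v).im := by
        rw [← Complex.ofReal_pow, Complex.im_ofReal_mul]
      rw [h2, Real.norm_eq_abs, abs_mul, abs_of_nonneg (by positivity)] at this
      calc |(w θ v).im| = ((‖v‖⁻¹) ^ 2 * |(w θ v).im|) * ‖v‖ ^ 2 := by field_simp
        _ ≤ (|M| + 1) * ‖v‖ ^ 2 := by gcongr; linarith [le_abs_self M]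
  refine ⟨min (1 / 2) (k / (2 * M)), by positivity, min_le_left _ _, k / 2, by positivity, C, hC, fun θ v l κ hl hli hκ => ?_⟩
  set ε := min (1 / 2) (k / (2 * M)) with hε
  have hε1 : ε ≤ 1 / 2 := min_le_left _ _
  have hε2 : ε * M ≤ k / 2 := by
    calc ε * M ≤ k / (2 * M) * M := by gcongr; exact min_le_right _ _
      _ = k / 2 := by field_simp
  have hb1 := hb θ v
  have hM1 := hM θ v
  change _ ≤ (l * w θ v).re + _
  set W := w θ v
  set P := dot (pv g (zt θ) (x θ)) v
  exact coer_alg hk hM0 hC hε1 hε2 hb1 hM1 hl hli hκ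

theorem exN (h : Extr g Q R x γ) {ε : ℝ} (hε : 0 < ε) : ∃ f : ℂ → ℂ, Differentiable ℂ f ∧
    ∀ θ, 0 < (Complex.exp (f (zt θ)) / cf g Q (zt θ) (x θ)).re ∧
      |(Complex.exp (f (zt θ)) / cf g Q (zt θ) (x θ)).im| ≤ ε * (Complex.exp (f (zt θ)) / cf g Q (zt θ) (x θ)).re := by
  obtain ⟨L, hL, hLe⟩ := h.fib.haslog (ζ := zt) (w := x) (w' := fun θ => Q (zt θ)) zt_cont zt_circ h.xc h.Qc
    (fun θ => by rw [h.lev]; exact h.gR) (fun θ => by rw [(h.fib.zero _ (zt_circ θ) _).2 rfl]; exact h.fib.nonneg _ (zt_circ _) _)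
    h.ne h.ne
  obtain ⟨f, hf, -, c, hc⟩ := densityE (β := fun θ => (L θ).im) (by fun_prop) (ε := min 1 (ε / 2)) (by positivity)
  refine ⟨fun z => Complex.I * (f z + c), by fun_prop, fun θ => ?_⟩
  rw [show cf g Q (zt θ) (x θ) = Complex.exp (L θ) from (hLe θ).symm, ← Complex.exp_sub, Complex.exp_re, Complex.exp_im]
  set b := (Complex.I * (f (zt θ) + c) - L θ).im with hb
  have hbe : b = -((L θ).im - c - (f (zt θ)).re) := by simp [hb]; ring
  have hbl : |b| < min 1 (ε / 2) := by rw [hbe, abs_neg]; exact hc θ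
  have hb1 : |b| ≤ 1 := hbl.le.trans (min_le_left _ _)
  have hb2 : |b| ≤ ε / 2 := hbl.le.trans (min_le_right _ _)
  have hcos : 1 / 2 ≤ Real.cos b := by
    have h6 := Real.one_sub_sq_div_two_le_cos (x := b)
    have h7 : b ^ 2 ≤ 1 := by rw [sq_le_one_iff_abs_le_one]; exact hb1
    linarith
  have he := Real.exp_pos (Complex.I * (f (zt θ) + c) - L θ).re
  refine ⟨by positivity, ?_⟩
  rw [abs_mul, abs_of_pos he]
  have : |Real.sin b| ≤ ε * Real.cos b := Real.abs_sin_le_abs.trans (hb2.trans (by nlinarith))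
  calc _ ≤ Real.exp (Complex.I * (f (zt θ) + c) - L θ).re * (ε * Real.cos b) := by gcongr
    _ = _ := by ring

end Extr

theorem bddTT {E : Type*} [NormedAddCommGroup E] {f : TT → E} (hf : Continuous f) : ∃ C > 0, ∀ θ, ‖f θ‖ ≤ C := by
  obtain ⟨C, hC⟩ := isCompact_univ.exists_bound_of_continuousOn hf.continuousOn
  exact ⟨|C| + 1, by positivity, fun θ => (hC θ trivial).trans (by linarith [le_abs_self C])⟩

theorem posTT {f : TT → ℝ} (hf : Continuous f) (h : ∀ θ, 0 < f θ) : ∃ c > 0, ∀ θ, c ≤ f θ := by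
  obtain ⟨θ0, -, h0⟩ := isCompact_univ.exists_isMinOn (univ_nonempty : (univ : Set TT).Nonempty) hf.continuousOn
  exact ⟨f θ0, h θ0, fun θ => h0 trivial⟩

/-- gradient of a functional -/
def pg {n : ℕ} (L : ℂ × (Fin n → ℂ) →L[ℝ] ℝ) : Fin n → ℂ := fun j =>
  (L (0, Pi.single j 1) : ℂ) - Complex.I * (L (0, Pi.single j Complex.I) : ℂ)

theorem pg_sub {n : ℕ} (L M : ℂ × (Fin n → ℂ) →L[ℝ] ℝ) : pg (L - M) = pg L - pg M := by
  ext j; simp [pg]; ring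

theorem norm_pg_le {n : ℕ} (L : ℂ × (Fin n → ℂ) →L[ℝ] ℝ) : ‖pg L‖ ≤ 2 * ‖L‖ := by
  refine (pi_norm_le_iff_of_nonneg (by positivity)).2 fun j => ?_
  unfold pg
  refine (norm_sub_le _ _).trans ?_
  rw [norm_mul, Complex.norm_I, one_mul, Complex.norm_real, Complex.norm_real, two_mul]
  have h1 : ∀ c : ℂ, ‖c‖ = 1 → ‖((0:ℂ), (Pi.single j c : Fin n → ℂ))‖ ≤ 1 := by
    intro c hc
    rw [Prod.norm_def]; simp [Pi.norm_single, hc]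
  gcongr
  · exact L.le_of_opNorm_le_of_le le_rfl (h1 1 (by simp)) |>.trans (by simp)
  · exact L.le_of_opNorm_le_of_le le_rfl (h1 Complex.I (by simp)) |>.trans (by simp)

theorem zt_add (θ s : TT) : zt (θ + s) = zt θ * zt s := by
  simp [zt, fourier_apply, AddCircle.toCircle_add]

theorem zt_lip (θ : TT) (s : ℝ) : ‖zt (θ + s) - zt θ‖ ≤ |s| := by
  rw [zt_add, show zt θ * zt s - zt θ = zt θ * (zt s - 1) by ring, norm_mul, zt_norm, one_mul, zt_coe, mul_comm (s:ℂ)]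
  exact Real.norm_exp_I_mul_ofReal_sub_one_le (x := s)

namespace Extr
variable {n : ℕ} {g : ℂ × (Fin n → ℂ) → ℝ} {Q : ℂ → Fin n → ℂ} {R : ℝ} {x : TT → Fin n → ℂ} {γ : ℝ}

theorem prj_bd (h : Extr g Q R x γ) : ∃ A > 0, ∀ θ v, ‖prj g Q (zt θ) (x θ) v‖ ≤ A * ‖v‖ := by
  obtain ⟨a, ha, ha'⟩ := bddTT h.psic
  obtain ⟨b, hb, hb'⟩ := bddTT (h.xc.sub h.Qc)
  refine ⟨1 + n * a * b, by positivity, fun θ v => ?_⟩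
  unfold prj
  refine (norm_sub_le _ _).trans ?_
  rw [norm_smul, add_mul, one_mul]
  refine add_le_add le_rfl ?_
  calc _ ≤ (n * ‖psi g Q (zt θ) (x θ)‖ * ‖v‖) * ‖x θ - Q (zt θ)‖ := by gcongr; exact norm_dot_le _ _
    _ ≤ (n * a * ‖v‖) * b := by gcongr; exacts [ha' θ, hb' θ]
    _ = _ := by ring

theorem shift_small {E : Type*} [NormedAddCommGroup E] {f : TT → E} (hf : Continuous f) {η : ℝ} (hη : 0 < η) :
    ∃ s0 > 0, ∀ s : ℝ, |s| < s0 → ∀ θ : TT, ‖f (θ + s) - f θ‖ < η := by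
  have key : ∀ᶠ s : ℝ in nhds (0:ℝ), ∀ θ ∈ (univ : Set TT), ‖f (θ + (s : TT)) - f θ‖ < η := by
    refine isCompact_univ.eventually_forall_of_forall_eventually fun y _ => ?_
    have hc : Continuous fun p : ℝ × TT => ‖f (p.2 + (p.1 : TT)) - f p.2‖ := by
      have : Continuous fun s : ℝ => (s : TT) := AddCircle.continuous_mk' _
      fun_prop
    exact (hc.tendsto (0, y)).eventually (gt_mem_nhds (by simpa using hη))
  obtain ⟨δ, hδ, h⟩ := Metric.eventually_nhds_iff_ball.1 key
  exact ⟨δ, hδ, fun s hs θ => h s (by simpa using hs) θ trivial⟩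

theorem fd1c (h : Extr g Q R x γ) : Continuous fun θ => fderiv ℝ g (zt θ, x θ) :=
  continuous_iff_continuousAt.2 fun θ => ContinuousAt.comp (g := fderiv ℝ g) (f := fun θ => (zt θ, x θ)) (x := θ)
    (h.fib.cda1 (h.mem θ)).continuousAt (zt_cont.prodMk h.xc).continuousAt
theorem fd2c (h : Extr g Q R x γ) : Continuous fun θ => fderiv ℝ (fderiv ℝ g) (zt θ, x θ) :=
  continuous_iff_continuousAt.2 fun θ => ContinuousAt.comp (g := fderiv ℝ (fderiv ℝ g)) (f := fun θ => (zt θ, x θ)) (x := θ)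
    (h.fib.cda2 (h.mem θ)).continuousAt (zt_cont.prodMk h.xc).continuousAt

theorem est1 (h : Extr g Q R x γ) : ∃ M > 0, ∀ η > 0, ∃ s0 > 0, ∀ s : ℝ, |s| < s0 → ∀ θ : TT,
    ‖pv g (zt (θ + s)) (x (θ + s)) - pv g (zt θ) (x θ) - hv g (zt θ) (x θ) (x (θ + s) - x θ)‖ ≤ η * (|s| + ‖x (θ + s) - x θ‖) + M * |s| ∧
    |dg g (zt θ) (x θ) (x (θ + s) - x θ)| ≤ η * (|s| + ‖x (θ + s) - x θ‖) + M * |s| := by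
  obtain ⟨M1, hM1, hM1'⟩ := bddTT h.fd1c
  obtain ⟨M2, hM2, hM2'⟩ := bddTT (E := ℂ × (Fin n → ℂ) →L[ℝ] ℂ × (Fin n → ℂ) →L[ℝ] ℝ) h.fd2c
  refine ⟨M1 + 2 * M2, by positivity, fun η hη => ?_⟩
  have hs1 : ContDiffOn ℝ 1 g (Ud Q) := h.fib.sm.of_le (by norm_num)
  have hs2 : ContDiffOn ℝ 1 (fderiv ℝ g) (Ud Q) := h.fib.sm.fderiv_of_isOpen h.fib.Uo (by norm_num)
  have hq : Continuous fun θ => (zt θ, x θ) := zt_cont.prodMk h.xc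
  obtain ⟨δ1, hδ1, h1⟩ := unif_diff h.fib.Uo hs1 hq h.mem hη
  obtain ⟨δ2, hδ2, h2⟩ := unif_diff h.fib.Uo hs2 hq h.mem (half_pos hη)
  obtain ⟨s0, hs0, h0⟩ := shift_small hq (lt_min hδ1 hδ2)
  refine ⟨s0, hs0, fun s hs θ => ?_⟩
  have hz := zt_lip θ s
  set e : ℂ × (Fin n → ℂ) := (zt (θ + s), x (θ + s)) with he
  set D := x (θ + s) - x θ with hD
  set dz := zt (θ + s) - zt θ with hdz
  have hes : e - (zt θ, x θ) = (dz, 0) + (0, D) := by simp [he, hdz, hD]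
  have hen : ‖e - (zt θ, x θ)‖ ≤ |s| + ‖D‖ := by
    rw [hes]; refine (norm_add_le _ _).trans ?_
    gcongr
    · simpa [Prod.norm_def] using hz
    · simp [Prod.norm_def]
  have hdn : ‖((dz, 0) : ℂ × (Fin n → ℂ))‖ ≤ |s| := by simpa [Prod.norm_def] using hz
  have a1 := h1 θ e ((h0 s hs θ).trans_le (min_le_left _ _))
  have a2 := h2 θ e ((h0 s hs θ).trans_le (min_le_right _ _))
  constructor
  · have : pv g (zt (θ + s)) (x (θ + s)) - pv g (zt θ) (x θ) - hv g (zt θ) (x θ) D =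
        pg (fderiv ℝ g e - fderiv ℝ g (zt θ, x θ) - fderiv ℝ (fderiv ℝ g) (zt θ, x θ) (e - (zt θ, x θ))) + pg (fderiv ℝ (fderiv ℝ g) (zt θ, x θ) (dz, 0)) := by
      rw [pg_sub, pg_sub, hes, map_add]
      ext j
      simp only [pg, pv, hv, dg, d2, Pi.sub_apply, Pi.add_apply, add_apply, he]
      push_cast; ring
    rw [this]
    refine (norm_add_le _ _).trans ?_
    have b1 := norm_pg_le (fderiv ℝ g e - fderiv ℝ g (zt θ, x θ) - fderiv ℝ (fderiv ℝ g) (zt θ, x θ) (e - (zt θ, x θ)))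
    have b2 := norm_pg_le (fderiv ℝ (fderiv ℝ g) (zt θ, x θ) (dz, 0))
    have b3 : ‖fderiv ℝ (fderiv ℝ g) (zt θ, x θ) (dz, 0)‖ ≤ M2 * |s| := ContinuousLinearMap.le_of_opNorm_le_of_le _ (hM2' θ) hdn
    have b4 := mul_nonneg hM1.le (abs_nonneg s)
    have b5 := mul_le_mul_of_nonneg_left hen hη.le
    nlinarith
  · have : dg g (zt θ) (x θ) D = -(g e - g (zt θ, x θ) - fderiv ℝ g (zt θ, x θ) (e - (zt θ, x θ))) - fderiv ℝ g (zt θ, x θ) (dz, 0) := by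
      rw [hes, map_add, he, h.lev, h.lev]; unfold dg; ring
    rw [this, ← Real.norm_eq_abs]
    refine (norm_sub_le _ _).trans ?_
    rw [norm_neg]
    have b3 : ‖fderiv ℝ g (zt θ, x θ) (dz, 0)‖ ≤ M1 * |s| := ContinuousLinearMap.le_of_opNorm_le_of_le _ (hM1' θ) hdn
    have b4 := mul_nonneg hM2.le (abs_nonneg s)
    have b5 := mul_le_mul_of_nonneg_left hen hη.le
    linarith

theorem hv_bd (h : Extr g Q R x γ) : ∃ A > 0, ∀ θ v, ‖hv g (zt θ) (x θ) v‖ ≤ A * ‖v‖ := by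
  obtain ⟨M2, hM2, hM2'⟩ := bddTT (E := ℂ × (Fin n → ℂ) →L[ℝ] ℂ × (Fin n → ℂ) →L[ℝ] ℝ) h.fd2c
  refine ⟨2 * M2, by positivity, fun θ v => ?_⟩
  have : hv g (zt θ) (x θ) v = pg (fderiv ℝ (fderiv ℝ g) (zt θ, x θ) (0, v)) := rfl
  rw [this, mul_assoc]
  refine (norm_pg_le _).trans ?_
  gcongr
  exact ContinuousLinearMap.le_of_opNorm_le_of_le _ (hM2' θ) (by simp [Prod.norm_def])

end Extr

theorem mean_shift (u : TT → ℂ) (s : TT) : mean (fun θ => u (θ + s)) = mean u :=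
  integral_add_right_eq_self (μ := (AddCircle.haarAddCircle : Measure TT)) u s

theorem fc_shift (u : TT → ℂ) (s : TT) (j : ℤ) : fourierCoeff (fun θ => u (θ + s)) j = zt s ^ j * fourierCoeff u j := by
  rw [fc_def, fc_def, ← mean_shift (fun θ => zt θ ^ (-j) * u θ) s]
  unfold mean
  rw [← integral_const_mul]
  congr 1; ext θ
  rw [zt_add, mul_zpow, ← mul_assoc, ← mul_assoc, mul_comm (zt s ^ j), mul_assoc (zt θ ^ (-j)), ← zpow_add₀ (zt_ne s)]
  simp

theorem InH.shift {u : TT → ℂ} (hu : InH u) (s : TT) : InH fun θ => u (θ + s) :=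
  ⟨hu.1.comp (by fun_prop), fun j hj => by rw [fc_shift, hu.2 j hj, mul_zero]⟩

theorem InH.mean_mul0 {u v : TT → ℂ} (hu : InH u) (hv : InH v) (h0 : mean u = 0) : mean (fun θ => u θ * v θ) = 0 := by
  rw [hu.mean_mul hv, h0, zero_mul]

theorem mean_dot {n : ℕ} {u v : TT → Fin n → ℂ} (hu : ∀ i, InH fun θ => u θ i) (hv : ∀ i, InH fun θ => v θ i) :
    mean (fun θ => dot (u θ) (v θ)) = ∑ i, mean (fun θ => u θ i) * mean (fun θ => v θ i) := by
  unfold dot mean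
  rw [integral_finsetSum]
  · exact Finset.sum_congr rfl fun i _ => (hu i).mean_mul (hv i)
  · exact fun i _ => intg ((hu i).mul (hv i)).1

theorem reg_alg {k κ C d a X Y E P r : ℝ} (hk : 0 < k) (hXY : |X - Y| ≤ C * d * (a + k / (4 * C) * d))
    (hC : 0 < C) (hd : 0 ≤ d) (h : k * d ^ 2 ≤ Y + κ * (P - r)) (hP : κ * P ≤ C * d * (a + k / (4 * C) * d)) :
    k / 4 * d ^ 2 ≤ X - κ * r + (4 * C ^ 2 / k) * a ^ 2 + E * 0 := by
  have h1 := (abs_le.1 hXY).1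
  have h2 : C * d * (a + k / (4 * C) * d) = C * d * a + k / 4 * d ^ 2 := by field_simp
  have h3 : 2 * (C * d * a) ≤ k / 4 * d ^ 2 + 4 * C ^ 2 / k * a ^ 2 := by
    have := sq_nonneg (k * d / 2 - 2 * C * a)
    have e : k / 4 * d ^ 2 + 4 * C ^ 2 / k * a ^ 2 - 2 * (C * d * a) = (k * d / 2 - 2 * C * a) ^ 2 / k := by field_simp; ring
    have : 0 ≤ (k * d / 2 - 2 * C * a) ^ 2 / k := by positivity
    linarith
  nlinarith

theorem int_step {n : ℕ} {X Z : TT → ℂ} {D : TT → Fin n → ℂ} {a b c : ℝ} (hX : Continuous X) (hZ : Continuous Z) (hD : Continuous D) (hX0 : mean X = 0)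
    (hZ0 : mean Z = 0) (hpt : ∀ θ, a * ‖D θ‖ ^ 2 ≤ (X θ).re - b * (Z θ).re + c) :
    a * ∫ θ, ‖D θ‖ ^ 2 ∂(AddCircle.haarAddCircle : Measure TT) ≤ c := by
  have hXr : Continuous fun θ => (X θ).re := Complex.continuous_re.comp hX
  have hZr : Continuous fun θ => (Z θ).re := Complex.continuous_re.comp hZ
  rw [← integral_const_mul]
  calc _ ≤ ∫ θ, ((X θ).re - b * (Z θ).re + c) ∂(AddCircle.haarAddCircle : Measure TT) :=
        integral_mono (intgR (by fun_prop)) (intgR (by fun_prop)) hpt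
    _ = (mean X).re - b * (mean Z).re + c := by
        rw [integral_add (intgR (by fun_prop)) (intgR (by fun_prop)), integral_sub (intgR (by fun_prop)) (intgR (by fun_prop)), integral_const_mul,
          mean_re X hX, mean_re Z hZ]
        simp
    _ = _ := by rw [hX0, hZ0]; simp

namespace Extr
variable {n : ℕ} {g : ℂ × (Fin n → ℂ) → ℝ} {Q : ℂ → Fin n → ℂ} {R : ℝ} {x : TT → Fin n → ℂ} {γ : ℝ}

theorem est2 (h : Extr g Q R x γ) {N : TT → ℂ} (hN : Continuous N) (κ : ℝ) (hκ : 0 ≤ κ) : ∃ C > 0, ∀ η > 0, ∃ s0 > 0, ∀ s : ℝ, |s| < s0 → ∀ θ : TT,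
    ‖N θ * dot (prj g Q (zt θ) (x θ) (x (θ + s) - x θ)) (psi g Q (zt (θ + s)) (x (θ + s)) - psi g Q (zt θ) (x θ))
      - N θ / cf g Q (zt θ) (x θ) * dot (hv g (zt θ) (x θ) (x (θ + s) - x θ)) (prj g Q (zt θ) (x θ) (x (θ + s) - x θ))‖
      ≤ C * ‖x (θ + s) - x θ‖ * (|s| + η * ‖x (θ + s) - x θ‖) ∧
    κ * ((N θ / cf g Q (zt θ) (x θ)).re * (dot (pv g (zt θ) (x θ)) (x (θ + s) - x θ)).re *
      (N θ / cf g Q (zt θ) (x θ) * dot (pv g (zt θ) (x θ)) (x (θ + s) - x θ)).re)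
      ≤ C * ‖x (θ + s) - x θ‖ * (|s| + η * ‖x (θ + s) - x θ‖) := by
  obtain ⟨M, hM, hM'⟩ := h.est1
  obtain ⟨A, hA, hA'⟩ := h.prj_bd
  obtain ⟨B, hB, hB'⟩ := bddTT hN
  obtain ⟨I, hI, hI'⟩ := bddTT (h.cc.inv₀ h.c_ne)
  obtain ⟨p, hp, hp'⟩ := bddTT h.pvc
  obtain ⟨V, hV, hV'⟩ := h.hv_bd
  set C0 := B * I * n * A + B * n * V * A + κ * (B * I) * (B * I) * n * p with hC0
  have hC0' : 0 ≤ C0 := by positivity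
  refine ⟨(C0 + 1) * (1 + M), by positivity, fun η0 hη0 => ?_⟩
  obtain ⟨η, hη, hη1, hηη⟩ : ∃ η > 0, η ≤ 1 ∧ η ≤ η0 := ⟨min 1 η0, by positivity, min_le_left _ _, min_le_right _ _⟩
  obtain ⟨s1, hs1, h1⟩ := hM' η hη
  obtain ⟨s2, hs2, h2⟩ := shift_small (h.cc.inv₀ h.c_ne) hη
  refine ⟨min s1 s2, by positivity, fun s hs θ => ?_⟩
  obtain ⟨a1, a2⟩ := h1 s (hs.trans_le (min_le_left _ _)) θ
  have a3 := h2 s (hs.trans_le (min_le_right _ _)) θ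
  rw [← re_dot_pv] at a2
  set D := x (θ + s) - x θ with hD
  set P := prj g Q (zt θ) (x θ) D with hP
  set c := cf g Q (zt θ) (x θ) with hc
  have hPn : ‖P‖ ≤ A * ‖D‖ := hA' θ D
  have hd := norm_nonneg D
  have hl : ‖N θ / c‖ ≤ B * I := by
    rw [div_eq_mul_inv, norm_mul]; gcongr
    · exact hB' θ
    · exact hI' θ
  have hfin : η * (|s| + ‖D‖) + M * |s| ≤ (1 + M) * (|s| + η0 * ‖D‖) := by
    have : η * ‖D‖ ≤ η0 * ‖D‖ := by gcongr
    have : η * |s| ≤ 1 * |s| := by gcongr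
    have : 0 ≤ M * (η0 * ‖D‖) := by positivity
    nlinarith
  have hη0' : η * ‖D‖ ≤ (1 + M) * (|s| + η0 * ‖D‖) := by
    refine le_trans ?_ hfin
    have := abs_nonneg s
    have : 0 ≤ η * |s| + M * |s| := by positivity
    linarith
  set T := (1 + M) * (|s| + η0 * ‖D‖) with hT
  have hT0 : 0 ≤ T := by positivity
  have goal' : (C0 + 1) * (1 + M) * ‖D‖ * (|s| + η0 * ‖D‖) = (C0 + 1) * ‖D‖ * T := by rw [hT]; ring
  rw [goal']
  constructor
  · have hcs := h.c_ne (θ + s)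
    have e1 : N θ * dot P (psi g Q (zt (θ + s)) (x (θ + s)) - psi g Q (zt θ) (x θ)) - N θ / c * dot (hv g (zt θ) (x θ) D) P
        = N θ * (cf g Q (zt (θ + s)) (x (θ + s)))⁻¹ * dot P (pv g (zt (θ + s)) (x (θ + s)) - pv g (zt θ) (x θ) - hv g (zt θ) (x θ) D)
          + N θ * ((cf g Q (zt (θ + s)) (x (θ + s)))⁻¹ - c⁻¹) * dot (hv g (zt θ) (x θ) D) P := by
      have e0 : dot P (pv g (zt θ) (x θ)) = 0 := by rw [dot_comm']; exact dot_pv_prj (h.c_ne θ) D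
      rw [psi_eq, psi_eq, dot_sub, dot_sub, dot_sub, dot_smul, dot_smul, e0, dot_comm' P (hv _ _ _ _), ← hc]
      ring
    rw [e1]
    refine (norm_add_le _ _).trans ?_
    have b1 : ‖N θ * (cf g Q (zt (θ + s)) (x (θ + s)))⁻¹ * dot P (pv g (zt (θ + s)) (x (θ + s)) - pv g (zt θ) (x θ) - hv g (zt θ) (x θ) D)‖ ≤ B * I * (n * (A * ‖D‖) * T) := by
      rw [norm_mul, norm_mul]
      gcongr
      · exact hB' θ
      · exact hI' (θ + s)
      · refine (norm_dot_le _ _).trans ?_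
        gcongr
        exact a1.trans hfin
    have b2 : ‖N θ * ((cf g Q (zt (θ + s)) (x (θ + s)))⁻¹ - c⁻¹) * dot (hv g (zt θ) (x θ) D) P‖ ≤ B * η * (n * (V * ‖D‖) * (A * ‖D‖)) := by
      rw [norm_mul, norm_mul]
      gcongr
      · exact hB' θ
      · exact a3.le
      · refine (norm_dot_le _ _).trans ?_
        gcongr
        exact hV' θ D
    have b3 : B * η * (n * (V * ‖D‖) * (A * ‖D‖)) ≤ B * n * V * A * ‖D‖ * T := by
      calc _ = B * n * V * A * ‖D‖ * (η * ‖D‖) := by ring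
        _ ≤ _ := by gcongr
    calc _ ≤ B * I * (n * (A * ‖D‖) * T) + B * n * V * A * ‖D‖ * T := add_le_add b1 (b2.trans b3)
      _ = (B * I * n * A + B * n * V * A + 0) * ‖D‖ * T := by ring
      _ ≤ (C0 + 1) * ‖D‖ * T := by
        refine mul_le_mul_of_nonneg_right (mul_le_mul_of_nonneg_right ?_ hd) hT0
        have : 0 ≤ κ * (B * I) * (B * I) * n * p := by positivity
        linarith
  · have c1 : (N θ / c).re ≤ B * I := (Complex.re_le_norm _).trans hl
    have c2 : ‖dot (pv g (zt θ) (x θ)) D‖ ≤ n * p * ‖D‖ := (norm_dot_le _ _).trans (by gcongr; exact hp' θ)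
    have c3 : |(N θ / c * dot (pv g (zt θ) (x θ)) D).re| ≤ B * I * (n * p * ‖D‖) := (Complex.abs_re_le_norm _).trans (by
      rw [norm_mul]; gcongr)
    have c4 : |(N θ / c).re| ≤ B * I := (Complex.abs_re_le_norm _).trans hl
    calc _ ≤ κ * (|(N θ / c).re| * |(dot (pv g (zt θ) (x θ)) D).re| * |(N θ / c * dot (pv g (zt θ) (x θ)) D).re|) := by
          refine mul_le_mul_of_nonneg_left ?_ hκ
          rw [← abs_mul, ← abs_mul]; exact le_abs_self _
      _ ≤ κ * ((B * I) * T * (B * I * (n * p * ‖D‖))) := by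
          gcongr
          exact a2.trans hfin
      _ = (κ * (B * I) * (B * I) * n * p) * ‖D‖ * T := by ring
      _ ≤ (C0 + 1) * ‖D‖ * T := by
          refine mul_le_mul_of_nonneg_right (mul_le_mul_of_nonneg_right ?_ hd) hT0
          have : 0 ≤ B * I * n * A + B * n * V * A := by positivity
          linarith

theorem NH {f : ℂ → ℂ} (hf : Differentiable ℂ f) : InH fun θ => Complex.exp (f (zt θ)) := ((MemA.of_entire hf).inH).exp

set_option maxHeartbeats 800000 in
theorem reg1 (h : Extr g Q R x γ) : ∃ M > 0, ∃ s0 > 0, ∀ s : ℝ, |s| < s0 →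
    ∫ θ, ‖x (θ + s) - x θ‖ ^ 2 ∂(AddCircle.haarAddCircle : Measure TT) ≤ M * s ^ 2 := by
  obtain ⟨ε, hε, hε2, k, hk, C, hC, hco⟩ := h.coer
  obtain ⟨f, hf, hN⟩ := h.exN hε
  set N : TT → ℂ := fun θ => Complex.exp (f (zt θ)) with hNdef
  have hNH : InH N := NH hf
  have hlc : Continuous fun θ => N θ / cf g Q (zt θ) (x θ) := hNH.1.div h.cc h.c_ne
  obtain ⟨μ, hμ, hμ'⟩ := posTT (f := fun θ => (N θ / cf g Q (zt θ) (x θ)).re) (Complex.continuous_re.comp hlc) (fun θ => (hN θ).1)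
  set κ := 8 * C / μ with hκ
  have hκ0 : 0 < κ := by positivity
  obtain ⟨C1, hC1, hest⟩ := h.est2 hNH.1 κ hκ0.le
  have hkμ : 0 < k * μ := by positivity
  obtain ⟨s0, hs0, hest⟩ := hest (k * μ / (4 * C1)) (by positivity)
  refine ⟨(4 * C1 ^ 2 / (k * μ)) / (k * μ / 4), by positivity, s0, hs0, fun s hs => ?_⟩
  set D : TT → Fin n → ℂ := fun θ => x (θ + s) - x θ with hD
  have hDH : ∀ i, InH fun θ => D θ i := fun i => ((h.xH i).shift s).sub (h.xH i)
  have hD0 : ∀ i, mean (fun θ => D θ i) = 0 := by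
    intro i
    have h1 : mean (fun θ => D θ i) = mean (fun θ => x (θ + s) i) - mean (fun θ => x θ i) :=
      integral_sub (intg ((h.xH i).shift s).1) (intg (h.xH i).1)
    rw [h1, mean_shift (fun θ => x θ i), sub_self]
  have hDc : Continuous D := continuous_pi fun i => (hDH i).1
  set X : TT → ℂ := fun θ => N θ * dot (prj g Q (zt θ) (x θ) (D θ)) (psi g Q (zt (θ + s)) (x (θ + s)) - psi g Q (zt θ) (x θ)) with hX
  set Z : TT → ℂ := fun θ => (N θ / cf g Q (zt θ) (x θ) * dot (pv g (zt θ) (x θ)) (D θ)) ^ 2 with hZ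
  have hpD : InH fun θ => dot (psi g Q (zt θ) (x θ)) (D θ) := InH.dot h.psiH hDH
  have hpD0 : mean (fun θ => dot (psi g Q (zt θ) (x θ)) (D θ)) = 0 := by
    rw [mean_dot h.psiH hDH]; simp [hD0]
  have hφ : ∀ i, InH fun θ => (x θ - Q (zt θ)) i := fun i => (h.xH i).sub (h.QH i)
  have hprH : ∀ i, InH fun θ => prj g Q (zt θ) (x θ) (D θ) i := fun i => (hDH i).sub (hpD.mul (hφ i))
  have hpr0 : ∀ i, mean (fun θ => prj g Q (zt θ) (x θ) (D θ) i) = 0 := by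
    intro i
    have : mean (fun θ => prj g Q (zt θ) (x θ) (D θ) i) = mean (fun θ => D θ i) - mean (fun θ => dot (psi g Q (zt θ) (x θ)) (D θ) * (x θ - Q (zt θ)) i) :=
      integral_sub (intg (hDH i).1) (intg (hpD.mul (hφ i)).1)
    rw [this, hD0, hpD.mean_mul0 (hφ i) hpD0, sub_self]
  have hdψ : ∀ i, InH fun θ => (psi g Q (zt (θ + s)) (x (θ + s)) - psi g Q (zt θ) (x θ)) i := fun i => ((h.psiH i).shift s).sub (h.psiH i)
  have hXdH := InH.dot hprH hdψ
  have hXH : InH X := hNH.mul hXdH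
  have hX0 : mean X = 0 := by
    rw [hX, hNH.mean_mul hXdH, mean_dot hprH hdψ]; simp [hpr0]
  have hZe : ∀ θ, N θ / cf g Q (zt θ) (x θ) * dot (pv g (zt θ) (x θ)) (D θ) = N θ * dot (psi g Q (zt θ) (x θ)) (D θ) := by
    intro θ; rw [dot_psi]; ring
  have hW : InH fun θ => N θ * dot (psi g Q (zt θ) (x θ)) (D θ) := hNH.mul hpD
  have hZH : InH Z := by
    rw [hZ]; simp only [hZe]; exact hW.pow 2
  have hZ0 : mean Z = 0 := by
    rw [hZ]; simp only [hZe, sq]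
    refine hW.mean_mul0 hW ?_
    rw [hNH.mean_mul hpD, hpD0, mul_zero]
  have hpt : ∀ θ, k * μ / 4 * ‖D θ‖ ^ 2 ≤ (X θ).re - κ / 2 * (Z θ).re + 4 * C1 ^ 2 / (k * μ) * s ^ 2 := by
    intro θ
    obtain ⟨e1, e2⟩ := hest s hs θ
    have hc := hco θ (D θ) _ κ (hN θ).1 (hN θ).2 (by
      have := mul_le_mul_of_nonneg_left (hμ' θ) hκ0.le
      calc 8 * C = κ * μ := by rw [hκ]; field_simp
        _ ≤ _ := this)
    have h1 : k * μ * ‖D θ‖ ^ 2 ≤ k * (N θ / cf g Q (zt θ) (x θ)).re * ‖D θ‖ ^ 2 := by gcongr; exact hμ' θ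
    have e1' : |(X θ).re - (N θ / cf g Q (zt θ) (x θ) * dot (hv g (zt θ) (x θ) (D θ)) (prj g Q (zt θ) (x θ) (D θ))).re| ≤ C1 * ‖D θ‖ * (|s| + k * μ / (4 * C1) * ‖D θ‖) := by
      rw [← Complex.sub_re]; exact (Complex.abs_re_le_norm _).trans e1
    have := reg_alg (E := 0) hkμ e1' hC1 (norm_nonneg _) (h1.trans hc) e2
    rw [sq_abs] at this
    have hz : (Z θ).re = ((N θ / cf g Q (zt θ) (x θ) * dot (pv g (zt θ) (x θ)) (D θ)) ^ 2).re := rfl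
    rw [hz]
    linarith
  have hintg := int_step hXH.1 hZH.1 hDc hX0 hZ0 hpt
  rw [div_mul_eq_mul_div, le_div_iff₀ (by positivity)]
  linarith

theorem parseval_c {u : TT → ℂ} (hu : Continuous u) : HasSum (fun j : ℤ => ‖fourierCoeff u j‖ ^ 2) (∫ θ, ‖u θ‖ ^ 2 ∂(AddCircle.haarAddCircle : Measure TT)) := by
  have h := hasSum_fc_mul (memLp_of_cont hu 2) (memLp_of_cont (u := fun θ => (starRingEnd ℂ) (u θ)) (by fun_prop) 2)
  simp only [fc_conj, neg_neg, Complex.mul_conj, Complex.normSq_eq_norm_sq] at h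
  have e : mean (fun θ => ((‖u θ‖ ^ 2 : ℝ) : ℂ)) = ((∫ θ, ‖u θ‖ ^ 2 ∂(AddCircle.haarAddCircle : Measure TT) : ℝ) : ℂ) := integral_ofReal
  rw [e] at h
  exact_mod_cast h

theorem reg (h : Extr g Q R x γ) (i : Fin n) : Summable fun j : ℤ => (j:ℝ) ^ 2 * ‖fourierCoeff (fun θ => x θ i) j‖ ^ 2 := by
  obtain ⟨M, hM, s0, hs0, h1⟩ := h.reg1
  refine summable_of_sum_le (c := M) (fun j => by positivity) fun F => ?_
  have hlim : Tendsto (fun s : ℝ => ∑ j ∈ F, (‖zt s ^ j - 1‖ / |s|) ^ 2 * ‖fourierCoeff (fun θ => x θ i) j‖ ^ 2) (nhdsWithin 0 {0}ᶜ)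
      (nhds (∑ j ∈ F, (j:ℝ) ^ 2 * ‖fourierCoeff (fun θ => x θ i) j‖ ^ 2)) := by
    refine tendsto_finsetSum _ fun j _ => Tendsto.mul_const _ ?_
    have hd : HasDerivAt (fun s : ℝ => Complex.exp (s * (j * Complex.I))) (j * Complex.I) 0 := by
      have : HasDerivAt (fun s : ℝ => (s : ℂ) * (j * Complex.I)) (1 * (j * Complex.I)) 0 := (Complex.ofRealCLM.hasDerivAt (x := 0)).mul_const _
      have := this.cexp
      simpa using this
    have h2 := (hasDerivAt_iff_tendsto_slope.1 hd).norm.pow 2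
    have e : ‖(j:ℂ) * Complex.I‖ ^ 2 = (j:ℝ) ^ 2 := by
      rw [norm_mul, Complex.norm_I, mul_one, Complex.norm_intCast, sq_abs]
    rw [e] at h2
    refine h2.congr fun s => ?_
    rw [slope_def_module, norm_smul, zt_coe, ← Complex.exp_int_mul]
    simp only [sub_zero, ofReal_zero, zero_mul, Complex.exp_zero, norm_inv, Real.norm_eq_abs]
    rw [show (j:ℂ) * (s * Complex.I) = s * (j * Complex.I) by ring, div_eq_inv_mul]
  refine le_of_tendsto hlim ?_
  have : Metric.ball (0:ℝ) s0 ∩ {0}ᶜ ∈ nhdsWithin (0:ℝ) {0}ᶜ := inter_mem (mem_nhdsWithin_of_mem_nhds (ball_mem_nhds _ hs0)) self_mem_nhdsWithin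
  filter_upwards [this] with s hs
  have hs1 : |s| < s0 := by simpa using hs.1
  have hs2 : s ≠ 0 := hs.2
  have h3 := h1 s hs1
  have hDc : Continuous fun θ => x (θ + s) - x θ := by have := h.xc; fun_prop
  have hDi : Continuous fun θ => x (θ + s) i - x θ i := (continuous_apply i).comp hDc
  have h4 : ∫ θ, ‖x (θ + s) i - x θ i‖ ^ 2 ∂(AddCircle.haarAddCircle : Measure TT) ≤ M * s ^ 2 := by
    refine le_trans (integral_mono (intgR (by fun_prop)) (intgR (by fun_prop)) fun θ => ?_) h3
    have := norm_le_pi_norm (x (θ + s) - x θ) i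
    simp only [Pi.sub_apply] at this
    dsimp only
    gcongr
  have h5 := sum_le_hasSum F (fun j _ => by positivity) (parseval_c hDi)
  have h6 : ∀ j, fourierCoeff (fun θ : TT => x (θ + s) i - x θ i) j = (zt s ^ j - 1) * fourierCoeff (fun θ => x θ i) j := by
    intro j
    rw [fc_sub ((h.xH i).shift s).1 (h.xH i).1, fc_shift (fun θ => x θ i)]; ring
  simp only [h6, norm_mul, mul_pow] at h5
  have h7 : ∑ j ∈ F, (‖zt s ^ j - 1‖ / |s|) ^ 2 * ‖fourierCoeff (fun θ => x θ i) j‖ ^ 2 = (∑ j ∈ F, ‖zt s ^ j - 1‖ ^ 2 * ‖fourierCoeff (fun θ => x θ i) j‖ ^ 2) / s ^ 2 := by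
    rw [Finset.sum_div]; refine Finset.sum_congr rfl fun j _ => ?_
    rw [div_pow, sq_abs]; ring
  rw [h7, div_le_iff₀ (by positivity)]
  exact h5.trans h4

end Extr

/-- weighted reindexing operators between sequence spaces -/
theorem lpMul_bd {ι κ : Type*} {e : κ → ι} {w : κ → ℂ} {C : ℝ} (hC : ∀ k, ‖w k‖ ≤ C) (hC0 : 0 ≤ C)
    (he : ∀ k k', w k ≠ 0 → w k' ≠ 0 → e k = e k' → k = k') (a : lp (fun _ : ι => ℂ) 2) (s : Finset κ) :
    ∑ k ∈ s, ‖w k * a (e k)‖ ^ (2 : ENNReal).toReal ≤ (C * ‖a‖) ^ (2 : ENNReal).toReal := by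
  classical
  have h2 : (2 : ENNReal).toReal = ((2 : ℕ) : ℝ) := by simp
  have h0 : 0 < (2 : ENNReal).toReal := by simp
  rw [← Finset.sum_filter_add_sum_filter_not s (fun k => w k ≠ 0)]
  have hz : ∑ k ∈ s with ¬ (w k ≠ 0), ‖w k * a (e k)‖ ^ (2 : ENNReal).toReal = 0 := by
    refine Finset.sum_eq_zero fun k hk => ?_
    have : w k = 0 := by simpa using (Finset.mem_filter.1 hk).2
    simp [this]
  rw [hz, add_zero]
  have hinj : Set.InjOn e (s.filter (fun k => w k ≠ 0) : Finset κ) := by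
    intro k hk k' hk' h
    have hk1 := (Finset.mem_filter.1 (Finset.mem_coe.1 hk)).2
    have hk2 := (Finset.mem_filter.1 (Finset.mem_coe.1 hk')).2
    exact he k k' hk1 hk2 h
  have hs := lp.sum_rpow_le_norm_rpow h0 a ((s.filter (fun k => w k ≠ 0)).image e)
  rw [Finset.sum_image hinj] at hs
  rw [Real.mul_rpow hC0 (norm_nonneg _)]
  refine le_trans ?_ (mul_le_mul_of_nonneg_left hs (Real.rpow_nonneg hC0 _))
  rw [Finset.mul_sum]
  refine Finset.sum_le_sum fun k _ => ?_
  rw [norm_mul, Real.mul_rpow (norm_nonneg _) (norm_nonneg _)]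
  exact mul_le_mul_of_nonneg_right (Real.rpow_le_rpow (norm_nonneg _) (hC k) h0.le) (Real.rpow_nonneg (norm_nonneg _) _)

/-- weighted reindexing as a continuous linear map -/
def lpMul {ι κ : Type*} (e : κ → ι) (w : κ → ℂ) (C : ℝ) (hC : ∀ k, ‖w k‖ ≤ C) (hC0 : 0 ≤ C)
    (he : ∀ k k', w k ≠ 0 → w k' ≠ 0 → e k = e k' → k = k') : lp (fun _ : ι => ℂ) 2 →L[ℂ] lp (fun _ : κ => ℂ) 2 :=
  LinearMap.mkContinuous
    { toFun := fun a => ⟨fun k => w k * a (e k), memℓp_gen' (lpMul_bd hC hC0 he a)⟩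
      map_add' := by intro a b; ext k; simp only [lp.coeFn_add, Pi.add_apply, mul_add]
      map_smul' := by intro c a; ext k; simp; ring } C
    (fun a => lp.norm_le_of_forall_sum_le (by simp) (by positivity) (lpMul_bd hC hC0 he a))

theorem lpMul_apply {ι κ : Type*} (e : κ → ι) (w : κ → ℂ) (C : ℝ) (hC : ∀ k, ‖w k‖ ≤ C) (hC0 : 0 ≤ C)
    (he : ∀ k k', w k ≠ 0 → w k' ≠ 0 → e k = e k' → k = k') (a : lp (fun _ : ι => ℂ) 2) (k : κ) :
    lpMul e w C hC hC0 he a k = w k * a (e k) := rfl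

/-- coefficient space -/
abbrev VV (n : ℕ) : Type := lp (fun _ : Fin n × ℕ => ℂ) 2

/-- square integrable functions on the circle -/
abbrev L2T (E : Type) [NormedAddCommGroup E] : Type := Lp E 2 (AddCircle.haarAddCircle : Measure TT)

/-- component `i` of the coefficients -/
def Rco {n : ℕ} (i : Fin n) : VV n →L[ℂ] lp (fun _ : ℤ => ℂ) 2 :=
  lpMul (fun j : ℤ => (i, (j - 1).toNat)) (fun j => if 1 ≤ j then 1 else 0) 1
    (by intro k; split_ifs <;> simp) zero_le_one
    (by
      intro k k' h h' e
      have h1 : 1 ≤ k := by by_contra h1; simp [h1] at h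
      have h2 : 1 ≤ k' := by by_contra h1; simp [h1] at h'
      have := congrArg Prod.snd e
      simp only at this
      omega)

/-- vector valued monomials -/
def monC {n : ℕ} (p : Fin n × ℕ) (c : ℂ) : C(TT, Fin n → ℂ) :=
  ⟨fun θ => Pi.single p.1 (c * zt θ ^ (p.2 + 1)), by
    refine continuous_pi fun i => ?_
    by_cases h : i = p.1
    · subst h; simp only [Pi.single_eq_same]; exact continuous_const.mul (zt_cont.pow _)
    · simpa [h] using continuous_const⟩

theorem monC_norm {n : ℕ} (p : Fin n × ℕ) (c : ℂ) : ‖monC p c‖ ≤ ‖c‖ := by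
  rw [ContinuousMap.norm_le _ (norm_nonneg _)]
  intro θ
  change ‖(Pi.single p.1 (c * zt θ ^ (p.2 + 1)) : Fin n → ℂ)‖ ≤ ‖c‖
  rw [Pi.norm_single, norm_mul, norm_pow, zt_norm]; simp

theorem monC_memlp (n : ℕ) : Memℓp (fun p : Fin n × ℕ => monC p ((Complex.I * (p.2 + 1))⁻¹)) 2 := by
  refine memℓp_gen ?_
  have h1 : Summable fun k : ℕ => 1 / ((k : ℝ) + 1) ^ 2 := by
    have := (summable_nat_add_iff 1).2 (Real.summable_one_div_nat_pow.2 (by norm_num : 1 < 2))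
    simpa using this
  have h2 : Summable fun p : Fin n × ℕ => 1 / ((p.2 : ℝ) + 1) ^ 2 := by
    rw [summable_prod_of_nonneg (fun _ => by positivity)]
    exact ⟨fun _ => h1, Summable.of_finite⟩
  refine h2.of_nonneg_of_le (fun _ => by positivity) fun p => ?_
  have h3 := monC_norm p ((Complex.I * (p.2 + 1))⁻¹)
  have h4 : ‖(Complex.I * ((p.2 : ℂ) + 1))⁻¹‖ = 1 / ((p.2 : ℝ) + 1) := by
    rw [norm_inv, norm_mul, Complex.norm_I, one_mul]
    have : ‖(p.2 : ℂ) + 1‖ = (p.2 : ℝ) + 1 := by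
      exact_mod_cast Complex.norm_natCast (p.2 + 1)
    rw [this, one_div]
  rw [h4] at h3
  have : ((2 : ENNReal).toReal) = ((2 : ℕ) : ℝ) := by simp
  rw [this, Real.rpow_natCast]
  calc _ ≤ (1 / ((p.2 : ℝ) + 1)) ^ 2 := pow_le_pow_left₀ (norm_nonneg _) h3 2
    _ = _ := by rw [div_pow, one_pow]

/-- the function with derivative coefficients `a` -/
def T1c (n : ℕ) : VV n →L[ℂ] C(TT, Fin n → ℂ) :=
  (lp.dualPairing 2 2 (fun _ : Fin n × ℕ => ContinuousLinearMap.lsmul ℂ ℂ (E := C(TT, Fin n → ℂ))) (K := 1)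
    (fun _ => ContinuousLinearMap.opNorm_lsmul_le)).flip ⟨_, monC_memlp n⟩

/-- the derivative -/
def T2c (n : ℕ) : VV n →L[ℂ] L2T (Fin n → ℂ) :=
  ∑ i, ((ContinuousLinearMap.single ℂ (fun _ : Fin n => ℂ) i).compLpL 2 AddCircle.haarAddCircle) ∘L
    ((fourierBasis (T := 2 * Real.pi)).repr.symm.toContinuousLinearEquiv : lp (fun _ : ℤ => ℂ) 2 →L[ℂ] L2T ℂ) ∘L Rco i

theorem T1c_apply {n : ℕ} (a : VV n) : T1c n a = ∑' p, a p • monC p ((Complex.I * (p.2 + 1))⁻¹) := rfl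

theorem T1c_single {n : ℕ} (p : Fin n × ℕ) (c : ℂ) : T1c n (lp.single 2 p c) = monC p (c * (Complex.I * (p.2 + 1))⁻¹) := by
  rw [T1c_apply, tsum_eq_single p]
  · ext θ i
    by_cases h : i = p.1
    · subst h; simp [monC, lp.single_apply]; ring
    · simp [monC, lp.single_apply, h]
  · intro q hq
    rw [lp.single_apply, Pi.single_eq_of_ne hq]; exact zero_smul ℂ (monC (n := n) q ((Complex.I * (q.2 + 1))⁻¹))

theorem Rco_single {n : ℕ} (i : Fin n) (p : Fin n × ℕ) (c : ℂ) :
    Rco i (lp.single 2 p c) = if i = p.1 then lp.single 2 ((p.2 : ℤ) + 1) c else 0 := by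
  ext j
  rw [Rco, lpMul_apply]
  by_cases h : i = p.1
  · subst h
    simp only [if_true]
    by_cases hj : j = (p.2 : ℤ) + 1
    · subst hj
      simp [lp.single_apply]
    · rw [lp.single_apply, lp.single_apply, Pi.single_eq_of_ne hj]
      by_cases h1 : 1 ≤ j
      · rw [Pi.single_eq_of_ne, mul_zero]
        intro h2
        have := congrArg Prod.snd h2
        simp only at this
        omega
      · simp [h1]
  · rw [if_neg h, lp.single_apply, Pi.single_eq_of_ne, mul_zero]
    · rfl
    · intro h2
      exact h (congrArg Prod.fst h2)

theorem T2c_single {n : ℕ} (p : Fin n × ℕ) (c : ℂ) :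
    T2c n (lp.single 2 p c) = ContinuousMap.toLp 2 AddCircle.haarAddCircle ℂ (monC p c) := by
  have h0 : T2c n (lp.single 2 p c) = ∑ i, ((ContinuousLinearMap.single ℂ (fun _ : Fin n => ℂ) i).compLpL 2 AddCircle.haarAddCircle) 
    ((fourierBasis (T := 2 * Real.pi)).repr.symm (Rco i (lp.single 2 p c))) := by
    simp [T2c, ContinuousLinearMap.sum_apply]
  rw [h0, Finset.sum_eq_single p.1]
  · rw [Rco_single, if_pos rfl]
    have h1 : (fourierBasis (T := 2 * Real.pi)).repr.symm (lp.single 2 ((p.2 : ℤ) + 1) c) = c • fourierLp 2 ((p.2 : ℤ) + 1) := by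
      have : (lp.single 2 ((p.2 : ℤ) + 1) c : lp (fun _ : ℤ => ℂ) 2) = c • lp.single 2 ((p.2 : ℤ) + 1) (1 : ℂ) := by
        rw [← lp.single_smul]; simp
      rw [this, map_smul, HilbertBasis.repr_symm_single, coe_fourierBasis]
    rw [h1]
    refine Lp.ext ?_
    refine EventuallyEq.trans ((ContinuousLinearMap.single ℂ (fun _ : Fin n => ℂ) p.1).coeFn_compLp _) ?_
    refine EventuallyEq.trans ?_ (ContinuousMap.coeFn_toLp _ _).symm
    filter_upwards [Lp.coeFn_smul c (fourierLp (T := 2 * Real.pi) 2 ((p.2 : ℤ) + 1)), coeFn_fourierLp (T := 2 * Real.pi) 2 ((p.2 : ℤ) + 1)] with θ h2 h3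
    rw [h2, Pi.smul_apply, h3, fourier_zt]
    simp only [monC, ContinuousMap.coe_mk, ContinuousLinearMap.single_apply, smul_eq_mul]
    congr 2
  · intro i _ hi
    rw [Rco_single, if_neg hi, map_zero, map_zero]
  · simp

/-- two continuous linear maps on `VV` agreeing on the basis agree -/
theorem VV.ext_clm {n : ℕ} {F : Type*} [NormedAddCommGroup F] [NormedSpace ℝ F] {A B : VV n →L[ℝ] F}
    (h : ∀ p c, A (lp.single 2 p c) = B (lp.single 2 p c)) (a : VV n) : A a = B a := by
  have h1 := (lp.hasSum_single (by simp) a).mapL A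
  have h2 := (lp.hasSum_single (by simp) a).mapL B
  simp only [h] at h1
  exact h1.unique h2

/-- the operators as real linear maps -/
def T1 (n : ℕ) : VV n →L[ℝ] C(TT, Fin n → ℂ) := (T1c n).restrictScalars ℝ
def T2 (n : ℕ) : VV n →L[ℝ] L2T (Fin n → ℂ) := (T2c n).restrictScalars ℝ

theorem T1_single {n : ℕ} (p : Fin n × ℕ) (c : ℂ) : T1 n (lp.single 2 p c) = monC p (c * (Complex.I * (p.2 + 1))⁻¹) := T1c_single p c
theorem T2_single {n : ℕ} (p : Fin n × ℕ) (c : ℂ) :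
    T2 n (lp.single 2 p c) = ContinuousMap.toLp 2 AddCircle.haarAddCircle ℝ (monC p c) := T2c_single p c

/-- Fourier coefficients of components of continuous functions -/
def fcC {n : ℕ} (i : Fin n) (j : ℤ) : C(TT, Fin n → ℂ) →L[ℝ] ℂ :=
  LinearMap.mkContinuous
    { toFun := fun u => fourierCoeff (fun θ => u θ i) j
      map_add' := by
        intro u v
        exact fc_add (u := fun θ => u θ i) (v := fun θ => v θ i) (by fun_prop) (by fun_prop) j
      map_smul' := by
        intro c u
        have := fc_smul (fun θ => u θ i) (c : ℂ) j
        simpa using this } 1 (by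
      intro u
      rw [one_mul]
      exact norm_fc_le (fun θ => (norm_le_pi_norm _ i).trans (u.norm_coe_le_norm θ)) j)

theorem fcC_apply {n : ℕ} (i : Fin n) (j : ℤ) (u : C(TT, Fin n → ℂ)) : fcC i j u = fourierCoeff (fun θ => u θ i) j := rfl

/-- Fourier coefficients of components of square integrable functions -/
def fcL {n : ℕ} (i : Fin n) (j : ℤ) : L2T (Fin n → ℂ) →L[ℝ] ℂ :=
  (innerSL ℂ (fourierLp (T := 2 * Real.pi) 2 j) ∘L
    ((ContinuousLinearMap.proj i : (Fin n → ℂ) →L[ℂ] ℂ).compLpL 2 AddCircle.haarAddCircle)).restrictScalars ℝ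

theorem fcL_apply {n : ℕ} (i : Fin n) (j : ℤ) (u : L2T (Fin n → ℂ)) : fcL i j u = fourierCoeff (fun θ => u θ i) j := by
  have h1 : fcL i j u = inner ℂ (fourierLp (T := 2 * Real.pi) 2 j) ((ContinuousLinearMap.proj i : (Fin n → ℂ) →L[ℂ] ℂ).compLp u) := rfl
  rw [h1, ← coe_fourierBasis, ← HilbertBasis.repr_apply_apply, fourierBasis_repr]
  exact congrFun (fourierCoeff_congr_ae ((ContinuousLinearMap.proj i : (Fin n → ℂ) →L[ℂ] ℂ).coeFn_compLp u)) j

theorem fcL_toLp {n : ℕ} (i : Fin n) (j : ℤ) (u : C(TT, Fin n → ℂ)) :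
    fcL i j (ContinuousMap.toLp 2 AddCircle.haarAddCircle ℝ u) = fcC i j u := by
  rw [fcL_apply, fcC_apply]
  refine congrFun (fourierCoeff_congr_ae ?_) j
  filter_upwards [ContinuousMap.coeFn_toLp (p := 2) (𝕜 := ℝ) AddCircle.haarAddCircle u] with θ h
  rw [h]

theorem fcC_monC {n : ℕ} (i : Fin n) (j : ℤ) (p : Fin n × ℕ) (c : ℂ) :
    fcC i j (monC p c) = if i = p.1 ∧ j = (p.2 : ℤ) + 1 then c else 0 := by
  rw [fcC_apply]
  by_cases h : i = p.1
  · subst h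
    have : (fun θ => monC p c θ p.1) = fun θ => c * zt θ ^ ((p.2 : ℤ) + 1) := by
      ext θ
      simp only [monC, ContinuousMap.coe_mk, Pi.single_eq_same]
      congr 1
    rw [this, fc_smul, fc_fourier]
    simp
  · have : (fun θ => monC p c θ i) = fun θ => (0 : ℂ) := by
      ext θ
      simp [monC, h]
    rw [this, fc_const]
    simp [h]

/-- evaluation at an index -/
def evV {n : ℕ} (p : Fin n × ℕ) : VV n →L[ℝ] ℂ :=
  LinearMap.mkContinuous { toFun := fun a => a p, map_add' := fun _ _ => rfl, map_smul' := fun _ _ => rfl } 1 (fun a => by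
    rw [one_mul]; exact lp.norm_apply_le_norm (by simp) a p)

theorem evV_apply {n : ℕ} (p : Fin n × ℕ) (a : VV n) : evV p a = a p := rfl

theorem fc_T2 {n : ℕ} (a : VV n) (i : Fin n) (k : ℕ) : fcL i ((k : ℤ) + 1) (T2 n a) = a (i, k) := by
  rw [← evV_apply]
  refine VV.ext_clm (A := fcL i ((k : ℤ) + 1) ∘L T2 n) (B := evV (i, k)) (fun p c => ?_) a
  rw [ContinuousLinearMap.comp_apply, T2_single, fcL_toLp, fcC_monC, evV_apply, lp.single_apply]
  by_cases h : p = (i, k)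
  · subst h; simp
  · rw [Pi.single_eq_of_ne (Ne.symm h), if_neg]
    rintro ⟨h1, h2⟩
    exact h (Prod.ext h1.symm (by simp only; omega))

theorem fc_T1 {n : ℕ} (a : VV n) (i : Fin n) (k : ℕ) : fcC i ((k : ℤ) + 1) (T1 n a) = (Complex.I * (k + 1))⁻¹ * a (i, k) := by
  refine VV.ext_clm (A := fcC i ((k : ℤ) + 1) ∘L T1 n) (B := (Complex.I * (k + 1))⁻¹ • evV (i, k)) (fun p c => ?_) a
  rw [ContinuousLinearMap.comp_apply, T1_single, fcC_monC, smul_apply, evV_apply, lp.single_apply]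
  by_cases h : p = (i, k)
  · subst h; simp [mul_comm]
  · rw [Pi.single_eq_of_ne (Ne.symm h), if_neg]
    · simp
    rintro ⟨h1, h2⟩
    exact h (Prod.ext h1.symm (by simp only; omega))

theorem fc_T1_zero {n : ℕ} (a : VV n) (i : Fin n) (j : ℤ) (hj : j ≤ 0) : fcC i j (T1 n a) = 0 := by
  refine VV.ext_clm (A := fcC i j ∘L T1 n) (B := 0) (fun p c => ?_) a
  rw [ContinuousLinearMap.comp_apply, T1_single, fcC_monC, if_neg (by omega)]; rfl

theorem fc_T2_zero {n : ℕ} (a : VV n) (i : Fin n) (j : ℤ) (hj : j ≤ 0) : fcL i j (T2 n a) = 0 := by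
  refine VV.ext_clm (A := fcL i j ∘L T2 n) (B := 0) (fun p c => ?_) a
  rw [ContinuousLinearMap.comp_apply, T2_single, fcL_toLp, fcC_monC, if_neg (by omega)]; rfl

section nemy
variable {E F : Type} [NormedAddCommGroup E] [NormedSpace ℝ E] [NormedAddCommGroup F] [NormedSpace ℝ F]

/-- superposition operator -/
def nem {G : Type*} [TopologicalSpace G] (Φ : E → G) (hΦ : Continuous Φ) (u : C(TT, E)) : C(TT, G) := (⟨Φ, hΦ⟩ : C(E, G)).comp u

theorem nem_apply {G : Type*} [TopologicalSpace G] (Φ : E → G) (hΦ : Continuous Φ) (u : C(TT, E)) (θ : TT) : nem Φ hΦ u θ = Φ (u θ) := rfl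

theorem nem_cont {G : Type*} [TopologicalSpace G] (Φ : E → G) (hΦ : Continuous Φ) : Continuous (nem Φ hΦ) :=
  ContinuousMap.continuous_postcomp _

/-- pointwise application -/
def mulC : C(TT, E →L[ℝ] F) →L[ℝ] C(TT, E) →L[ℝ] C(TT, F) :=
  LinearMap.mkContinuous₂ (LinearMap.mk₂ ℝ (fun (A : C(TT, E →L[ℝ] F)) (u : C(TT, E)) => (⟨fun θ => A θ (u θ), by fun_prop⟩ : C(TT, F)))
    (by intro A B u; ext θ; simp) (by intro c A u; ext θ; simp) (by intro A u v; ext θ; simp) (by intro c A u; ext θ; simp)) 1 (by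
    intro A u
    rw [ContinuousMap.norm_le _ (by positivity)]
    intro θ
    simp only [one_mul]
    refine ((A θ).le_opNorm _).trans ?_
    exact mul_le_mul (A.norm_coe_le_norm θ) (u.norm_coe_le_norm θ) (norm_nonneg _) ((norm_nonneg _).trans (A.norm_coe_le_norm θ)))

theorem mulC_apply (A : C(TT, E →L[ℝ] F)) (u : C(TT, E)) (θ : TT) : mulC A u θ = A θ (u θ) := rfl

theorem nem_hasFDerivAt {Φ : E → F} (hΦ : ContDiff ℝ 1 Φ) (u : C(TT, E)) :
    HasFDerivAt (nem Φ hΦ.continuous) (mulC (nem (fderiv ℝ Φ) (hΦ.continuous_fderiv one_ne_zero) u)) u := by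
  rw [hasFDerivAt_iff_isLittleO_nhds_zero, Asymptotics.isLittleO_iff]
  intro η hη
  obtain ⟨δ, hδ, h⟩ := unif_diff isOpen_univ hΦ.contDiffOn u.continuous (fun _ => mem_univ _) hη
  filter_upwards [Metric.ball_mem_nhds (0 : C(TT, E)) hδ] with v hv
  rw [mem_ball_zero_iff] at hv
  rw [ContinuousMap.norm_le _ (by positivity)]
  intro θ
  have h1 : ‖v θ‖ ≤ ‖v‖ := v.norm_coe_le_norm θ
  have := h θ (u θ + v θ) (by simpa using h1.trans_lt hv)
  rw [add_sub_cancel_left] at this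
  exact this.trans (mul_le_mul_of_nonneg_left h1 hη.le)

theorem nem_contDiff {Φ : E → F} (hΦ : ContDiff ℝ 1 Φ) : ContDiff ℝ 1 (nem Φ hΦ.continuous) := by
  refine contDiff_one_iff_hasFDerivAt.2 ⟨_, ?_, nem_hasFDerivAt hΦ⟩
  exact mulC.continuous.comp (nem_cont _ _)

/-- pointwise application on square integrable functions -/
def mulL : C(TT, E →L[ℝ] F) →L[ℝ] L2T E →L[ℝ] L2T F :=
  ((ContinuousLinearMap.id ℝ (E →L[ℝ] F)).holderL AddCircle.haarAddCircle ⊤ 2 2) ∘L (ContinuousMap.toLp ⊤ AddCircle.haarAddCircle ℝ)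

theorem mulL_ae (A : C(TT, E →L[ℝ] F)) (u : L2T E) : ∀ᵐ θ ∂(AddCircle.haarAddCircle : Measure TT), mulL A u θ = A θ (u θ) := by
  have h1 := (ContinuousLinearMap.id ℝ (E →L[ℝ] F)).coeFn_holder (r := 2) (μ := (AddCircle.haarAddCircle : Measure TT)) (ContinuousMap.toLp ⊤ AddCircle.haarAddCircle ℝ A) u
  filter_upwards [h1, ContinuousMap.coeFn_toLp (p := ⊤) (𝕜 := ℝ) AddCircle.haarAddCircle A] with θ h1 h2
  rw [h2] at h1
  exact h1

theorem toLp_ae (u : C(TT, E)) : ∀ᵐ θ ∂(AddCircle.haarAddCircle : Measure TT), ContinuousMap.toLp 2 AddCircle.haarAddCircle ℝ u θ = u θ :=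
  ContinuousMap.coeFn_toLp (p := 2) (𝕜 := ℝ) AddCircle.haarAddCircle u

theorem mulL_toLp (A : C(TT, E →L[ℝ] F)) (u : C(TT, E)) :
    mulL A (ContinuousMap.toLp 2 AddCircle.haarAddCircle ℝ u) = ContinuousMap.toLp 2 AddCircle.haarAddCircle ℝ (mulC A u) := by
  refine Lp.ext ?_
  filter_upwards [mulL_ae A (ContinuousMap.toLp 2 AddCircle.haarAddCircle ℝ u), toLp_ae u, toLp_ae (mulC A u)] with θ h1 h2 h3
  rw [h1, h2, h3, mulC_apply]

/-- a continuously differentiable function and its derivative -/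
def C1P (u : C(TT, E)) (u' : L2T E) : Prop :=
  ∃ v : C(TT, E), u' = ContinuousMap.toLp 2 AddCircle.haarAddCircle ℝ v ∧ ∀ s : ℝ, HasDerivAt (fun s : ℝ => u (s : TT)) (v (s : TT)) s

theorem C1P.add {u v : C(TT, E)} {u' v' : L2T E} (hu : C1P u u') (hv : C1P v v') : C1P (u + v) (u' + v') := by
  obtain ⟨a, rfl, ha⟩ := hu
  obtain ⟨b, rfl, hb⟩ := hv
  exact ⟨a + b, (map_add _ _ _).symm, fun s => (ha s).add (hb s)⟩

theorem C1P.lin {u : C(TT, E)} {u' : L2T E} (hu : C1P u u') (A : E →L[ℝ] F) :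
    C1P (A.compLeftContinuous ℝ TT u) (A.compLpL 2 AddCircle.haarAddCircle u') := by
  obtain ⟨a, rfl, ha⟩ := hu
  refine ⟨A.compLeftContinuous ℝ TT a, ?_, fun s => A.hasFDerivAt.comp_hasDerivAt s (ha s)⟩
  refine Lp.ext ?_
  filter_upwards [A.coeFn_compLp (ContinuousMap.toLp 2 AddCircle.haarAddCircle ℝ a), toLp_ae a, toLp_ae (A.compLeftContinuous ℝ TT a)] with θ h1 h2 h3
  rw [h3]
  refine h1.trans ?_
  rw [h2]; rfl

theorem C1P.nemy {Φ : E → F} (hΦ : ContDiff ℝ 1 Φ) {u : C(TT, E)} {u' : L2T E} (hu : C1P u u') :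
    C1P (nem Φ hΦ.continuous u) (mulL (nem (fderiv ℝ Φ) (hΦ.continuous_fderiv one_ne_zero) u) u') := by
  obtain ⟨a, rfl, ha⟩ := hu
  refine ⟨_, mulL_toLp _ _, fun s => ?_⟩
  exact (hΦ.differentiable one_ne_zero (u s)).hasFDerivAt.comp_hasDerivAt s (ha s)

theorem C1P.zero : C1P (0 : C(TT, E)) 0 := ⟨0, (map_zero _).symm, fun s => hasDerivAt_const s (0 : E)⟩
end nemy

theorem C1P.const {E : Type} [NormedAddCommGroup E] [NormedSpace ℝ E] (c : E) : C1P (ContinuousMap.const TT c) 0 :=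
  ⟨0, (map_zero _).symm, fun s => hasDerivAt_const s c⟩

theorem zt_deriv (s : ℝ) : HasDerivAt (fun s : ℝ => zt (s : TT)) (Complex.I * zt (s : TT)) s := by
  simp only [zt_coe]
  have h : HasDerivAt (fun s : ℝ => Complex.exp ((s : ℂ) * Complex.I)) (Complex.exp ((s : ℂ) * Complex.I) * (1 * Complex.I)) s :=
    ((Complex.ofRealCLM.hasDerivAt).mul_const Complex.I).cexp
  convert h using 1; ring

/-- the coordinate function -/
def ztC : C(TT, ℂ) := ⟨zt, zt_cont⟩

theorem C1P.ztp : C1P ztC (ContinuousMap.toLp 2 AddCircle.haarAddCircle ℝ (Complex.I • ztC)) :=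
  ⟨_, rfl, zt_deriv⟩

theorem C1P.mono {n : ℕ} (p : Fin n × ℕ) (c : ℂ) :
    C1P (T1 n (lp.single 2 p c)) (T2 n (lp.single 2 p c)) := by
  refine ⟨_, T2_single p c, fun s => ?_⟩
  rw [T1_single]
  refine hasDerivAt_pi.2 fun i => ?_
  by_cases h : i = p.1
  · subst h
    simp only [monC, ContinuousMap.coe_mk, Pi.single_eq_same]
    have h1 := ((zt_deriv s).pow (p.2 + 1)).const_mul (c * (Complex.I * (p.2 + 1))⁻¹)
    refine h1.congr_deriv ?_
    have : ((p.2 : ℂ) + 1) ≠ 0 := by exact_mod_cast Nat.succ_ne_zero p.2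
    have hI := Complex.I_ne_zero
    push_cast
    field_simp
    rw [pow_succ]; ring
  · simp only [monC, ContinuousMap.coe_mk, Pi.single_eq_of_ne h]
    exact hasDerivAt_const _ _

theorem C1P.dense {n : ℕ} {P : VV n → Prop} (hcl : IsClosed {a | P a}) (h : ∀ a, C1P (T1 n a) (T2 n a) → P a) (a : VV n) : P a := by
  have hs := lp.hasSum_single (p := 2) (by simp) a
  refine hcl.mem_of_tendsto hs (Eventually.of_forall fun s => h _ ?_)
  classical
  induction s using Finset.induction_on with
  | empty => simpa using C1P.zero
  | insert p s hp ih => 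
    rw [Finset.sum_insert hp, map_add, map_add]
    exact (C1P.mono p _).add ih

theorem C1P.fc {n : ℕ} {u : C(TT, Fin n → ℂ)} {u' : L2T (Fin n → ℂ)} (hu : C1P u u') (i : Fin n) (j : ℤ) :
    fcL i j u' = Complex.I * j * fcC i j u := by
  obtain ⟨v, rfl, hv⟩ := hu
  rw [fcL_toLp, fcC_apply, fcC_apply]
  simp only [fc_def, mean_interval]
  have h1 : ∀ s ∈ Set.uIcc 0 (2 * Real.pi), HasDerivAt (fun s : ℝ => zt (s : TT) ^ (-j)) (-(Complex.I * j) * zt (s : TT) ^ (-j)) s := by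
    intro s _
    have := (hasDerivAt_zpow (-j) (zt (s : TT)) (Or.inl (zt_ne _))).comp s (zt_deriv s)
    refine this.congr_deriv ?_
    rw [zpow_sub_one₀ (zt_ne _)]
    push_cast
    field_simp [zt_ne]
  have h2 : ∀ s ∈ Set.uIcc 0 (2 * Real.pi), HasDerivAt (fun s : ℝ => u (s : TT) i) (v (s : TT) i) s := fun s _ => hasDerivAt_pi.1 (hv s) i
  have c1 : Continuous fun s : ℝ => zt (s : TT) ^ (-j) := by
    refine Continuous.zpow₀ (zt_cont.comp (AddCircle.continuous_mk' _)) _ fun s => Or.inl (zt_ne _)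
  have c2 : Continuous fun s : ℝ => v (s : TT) i := (continuous_apply i).comp (v.continuous.comp (AddCircle.continuous_mk' _))
  have h3 := intervalIntegral.integral_mul_deriv_eq_deriv_mul h1 h2 ((continuous_const.mul c1).intervalIntegrable _ _) (c2.intervalIntegrable _ _)
  have h4 : ((2 * Real.pi : ℝ) : TT) = ((0 : ℝ) : TT) := by simp
  rw [h3]
  simp only [h4, sub_self, zero_sub]
  rw [← intervalIntegral.integral_neg, mul_smul_comm, ← intervalIntegral.integral_const_mul]
  congr 2
  ext s
  ring

theorem cutoff {E F : Type} [NormedAddCommGroup E] [NormedSpace ℝ E] [FiniteDimensional ℝ E] [NormedAddCommGroup F] [NormedSpace ℝ F]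
    {O K : Set E} (hO : IsOpen O) (hK : IsCompact K) (hKO : K ⊆ O) {Φ : E → F} (hΦ : ContDiffOn ℝ 2 Φ O) :
    ∃ Ψ : E → F, ContDiff ℝ 2 Ψ ∧ ∃ U, IsOpen U ∧ K ⊆ U ∧ U ⊆ O ∧ ∀ x ∈ U, Ψ x = Φ x := by
  obtain ⟨f, h0, h1, -⟩ := exists_contMDiffMap_zero_one_nhds_of_isClosed (n := 2) (modelWithCornersSelf ℝ E) hO.isClosed_compl hK.isClosed
    (Set.disjoint_left.2 fun x hx hx' => hx (hKO hx'))
  have hf : ContDiff ℝ 2 f := f.contMDiff.contDiff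
  rw [eventually_nhdsSet_iff_exists] at h0 h1
  obtain ⟨V, hV, hOV, h0⟩ := h0
  obtain ⟨W, hW, hKW, h1⟩ := h1
  refine ⟨fun x => f x • Φ x, ?_, W ∩ O, hW.inter hO, subset_inter hKW hKO, inter_subset_right, fun x hx => ?_⟩
  · rw [contDiff_iff_contDiffAt]
    intro x
    by_cases hx : x ∈ O
    · exact hf.contDiffAt.smul (hΦ.contDiffAt (hO.mem_nhds hx))
    · refine (contDiffAt_const (c := (0 : F))).congr_of_eventuallyEq ?_
      filter_upwards [hV.mem_nhds (hOV hx)] with y hy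
      simp [h0 y hy]
  · simp [h1 x hx.1]

/-- real part of the bilinear dot product -/
def Bd (n : ℕ) : (Fin n → ℂ) →L[ℝ] (Fin n → ℂ) →L[ℝ] ℝ :=
  LinearMap.mkContinuous₂ (LinearMap.mk₂ ℝ (fun u v => (dot u v).re)
    (by intro a b c; rw [add_dot, add_re]) (by intro c a b; rw [rsmul_dot]; simp)
    (by intro a b c; rw [dot_add, add_re]) (by intro c a b; rw [dot_rsmul]; simp)) n (by
    intro u v
    exact (Complex.abs_re_le_norm _).trans (norm_dot_le u v))

theorem Bd_apply {n : ℕ} (u v : Fin n → ℂ) : Bd n u v = (dot u v).re := rfl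

/-- the pairing on square integrable functions -/
def prL (n : ℕ) : L2T (Fin n → ℂ) →L[ℝ] L2T (Fin n → ℂ) →L[ℝ] ℝ := (Bd n).lpPairing AddCircle.haarAddCircle 2 2

theorem prL_apply {n : ℕ} (u v : L2T (Fin n → ℂ)) : prL n u v = ∫ θ, (dot (u θ) (v θ)).re ∂AddCircle.haarAddCircle :=
  ContinuousLinearMap.lpPairing_eq_integral (Bd n) u v

/-- inclusion of continuous functions into square integrable ones -/
def JJ (E : Type) [NormedAddCommGroup E] [NormedSpace ℝ E] : C(TT, E) →L[ℝ] L2T E := ContinuousMap.toLp 2 AddCircle.haarAddCircle ℝ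

theorem JJ_ae {E : Type} [NormedAddCommGroup E] [NormedSpace ℝ E] (u : C(TT, E)) :
    ∀ᵐ θ ∂(AddCircle.haarAddCircle : Measure TT), JJ E u θ = u θ := toLp_ae u

/-- the weak form -/
def EvL (n : ℕ) (K : ℝ) : (C(TT, Fin n → ℂ) × L2T (Fin n → ℂ)) →L[ℝ] (VV n →L[ℝ] ℝ) :=
  K • (((prL n).bilinearComp (JJ _ ∘L T1 n) (JJ _)).flip ∘L ContinuousLinearMap.fst ℝ _ _) +
    ((prL n).bilinearComp (T2 n) (ContinuousLinearMap.id ℝ _)).flip ∘L ContinuousLinearMap.snd ℝ _ _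

theorem EvL_apply {n : ℕ} (K : ℝ) (y : C(TT, Fin n → ℂ)) (y' : L2T (Fin n → ℂ)) (b : VV n) :
    EvL n K (y, y') b = K * prL n (JJ _ (T1 n b)) (JJ _ y) + prL n (T2 n b) y' := rfl

theorem prL_mon {n : ℕ} (p : Fin n × ℕ) (c : ℂ) (v : L2T (Fin n → ℂ)) :
    prL n (JJ _ (monC p c)) v = (c * fcL p.1 (-((p.2 : ℤ) + 1)) v).re := by
  rw [prL_apply, fcL_apply, fc_def, mean]
  have hi : Integrable (fun θ => zt θ ^ (- -((p.2 : ℤ) + 1)) * v θ p.1) AddCircle.haarAddCircle := by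
    have h1 : MemLp (fun θ => zt θ ^ (- -((p.2 : ℤ) + 1))) 2 (AddCircle.haarAddCircle : Measure TT) := by
      refine memLp_of_cont (zt_cont.zpow₀ _ fun θ => Or.inl (zt_ne θ)) 2
    have h2 : MemLp (fun θ => v θ p.1) 2 (AddCircle.haarAddCircle : Measure TT) := (memLp_pi_iff.1 (Lp.memLp v)) p.1
    exact h1.integrable_mul h2
  rw [← integral_const_mul, ← RCLike.re_eq_complex_re, ← integral_re (hi.const_mul c)]
  refine integral_congr_ae ?_
  filter_upwards [JJ_ae (monC p c)] with θ h
  rw [h]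
  simp only [dot, monC, ContinuousMap.coe_mk, RCLike.re_eq_complex_re, neg_neg]
  rw [Finset.sum_eq_single p.1]
  · rw [Pi.single_eq_same]
    congr 1
    have : zt θ ^ ((p.2 : ℤ) + 1) = zt θ ^ (p.2 + 1) := by exact_mod_cast zpow_natCast (zt θ) (p.2 + 1)
    rw [this]; ring
  · intro i _ hi
    rw [Pi.single_eq_of_ne hi]; simp
  · simp

theorem EvL_single {n : ℕ} {K : ℝ} {y : C(TT, Fin n → ℂ)} {y' : L2T (Fin n → ℂ)}
    (hr : ∀ i j, fcL i j y' = Complex.I * j * fcC i j y) (p : Fin n × ℕ) (c : ℂ) :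
    EvL n K (y, y') (lp.single 2 p c) = (c * (-Complex.I * ((K / (p.2 + 1) + (p.2 + 1) : ℝ)) * fcC p.1 (-((p.2 : ℤ) + 1)) y)).re := by
  have h2 : T2 n (lp.single 2 p c) = JJ _ (monC p c) := T2_single p c
  have h3 : fcL p.1 (-((p.2 : ℤ) + 1)) (JJ _ y) = fcC p.1 (-((p.2 : ℤ) + 1)) y := fcL_toLp _ _ _
  rw [EvL_apply, T1_single, h2, prL_mon, prL_mon, hr, h3]
  have h4 : ∀ w : ℂ, K * w.re = ((K : ℂ) * w).re := by intro w; simp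
  rw [h4, ← add_re]
  congr 1
  have : ((p.2 : ℂ) + 1) ≠ 0 := by exact_mod_cast Nat.succ_ne_zero p.2
  have hI : (Complex.I)⁻¹ = - Complex.I := Complex.inv_I
  push_cast
  rw [mul_inv, hI]
  field_simp
  ring

theorem EvL_imp {n : ℕ} {K : ℝ} (hK : 0 ≤ K) {y : C(TT, Fin n → ℂ)} {y' : L2T (Fin n → ℂ)}
    (hr : ∀ i j, fcL i j y' = Complex.I * j * fcC i j y) (h0 : EvL n K (y, y') = 0) (i : Fin n) : InH fun θ => y θ i := by
  refine ⟨by fun_prop, fun j hj => ?_⟩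
  obtain ⟨k, rfl⟩ : ∃ k : ℕ, j = -((k : ℤ) + 1) := ⟨(-j-1).toNat, by omega⟩
  rw [← fcC_apply]
  by_contra hne
  set w := -Complex.I * ((K / (k + 1) + (k + 1) : ℝ)) * fcC i (-((k : ℤ) + 1)) y with hw
  have hpos : 0 < K / ((k : ℝ) + 1) + (k + 1) := by positivity
  have hw0 : w ≠ 0 := by
    rw [hw]
    refine mul_ne_zero (mul_ne_zero (neg_ne_zero.2 Complex.I_ne_zero) ?_) hne
    exact_mod_cast hpos.ne'
  have h1 := EvL_single (K := K) hr (i, k) ((starRingEnd ℂ) w)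
  rw [h0] at h1
  simp only [← hw] at h1
  rw [mul_comm, Complex.mul_conj] at h1
  simp at h1
  exact hw0 (Complex.normSq_eq_zero.1 h1.symm)

theorem EvL_zero {n : ℕ} {K : ℝ} {y : C(TT, Fin n → ℂ)} {y' : L2T (Fin n → ℂ)}
    (hr : ∀ i j, fcL i j y' = Complex.I * j * fcC i j y) (h0 : ∀ i, InH fun θ => y θ i) : EvL n K (y, y') = 0 := by
  ext b
  refine VV.ext_clm (fun p c => ?_) b
  rw [EvL_single hr, fcC_apply, (h0 p.1).2 _ (by omega)]
  simp

theorem normL2_sq {E : Type} [NormedAddCommGroup E] (u : L2T E) : ‖u‖ ^ 2 = ∫ θ, ‖u θ‖ ^ 2 ∂AddCircle.haarAddCircle := by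
  rw [Lp.norm_def, (Lp.memLp u).eLpNorm_eq_integral_rpow_norm (by simp) (by simp)]
  have h0 : 0 ≤ ∫ θ, ‖u θ‖ ^ 2 ∂AddCircle.haarAddCircle := integral_nonneg fun _ => by positivity
  simp only [ENNReal.toReal_ofNat, Real.rpow_ofNat]
  rw [ENNReal.toReal_ofReal (by positivity), ← Real.rpow_natCast, ← Real.rpow_mul h0]
  norm_num

/-- left inverse of `T2` -/
def Linv (n : ℕ) : L2T (Fin n → ℂ) →L[ℂ] VV n :=
  ∑ i, (lpMul (fun p : Fin n × ℕ => (p.2 : ℤ) + 1) (fun p => if p.1 = i then 1 else 0) 1 (by intro k; split_ifs <;> simp) zero_le_one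
    (by
      intro k k' h h' e
      have h1 : k.1 = i := by by_contra h1; simp [h1] at h
      have h2 : k'.1 = i := by by_contra h1; simp [h1] at h'
      refine Prod.ext (h1.trans h2.symm) ?_
      omega)) ∘L
    ((fourierBasis (T := 2 * Real.pi)).repr.toContinuousLinearEquiv : L2T ℂ →L[ℂ] lp (fun _ : ℤ => ℂ) 2) ∘L
    ((ContinuousLinearMap.proj i : (Fin n → ℂ) →L[ℂ] ℂ).compLpL 2 AddCircle.haarAddCircle)

theorem Linv_T2 {n : ℕ} (a : VV n) : Linv n (T2 n a) = a := by
  ext p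
  have h1 : ∀ q : VV n, q p = evV p q := fun q => rfl
  rw [h1 (Linv n (T2 n a))]
  simp only [Linv, ContinuousLinearMap.sum_apply, map_sum]
  rw [Finset.sum_eq_single p.1]
  · have := fc_T2 a p.1 p.2
    rw [← this, evV_apply]
    simp only [ContinuousLinearMap.comp_apply]
    rw [lpMul_apply]
    simp only [if_true, one_mul]
    change (fourierBasis (T := 2 * Real.pi)).repr _ _ = _
    rw [HilbertBasis.repr_apply_apply, coe_fourierBasis]
    rfl
  · intro i _ hi
    rw [evV_apply]
    simp only [ContinuousLinearMap.comp_apply]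
    rw [lpMul_apply, if_neg (Ne.symm hi), zero_mul]
  · simp

theorem T2_below (n : ℕ) : ∃ C > 0, ∀ a : VV n, ‖a‖ ≤ C * ‖T2 n a‖ := by
  refine ⟨‖Linv n‖ + 1, by positivity, fun a => ?_⟩
  have := (Linv n).le_opNorm (T2 n a)
  rw [Linv_T2] at this
  nlinarith [norm_nonneg (T2 n a)]

theorem interp (n : ℕ) {ε : ℝ} (hε : 0 < ε) : ∃ C > 0, ∀ a : VV n, ‖T1 n a‖ ≤ ε * ‖a‖ + C * ‖JJ _ (T1 n a)‖ := by
  classical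
  set e1 : lp (fun _ : Fin n × ℕ => C(TT, Fin n → ℂ)) 2 := ⟨_, monC_memlp n⟩ with he1
  obtain ⟨pr, hpr, hprn⟩ : ∃ pr : VV n → (lp (fun _ : Fin n × ℕ => C(TT, Fin n → ℂ)) 2 →L[ℂ] C(TT, Fin n → ℂ)), (∀ a f, pr a f = ∑' p, a p • f p) ∧
      ∀ a f, ‖pr a f‖ ≤ ‖a‖ * ‖f‖ := by
    refine ⟨fun a => lp.dualPairing 2 2 (fun _ : Fin n × ℕ => ContinuousLinearMap.lsmul ℂ ℂ (E := C(TT, Fin n → ℂ))) (K := 1)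
      (fun _ => ContinuousLinearMap.opNorm_lsmul_le) a, fun a f => rfl, fun a f => ?_⟩
    refine (ContinuousLinearMap.le_opNorm₂ _ a f).trans ?_
    have h1 := lp.norm_dualPairing (p := 2) (q := 2) (fun _ : Fin n × ℕ => ContinuousLinearMap.lsmul ℂ ℂ (E := C(TT, Fin n → ℂ))) (K := 1) (fun _ => ContinuousLinearMap.opNorm_lsmul_le)
    calc _ ≤ ((1 : NNReal) : ℝ) * ‖a‖ * ‖f‖ := by gcongr
      _ = _ := by simp
  have hT : ∀ a, T1 n a = pr a e1 := fun a => by rw [hpr]; rfl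
  have hs := lp.hasSum_single (p := 2) (by simp) e1
  obtain ⟨s, hs⟩ := ((Metric.tendsto_nhds.1 hs) ε hε).exists
  have hsingle : ∀ a p, pr a (lp.single 2 p (e1 p)) = monC p (fcC p.1 ((p.2 : ℤ) + 1) (T1 n a)) := by
    intro a p
    rw [fc_T1, hpr, tsum_eq_single p]
    · rw [lp.single_apply, Pi.single_eq_same]
      ext θ i
      by_cases h : i = p.1
      · subst h; simp [monC, he1]; ring
      · simp [monC, he1, h]
    · intro q hq
      rw [lp.single_apply, Pi.single_eq_of_ne hq]; exact smul_zero (A := C(TT, Fin n → ℂ)) (a q)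
  refine ⟨(∑ p ∈ s, ‖fcL p.1 ((p.2 : ℤ) + 1)‖) + 1, by positivity, fun a => ?_⟩
  have h1 : T1 n a = pr a (e1 - ∑ p ∈ s, lp.single 2 p (e1 p)) + ∑ p ∈ s, monC p (fcC p.1 ((p.2 : ℤ) + 1) (T1 n a)) := by
    rw [map_sub, map_sum]
    simp only [hsingle]
    rw [← hT]; abel
  calc ‖T1 n a‖ = _ := congrArg norm h1
    _ ≤ _ := norm_add_le _ _
    _ ≤ _ := by
      refine add_le_add ?_ ?_
      · refine ((hprn a _).trans ?_).trans_eq (mul_comm _ _)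
        refine mul_le_mul_of_nonneg_left ?_ (norm_nonneg _)
        rw [← dist_eq_norm, dist_comm]; exact hs.le
      · refine (norm_sum_le _ _).trans ?_
        rw [add_mul, Finset.sum_mul]
        refine le_trans (Finset.sum_le_sum fun p _ => ?_) (le_add_of_nonneg_right (by positivity))
        refine (monC_norm _ _).trans ?_
        rw [← fcL_toLp]
        exact (fcL p.1 ((p.2 : ℤ) + 1)).le_opNorm _

theorem coercive_inv {V : Type*} [NormedAddCommGroup V] [InnerProductSpace ℝ V] [CompleteSpace V] {B : V →L[ℝ] V →L[ℝ] ℝ}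
    (hB : IsCoercive B) : B.IsInvertible := by
  have hk : B.ker = ⊥ := by
    rw [LinearMap.ker_eq_bot']
    intro v hv
    have h1 : hB.continuousLinearEquivOfBilin v = 0 := by
      refine ext_inner_right ℝ fun w => ?_
      rw [hB.continuousLinearEquivOfBilin_apply]
      have : B v = 0 := hv
      rw [this]; simp
    simpa using h1
  have hr : B.range = ⊤ := by
    rw [LinearMap.range_eq_top]
    intro l
    refine ⟨hB.continuousLinearEquivOfBilin.symm ((InnerProductSpace.toDual ℝ V).symm l), ?_⟩
    ext w
    have := hB.continuousLinearEquivOfBilin_apply (hB.continuousLinearEquivOfBilin.symm ((InnerProductSpace.toDual ℝ V).symm l)) w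
    rw [ContinuousLinearEquiv.apply_symm_apply, InnerProductSpace.toDual_symm_apply] at this
    exact this.symm
  exact ⟨ContinuousLinearEquiv.ofBijective B hk hr, by ext; rfl⟩

section gen
variable {E F : Type} [NormedAddCommGroup E] [NormedSpace ℝ E] [NormedAddCommGroup F] [NormedSpace ℝ F]

theorem hΦ1 {Φ : E → F} (hΦ : ContDiff ℝ 2 Φ) : ContDiff ℝ 1 Φ := hΦ.of_le (by norm_num)
theorem hΦd {Φ : E → F} (hΦ : ContDiff ℝ 2 Φ) : ContDiff ℝ 1 (fderiv ℝ Φ) := hΦ.fderiv_right (by norm_num)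
theorem hΦc {Φ : E → F} (hΦ : ContDiff ℝ 2 Φ) : Continuous (fderiv ℝ Φ) := (hΦd hΦ).continuous
theorem hΦcc {Φ : E → F} (hΦ : ContDiff ℝ 2 Φ) : Continuous (fderiv ℝ (fderiv ℝ Φ)) := (hΦd hΦ).continuous_fderiv one_ne_zero

/-- first derivative operator -/
def dN {Φ : E → F} (hΦ : ContDiff ℝ 2 Φ) (u : C(TT, E)) : C(TT, E →L[ℝ] F) := nem (fderiv ℝ Φ) (hΦc hΦ) u
/-- second derivative operator -/
def ddN {Φ : E → F} (hΦ : ContDiff ℝ 2 Φ) (u : C(TT, E)) : C(TT, E →L[ℝ] E →L[ℝ] F) := nem (fderiv ℝ (fderiv ℝ Φ)) (hΦcc hΦ) u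

/-- superposition operator with derivative -/
def NP {Φ : E → F} (hΦ : ContDiff ℝ 2 Φ) (y : C(TT, E) × L2T E) : C(TT, F) × L2T F :=
  (nem Φ hΦ.continuous y.1, mulL (dN hΦ y.1) y.2)

theorem NP_fd {Φ : E → F} (hΦ : ContDiff ℝ 2 Φ) (y : C(TT, E) × L2T E) :
    HasFDerivAt (NP hΦ) (((mulC (dN hΦ y.1)) ∘L ContinuousLinearMap.fst ℝ _ _).prod
      (mulL.precompR _ (dN hΦ y.1) (ContinuousLinearMap.snd ℝ _ _) + mulL.precompL _ (mulC (ddN hΦ y.1) ∘L ContinuousLinearMap.fst ℝ _ _) y.2)) y := by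
  have f1 : HasFDerivAt (fun y : C(TT, E) × L2T E => y.1) (ContinuousLinearMap.fst ℝ _ _) y := hasFDerivAt_fst
  have f2 : HasFDerivAt (fun y : C(TT, E) × L2T E => y.2) (ContinuousLinearMap.snd ℝ _ _) y := hasFDerivAt_snd
  have h1 := (nem_hasFDerivAt (hΦ1 hΦ) y.1).comp y f1
  have h2 := (nem_hasFDerivAt (hΦd hΦ) y.1).comp y f1
  have h3 := mulL.hasFDerivAt_of_bilinear h2 f2
  exact h1.prodMk h3

theorem bil_cd {A B C Q : Type*} [NormedAddCommGroup A] [NormedSpace ℝ A] [NormedAddCommGroup B] [NormedSpace ℝ B] [NormedAddCommGroup C] [NormedSpace ℝ C]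
    [NormedAddCommGroup Q] [NormedSpace ℝ Q] (L : A →L[ℝ] B →L[ℝ] C) {f : Q → A} {g : Q → B} (hf : ContDiff ℝ 1 f) (hg : ContDiff ℝ 1 g) :
    ContDiff ℝ 1 fun y => L (f y) (g y) := L.isBoundedBilinearMap.contDiff.comp (hf.prodMk hg)

theorem dN_cd {Φ : E → F} (hΦ : ContDiff ℝ 2 Φ) : ContDiff ℝ 1 (dN hΦ) := nem_contDiff (hΦd hΦ)

theorem NP_cd {Φ : E → F} (hΦ : ContDiff ℝ 2 Φ) : ContDiff ℝ 1 (NP hΦ) := by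
  have f1 : ContDiff ℝ 1 (fun y : C(TT, E) × L2T E => y.1) := contDiff_fst
  have f2 : ContDiff ℝ 1 (fun y : C(TT, E) × L2T E => y.2) := contDiff_snd
  have h2 := bil_cd (mulL (E := E) (F := F)) ((dN_cd hΦ).comp f1) f2
  have h1 := (nem_contDiff (hΦ1 hΦ)).comp f1
  exact h1.prodMk h2

theorem NP_fd_apply {Φ : E → F} (hΦ : ContDiff ℝ 2 Φ) (y h : C(TT, E) × L2T E) :
    fderiv ℝ (NP hΦ) y h = (mulC (dN hΦ y.1) h.1, mulL (dN hΦ y.1) h.2 + mulL (mulC (ddN hΦ y.1) h.1) y.2) := by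
  rw [(NP_fd hΦ y).fderiv]; rfl

theorem cross_gen (D2 : C(TT, E →L[ℝ] E →L[ℝ] F)) (u2 : L2T E) : ∃ L : C(TT, E) →L[ℝ] L2T F, ∀ u, L u = mulL (mulC D2 u) u2 :=
  ⟨mulL.flip u2 ∘L (mulC D2), fun u => rfl⟩
end gen

theorem real_coer {k C1 C2 C3 K x y X nb A B D : ℝ} (hk : 0 < k) (hC1 : 0 < C1) (hC2 : 0 < C2) (hC3 : 0 < C3) (hK : K = (C2 * C3) ^ 2 / k ^ 2)
    (hx : 0 ≤ x) (hnb : 0 ≤ nb) (h1 : k * y ^ 2 ≤ A) (h2 : k * x ^ 2 ≤ B) (h4 : |D| ≤ C2 * x * X)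
    (h5 : X ≤ k / (4 * C1 * C2) * nb + C3 * y) (h6 : nb ≤ C1 * x) : k / 2 / C1 ^ 2 * nb * nb ≤ K * A + (B + D) := by
  have h3 := neg_abs_le D
  have h7 : C2 * x * X ≤ k / 4 * x ^ 2 + C2 * C3 * x * y := by
    have : X ≤ k / (4 * C1 * C2) * (C1 * x) + C3 * y := h5.trans (by gcongr)
    calc C2 * x * X ≤ C2 * x * (k / (4 * C1 * C2) * (C1 * x) + C3 * y) := by gcongr
      _ = _ := by field_simp
  have h8 : C2 * C3 * x * y ≤ k / 4 * x ^ 2 + K * (k * y ^ 2) := by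
    have : K * (k * y ^ 2) = (C2 * C3) ^ 2 * y ^ 2 / k := by rw [hK]; field_simp
    rw [this]
    have : k / 4 * x ^ 2 + (C2 * C3) ^ 2 * y ^ 2 / k - C2 * C3 * x * y = (k * x / 2 - C2 * C3 * y) ^ 2 / k := by field_simp; ring
    have h9 : 0 ≤ (k * x / 2 - C2 * C3 * y) ^ 2 / k := by positivity
    linarith
  have hK0 : 0 ≤ K := by rw [hK]; positivity
  have h10 := mul_le_mul_of_nonneg_left h1 hK0
  have h11 : k / 2 / C1 ^ 2 * nb * nb ≤ k / 2 * x ^ 2 := by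
    have : nb * nb ≤ (C1 * x) * (C1 * x) := mul_self_le_mul_self hnb h6
    calc k / 2 / C1 ^ 2 * nb * nb = k / 2 / C1 ^ 2 * (nb * nb) := by ring
      _ ≤ k / 2 / C1 ^ 2 * ((C1 * x) * (C1 * x)) := by gcongr
      _ = _ := by field_simp
  linarith

/-- the space of pointwise variables -/
abbrev PE (n : ℕ) : Type := (ℝ × ℝ) × (ℂ × ((Fin n → ℂ) × (Fin n → ℂ)))

def i1 (n : ℕ) : (ℝ × ℝ) →L[ℝ] PE n := ContinuousLinearMap.inl ℝ _ _
def i2 (n : ℕ) : ℂ →L[ℝ] PE n := ContinuousLinearMap.inr ℝ _ _ ∘L ContinuousLinearMap.inl ℝ _ _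
def i3 (n : ℕ) : (Fin n → ℂ) →L[ℝ] PE n := ContinuousLinearMap.inr ℝ _ _ ∘L ContinuousLinearMap.inr ℝ _ _ ∘L ContinuousLinearMap.inl ℝ _ _
def i4 (n : ℕ) : (Fin n → ℂ) →L[ℝ] PE n := ContinuousLinearMap.inr ℝ _ _ ∘L ContinuousLinearMap.inr ℝ _ _ ∘L ContinuousLinearMap.inr ℝ _ _

/-- constants -/
def cstL (E : Type) [NormedAddCommGroup E] [NormedSpace ℝ E] : E →L[ℝ] C(TT, E) :=
  LinearMap.mkContinuous { toFun := fun c => ContinuousMap.const TT c, map_add' := fun _ _ => rfl, map_smul' := fun _ _ => rfl } 1 (fun c => by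
    rw [one_mul, ContinuousMap.norm_le _ (norm_nonneg _)]; intro θ; rfl)

/-- linear part of the pointwise variables -/
def LC (n : ℕ) : ((ℝ × ℝ) × VV n) →L[ℝ] C(TT, PE n) :=
  (i1 n).compLeftContinuous ℝ TT ∘L cstL _ ∘L ContinuousLinearMap.fst ℝ _ _ + (i3 n).compLeftContinuous ℝ TT ∘L T1 n ∘L ContinuousLinearMap.snd ℝ _ _

def L2 (n : ℕ) : ((ℝ × ℝ) × VV n) →L[ℝ] L2T (PE n) :=
  (i3 n).compLpL 2 AddCircle.haarAddCircle ∘L T2 n ∘L ContinuousLinearMap.snd ℝ _ _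

def UC {n : ℕ} (a0 : VV n) (q : (ℝ × ℝ) × VV n) : C(TT, PE n) :=
  LC n q + ((i2 n).compLeftContinuous ℝ TT ztC + (i4 n).compLeftContinuous ℝ TT (T1 n a0))

def U2 {n : ℕ} (a0 : VV n) (q : (ℝ × ℝ) × VV n) : L2T (PE n) :=
  L2 n q + ((i2 n).compLpL 2 AddCircle.haarAddCircle (ContinuousMap.toLp 2 AddCircle.haarAddCircle ℝ (Complex.I • ztC)) +
    (i4 n).compLpL 2 AddCircle.haarAddCircle (T2 n a0))

theorem UC_apply {n : ℕ} (a0 : VV n) (q : (ℝ × ℝ) × VV n) (θ : TT) : UC a0 q θ = (q.1, zt θ, T1 n q.2 θ, T1 n a0 θ) := by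
  have : UC a0 q θ = (i1 n q.1 + i3 n (T1 n q.2 θ)) + (i2 n (zt θ) + i4 n (T1 n a0 θ)) := rfl
  rw [this]
  simp [i1, i2, i3, i4]

/-- both parts -/
def WW {n : ℕ} (a0 : VV n) (q : (ℝ × ℝ) × VV n) : C(TT, PE n) × L2T (PE n) := (UC a0 q, U2 a0 q)

theorem WW_cont {n : ℕ} : Continuous fun y : VV n × ((ℝ × ℝ) × VV n) => WW y.1 y.2 := by
  have h1 : Continuous fun y : VV n × ((ℝ × ℝ) × VV n) => UC y.1 y.2 := by unfold UC; fun_prop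
  have h2 : Continuous fun y : VV n × ((ℝ × ℝ) × VV n) => U2 y.1 y.2 := by unfold U2; fun_prop
  exact h1.prodMk h2

theorem WW_fd {n : ℕ} (a0 : VV n) (q : (ℝ × ℝ) × VV n) : HasFDerivAt (WW a0) ((LC n).prod (L2 n)) q := by
  have h1 : HasFDerivAt (UC a0) (LC n) q := (LC n).hasFDerivAt.add_const _
  have h2 : HasFDerivAt (U2 a0) (L2 n) q := (L2 n).hasFDerivAt.add_const _
  exact h1.prodMk h2

theorem WW_cd {n : ℕ} (a0 : VV n) : ContDiff ℝ 1 (WW a0) := by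
  have h1 : ContDiff ℝ 1 (UC a0) := (LC n).contDiff.add contDiff_const
  have h2 : ContDiff ℝ 1 (U2 a0) := (L2 n).contDiff.add contDiff_const
  exact h1.prodMk h2

theorem WW_C1P {n : ℕ} {a0 a : VV n} (p : ℝ × ℝ) (h0 : C1P (T1 n a0) (T2 n a0)) (h : C1P (T1 n a) (T2 n a)) : C1P (UC a0 (p, a)) (U2 a0 (p, a)) := by
  have h1 := ((((C1P.const p).lin (i1 n)).add (h.lin (i3 n)))).add ((C1P.ztp.lin (i2 n)).add (h0.lin (i4 n)))
  rw [map_zero, zero_add] at h1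
  exact h1

/-- Fourier coefficient relation -/
def Rl {n : ℕ} (i : Fin n) (j : ℤ) (y : C(TT, Fin n → ℂ) × L2T (Fin n → ℂ)) : Prop := fcL i j y.2 = Complex.I * j * fcC i j y.1

theorem Rl_closed {n : ℕ} (i : Fin n) (j : ℤ) : IsClosed {y : C(TT, Fin n → ℂ) × L2T (Fin n → ℂ) | Rl i j y} := by
  refine isClosed_eq ?_ ?_
  · exact (fcL i j).continuous.comp continuous_snd
  · exact continuous_const.mul ((fcC i j).continuous.comp continuous_fst)

theorem rel {n : ℕ} {Φ : PE n → (Fin n → ℂ)} (hΦ : ContDiff ℝ 2 Φ) (a0 : VV n) (q : (ℝ × ℝ) × VV n) (i : Fin n) (j : ℤ) :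
    Rl i j (NP hΦ (WW a0 q)) := by
  obtain ⟨p, a⟩ := q
  have hN : Continuous (NP hΦ) := (NP_cd hΦ).continuous
  refine C1P.dense (P := fun a0 => Rl i j (NP hΦ (WW a0 (p, a)))) ?_ (fun a0 h0 => ?_) a0
  · have hg : Continuous fun a0 : VV n => (a0, (p, a)) := by fun_prop
    exact (Rl_closed i j).preimage (hN.comp (WW_cont.comp hg))
  refine C1P.dense (P := fun a => Rl i j (NP hΦ (WW a0 (p, a)))) ?_ (fun a h => ?_) a
  · have hg : Continuous fun a : VV n => (a0, (p, a)) := by fun_prop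
    exact (Rl_closed i j).preimage (hN.comp (WW_cont.comp hg))
  exact ((WW_C1P p h0 h).nemy (hΦ1 hΦ)).fc i j

/-- the nonlinear weak equation -/
def GG {n : ℕ} {Φ : PE n → (Fin n → ℂ)} (hΦ : ContDiff ℝ 2 Φ) (K : ℝ) (a0 : VV n) (q : (ℝ × ℝ) × VV n) : VV n →L[ℝ] ℝ :=
  EvL n K (NP hΦ (WW a0 q))

theorem GG_cd {n : ℕ} {Φ : PE n → (Fin n → ℂ)} (hΦ : ContDiff ℝ 2 Φ) (K : ℝ) (a0 : VV n) : ContDiff ℝ 1 (GG hΦ K a0) :=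
  (EvL n K).contDiff.comp ((NP_cd hΦ).comp (WW_cd a0))

theorem GG_fd {n : ℕ} {Φ : PE n → (Fin n → ℂ)} (hΦ : ContDiff ℝ 2 Φ) (K : ℝ) (a0 : VV n) (q : (ℝ × ℝ) × VV n) (h : (ℝ × ℝ) × VV n) :
    fderiv ℝ (GG hΦ K a0) q h = EvL n K (mulC (dN hΦ (UC a0 q)) (LC n h),
      mulL (dN hΦ (UC a0 q)) (L2 n h) + mulL (mulC (ddN hΦ (UC a0 q)) (LC n h)) (U2 a0 q)) := by
  have h1 := (((NP_cd hΦ).differentiable one_ne_zero) (WW a0 q)).hasFDerivAt.comp q (WW_fd a0 q)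
  have h4 := (EvL n K).hasFDerivAt.comp q h1
  have h5 : HasFDerivAt (GG hΦ K a0) _ q := h4
  rw [h5.fderiv]
  exact congrArg (EvL n K) (NP_fd_apply hΦ (WW a0 q) (LC n h, L2 n h))

theorem cross {n : ℕ} (D2 : C(TT, PE n →L[ℝ] PE n →L[ℝ] (Fin n → ℂ))) (u2 : L2T (PE n)) :
    ∃ C2 > 0, ∀ b : VV n, |prL n (T2 n b) (mulL (mulC D2 (LC n (0, b))) u2)| ≤ C2 * ‖T2 n b‖ * ‖T1 n b‖ := by
  have e : ∀ b : VV n, LC n (0, b) = (i3 n).compLeftContinuous ℝ TT (T1 n b) := by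
    intro b
    simp [LC]
  obtain ⟨L, hL⟩ := cross_gen D2 u2
  refine ⟨‖prL n‖ * (‖L‖ * ‖(i3 n).compLeftContinuous ℝ TT‖) + 1, by positivity, fun b => ?_⟩
  rw [e b, ← hL]
  have h1 := (prL n).le_opNorm₂ (T2 n b) (L ((i3 n).compLeftContinuous ℝ TT (T1 n b)))
  have h2 := L.le_opNorm ((i3 n).compLeftContinuous ℝ TT (T1 n b))
  have h3 := ((i3 n).compLeftContinuous ℝ TT).le_opNorm (T1 n b)
  rw [Real.norm_eq_abs] at h1
  generalize L ((i3 n).compLeftContinuous ℝ TT (T1 n b)) = w at *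
  generalize ‖(i3 n).compLeftContinuous ℝ TT‖ = c3 at *
  calc _ ≤ ‖prL n‖ * ‖T2 n b‖ * ‖w‖ := h1
    _ ≤ ‖prL n‖ * ‖T2 n b‖ * (‖L‖ * (c3 * ‖T1 n b‖)) := mul_le_mul_of_nonneg_left (h2.trans (mul_le_mul_of_nonneg_left h3 (norm_nonneg _))) (by positivity)
    _ ≤ _ := by nlinarith [mul_nonneg (norm_nonneg (T2 n b)) (norm_nonneg (T1 n b))]

theorem GG_coer {n : ℕ} {Φ : PE n → (Fin n → ℂ)} (hΦ : ContDiff ℝ 2 Φ) (a0 : VV n) (q0 : (ℝ × ℝ) × VV n) {k : ℝ} (hk : 0 < k)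
    (hc1 : ∀ b : VV n, k * ‖JJ _ (T1 n b)‖ ^ 2 ≤ prL n (JJ _ (T1 n b)) (JJ _ (mulC (dN hΦ (UC a0 q0)) (LC n (0, b)))))
    (hc2 : ∀ b : VV n, k * ‖T2 n b‖ ^ 2 ≤ prL n (T2 n b) (mulL (dN hΦ (UC a0 q0)) (L2 n (0, b)))) :
    ∃ K : ℝ, 0 ≤ K ∧ ∃ c > 0, ∀ b : VV n, c * ‖b‖ * ‖b‖ ≤ fderiv ℝ (GG hΦ K a0) q0 (0, b) b := by
  obtain ⟨C1, hC1, hC1'⟩ := T2_below n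
  obtain ⟨C2, hC2, hcross⟩ := cross (ddN hΦ (UC a0 q0)) (U2 a0 q0)
  obtain ⟨C3, hC3, hintg⟩ := interp n (ε := k / (4 * C1 * C2)) (by positivity)
  refine ⟨(C2 * C3) ^ 2 / k ^ 2, by positivity, k / 2 / C1 ^ 2, by positivity, fun b => ?_⟩
  rw [GG_fd, EvL_apply, map_add]
  exact real_coer hk hC1 hC2 hC3 rfl (norm_nonneg _) (norm_nonneg _) (hc1 b) (hc2 b) (hcross b) (hintg b) (hC1' b)

theorem ift_abs {n : ℕ} {Φ : PE n → (Fin n → ℂ)} (hΦ : ContDiff ℝ 2 Φ) (a0 : VV n) (p0 : ℝ × ℝ)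
    (hbase : ∀ i, InH fun θ => Φ (p0, zt θ, T1 n a0 θ, T1 n a0 θ) i) {k : ℝ} (hk : 0 < k)
    (hc1 : ∀ b : VV n, k * ‖JJ _ (T1 n b)‖ ^ 2 ≤ prL n (JJ _ (T1 n b)) (JJ _ (mulC (dN hΦ (UC a0 (p0, a0))) (LC n (0, b)))))
    (hc2 : ∀ b : VV n, k * ‖T2 n b‖ ^ 2 ≤ prL n (T2 n b) (mulL (dN hΦ (UC a0 (p0, a0))) (L2 n (0, b)))) :
    ∃ A : ℝ × ℝ → VV n, ContDiffAt ℝ 1 A p0 ∧ A p0 = a0 ∧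
      ∀ᶠ p in nhds p0, ∀ i, InH fun θ => Φ (p, zt θ, T1 n (A p) θ, T1 n a0 θ) i := by
  obtain ⟨K, hK, c, hc, hco⟩ := GG_coer hΦ a0 (p0, a0) hk hc1 hc2
  have hinv := coercive_inv (B := fderiv ℝ (GG hΦ K a0) (p0, a0) ∘SL ContinuousLinearMap.inr ℝ (ℝ × ℝ) (VV n)) ⟨c, hc, hco⟩
  have hcd : ContDiffAt ℝ 1 (GG hΦ K a0) (p0, a0) := (GG_cd hΦ K a0).contDiffAt
  have hz : GG hΦ K a0 (p0, a0) = 0 := by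
    refine EvL_zero (rel hΦ a0 (p0, a0)) fun i => ?_
    have := hbase i
    simp only [NP, WW, nem_apply, UC_apply]
    exact this
  refine ⟨hcd.implicitFunction one_ne_zero hinv, hcd.contDiffAt_implicitFunction one_ne_zero hinv, hcd.implicitFunction_apply_self one_ne_zero hinv, ?_⟩
  filter_upwards [hcd.eventually_apply_implicitFunction one_ne_zero hinv] with p hp i
  rw [hz] at hp
  have := EvL_imp hK (rel hΦ a0 _) hp i
  simp only [NP, WW, nem_apply, UC_apply] at this
  exact this

/-- products with analytic functions -/
theorem fc_mul_L2 {u v : TT → ℂ} (hu : InH u) (hv : MemLp v 2 (AddCircle.haarAddCircle : Measure TT)) (h0 : ∀ j ≤ 0, fourierCoeff v j = 0) (j : ℤ) (hj : j ≤ 0) :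
    fourierCoeff (fun θ => u θ * v θ) j = 0 := by
  rw [fc_def]
  have hc : Continuous fun θ => zt θ ^ (-j) * u θ := (zt_cont.zpow₀ _ fun θ => Or.inl (zt_ne θ)).mul hu.1
  have h := hasSum_fc_mul (memLp_of_cont hc 2) hv
  have h2 : ∀ k : ℤ, fourierCoeff (fun θ => zt θ ^ (-j) * u θ) k * fourierCoeff v (-k) = 0 := by
    intro k
    rw [fc_zt_mul]
    rcases le_or_gt 0 k with hk | hk
    · rw [h0 (-k) (by omega), mul_zero]
    · rw [hu.2 _ (by omega), zero_mul]
  simp only [h2] at h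
  have := h.unique hasSum_zero
  rw [← this]
  congr 1; ext θ; ring

theorem memLp_dot {n : ℕ} {w : TT → Fin n → ℂ} (hw : Continuous w) {u : TT → Fin n → ℂ} (hu : MemLp u 2 (AddCircle.haarAddCircle : Measure TT)) :
    MemLp (fun θ => dot (w θ) (u θ)) 2 (AddCircle.haarAddCircle : Measure TT) := by
  unfold dot
  refine memLp_finsetSum _ fun i _ => ?_
  have h1 : MemLp (fun θ => w θ i) ⊤ (AddCircle.haarAddCircle : Measure TT) := memLp_of_cont ((continuous_apply i).comp hw) ⊤
  have h2 : MemLp (fun θ => u θ i) 2 (AddCircle.haarAddCircle : Measure TT) := memLp_pi_iff.1 hu i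
  exact h2.mul h1

theorem mean_sq_zero {n : ℕ} {w : TT → Fin n → ℂ} (hw : ∀ i, InH fun θ => w θ i) {u : TT → Fin n → ℂ} (hu : MemLp u 2 (AddCircle.haarAddCircle : Measure TT))
    (h0 : ∀ i, ∀ j ≤ 0, fourierCoeff (fun θ => u θ i) j = 0) : mean (fun θ => (dot (w θ) (u θ)) ^ 2) = 0 := by
  have hwc : Continuous w := continuous_pi fun i => (hw i).1
  have hm := memLp_dot hwc hu
  have hf : ∀ j ≤ 0, fourierCoeff (fun θ => dot (w θ) (u θ)) j = 0 := by
    intro j hj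
    unfold dot
    rw [fc_def, mean]
    simp only [Finset.mul_sum]
    rw [integral_finsetSum]
    · refine Finset.sum_eq_zero fun i _ => ?_
      have := fc_mul_L2 (hw i) (memLp_pi_iff.1 hu i) (h0 i) j hj
      rw [fc_def] at this
      exact this
    · intro i _
      have h1 : Continuous fun θ => zt θ ^ (-j) * w θ i := (zt_cont.zpow₀ _ fun θ => Or.inl (zt_ne θ)).mul (hw i).1
      have := (memLp_of_cont h1 2).integrable_mul (memLp_pi_iff.1 hu i)
      refine this.congr (ae_of_all _ fun θ => ?_)
      simp [mul_assoc]
  have h := hasSum_fc_mul hm hm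
  have h2 : ∀ k : ℤ, fourierCoeff (fun θ => dot (w θ) (u θ)) k * fourierCoeff (fun θ => dot (w θ) (u θ)) (-k) = 0 := by
    intro k
    rcases le_or_gt k 0 with hk | hk
    · rw [hf k hk, zero_mul]
    · rw [hf (-k) (by omega), mul_zero]
  simp only [h2] at h
  rw [← h.unique hasSum_zero]
  congr 1; ext θ; ring

theorem int_aux1 {n : ℕ} {w : TT → Fin n → ℂ} (hwc : Continuous w) {u : TT → Fin n → ℂ} (hu : MemLp u 2 (AddCircle.haarAddCircle : Measure TT)) :
    Integrable (fun θ => (dot (w θ) (u θ)) ^ 2) (AddCircle.haarAddCircle : Measure TT) := by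
  have hm := memLp_dot hwc hu
  have := hm.integrable_mul hm
  refine this.congr (ae_of_all _ fun θ => ?_)
  simp [sq]

theorem int_aux2 {n : ℕ} {u v : TT → Fin n → ℂ} (hu : MemLp u 2 (AddCircle.haarAddCircle : Measure TT)) (h1 : MemLp v 2 (AddCircle.haarAddCircle : Measure TT)) :
    Integrable (fun θ => (dot (u θ) (v θ)).re) (AddCircle.haarAddCircle : Measure TT) := by
  have h2 : Integrable (fun θ => dot (u θ) (v θ)) (AddCircle.haarAddCircle : Measure TT) := by
    unfold dot
    refine integrable_finsetSum _ fun i _ => ?_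
    exact (memLp_pi_iff.1 hu i).integrable_mul (memLp_pi_iff.1 h1 i)
  exact h2.re

theorem int_aux3 {n : ℕ} {w : TT → Fin n → ℂ} (hw : ∀ i, InH fun θ => w θ i) {u : TT → Fin n → ℂ} (hu : MemLp u 2 (AddCircle.haarAddCircle : Measure TT))
    (h0 : ∀ i, ∀ j ≤ 0, fourierCoeff (fun θ => u θ i) j = 0) : ∫ θ, ((dot (w θ) (u θ)) ^ 2).re ∂AddCircle.haarAddCircle = 0 := by
  have hi2 := int_aux1 (continuous_pi fun i => (hw i).1) hu
  have h1 := mean_sq_zero hw hu h0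
  have h2 : ∫ θ, RCLike.re ((dot (w θ) (u θ)) ^ 2) ∂AddCircle.haarAddCircle = RCLike.re (∫ θ, (dot (w θ) (u θ)) ^ 2 ∂AddCircle.haarAddCircle) := integral_re hi2
  rw [mean] at h1
  rw [h1] at h2
  simpa using h2

theorem int_aux5 {f g h : TT → ℝ} {k κ : ℝ} (hf : Integrable f (AddCircle.haarAddCircle : Measure TT)) (hg : Integrable g (AddCircle.haarAddCircle : Measure TT)) (hh : Integrable h (AddCircle.haarAddCircle : Measure TT))
    (h0 : ∫ θ, g θ ∂AddCircle.haarAddCircle = 0) (hB : ∀ᵐ θ ∂(AddCircle.haarAddCircle : Measure TT), k * f θ + κ * g θ ≤ h θ) :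
    k * ∫ θ, f θ ∂AddCircle.haarAddCircle ≤ ∫ θ, h θ ∂AddCircle.haarAddCircle := by
  have h1 := integral_mono_ae ((hf.const_mul k).add (hg.const_mul κ)) hh hB
  have h2 := integral_add (hf.const_mul k) (hg.const_mul κ)
  rw [integral_const_mul, integral_const_mul, h0] at h2
  simp only [Pi.add_apply] at h1
  linarith

theorem int_aux4 {n : ℕ} {w : TT → Fin n → ℂ} (hw : ∀ i, InH fun θ => w θ i) {u v : TT → Fin n → ℂ} (hu : MemLp u 2 (AddCircle.haarAddCircle : Measure TT))
    (hv : MemLp v 2 (AddCircle.haarAddCircle : Measure TT))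
    (h0 : ∀ i, ∀ j ≤ 0, fourierCoeff (fun θ => u θ i) j = 0) {k κ : ℝ}
    (hB : ∀ᵐ θ ∂(AddCircle.haarAddCircle : Measure TT), k * ‖u θ‖ ^ 2 + κ * ((dot (w θ) (u θ)) ^ 2).re ≤ (dot (u θ) (v θ)).re) :
    k * ∫ θ, ‖u θ‖ ^ 2 ∂AddCircle.haarAddCircle ≤ ∫ θ, (dot (u θ) (v θ)).re ∂AddCircle.haarAddCircle := by
  have hi1 : Integrable (fun θ => ‖u θ‖ ^ 2) (AddCircle.haarAddCircle : Measure TT) := hu.integrable_norm_pow two_ne_zero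
  have hi2' : Integrable (fun θ => ((dot (w θ) (u θ)) ^ 2).re) (AddCircle.haarAddCircle : Measure TT) := (int_aux1 (continuous_pi fun i => (hw i).1) hu).re
  exact int_aux5 hi1 hi2' (int_aux2 hu hv) (int_aux3 hw hu h0) hB

theorem coer_int {n : ℕ} {B : C(TT, (Fin n → ℂ) →L[ℝ] (Fin n → ℂ))} {w : TT → Fin n → ℂ} (hw : ∀ i, InH fun θ => w θ i) {k κ : ℝ}
    (hB : ∀ θ v, k * ‖v‖ ^ 2 + κ * ((dot (w θ) v) ^ 2).re ≤ (dot v (B θ v)).re) (u : L2T (Fin n → ℂ))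
    (h0 : ∀ i, ∀ j ≤ 0, fcL i j u = 0) : k * ‖u‖ ^ 2 ≤ prL n u (mulL B u) := by
  rw [prL_apply, normL2_sq]
  refine int_aux4 hw (Lp.memLp u) (Lp.memLp (mulL B u)) (fun i j hj => ?_) ?_ (κ := κ)
  · rw [← fcL_apply]; exact h0 i j hj
  · filter_upwards [mulL_ae B u] with θ hθ
    rw [hθ]
    exact hB θ (u θ)

theorem mulL_comp {n : ℕ} {E F : Type} [NormedAddCommGroup E] [NormedSpace ℝ E] [NormedAddCommGroup F] [NormedSpace ℝ F] (A : C(TT, E →L[ℝ] F)) (T : (Fin n → ℂ) →L[ℝ] E)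
    (B : C(TT, (Fin n → ℂ) →L[ℝ] F)) (hB : ∀ θ v, B θ v = A θ (T v)) (u : L2T (Fin n → ℂ)) :
    mulL A (T.compLpL 2 AddCircle.haarAddCircle u) = mulL B u := by
  refine Lp.ext ?_
  filter_upwards [mulL_ae A (T.compLpL 2 AddCircle.haarAddCircle u), mulL_ae B u, T.coeFn_compLp u] with θ h1 h2 h3
  rw [h1, h2, hB]
  exact congrArg (A θ) h3

theorem ift_abs' {n : ℕ} {Φ : PE n → (Fin n → ℂ)} (hΦ : ContDiff ℝ 2 Φ) (a0 : VV n) (p0 : ℝ × ℝ)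
    (hbase : ∀ i, InH fun θ => Φ (p0, zt θ, T1 n a0 θ, T1 n a0 θ) i) {k κ : ℝ} (hk : 0 < k) {w : TT → Fin n → ℂ} (hw : ∀ i, InH fun θ => w θ i)
    (hB : ∀ θ v, k * ‖v‖ ^ 2 + κ * ((dot (w θ) v) ^ 2).re ≤ (dot v (fderiv ℝ Φ (p0, zt θ, T1 n a0 θ, T1 n a0 θ) (0, 0, v, 0))).re) :
    ∃ A : ℝ × ℝ → VV n, ContDiffAt ℝ 1 A p0 ∧ A p0 = a0 ∧
      ∀ᶠ p in nhds p0, ∀ i, InH fun θ => Φ (p, zt θ, T1 n (A p) θ, T1 n a0 θ) i := by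
  set A0 := dN hΦ (UC a0 (p0, a0)) with hA0
  set B : C(TT, (Fin n → ℂ) →L[ℝ] (Fin n → ℂ)) := ⟨fun θ => (A0 θ) ∘L (i3 n), by
    exact A0.continuous.clm_comp continuous_const⟩ with hBdef
  have hBv : ∀ θ v, B θ v = A0 θ (i3 n v) := fun θ v => rfl
  have hB' : ∀ θ v, k * ‖v‖ ^ 2 + κ * ((dot (w θ) v) ^ 2).re ≤ (dot v (B θ v)).re := by
    intro θ v
    have h1 := hB θ v
    have h2 : B θ v = fderiv ℝ Φ (p0, zt θ, T1 n a0 θ, T1 n a0 θ) (0, 0, v, 0) := by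
      rw [hBv, hA0, dN, nem_apply, UC_apply]
      rfl
    rw [h2]; exact h1
  refine ift_abs hΦ a0 p0 hbase hk (fun b => ?_) (fun b => ?_)
  · have h1 := coer_int hw hB' (JJ _ (T1 n b)) (fun i j hj => by
      have : fcL i j (JJ _ (T1 n b)) = fcC i j (T1 n b) := fcL_toLp _ _ _
      rw [this, fc_T1_zero b i j hj])
    have e : LC n (0, b) = (i3 n).compLeftContinuous ℝ TT (T1 n b) := by simp [LC]
    have h3 : mulL B (JJ _ (T1 n b)) = JJ _ (mulC A0 (LC n (0, b))) := by
      rw [e]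
      have := mulL_toLp B (T1 n b)
      exact this
    rw [h3] at h1
    exact h1
  · have h1 := coer_int hw hB' (T2 n b) (fun i j hj => fc_T2_zero b i j hj)
    rw [← mulL_comp A0 (i3 n) B hBv] at h1
    exact h1

theorem pv_hasDerivAt {n : ℕ} {g : ℂ × (Fin n → ℂ) → ℝ} {z : ℂ} {x : Fin n → ℂ} (hg : ContDiffAt ℝ 2 g (z, x)) (v : Fin n → ℂ) :
    HasDerivAt (fun s : ℝ => pv g z (x + s • v)) (hv g z x v) 0 := by
  have h1 : ContDiffAt ℝ 1 (fderiv ℝ g) (z, x) := hg.fderiv_right (by norm_num)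
  have h2 : HasFDerivAt (fderiv ℝ g) (fderiv ℝ (fderiv ℝ g) (z, x)) (z, x + (0:ℝ) • v) := by
    simpa using (h1.differentiableAt one_ne_zero).hasFDerivAt
  have hp : HasDerivAt (fun s : ℝ => ((z, x + s • v) : ℂ × (Fin n → ℂ))) (0, v) 0 := by
    refine HasDerivAt.prodMk (hasDerivAt_const _ _) ?_
    have := ((hasDerivAt_id (0:ℝ)).smul_const v).const_add x
    simpa using this
  have h3 := h2.comp_hasDerivAt (0:ℝ) hp
  have h4 : ∀ u : Fin n → ℂ, HasDerivAt (fun s : ℝ => ((dg g z (x + s • v) u : ℝ) : ℂ)) ((d2 g z x v u : ℝ) : ℂ) 0 := by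
    intro u
    have := h3.clm_apply (hasDerivAt_const (0:ℝ) ((0, u) : ℂ × (Fin n → ℂ)))
    have h5 := this.ofReal_comp
    refine h5.congr_deriv ?_
    simp [d2]
  rw [hasDerivAt_pi]
  intro j
  exact (h4 _).sub ((h4 _).const_mul Complex.I)

theorem dg_hasDerivAt {n : ℕ} {g : ℂ × (Fin n → ℂ) → ℝ} {z : ℂ} {x : Fin n → ℂ} (hg : DifferentiableAt ℝ g (z, x)) (v : Fin n → ℂ) :
    HasDerivAt (fun s : ℝ => g (z, x + s • v)) (dg g z x v) 0 := by
  have h2 : HasFDerivAt g (fderiv ℝ g (z, x)) (z, x + (0:ℝ) • v) := by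
    simpa using hg.hasFDerivAt
  have hp : HasDerivAt (fun s : ℝ => ((z, x + s • v) : ℂ × (Fin n → ℂ))) (0, v) 0 := by
    refine HasDerivAt.prodMk (hasDerivAt_const _ _) ?_
    have := ((hasDerivAt_id (0:ℝ)).smul_const v).const_add x
    simpa using this
  exact h2.comp_hasDerivAt (0:ℝ) hp

theorem dot_hasDerivAt {n : ℕ} {p : ℝ → Fin n → ℂ} {p' : Fin n → ℂ} {s : ℝ} (hp : HasDerivAt p p' s) (φ : Fin n → ℂ) :
    HasDerivAt (fun s => dot (p s) φ) (dot p' φ) s := by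
  unfold dot
  exact HasDerivAt.fun_sum fun i _ => (hasDerivAt_pi.1 hp i).mul_const _

theorem line_der {n : ℕ} {g : ℂ × (Fin n → ℂ) → ℝ} {z : ℂ} {x : Fin n → ℂ} (hg : ContDiffAt ℝ 2 g (z, x)) (v φ W : Fin n → ℂ) (N : ℂ) (a t : ℝ)
    (hc : dot (pv g z x) φ ≠ 0) :
    HasDerivAt (fun s : ℝ => (N / dot (pv g z (x + s • v)) φ) • pv g z (x + s • v) + ((a * (g (z, x + s • v) - t) : ℝ) : ℂ) • W)
      ((N / dot (pv g z x) φ) • (hv g z x v - (dot (hv g z x v) φ / dot (pv g z x) φ) • pv g z x) + ((a * dg g z x v : ℝ) : ℂ) • W) 0 := by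
  have h1 := pv_hasDerivAt hg v
  have h2 := dot_hasDerivAt h1 φ
  have h3 := dg_hasDerivAt (hg.differentiableAt two_ne_zero) v
  have h4 := (((h3.sub_const t).const_mul a).ofReal_comp).smul_const W
  have h5 := ((hasDerivAt_const (0:ℝ) N).fun_div h2 (by simpa using hc)).fun_smul h1
  refine (h5.add h4).congr_deriv ?_
  simp only [zero_smul, add_zero]
  ext i
  simp only [Pi.add_apply, Pi.smul_apply, Pi.sub_apply, smul_eq_mul]
  field_simp
  ring

/-- complex gradient with parameter -/
def PH {n : ℕ} (G : ℝ × (ℂ × (Fin n → ℂ)) → ℝ) (q : ℝ × (ℂ × (Fin n → ℂ))) : Fin n → ℂ := fun j =>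
  ((fderiv ℝ G q (0, 0, Pi.single j 1) : ℝ) : ℂ) - Complex.I * ((fderiv ℝ G q (0, 0, Pi.single j Complex.I) : ℝ) : ℂ)

theorem PH_eq {n : ℕ} {G : ℝ × (ℂ × (Fin n → ℂ)) → ℝ} {τ : ℝ} {z : ℂ} {x : Fin n → ℂ} (hG : DifferentiableAt ℝ G (τ, z, x)) :
    PH G (τ, z, x) = pv (fun p => G (τ, p)) z x := by
  have h : HasFDerivAt (fun p : ℂ × (Fin n → ℂ) => G (τ, p)) ((fderiv ℝ G (τ, z, x)) ∘L (ContinuousLinearMap.inr ℝ ℝ (ℂ × (Fin n → ℂ)))) (z, x) :=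
    hG.hasFDerivAt.comp (z, x) (hasFDerivAt_prodMk_right τ (z, x))
  ext j
  simp [PH, pv, dg, h.fderiv]

theorem PH_cd {n : ℕ} {G : ℝ × (ℂ × (Fin n → ℂ)) → ℝ} {q} (hG : ContDiffAt ℝ 6 G q) : ContDiffAt ℝ 2 (PH G) q := by
  have h : ContDiffAt ℝ 2 (fderiv ℝ G) q := hG.fderiv_right (by norm_num)
  unfold PH
  rw [contDiffAt_pi]
  intro j
  have h1 : ∀ u, ContDiffAt ℝ 2 (fun q => ((fderiv ℝ G q u : ℝ) : ℂ)) q := fun u =>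
    Complex.ofRealCLM.contDiff.contDiffAt.comp q (h.clm_apply contDiffAt_const)
  exact (h1 _).sub (contDiffAt_const.mul (h1 _))

theorem dot_cd {E : Type*} [NormedAddCommGroup E] [NormedSpace ℝ E] {n : ℕ} {k : WithTop ℕ∞} {u v : E → Fin n → ℂ} {q : E} (hu : ContDiffAt ℝ k u q) (hv : ContDiffAt ℝ k v q) :
    ContDiffAt ℝ k (fun q => dot (u q) (v q)) q := by
  unfold dot
  exact ContDiffAt.sum fun i _ => (contDiffAt_pi.1 hu i).mul (contDiffAt_pi.1 hv i)

/-- the multiplier -/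
def lamM {n : ℕ} (G : ℝ × (ℂ × (Fin n → ℂ)) → ℝ) (Q0 : ℂ → Fin n → ℂ) (τ0 : ℝ) (f : ℂ → ℂ) (z : ℂ) (x0 : Fin n → ℂ) : ℂ :=
  Complex.exp (f z) / dot (PH G (τ0, z, x0)) (x0 - Q0 z)

/-- the nonlinear map -/
def PhiM {n : ℕ} (G : ℝ × (ℂ × (Fin n → ℂ)) → ℝ) (Q0 : ℂ → Fin n → ℂ) (τ0 : ℝ) (f : ℂ → ℂ) (κ : ℝ) (q : PE n) : Fin n → ℂ :=
  (Complex.exp (f q.2.1) / dot (PH G (q.1.1, q.2.1, q.2.2.1)) (q.2.2.2 - Q0 q.2.1)) • PH G (q.1.1, q.2.1, q.2.2.1) +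
    ((κ * (lamM G Q0 τ0 f q.2.1 q.2.2.2).re * (G (q.1.1, q.2.1, q.2.2.1) - q.1.2) : ℝ) : ℂ) • (lamM G Q0 τ0 f q.2.1 q.2.2.2 • PH G (τ0, q.2.1, q.2.2.2))

theorem exp_cd {f : ℂ → ℂ} (hf : Differentiable ℂ f) : ContDiff ℝ 2 fun z => Complex.exp (f z) := by
  have : ContDiff ℂ 2 fun z => Complex.exp (f z) := hf.cexp.contDiff
  exact this.restrict_scalars ℝ

theorem lamM_cd {n : ℕ} {G : ℝ × (ℂ × (Fin n → ℂ)) → ℝ} {Q0 : ℂ → Fin n → ℂ} {τ0 : ℝ} {f : ℂ → ℂ} (hf : Differentiable ℂ f) {z : ℂ} {x0 : Fin n → ℂ}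
    (hG : ContDiffAt ℝ 6 G (τ0, z, x0)) (hQ : ContDiffAt ℝ 2 Q0 z) (hd : dot (PH G (τ0, z, x0)) (x0 - Q0 z) ≠ 0) :
    ContDiffAt ℝ 2 (fun p : ℂ × (Fin n → ℂ) => lamM G Q0 τ0 f p.1 p.2) (z, x0) := by
  unfold lamM
  have h1 : ContDiffAt ℝ 2 (fun p : ℂ × (Fin n → ℂ) => PH G (τ0, p.1, p.2)) (z, x0) :=
    (PH_cd hG).comp (z, x0) (contDiffAt_const.prodMk contDiffAt_id)
  have h2 : ContDiffAt ℝ 2 (fun p : ℂ × (Fin n → ℂ) => p.2 - Q0 p.1) (z, x0) :=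
    contDiffAt_snd.sub (ContDiffAt.comp (g := Q0) (f := Prod.fst) (z, x0) hQ contDiffAt_fst)
  have h3 : ContDiffAt ℝ 2 (fun p : ℂ × (Fin n → ℂ) => Complex.exp (f p.1)) (z, x0) :=
    ContDiffAt.comp (g := fun z => Complex.exp (f z)) (f := Prod.fst) (z, x0) (exp_cd hf).contDiffAt contDiffAt_fst
  have h4 := (dot_cd h1 h2).inv hd
  exact (h3.mul h4).congr_of_eventuallyEq (Eventually.of_forall fun p => div_eq_mul_inv _ _)

theorem PhiM_cd {n : ℕ} {G : ℝ × (ℂ × (Fin n → ℂ)) → ℝ} {Q0 : ℂ → Fin n → ℂ} {τ0 : ℝ} {f : ℂ → ℂ} (hf : Differentiable ℂ f) {κ t : ℝ} {z : ℂ} {x0 : Fin n → ℂ}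
    (hG : ContDiffAt ℝ 6 G (τ0, z, x0)) (hQ : ContDiffAt ℝ 2 Q0 z) (hd : dot (PH G (τ0, z, x0)) (x0 - Q0 z) ≠ 0) :
    ContDiffAt ℝ 2 (PhiM G Q0 τ0 f κ) ((τ0, t), z, x0, x0) := by
  unfold PhiM
  have hz : ContDiffAt ℝ 2 (fun q : PE n => q.2.1) ((τ0, t), z, x0, x0) := (contDiff_snd.fst).contDiffAt
  have hx0 : ContDiffAt ℝ 2 (fun q : PE n => q.2.2.2) ((τ0, t), z, x0, x0) := (contDiff_snd.snd.snd).contDiffAt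
  have hx : ContDiffAt ℝ 6 (fun q : PE n => (q.1.1, q.2.1, q.2.2.1)) ((τ0, t), z, x0, x0) :=
    (contDiff_fst.fst.prodMk (contDiff_snd.fst.prodMk contDiff_snd.snd.fst)).contDiffAt
  have h0 : ContDiffAt ℝ 2 (fun q : PE n => (τ0, q.2.1, q.2.2.2)) ((τ0, t), z, x0, x0) :=
    contDiffAt_const.prodMk (hz.prodMk hx0)
  have h1 : ContDiffAt ℝ 2 (fun q : PE n => PH G (q.1.1, q.2.1, q.2.2.1)) ((τ0, t), z, x0, x0) :=
    ContDiffAt.comp (g := PH G) (f := fun q : PE n => (q.1.1, q.2.1, q.2.2.1)) ((τ0, t), z, x0, x0) (PH_cd hG) (hx.of_le (by norm_num))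
  have h1' : ContDiffAt ℝ 2 (fun q : PE n => PH G (τ0, q.2.1, q.2.2.2)) ((τ0, t), z, x0, x0) :=
    ContDiffAt.comp (g := PH G) (f := fun q : PE n => (τ0, q.2.1, q.2.2.2)) ((τ0, t), z, x0, x0) (PH_cd hG) h0
  have h2 : ContDiffAt ℝ 2 (fun q : PE n => G (q.1.1, q.2.1, q.2.2.1)) ((τ0, t), z, x0, x0) :=
    ContDiffAt.comp (g := G) (f := fun q : PE n => (q.1.1, q.2.1, q.2.2.1)) ((τ0, t), z, x0, x0) (hG.of_le (by norm_num)) (hx.of_le (by norm_num))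
  have h3 : ContDiffAt ℝ 2 (fun q : PE n => q.2.2.2 - Q0 q.2.1) ((τ0, t), z, x0, x0) :=
    hx0.sub (ContDiffAt.comp (g := Q0) (f := fun q : PE n => q.2.1) ((τ0, t), z, x0, x0) hQ hz)
  have h4 : ContDiffAt ℝ 2 (fun q : PE n => Complex.exp (f q.2.1)) ((τ0, t), z, x0, x0) :=
    ContDiffAt.comp (g := fun z => Complex.exp (f z)) (f := fun q : PE n => q.2.1) ((τ0, t), z, x0, x0) (exp_cd hf).contDiffAt hz
  have h5 : ContDiffAt ℝ 2 (fun q : PE n => lamM G Q0 τ0 f q.2.1 q.2.2.2) ((τ0, t), z, x0, x0) :=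
    ContDiffAt.comp (g := fun p : ℂ × (Fin n → ℂ) => lamM G Q0 τ0 f p.1 p.2) (f := fun q : PE n => (q.2.1, q.2.2.2)) ((τ0, t), z, x0, x0) (lamM_cd hf hG hQ hd) (hz.prodMk hx0)
  have ht : ContDiffAt ℝ 2 (fun q : PE n => q.1.2) ((τ0, t), z, x0, x0) := (contDiff_fst.snd).contDiffAt
  have h6 : ContDiffAt ℝ 2 (fun q : PE n => (lamM G Q0 τ0 f q.2.1 q.2.2.2).re) ((τ0, t), z, x0, x0) :=
    Complex.reCLM.contDiff.contDiffAt.comp _ h5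
  have h7 : ContDiffAt ℝ 2 (fun q : PE n => ((κ * (lamM G Q0 τ0 f q.2.1 q.2.2.2).re * (G (q.1.1, q.2.1, q.2.2.1) - q.1.2) : ℝ) : ℂ)) ((τ0, t), z, x0, x0) :=
    Complex.ofRealCLM.contDiff.contDiffAt.comp _ ((contDiffAt_const.mul h6).mul (h2.sub ht))
  have h8 : ContDiffAt ℝ 2 (fun q : PE n => Complex.exp (f q.2.1) / dot (PH G (q.1.1, q.2.1, q.2.2.1)) (q.2.2.2 - Q0 q.2.1)) ((τ0, t), z, x0, x0) :=
    (h4.mul ((dot_cd h1 h3).inv hd)).congr_of_eventuallyEq (Eventually.of_forall fun p => div_eq_mul_inv _ _)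
  exact (h8.smul h1).add (h7.smul (h5.smul h1'))

theorem ev_unif {n : ℕ} {Y : Type*} [TopologicalSpace Y] {A : Y → VV n} {p0 : Y} (hA : ContinuousAt A p0) {w : TT → Fin n → ℂ} (hw : Continuous w)
    {Pr : Y × ℂ × (Fin n → ℂ) × (Fin n → ℂ) → Prop}
    (h : ∀ θ, ∀ᶠ q in nhds (p0, zt θ, T1 n (A p0) θ, w θ), Pr q) : ∀ᶠ p in nhds p0, ∀ θ, Pr (p, zt θ, T1 n (A p) θ, w θ) := by
  have := (isCompact_univ (X := TT)).eventually_forall_of_forall_eventually (x₀ := p0) (P := fun p θ => Pr (p, zt θ, T1 n (A p) θ, w θ)) (fun θ _ => ?_)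
  · filter_upwards [this] with p hp θ using hp θ (mem_univ _)
  · have hc : ContinuousAt (fun z : Y × TT => T1 n (A z.1) z.2) (p0, θ) := by
      have h1 : ContinuousAt (fun z : Y × TT => (T1 n (A z.1), z.2)) (p0, θ) :=
        (ContinuousAt.comp (g := fun y => T1 n (A y)) (f := Prod.fst) (x := (p0, θ)) (ContinuousAt.comp (g := T1 n) (f := A) (x := p0) (T1 n).continuous.continuousAt hA) continuousAt_fst).prodMk continuousAt_snd
      exact ContinuousAt.comp (g := fun z : C(TT, Fin n → ℂ) × TT => z.1 z.2) (f := fun z : Y × TT => (T1 n (A z.1), z.2)) (x := (p0, θ)) (ContinuousEval.continuous_eval.continuousAt) h1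
    have h2 : ContinuousAt (fun z : Y × TT => (z.1, zt z.2, T1 n (A z.1) z.2, w z.2)) (p0, θ) :=
      continuousAt_fst.prodMk ((zt_cont.continuousAt.comp continuousAt_snd).prodMk (hc.prodMk (hw.continuousAt.comp continuousAt_snd)))
    exact h2.tendsto.eventually (h θ)

theorem PhiM_fd {n : ℕ} {G : ℝ × (ℂ × (Fin n → ℂ)) → ℝ} {Q0 : ℂ → Fin n → ℂ} {τ0 : ℝ} {f : ℂ → ℂ} (hf : Differentiable ℂ f) {κ t : ℝ} {z : ℂ} {x0 : Fin n → ℂ}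
    (hG : ContDiffAt ℝ 6 G (τ0, z, x0)) (hQ : ContDiffAt ℝ 2 Q0 z) {g : ℂ × (Fin n → ℂ) → ℝ} (hg : g = fun p => G (τ0, p)) {l : ℂ} (hl : l = Complex.exp (f z) / cf g Q0 z x0)
    (hd : cf g Q0 z x0 ≠ 0) (v : Fin n → ℂ) :
    dot v (fderiv ℝ (PhiM G Q0 τ0 f κ) ((τ0, t), z, x0, x0) (0, 0, v, 0)) =
      l * dot (hv g z x0 v) (prj g Q0 z x0 v) + (κ * l.re * (dot (pv g z x0) v).re : ℝ) * (l * dot (pv g z x0) v) := by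
  have hP : PH G (τ0, z, x0) = pv g z x0 := by rw [hg]; exact PH_eq (hG.differentiableAt (by norm_num))
  have hll : lamM G Q0 τ0 f z x0 = l := by rw [lamM, hP, hl, cf]
  have h1 : HasFDerivAt (PhiM G Q0 τ0 f κ) (fderiv ℝ (PhiM G Q0 τ0 f κ) ((τ0, t), z, x0, x0)) ((τ0, t), z, x0 + (0:ℝ) • v, x0) := by
    simpa using ((PhiM_cd hf hG hQ (by rw [hP]; exact hd)).differentiableAt two_ne_zero).hasFDerivAt
  have hp : HasDerivAt (fun s : ℝ => (((τ0, t), z, x0 + s • v, x0) : PE n)) (0, 0, v, 0) 0 := by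
    refine HasDerivAt.prodMk (hasDerivAt_const _ _) (HasDerivAt.prodMk (hasDerivAt_const _ _) (HasDerivAt.prodMk ?_ (hasDerivAt_const _ _)))
    have := ((hasDerivAt_id (0:ℝ)).smul_const v).const_add x0
    simpa using this
  have h2 := h1.comp_hasDerivAt (0:ℝ) hp
  have hgc : ContDiffAt ℝ 2 g (z, x0) := by
    rw [hg]
    exact ContDiffAt.comp (g := G) (f := fun p => (τ0, p)) (z, x0) (hG.of_le (by norm_num)) (contDiffAt_const.prodMk contDiffAt_id)
  have h3 := line_der hgc v (x0 - Q0 z) (l • pv g z x0) (Complex.exp (f z)) (κ * l.re) t hd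
  have hev : (PhiM G Q0 τ0 f κ ∘ fun s : ℝ => (((τ0, t), z, x0 + s • v, x0) : PE n)) =ᶠ[nhds 0]
      fun s : ℝ => (Complex.exp (f z) / dot (pv g z (x0 + s • v)) (x0 - Q0 z)) • pv g z (x0 + s • v) + ((κ * l.re * (g (z, x0 + s • v) - t) : ℝ) : ℂ) • (l • pv g z x0) := by
    have he : ∀ᶠ q in nhds (τ0, z, x0), ContDiffAt ℝ 6 G q := hG.eventually (by simp)
    have hc : ContinuousAt (fun s : ℝ => (τ0, z, x0 + s • v)) 0 := by fun_prop
    have he' : ∀ᶠ s : ℝ in nhds 0, ContDiffAt ℝ 6 G (τ0, z, x0 + s • v) := hc.tendsto.eventually (by simpa using he)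
    filter_upwards [he'] with s hs
    have hPs : PH G (τ0, z, x0 + s • v) = pv g z (x0 + s • v) := by rw [hg]; exact PH_eq (hs.differentiableAt (by norm_num))
    simp only [Function.comp, PhiM, hll, hPs, hP]
    rw [hg]
  have h4 := (h2.congr_of_eventuallyEq hev.symm).unique h3
  have e1 : dot (pv g z x0) (x0 - Q0 z) = cf g Q0 z x0 := rfl
  rw [e1, ← hl] at h4
  rw [h4, prj]
  generalize hφ : x0 - Q0 z = φ
  simp only [dot_add, dot_smul, dot_sub, dot_psi]
  rw [re_dot_pv, dot_comm' v, dot_comm' v (pv g z x0), div_eq_mul_inv]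
  ring

theorem ift_step1 {n : ℕ} {G : ℝ × (ℂ × (Fin n → ℂ)) → ℝ} {Q0 : ℂ → Fin n → ℂ} {R τ0 γ0 : ℝ} {x0 : TT → Fin n → ℂ}
    (h : Extr (fun p => G (τ0, p)) Q0 R x0 γ0) (hG : ∀ θ, ContDiffAt ℝ 6 G (τ0, zt θ, x0 θ)) (hQ : ∀ θ, ContDiffAt ℝ 2 Q0 (zt θ))
    (a0 : VV n) (ha0 : ∀ θ, T1 n a0 θ = x0 θ) :
    ∃ f : ℂ → ℂ, Differentiable ℂ f ∧ ∃ κ > 0, (∀ θ, 0 < (lamM G Q0 τ0 f (zt θ) (x0 θ)).re) ∧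
      ∃ A : ℝ × ℝ → VV n, ContDiffAt ℝ 1 A (τ0, γ0) ∧ A (τ0, γ0) = a0 ∧
        ∀ᶠ p in nhds (τ0, γ0), ∀ i, InH fun θ => PhiM G Q0 τ0 f κ (p, zt θ, T1 n (A p) θ, x0 θ) i := by
  set g : ℂ × (Fin n → ℂ) → ℝ := fun p => G (τ0, p) with hg
  have hP : ∀ θ, PH G (τ0, zt θ, x0 θ) = pv g (zt θ) (x0 θ) := fun θ => PH_eq ((hG θ).differentiableAt (by norm_num))
  obtain ⟨ε, hε, hε1, k, hk, C, hC, hco⟩ := h.coer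
  obtain ⟨f, hf, hN⟩ := h.exN hε
  have hl : ∀ θ, lamM G Q0 τ0 f (zt θ) (x0 θ) = Complex.exp (f (zt θ)) / cf g Q0 (zt θ) (x0 θ) := fun θ => by rw [lamM, hP, cf]
  have hfc : Continuous fun θ => Complex.exp (f (zt θ)) := (hf.continuous.comp zt_cont).cexp
  have hlc : Continuous fun θ => (Complex.exp (f (zt θ)) / cf g Q0 (zt θ) (x0 θ)).re :=
    Complex.continuous_re.comp (hfc.div h.cc h.c_ne)
  obtain ⟨m0, hm0, hm⟩ := posTT hlc fun θ => (hN θ).1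
  have hκ : 0 < 8 * C / m0 := by positivity
  have hcd : ∀ θ, ContDiffAt ℝ 2 (PhiM G Q0 τ0 f (8 * C / m0)) ((τ0, γ0), zt θ, x0 θ, x0 θ) := fun θ =>
    PhiM_cd hf (hG θ) (hQ θ) (by rw [hP]; exact h.c_ne θ)
  have hbc : Continuous fun θ => (((τ0, γ0), zt θ, x0 θ, x0 θ) : PE n) := continuous_const.prodMk (zt_cont.prodMk (h.xc.prodMk h.xc))
  have hOo : IsOpen {q : PE n | ContDiffAt ℝ 2 (PhiM G Q0 τ0 f (8 * C / m0)) q} := by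
    rw [isOpen_iff_mem_nhds]
    intro q hq
    exact ContDiffAt.eventually hq (by simp)
  obtain ⟨Ψ, hΨ, U, hU, hKU, hUO, hΨe⟩ := cutoff hOo (isCompact_range hbc) (by rintro _ ⟨θ, rfl⟩; exact hcd θ) (Φ := PhiM G Q0 τ0 f (8 * C / m0))
    (fun q hq => ContDiffAt.contDiffWithinAt hq)
  have hbU : ∀ θ, (((τ0, γ0), zt θ, x0 θ, x0 θ) : PE n) ∈ U := fun θ => hKU ⟨θ, rfl⟩
  have hNH : InH fun θ => Complex.exp (f (zt θ)) := (MemA.of_entire hf.cexp).inH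
  have hw : ∀ i, InH fun θ => (Complex.exp (f (zt θ)) • psi g Q0 (zt θ) (x0 θ)) i := fun i => hNH.mul (h.psiH i)
  have hbase : ∀ i, InH fun θ => Ψ ((τ0, γ0), zt θ, T1 n a0 θ, T1 n a0 θ) i := by
    intro i
    have e : (fun θ => Ψ ((τ0, γ0), zt θ, T1 n a0 θ, T1 n a0 θ) i) = fun θ => (Complex.exp (f (zt θ)) • psi g Q0 (zt θ) (x0 θ)) i := by
      ext θ
      rw [ha0, hΨe _ (hbU θ), psi_eq]
      have hlev : G (τ0, zt θ, x0 θ) = γ0 := h.lev θ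
      simp only [PhiM, hP, hlev, sub_self, mul_zero, Complex.ofReal_zero, zero_smul, add_zero, cf, smul_smul, zero_mul, div_eq_mul_inv]
    rw [e]; exact hw i
  obtain ⟨A, hA, hA0, hAe⟩ := ift_abs' hΨ a0 (τ0, γ0) hbase (k := k * m0) (κ := 8 * C / m0 * (1 / 2)) (by positivity) hw (fun θ v => by
    have e1 : fderiv ℝ Ψ ((τ0, γ0), zt θ, T1 n a0 θ, T1 n a0 θ) = fderiv ℝ (PhiM G Q0 τ0 f (8 * C / m0)) ((τ0, γ0), zt θ, x0 θ, x0 θ) := by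
      rw [ha0]
      refine Filter.EventuallyEq.fderiv_eq ?_
      filter_upwards [hU.mem_nhds (hbU θ)] with q hq using hΨe q hq
    rw [e1, PhiM_fd hf (hG θ) (hQ θ) hg rfl (h.c_ne θ)]
    obtain ⟨h1, h2⟩ := hN θ
    have h3 := hco θ v _ (8 * C / m0) h1 h2 (by
      have := mul_le_mul_of_nonneg_left (hm θ) hκ.le
      rwa [div_mul_cancel₀ _ hm0.ne'] at this)
    have e2 : dot (Complex.exp (f (zt θ)) • psi g Q0 (zt θ) (x0 θ)) v = Complex.exp (f (zt θ)) / cf g Q0 (zt θ) (x0 θ) * dot (pv g (zt θ) (x0 θ)) v := by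
      rw [smul_dot, dot_psi]; ring
    rw [e2]
    have h4 : k * m0 * ‖v‖ ^ 2 ≤ k * (Complex.exp (f (zt θ)) / cf g Q0 (zt θ) (x0 θ)).re * ‖v‖ ^ 2 := by
      have := hm θ
      gcongr
    rw [Complex.add_re, Complex.re_ofReal_mul]
    nlinarith [h3, h4])
  refine ⟨f, hf, 8 * C / m0, hκ, fun θ => by rw [hl]; exact (hN θ).1, A, hA, hA0, ?_⟩
  have hev := ev_unif hA.continuousAt h.xc (Pr := fun q => q ∈ U) (fun θ => by
    rw [hA0, ha0]; exact hU.mem_nhds (hbU θ))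
  filter_upwards [hAe, hev] with p hp hpU i
  have e : (fun θ => PhiM G Q0 τ0 f (8 * C / m0) (p, zt θ, T1 n (A p) θ, x0 θ) i) = fun θ => Ψ (p, zt θ, T1 n (A p) θ, T1 n a0 θ) i := by
    ext θ
    rw [ha0, hΨe _ (hpU θ)]
  rw [e]; exact hp i

theorem T1_InH {n : ℕ} (b : VV n) (i : Fin n) : InH fun θ => T1 n b θ i := by
  refine ⟨(continuous_apply i).comp (T1 n b).continuous, fun j hj => ?_⟩
  rw [← fcC_apply]
  exact fc_T1_zero b i j hj.le

theorem T1_mean {n : ℕ} (b : VV n) (i : Fin n) : mean (fun θ => T1 n b θ i) = 0 := by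
  rw [← fc_zero_eq, ← fcC_apply]
  exact fc_T1_zero b i 0 le_rfl

theorem mean_dot_zero {n : ℕ} {u v : TT → Fin n → ℂ} (hu : ∀ i, InH fun θ => u θ i) (hv : ∀ i, InH fun θ => v θ i) (h0 : ∀ i, mean (fun θ => v θ i) = 0) :
    mean (fun θ => dot (u θ) (v θ)) = 0 := by
  unfold dot
  rw [mean, integral_finsetSum _ fun i _ => intg ((hu i).mul (hv i)).1]
  refine Finset.sum_eq_zero fun i _ => ?_
  have := InH.mean_mul (hu i) (hv i)
  rw [h0 i, mul_zero] at this
  exact this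

theorem log_mean_ne {q L : TT → ℂ} (hq : InH q) (hL : Continuous L) (h : ∀ θ, Complex.exp (L θ) = q θ) : mean q ≠ 0 := by
  have h1 : InH fun θ => Complex.exp (-1 * L θ) := ((hq.log_of hL h).smul (-1)).exp
  have h2 := InH.mean_mul hq h1
  have h3 : (fun θ => q θ * Complex.exp (-1 * L θ)) = fun _ => 1 := by
    ext θ; rw [← h, ← Complex.exp_add]; simp
  rw [h3, mean_const] at h2
  intro h4
  rw [h4, zero_mul] at h2
  exact one_ne_zero h2

theorem Extr.nondeg {n : ℕ} {g : ℂ × (Fin n → ℂ) → ℝ} {Q : ℂ → Fin n → ℂ} {R γ : ℝ} {x : TT → Fin n → ℂ} (h : Extr g Q R x γ) {f : ℂ → ℂ} (hf : Differentiable ℂ f)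
    (hl : ∀ θ, 0 < (Complex.exp (f (zt θ)) / cf g Q (zt θ) (x θ)).re) {k : TT → Fin n → ℂ} (hk : ∀ i, InH fun θ => k θ i) (hk0 : ∀ i, mean (fun θ => k θ i) = 0)
    (h1 : ∀ θ, dg g (zt θ) (x θ) (k θ) = 1) : False := by
  have hNH : InH fun θ => Complex.exp (f (zt θ)) := (MemA.of_entire hf.cexp).inH
  have hw : ∀ i, InH fun θ => (Complex.exp (f (zt θ)) • psi g Q (zt θ) (x θ)) i := fun i => hNH.mul (h.psiH i)
  have hkc : Continuous k := continuous_pi fun i => (hk i).1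
  have hfc : Continuous fun θ => Complex.exp (f (zt θ)) := hNH.1
  have hre : ∀ θ, 0 < (dot (pv g (zt θ) (x θ)) (k θ)).re := fun θ => by rw [re_dot_pv, h1]; exact one_pos
  refine log_mean_ne (InH.dot hw hk) (L := fun θ => Complex.log (Complex.exp (f (zt θ)) / cf g Q (zt θ) (x θ)) + Complex.log (dot (pv g (zt θ) (x θ)) (k θ))) ?_ ?_ (mean_dot_zero hw hk hk0)
  · exact ((hfc.div h.cc h.c_ne).clog fun θ => Or.inl (hl θ)).add ((h.pvc.dot hkc).clog fun θ => Or.inl (hre θ))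
  · intro θ
    have a1 : Complex.exp (f (zt θ)) / cf g Q (zt θ) (x θ) ≠ 0 := fun h0 => by have := hl θ; rw [h0] at this; simp at this
    have a2 : dot (pv g (zt θ) (x θ)) (k θ) ≠ 0 := fun h0 => by have := hre θ; rw [h0] at this; simp at this
    rw [Complex.exp_add, Complex.exp_log a1, Complex.exp_log a2, smul_dot, dot_psi]; ring

theorem scalar_ift {c : ℝ × ℝ → ℝ} {p0 : ℝ × ℝ} (hc : ContDiffAt ℝ 1 c p0) (hd : fderiv ℝ c p0 (0, 1) ≠ 0) :
    ∃ t : ℝ → ℝ, ContDiffAt ℝ 1 t p0.1 ∧ t p0.1 = p0.2 ∧ ∀ᶠ τ in nhds p0.1, c (τ, t τ) = c p0 := by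
  have hinv : (fderiv ℝ c p0 ∘L ContinuousLinearMap.inr ℝ ℝ ℝ).IsInvertible := by
    refine ⟨ContinuousLinearEquiv.unitsEquivAut ℝ (Units.mk0 _ hd), ?_⟩
    ext
    simp
  exact ⟨hc.implicitFunction one_ne_zero hinv, hc.contDiffAt_implicitFunction one_ne_zero hinv, hc.implicitFunction_apply_self one_ne_zero hinv, hc.eventually_apply_implicitFunction one_ne_zero hinv⟩

/-- pointwise defect -/
def cM {n : ℕ} (G : ℝ × (ℂ × (Fin n → ℂ)) → ℝ) (A : ℝ × ℝ → VV n) (μ : TT → ℝ) (θ : TT) (p : ℝ × ℝ) : ℝ :=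
  μ θ * (G (p.1, zt θ, T1 n (A p) θ) - p.2)

theorem evT_cd {n : ℕ} {A : ℝ × ℝ → VV n} {p0 : ℝ × ℝ} (hA : ContDiffAt ℝ 1 A p0) (θ : TT) : ContDiffAt ℝ 1 (fun p => T1 n (A p) θ) p0 :=
  ((ContinuousMap.evalCLM ℝ θ ∘L T1 n : VV n →L[ℝ] (Fin n → ℂ)).contDiff.contDiffAt).comp p0 hA

theorem cM_cd {n : ℕ} {G : ℝ × (ℂ × (Fin n → ℂ)) → ℝ} {A : ℝ × ℝ → VV n} {p0 : ℝ × ℝ} (hA : ContDiffAt ℝ 1 A p0) (μ : TT → ℝ) (θ : TT)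
    (hG : ContDiffAt ℝ 1 G (p0.1, zt θ, T1 n (A p0) θ)) : ContDiffAt ℝ 1 (cM G A μ θ) p0 := by
  unfold cM
  refine contDiffAt_const.mul (ContDiffAt.sub ?_ contDiffAt_snd)
  exact ContDiffAt.comp (g := G) (f := fun p : ℝ × ℝ => (p.1, zt θ, T1 n (A p) θ)) p0 hG (contDiffAt_fst.prodMk (contDiffAt_const.prodMk (evT_cd hA θ)))

theorem cM_der {n : ℕ} {G : ℝ × (ℂ × (Fin n → ℂ)) → ℝ} {A : ℝ × ℝ → VV n} {p0 : ℝ × ℝ} (hA : ContDiffAt ℝ 1 A p0) (μ : TT → ℝ) (θ : TT)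
    (hG : ContDiffAt ℝ 1 G (p0.1, zt θ, T1 n (A p0) θ)) :
    fderiv ℝ (cM G A μ θ) p0 (0, 1) = μ θ * (dg (fun p => G (p0.1, p)) (zt θ) (T1 n (A p0) θ) (T1 n (fderiv ℝ A p0 (0, 1)) θ) - 1) := by
  have hA' := (hA.differentiableAt one_ne_zero).hasFDerivAt
  have hT : HasFDerivAt (fun p => T1 n (A p) θ) ((ContinuousMap.evalCLM ℝ θ ∘L T1 n : VV n →L[ℝ] (Fin n → ℂ)) ∘L fderiv ℝ A p0) p0 :=
    ((ContinuousMap.evalCLM ℝ θ ∘L T1 n : VV n →L[ℝ] (Fin n → ℂ)).hasFDerivAt).comp p0 hA'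
  have hG' := (hG.differentiableAt one_ne_zero).hasFDerivAt
  have h1 := hG'.comp (f := fun p : ℝ × ℝ => (p.1, zt θ, T1 n (A p) θ)) p0 (hasFDerivAt_fst.prodMk ((hasFDerivAt_const (zt θ) p0).prodMk hT))
  have h2 : HasFDerivAt (cM G A μ θ) _ p0 := (h1.sub hasFDerivAt_snd).const_mul (μ θ)
  have h3 : HasFDerivAt (fun p : ℂ × (Fin n → ℂ) => G (p0.1, p)) ((fderiv ℝ G (p0.1, zt θ, T1 n (A p0) θ)) ∘L (ContinuousLinearMap.inr ℝ ℝ (ℂ × (Fin n → ℂ)))) (zt θ, T1 n (A p0) θ) :=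
    hG'.comp (zt θ, T1 n (A p0) θ) (hasFDerivAt_prodMk_right p0.1 (zt θ, T1 n (A p0) θ))
  rw [h2.fderiv, dg, h3.fderiv]
  simp

theorem exists_coeff {n : ℕ} {x : TT → Fin n → ℂ} (hx : ∀ i, InH fun θ => x θ i) (hx0 : ∀ i, mean (fun θ => x θ i) = 0)
    (hs : ∀ i, Summable fun j : ℤ => (j : ℝ) ^ 2 * ‖fourierCoeff (fun θ => x θ i) j‖ ^ 2) : ∃ a : VV n, ∀ θ, T1 n a θ = x θ := by
  have hm : Memℓp (fun p : Fin n × ℕ => Complex.I * (p.2 + 1) * fourierCoeff (fun θ => x θ p.1) ((p.2 : ℤ) + 1)) 2 := by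
    refine memℓp_gen ?_
    rw [summable_prod_of_nonneg (fun p => by positivity)]
    refine ⟨fun i => ?_, Summable.of_finite⟩
    have h1 := (hs i).comp_injective (i := fun k : ℕ => (k : ℤ) + 1) (fun a b h => by simpa using h)
    refine h1.congr fun k => ?_
    have : ‖(k : ℂ) + 1‖ = (k : ℝ) + 1 := by
      have : ((k : ℂ) + 1) = ((k + 1 : ℕ) : ℂ) := by push_cast; ring
      rw [this, Complex.norm_natCast]; push_cast; ring
    simp [mul_pow, this]
  refine ⟨⟨_, hm⟩, fun θ => ?_⟩
  set a : VV n := ⟨_, hm⟩ with ha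
  ext i
  have hc : Continuous fun θ => T1 n a θ i - x θ i := (T1_InH a i).1.sub (hx i).1
  refine sub_eq_zero.1 (eq_zero_of_fc hc (fun j => ?_) θ)
  rw [fc_sub (T1_InH a i).1 (hx i).1, ← fcC_apply, sub_eq_zero]
  rcases lt_trichotomy j 0 with hj | hj | hj
  · rw [fc_T1_zero a i j hj.le, (hx i).2 j hj]
  · rw [hj, fc_T1_zero a i 0 le_rfl, fc_zero_eq, hx0 i]
  · obtain ⟨k, rfl⟩ : ∃ k : ℕ, j = (k : ℤ) + 1 := ⟨(j - 1).toNat, by omega⟩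
    rw [fc_T1]
    have hk : (k : ℂ) + 1 ≠ 0 := Nat.cast_add_one_ne_zero k
    show (Complex.I * (k + 1))⁻¹ * (Complex.I * (k + 1) * fourierCoeff (fun θ => x θ i) ((k : ℤ) + 1)) = _
    rw [← mul_assoc, inv_mul_cancel₀ (mul_ne_zero Complex.I_ne_zero hk), one_mul]

theorem phi_dot {n : ℕ} {G : ℝ × (ℂ × (Fin n → ℂ)) → ℝ} {Q0 : ℂ → Fin n → ℂ} {τ0 : ℝ} {f : ℂ → ℂ} {κ : ℝ} {p : ℝ × ℝ} {z : ℂ} {x x0 : Fin n → ℂ}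
    (h1 : dot (PH G (p.1, z, x)) (x0 - Q0 z) ≠ 0) (h2 : dot (PH G (τ0, z, x0)) (x0 - Q0 z) ≠ 0) :
    Complex.exp (-f z) * dot (PhiM G Q0 τ0 f κ (p, z, x, x0)) (x0 - Q0 z) = 1 + ((κ * ((lamM G Q0 τ0 f z x0).re * (G (p.1, z, x) - p.2)) : ℝ) : ℂ) := by
  have he : Complex.exp (-f z) * Complex.exp (f z) = 1 := by rw [← Complex.exp_add]; simp
  simp only [PhiM, add_dot, smul_dot]
  rw [div_mul_cancel₀ _ h1]
  have h3 : lamM G Q0 τ0 f z x0 * dot (PH G (τ0, z, x0)) (x0 - Q0 z) = Complex.exp (f z) := by rw [lamM, div_mul_cancel₀ _ h2]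
  rw [h3]
  push_cast
  linear_combination (1 + (κ * ((lamM G Q0 τ0 f z x0).re * (G (p.1, z, x) - p.2))) : ℂ) * he

theorem real_const' {v : TT → ℝ} {κ : ℝ} (hκ : 0 < κ) (h : InH fun θ => 1 + ((κ * v θ : ℝ) : ℂ)) (θ θ' : TT) : v θ = v θ' := by
  have h1 := h.real_const (fun θ => by simp)
  have h2 := (h1 θ).trans (h1 θ').symm
  have h3 : ((κ * v θ : ℝ) : ℂ) = ((κ * v θ' : ℝ) : ℂ) := add_left_cancel h2
  exact mul_left_cancel₀ hκ.ne' (Complex.ofReal_injective h3)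

theorem ift_main {n : ℕ} {G : ℝ × (ℂ × (Fin n → ℂ)) → ℝ} {Q0 : ℂ → Fin n → ℂ} {R τ0 γ0 : ℝ} {x0 : TT → Fin n → ℂ}
    (h : Extr (fun p => G (τ0, p)) Q0 R x0 γ0) (hG : ∀ θ, ContDiffAt ℝ 6 G (τ0, zt θ, x0 θ)) (hQ : ∀ θ, ContDiffAt ℝ 2 Q0 (zt θ)) :
    ∃ a : ℝ → VV n, ∃ t : ℝ → ℝ, ContDiffAt ℝ 1 a τ0 ∧ ContDiffAt ℝ 1 t τ0 ∧ t τ0 = γ0 ∧ (∀ θ, T1 n (a τ0) θ = x0 θ) ∧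
      ∀ᶠ τ in nhds τ0, (∀ θ, G (τ, zt θ, T1 n (a τ) θ) = t τ) ∧ (∀ θ, ContDiffAt ℝ 6 G (τ, zt θ, T1 n (a τ) θ)) ∧
        (∀ θ, dot (PH G (τ, zt θ, T1 n (a τ) θ)) (x0 θ - Q0 (zt θ)) ≠ 0) ∧
        ∀ i, InH fun θ => PH G (τ, zt θ, T1 n (a τ) θ) i / dot (PH G (τ, zt θ, T1 n (a τ) θ)) (x0 θ - Q0 (zt θ)) := by
  obtain ⟨a0, ha0⟩ := exists_coeff h.xH h.x0 h.reg
  obtain ⟨f, hf, κ, hκ, hl, A, hA, hA0, hAe⟩ := ift_step1 h hG hQ a0 ha0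
  have hP : ∀ θ, PH G (τ0, zt θ, x0 θ) = pv (fun p => G (τ0, p)) (zt θ) (x0 θ) := fun θ => PH_eq ((hG θ).differentiableAt (by norm_num))
  have hd0 : ∀ θ, dot (PH G (τ0, zt θ, x0 θ)) (x0 θ - Q0 (zt θ)) ≠ 0 := fun θ => by rw [hP]; exact h.c_ne θ
  set μ : TT → ℝ := fun θ => (lamM G Q0 τ0 f (zt θ) (x0 θ)).re with hμ
  have hNH : InH fun θ => Complex.exp (-f (zt θ)) := (MemA.of_entire hf.neg.cexp).inH
  have hφH : ∀ i, InH fun θ => (x0 θ - Q0 (zt θ)) i := fun i => (h.xH i).sub (h.QH i)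
  -- eventual nondegeneracy
  have hev1 : ∀ᶠ p in nhds (τ0, γ0), ∀ θ, ContDiffAt ℝ 6 G (p.1, zt θ, T1 n (A p) θ) ∧ dot (PH G (p.1, zt θ, T1 n (A p) θ)) (x0 θ - Q0 (zt θ)) ≠ 0 := by
    refine ev_unif hA.continuousAt (h.xc.sub h.Qc) (Pr := fun q => ContDiffAt ℝ 6 G (q.1.1, q.2.1, q.2.2.1) ∧ dot (PH G (q.1.1, q.2.1, q.2.2.1)) q.2.2.2 ≠ 0) fun θ => ?_
    rw [hA0, ha0]
    have hc : ContinuousAt (fun q : (ℝ × ℝ) × ℂ × (Fin n → ℂ) × (Fin n → ℂ) => (q.1.1, q.2.1, q.2.2.1)) ((τ0, γ0), zt θ, x0 θ, x0 θ - Q0 (zt θ)) := by fun_prop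
    have e1 : ∀ᶠ q in nhds (τ0, zt θ, x0 θ), ContDiffAt ℝ 6 G q := (hG θ).eventually (by simp)
    have e2 := hc.tendsto.eventually e1
    have c2 : ContinuousAt (fun q : (ℝ × ℝ) × ℂ × (Fin n → ℂ) × (Fin n → ℂ) => PH G (q.1.1, q.2.1, q.2.2.1)) ((τ0, γ0), zt θ, x0 θ, x0 θ - Q0 (zt θ)) :=
      ContinuousAt.comp (g := PH G) (f := fun q : (ℝ × ℝ) × ℂ × (Fin n → ℂ) × (Fin n → ℂ) => (q.1.1, q.2.1, q.2.2.1)) (x := ((τ0, γ0), zt θ, x0 θ, x0 θ - Q0 (zt θ))) (PH_cd (hG θ)).continuousAt hc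
    have c3 : ContinuousAt (fun q : (ℝ × ℝ) × ℂ × (Fin n → ℂ) × (Fin n → ℂ) => dot (PH G (q.1.1, q.2.1, q.2.2.1)) q.2.2.2) ((τ0, γ0), zt θ, x0 θ, x0 θ - Q0 (zt θ)) :=
      ContinuousAt.comp (g := fun p : (Fin n → ℂ) × (Fin n → ℂ) => dot p.1 p.2) (f := fun q : (ℝ × ℝ) × ℂ × (Fin n → ℂ) × (Fin n → ℂ) => (PH G (q.1.1, q.2.1, q.2.2.1), q.2.2.2)) (x := ((τ0, γ0), zt θ, x0 θ, x0 θ - Q0 (zt θ)))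
        continuous_dot.continuousAt (c2.prodMk (by fun_prop))
    exact e2.and (c3.eventually_ne (hd0 θ))
  -- the defect is constant
  have hev2 : ∀ᶠ p in nhds (τ0, γ0), ∀ θ θ', cM G A μ θ p = cM G A μ θ' p := by
    filter_upwards [hAe, hev1] with p hp hp1
    have h1 : InH fun θ => Complex.exp (-f (zt θ)) * dot (PhiM G Q0 τ0 f κ (p, zt θ, T1 n (A p) θ, x0 θ)) (x0 θ - Q0 (zt θ)) := hNH.mul (InH.dot hp hφH)
    have h2 : InH fun θ => 1 + ((κ * cM G A μ θ p : ℝ) : ℂ) := by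
      have e : (fun θ => 1 + ((κ * cM G A μ θ p : ℝ) : ℂ)) = fun θ => Complex.exp (-f (zt θ)) * dot (PhiM G Q0 τ0 f κ (p, zt θ, T1 n (A p) θ, x0 θ)) (x0 θ - Q0 (zt θ)) := by
        ext θ
        rw [phi_dot (hp1 θ).2 (hd0 θ)]; rfl
      rw [e]; exact h1
    exact real_const' hκ h2
  have hG1 : ∀ θ, ContDiffAt ℝ 1 G ((τ0, γ0).1, zt θ, T1 n (A (τ0, γ0)) θ) := fun θ => by
    rw [hA0, ha0]; exact (hG θ).of_le (by norm_num)
  have hcd := cM_cd hA μ 0 (hG1 0)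
  have hc0 : cM G A μ 0 (τ0, γ0) = 0 := by
    have : G (τ0, zt 0, x0 0) = γ0 := h.lev 0
    simp [cM, hA0, ha0, this]
  have hne : fderiv ℝ (cM G A μ 0) (τ0, γ0) (0, 1) ≠ 0 := by
    intro h0
    refine h.nondeg hf (fun θ => ?_) (k := fun θ => T1 n (fderiv ℝ A (τ0, γ0) (0, 1)) θ) (T1_InH _) (T1_mean _) (fun θ => ?_)
    · have := hl θ
      rwa [lamM, hP] at this
    · have h1 : fderiv ℝ (cM G A μ θ) (τ0, γ0) (0, 1) = 0 := by
        have e : fderiv ℝ (cM G A μ θ) (τ0, γ0) = fderiv ℝ (cM G A μ 0) (τ0, γ0) :=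
          Filter.EventuallyEq.fderiv_eq (by filter_upwards [hev2] with p hp using hp θ 0)
        rw [e]; exact h0
      rw [cM_der hA μ θ (hG1 θ), hA0, ha0] at h1
      rcases mul_eq_zero.1 h1 with h2 | h2
      · exact absurd h2 (hl θ).ne'
      · linarith
  obtain ⟨t, ht, ht0, hte⟩ := scalar_ift hcd hne
  simp only at ht ht0 hte
  have hpc : ContDiffAt ℝ 1 (fun τ => (τ, t τ)) τ0 := contDiffAt_id.prodMk ht
  have hpt : Tendsto (fun τ => (τ, t τ)) (nhds τ0) (nhds (τ0, γ0)) := by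
    have := hpc.continuousAt.tendsto
    rwa [ht0] at this
  refine ⟨fun τ => A (τ, t τ), t, ?_, ht, ht0, ?_, ?_⟩
  · refine ContDiffAt.comp (g := A) (f := fun τ => (τ, t τ)) τ0 ?_ hpc
    rw [ht0]; exact hA
  · intro θ
    show T1 n (A (τ0, t τ0)) θ = x0 θ
    rw [ht0, hA0, ha0]
  filter_upwards [hte, hpt.eventually hev1, hpt.eventually hev2, hpt.eventually hAe] with τ h1 h2 h3 h4
  have h5 : ∀ θ, G (τ, zt θ, T1 n (A (τ, t τ)) θ) = t τ := by
    intro θ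
    have := h3 θ 0
    rw [h1, hc0] at this
    rcases mul_eq_zero.1 this with h6 | h6
    · exact absurd h6 (hl θ).ne'
    · exact sub_eq_zero.1 h6
  refine ⟨h5, fun θ => (h2 θ).1, fun θ => (h2 θ).2, fun i => ?_⟩
  have h6 := hNH.mul (h4 i)
  have e : (fun θ => PH G (τ, zt θ, T1 n (A (τ, t τ)) θ) i / dot (PH G (τ, zt θ, T1 n (A (τ, t τ)) θ)) (x0 θ - Q0 (zt θ))) =
      fun θ => Complex.exp (-f (zt θ)) * PhiM G Q0 τ0 f κ ((τ, t τ), zt θ, T1 n (A (τ, t τ)) θ, x0 θ) i := by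
    ext θ
    have he : Complex.exp (-f (zt θ)) * Complex.exp (f (zt θ)) = 1 := by rw [← Complex.exp_add]; simp
    simp only [PhiM, h5, sub_self, mul_zero, Complex.ofReal_zero, zero_smul, add_zero, Pi.smul_apply, smul_eq_mul]
    rw [div_mul_eq_mul_div, mul_div_assoc', ← mul_assoc, he, one_mul]
  rw [e]; exact h6

theorem fc_pow_zero {u : TT → ℂ} (hu : InH u) (h0 : mean u = 0) {d : ℕ} {j : ℤ} (hj : j < d) :
    fourierCoeff (fun θ => u θ ^ d) j = 0 := by
  have hv : InH fun θ => zt θ ^ (-1 : ℤ) * u θ := by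
    refine ⟨?_, fun i hi => ?_⟩
    · have : Continuous fun θ => zt θ ^ (-1 : ℤ) := by
        simp only [zpow_neg_one]; exact zt_cont.inv₀ zt_ne
      exact this.mul hu.1
    · rw [fc_zt_mul]
      rcases eq_or_lt_of_le (show i - -1 ≤ 0 by omega) with h | h
      · rw [h, fc_zero_eq, h0]
      · exact hu.2 _ h
  have e : (fun θ => u θ ^ d) = fun θ => zt θ ^ (d : ℤ) * (zt θ ^ (-1 : ℤ) * u θ) ^ d := by
    ext θ
    have := zt_ne θ
    rw [zpow_natCast, ← mul_pow, zpow_neg_one, mul_inv_cancel_left₀ this]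
  rw [e, fc_zt_mul]
  exact (hv.pow d).2 _ (by omega)

theorem mean_pow {u : TT → ℂ} (hu : InH u) (d : ℕ) : mean (fun θ => u θ ^ d) = mean u ^ d := by
  induction d with
  | zero => simp [mean_const]
  | succ d ih =>
    have := InH.mean_mul (hu.pow d) hu
    simp only [pow_succ]
    rw [this, ih]

theorem root_bound {F L : TT → ℂ} (hF : InH F) (hL : Continuous L) (h : ∀ θ, Complex.exp (L θ) = F θ) {M η : ℝ} (hM : 1 ≤ M)
    (hFM : ∀ θ, ‖F θ‖ ≤ M) (hη : 0 ≤ η) {d : ℕ} (hd : d ≠ 0) (hm : ‖mean F‖ ≤ η ^ d) {j : ℤ} (hj : j < d) :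
    ‖fourierCoeff F j‖ ≤ d * (2 * M) ^ (d - 1) * η := by
  have hd' : (d : ℂ) ≠ 0 := Nat.cast_ne_zero.2 hd
  set r : TT → ℂ := fun θ => Complex.exp ((d : ℂ)⁻¹ * L θ) with hr
  have hrH : InH r := ((hF.log_of hL h).smul _).exp
  have hrd : ∀ θ, r θ ^ d = F θ := fun θ => by
    rw [hr]; simp only; rw [← Complex.exp_nat_mul, ← mul_assoc, mul_inv_cancel₀ hd', one_mul, h]
  have hrM : ∀ θ, ‖r θ‖ ≤ M := fun θ => by
    by_contra hc
    push Not at hc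
    have h1 : M ^ d < ‖r θ‖ ^ d := pow_lt_pow_left₀ hc (by linarith) hd
    rw [← norm_pow, hrd] at h1
    have h2 : M ≤ M ^ d := le_self_pow₀ hM hd
    linarith [hFM θ]
  set a := mean r with ha
  have hFr : F = fun θ => r θ ^ d := by ext θ; rw [hrd]
  have haη : ‖a‖ ≤ η := by
    have : mean F = a ^ d := by rw [hFr, mean_pow hrH]
    rw [this, norm_pow] at hm
    exact (pow_le_pow_iff_left₀ (norm_nonneg _) hη hd).1 hm
  have haM : ‖a‖ ≤ M := norm_mean_le hrM
  set u : TT → ℂ := fun θ => r θ - a with hu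
  have huH : InH u := hrH.sub (InH.const a)
  have hu0 : mean u = 0 := by
    rw [← fc_zero_eq, hu, fc_sub hrH.1 continuous_const, fc_zero_eq, fc_zero_eq, mean_const, ← ha, sub_self]
  have h1 : fourierCoeff F j = fourierCoeff (fun θ => r θ ^ d - u θ ^ d) j := by
    rw [fc_sub (hrH.pow d).1 (huH.pow d).1, fc_pow_zero huH hu0 hj, sub_zero, ← hFr]
  rw [h1]
  refine norm_fc_le (fun θ => ?_) j
  have h2 : r θ ^ d - u θ ^ d = a * ∑ i ∈ Finset.range d, r θ ^ i * u θ ^ (d - 1 - i) := by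
    have h3 := (Commute.all (r θ) (u θ)).mul_geom_sum₂ d
    rw [← h3]; congr 1; simp [hu]
  rw [h2, norm_mul, mul_comm]
  have hu2 : ‖u θ‖ ≤ 2 * M := by
    calc ‖u θ‖ ≤ ‖r θ‖ + ‖a‖ := norm_sub_le _ _
      _ ≤ 2 * M := by linarith [hrM θ]
  have h4 : ‖∑ i ∈ Finset.range d, r θ ^ i * u θ ^ (d - 1 - i)‖ ≤ d * (2 * M) ^ (d - 1) := by
    refine (norm_sum_le _ _).trans ?_
    refine (Finset.sum_le_card_nsmul _ _ ((2 * M) ^ (d - 1)) fun i hi => ?_).trans (by simp)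
    rw [norm_mul, norm_pow, norm_pow]
    have hi' : i ≤ d - 1 := by have := Finset.mem_range.1 hi; omega
    calc ‖r θ‖ ^ i * ‖u θ‖ ^ (d - 1 - i) ≤ (2 * M) ^ i * (2 * M) ^ (d - 1 - i) := by
          gcongr; linarith [hrM θ]
      _ = (2 * M) ^ (d - 1) := by rw [← pow_add]; congr 1; omega
  exact mul_le_mul h4 haη (norm_nonneg _) (by positivity)

theorem hurwitz {q N : TT → ℂ} (hq : InH q) (hq0 : mean q = 0) (hN : InH N) {s0 : ℝ} (hs0 : 0 < s0)
    (h : ∀ s : ℝ, 0 < s → s < s0 → HasLog fun θ => q θ + s * N θ) : ∀ θ, q θ = 0 := by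
  refine eq_zero_of_fc hq.1 fun j => ?_
  rcases lt_trichotomy j 0 with hj | rfl | hj
  · exact hq.2 j hj
  · rw [fc_zero_eq, hq0]
  obtain ⟨d, hd⟩ : ∃ d : ℕ, j + 1 = d := ⟨(j + 1).toNat, by omega⟩
  have hd0 : d ≠ 0 := by omega
  obtain ⟨B, hB, hqB⟩ := InH.bdd hq.1
  obtain ⟨C, hC, hNC⟩ := InH.bdd hN.1
  set M := B + C + 1 with hM
  by_contra hne
  have hpos : 0 < ‖fourierCoeff q j‖ := norm_pos_iff.2 hne
  set K := 1 + d * (2 * M) ^ (d - 1) with hK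
  have hKp : 0 < K := by positivity
  set η := min 1 (‖fourierCoeff q j‖ / (2 * K)) with hη
  have hηp : 0 < η := by positivity
  have hη1 : η ≤ 1 := min_le_left _ _
  set s := min (s0 / 2) (min 1 (η ^ d / (C + 1))) with hs
  have hsp : 0 < s := by positivity
  have hs1 : s ≤ 1 := (min_le_right _ _).trans (min_le_left _ _)
  have hs2 : s ≤ η ^ d / (C + 1) := (min_le_right _ _).trans (min_le_right _ _)
  have hsC : s * C ≤ η ^ d := by
    rw [le_div_iff₀ (by positivity)] at hs2
    nlinarith
  have hηd : η ^ d ≤ η := pow_le_of_le_one hηp.le hη1 hd0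
  obtain ⟨L, hL, hLe⟩ := h s hsp ((min_le_left _ _).trans_lt (by linarith))
  have hFH : InH fun θ => q θ + s * N θ := hq.add (hN.smul _)
  have hsn : ∀ c : ℂ, ‖(s : ℂ) * c‖ = s * ‖c‖ := fun c => by rw [norm_mul, Complex.norm_real, Real.norm_of_nonneg hsp.le]
  have hfc : ∀ i, fourierCoeff (fun θ => q θ + s * N θ) i = fourierCoeff q i + s * fourierCoeff N i := fun i => by
    rw [fc_add hq.1 (hN.smul _).1, fc_smul]
  have h1 := root_bound hFH hL hLe (M := M) (η := η) (by linarith) (fun θ => by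
    refine (norm_add_le _ _).trans ?_
    rw [hsn]
    nlinarith [hqB θ, hNC θ, norm_nonneg (N θ)]) hηp.le hd0 (by
    rw [← fc_zero_eq, hfc, fc_zero_eq, hq0, zero_add, hsn]
    have := norm_fc_le hNC 0
    nlinarith) (j := j) (by omega)
  rw [hfc] at h1
  have h2 : ‖fourierCoeff q j‖ ≤ K * η := by
    calc ‖fourierCoeff q j‖ = ‖(fourierCoeff q j + s * fourierCoeff N j) - s * fourierCoeff N j‖ := by rw [add_sub_cancel_right]
      _ ≤ _ := norm_sub_le _ _
      _ ≤ d * (2 * M) ^ (d - 1) * η + s * C := by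
          rw [hsn]
          have := norm_fc_le hNC j
          gcongr
      _ ≤ K * η := by
          rw [hK, add_mul]; linarith
  have h3 : K * η ≤ ‖fourierCoeff q j‖ / 2 := by
    have : η ≤ ‖fourierCoeff q j‖ / (2 * K) := min_le_right _ _
    rw [le_div_iff₀ (by positivity)] at this
    linarith
  linarith

namespace Extr
variable {n : ℕ} {g : ℂ × (Fin n → ℂ) → ℝ} {Q : ℂ → Fin n → ℂ} {R γ : ℝ} {x : TT → Fin n → ℂ}

/-- Uniform descent near the graph of `x`. -/
theorem desc_near (h : Extr g Q R x γ) {V : TT → Fin n → ℂ} (hV : Continuous V) (hd : ∀ θ, dg g (zt θ) (x θ) (V θ) < 0) :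
    ∃ δ > 0, ∃ s1 > 0, ∀ θ y, ‖y - x θ‖ ≤ δ → ∀ s : ℝ, 0 < s → s ≤ s1 → g (zt θ, y + s • V θ) < g (zt θ, y) := by
  have key : ∀ᶠ v in nhds (0 : Fin n → ℂ), ∀ θ ∈ (univ : Set TT), (zt θ, x θ + v) ∈ Ud Q ∧ dg g (zt θ) (x θ + v) (V θ) < 0 := by
    refine isCompact_univ.eventually_forall_of_forall_eventually fun θ _ => ?_
    have hc : Continuous fun p : (Fin n → ℂ) × TT => (zt p.2, x p.2 + p.1) := by
      have h1 := zt_cont.comp (continuous_snd (X := Fin n → ℂ) (Y := TT))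
      have h2 := h.xc.comp (continuous_snd (X := Fin n → ℂ) (Y := TT))
      exact h1.prodMk (h2.add continuous_fst)
    have hc' : Continuous fun p : (Fin n → ℂ) × TT => ((zt p.2, x p.2 + p.1), V p.2) := hc.prodMk (hV.comp continuous_snd)
    have hm : (zt θ, x θ + 0) ∈ Ud Q := by rw [add_zero]; exact h.mem θ
    have e1 : ∀ᶠ p in nhds ((0 : Fin n → ℂ), θ), (zt p.2, x p.2 + p.1) ∈ Ud Q :=
      hc.continuousAt.eventually_mem (h.fib.Uo.mem_nhds hm)
    have ho : IsOpen {q : (ℂ × (Fin n → ℂ)) × (Fin n → ℂ) | q.1 ∈ Ud Q} := h.fib.Uo.preimage continuous_fst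
    have c1 : ContinuousAt (fun q : (ℂ × (Fin n → ℂ)) × (Fin n → ℂ) => dg g q.1.1 q.1.2 q.2) ((zt θ, x θ + 0), V θ) :=
      h.fib.dg_cont.continuousAt (ho.mem_nhds hm)
    have c2 : ContinuousAt (fun p : (Fin n → ℂ) × TT => dg g (zt p.2) (x p.2 + p.1) (V p.2)) (0, θ) :=
      ContinuousAt.comp (g := fun q : (ℂ × (Fin n → ℂ)) × (Fin n → ℂ) => dg g q.1.1 q.1.2 q.2) (f := fun p : (Fin n → ℂ) × TT => ((zt p.2, x p.2 + p.1), V p.2)) (x := ((0 : Fin n → ℂ), θ)) c1 hc'.continuousAt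
    have e2 := c2.eventually_lt continuousAt_const (by simp only [add_zero]; exact hd θ)
    exact e1.and e2
  obtain ⟨ε, hε, hb⟩ := Metric.eventually_nhds_iff.1 key
  obtain ⟨C, hC, hVC⟩ := bddTT hV
  refine ⟨ε / 2, by positivity, ε / (4 * C), by positivity, fun θ y hy s hs hs1 => ?_⟩
  have hin : ∀ r ∈ Icc (0:ℝ) s, (zt θ, y + r • V θ) ∈ Ud Q ∧ dg g (zt θ) (y + r • V θ) (V θ) < 0 := fun r hr => by
    have := @hb (y + r • V θ - x θ) (by
      rw [dist_zero_right]
      have e : y + r • V θ - x θ = (y - x θ) + r • V θ := by abel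
      rw [e]
      refine (norm_add_le _ _).trans_lt ?_
      rw [norm_smul, Real.norm_of_nonneg hr.1]
      have h3 : r * ‖V θ‖ ≤ ε / (4 * C) * C := mul_le_mul (hr.2.trans hs1) (hVC θ) (norm_nonneg _) (by positivity)
      have h4 : ε / (4 * C) * C = ε / 4 := by field_simp
      linarith) θ (mem_univ _)
    rwa [add_sub_cancel] at this
  have hder : ∀ r ∈ Icc (0:ℝ) s, HasDerivAt (fun r : ℝ => g (zt θ, y + r • V θ)) (dg g (zt θ) (y + r • V θ) (V θ)) r := fun r hr => by
    have h1 : DifferentiableAt ℝ g (zt θ, y + r • V θ) := (h.fib.cda (hin r hr).1).differentiableAt (by norm_num)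
    have h2 : HasDerivAt (fun r : ℝ => (zt θ, y + r • V θ)) (0, V θ) r := by
      refine (hasDerivAt_const r (zt θ)).prodMk ?_
      have := ((hasDerivAt_id r).smul_const (V θ)).const_add y
      simpa using this
    exact h1.hasFDerivAt.comp_hasDerivAt r h2
  have := strictAntiOn_of_deriv_neg (convex_Icc 0 s) (fun r hr => (hder r hr).continuousAt.continuousWithinAt) (fun r hr => by
    rw [interior_Icc] at hr
    have hr' := Ioo_subset_Icc_self hr
    rw [(hder r hr').deriv]; exact (hin r hr').2) (left_mem_Icc.2 hs.le) (right_mem_Icc.2 hs.le) hs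
  simpa using this

theorem unique (h : Extr g Q R x γ) {x' : TT → Fin n → ℂ} (hx' : ∀ i, InH fun θ => x' θ i) (hx0 : ∀ i, mean (fun θ => x' θ i) = 0)
    (hle : ∀ θ, g (zt θ, x' θ) ≤ γ) : ∀ θ, x' θ = x θ := by
  have hx'c : Continuous x' := continuous_pi fun i => (hx' i).1
  obtain ⟨f, hf, hfp⟩ := h.exN (ε := 1) one_pos
  have hNH : InH fun θ => Complex.exp (-f (zt θ)) := (MemA.of_entire hf.neg.cexp).inH
  set N : TT → ℂ := fun θ => Complex.exp (-f (zt θ)) with hN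
  set V : TT → Fin n → ℂ := fun θ => -(N θ • (x θ - Q (zt θ))) with hV
  have hVc : Continuous V := (hNH.1.smul (h.xc.sub h.Qc)).neg
  have hre : ∀ θ, 0 < (N θ * cf g Q (zt θ) (x θ)).re := fun θ => by
    have e : N θ * cf g Q (zt θ) (x θ) = (Complex.exp (f (zt θ)) / cf g Q (zt θ) (x θ))⁻¹ := by
      rw [inv_div, hN]; simp only [Complex.exp_neg]; ring
    have hz : Complex.exp (f (zt θ)) / cf g Q (zt θ) (x θ) ≠ 0 := div_ne_zero (Complex.exp_ne_zero _) (h.c_ne θ)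
    rw [e, Complex.inv_re]
    exact div_pos (hfp θ).1 (Complex.normSq_pos.2 hz)
  have hVd : ∀ θ, dg g (zt θ) (x θ) (V θ) < 0 := fun θ => by
    have h1 := re_dot_pv g (zt θ) (x θ) (V θ)
    have h2 : dot (pv g (zt θ) (x θ)) (V θ) = - (N θ * cf g Q (zt θ) (x θ)) := by
      rw [hV]; simp only [dot_neg, dot_smul, cf]
    rw [h2, Complex.neg_re] at h1
    have := hre θ
    linarith
  obtain ⟨δ, hδ, s1, hs1, hdesc⟩ := h.desc_near hVc hVd
  set q : TT → ℂ := fun θ => dot (psi g Q (zt θ) (x θ)) (x θ - x' θ) with hq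
  have hqH : InH q := InH.dot h.psiH fun i => (h.xH i).sub (hx' i)
  have hq0 : mean q = 0 := by
    refine mean_dot_zero h.psiH (fun i => (h.xH i).sub (hx' i)) fun i => ?_
    have := fc_sub (h.xH i).1 (hx' i).1 0
    rw [fc_zero_eq, fc_zero_eq, fc_zero_eq, h.x0, hx0, sub_zero] at this
    exact this
  -- away from `x`, `q` is bounded below
  obtain ⟨c0, hc0, hq1⟩ : ∃ c0 > 0, ∀ θ, δ / 2 ≤ ‖x' θ - x θ‖ → c0 ≤ ‖q θ‖ := by
    have hK : IsCompact {θ | δ / 2 ≤ ‖x' θ - x θ‖} := (isClosed_le continuous_const (hx'c.sub h.xc).norm).isCompact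
    rcases Set.eq_empty_or_nonempty {θ | δ / 2 ≤ ‖x' θ - x θ‖} with he | hne
    · exact ⟨1, one_pos, fun θ hθ => by have : θ ∈ ({θ | δ / 2 ≤ ‖x' θ - x θ‖} : Set TT) := hθ
                                        rw [he] at this; exact this.elim⟩
    · obtain ⟨θ0, hθ0, hmin⟩ := hK.exists_isMinOn hne hqH.1.norm.continuousOn
      refine ⟨‖q θ0‖, ?_, fun θ hθ => hmin hθ⟩
      refine norm_pos_iff.2 ?_
      rw [hq]
      simp only
      rw [dot_psi]
      have hθ0' : δ / 2 ≤ ‖x' θ0 - x θ0‖ := hθ0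
      refine mul_ne_zero (inv_ne_zero (h.c_ne θ0)) ?_
      have := h.fib.linconv (zt_circ θ0) (h.ne θ0) (by rw [h.lev]; exact h.gR) (w1 := x' θ0) (by rw [h.lev]; exact hle θ0)
        (fun e => by rw [e, sub_self, norm_zero] at hθ0'; linarith)
      rw [← neg_sub, dot_neg]; exact neg_ne_zero.2 this
  obtain ⟨C, hC, hNC⟩ := InH.bdd hNH.1
  -- cutoff
  set χ : TT → ℝ := fun θ => max 0 (min 1 (2 - 2 * ‖x' θ - x θ‖ / δ)) with hχ
  have hχc : Continuous χ := by
    have := (hx'c.sub h.xc).norm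
    exact continuous_const.max (continuous_const.min (continuous_const.sub ((continuous_const.mul this).div_const _)))
  have hχ0 : ∀ θ, 0 ≤ χ θ := fun θ => le_max_left _ _
  have hχ1 : ∀ θ, χ θ ≤ 1 := fun θ => max_le zero_le_one (min_le_left _ _)
  have hχn : ∀ θ, ‖x' θ - x θ‖ ≤ δ / 2 → χ θ = 1 := fun θ hθ => by
    have : 1 ≤ 2 - 2 * ‖x' θ - x θ‖ / δ := by
      have : 2 * ‖x' θ - x θ‖ / δ ≤ 1 := by rw [div_le_one hδ]; linarith
      linarith
    simp [hχ, min_eq_left this]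
  have hχf : ∀ θ, 0 < χ θ → ‖x' θ - x θ‖ ≤ δ := fun θ hθ => by
    by_contra hc
    push Not at hc
    have h2 : 2 < 2 * ‖x' θ - x θ‖ / δ := by rw [lt_div_iff₀ hδ]; linarith
    have : χ θ ≤ 0 := max_le le_rfl ((min_le_right _ _).trans (by linarith))
    linarith
  have hq' := hurwitz hqH hq0 hNH (s0 := min s1 (c0 / (4 * C))) (by positivity) (fun s hs hs' => by
    have hss1 : s < s1 := hs'.trans_le (min_le_left _ _)
    have hsC : s * C < c0 / 4 := by
      have := hs'.trans_le (min_le_right _ _)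
      rw [lt_div_iff₀ (by positivity)] at this
      linarith
    set y : TT → Fin n → ℂ := fun θ => x' θ + (s * χ θ) • V θ with hy
    have hyc : Continuous y := hx'c.add ((continuous_const.mul hχc).smul hVc)
    have hylt : ∀ θ, 0 < χ θ → g (zt θ, y θ) < γ := fun θ hθ =>
      (hdesc θ (x' θ) (hχf θ hθ) (s * χ θ) (by positivity) (by nlinarith [hχ1 θ])).trans_le (hle θ)
    have hyz : ∀ θ, χ θ = 0 → y θ = x' θ := fun θ hθ => by simp [hy, hθ]
    have hyle : ∀ θ, g (zt θ, y θ) ≤ γ := fun θ => by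
      rcases (hχ0 θ).eq_or_lt with h1 | h1
      · rw [hyz θ h1.symm]; exact hle θ
      · exact (hylt θ h1).le
    have hyne : ∀ θ, x θ ≠ y θ := fun θ he => by
      rcases (hχ0 θ).eq_or_lt with h1 | h1
      · have e2 : x' θ = x θ := by rw [he, hyz θ h1.symm]
        have := hχn θ (by rw [e2, sub_self, norm_zero]; positivity)
        linarith
      · have := hylt θ h1
        rw [← he, h.lev] at this
        exact lt_irrefl _ this
    have hlog1 := h.fib.haslog (ζ := zt) (w := x) (w' := y) zt_cont zt_circ h.xc hyc (fun θ => by rw [h.lev]; exact h.gR)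
      (fun θ => by rw [h.lev]; exact hyle θ) hyne h.ne
    have hlog2 : HasLog fun θ => cf g Q (zt θ) (x θ) := h.fib.haslog (ζ := zt) (w := x) (w' := fun θ => Q (zt θ)) zt_cont zt_circ h.xc h.Qc
      (fun θ => by rw [h.lev]; exact h.gR) (fun θ => by rw [(h.fib.zero _ (zt_circ θ) _).2 rfl]; exact h.fib.nonneg _ (zt_circ _) _)
      h.ne h.ne
    have hpsiφ : ∀ θ, dot (psi g Q (zt θ) (x θ)) (V θ) = - N θ := fun θ => by
      rw [dot_psi, hV]
      simp only [dot_neg, dot_smul]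
      have := h.c_ne θ
      rw [show dot (pv g (zt θ) (x θ)) (x θ - Q (zt θ)) = cf g Q (zt θ) (x θ) from rfl]
      field_simp
    have hqs : ∀ θ, dot (pv g (zt θ) (x θ)) (x θ - y θ) / cf g Q (zt θ) (x θ) = q θ + (s * χ θ : ℝ) * N θ := fun θ => by
      have e : x θ - y θ = (x θ - x' θ) - (s * χ θ) • V θ := by rw [hy]; simp only; abel
      have e2 := dot_psi g Q (zt θ) (x θ) (x θ - y θ)
      rw [div_eq_inv_mul, ← e2, e, dot_sub, dot_rsmul, hpsiφ]
      ring
    have hlog3 : HasLog fun θ => q θ + (s * χ θ : ℝ) * N θ := by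
      obtain ⟨L1, c1, e1⟩ := hlog1
      obtain ⟨L2, c2, e2⟩ := hlog2
      exact ⟨fun θ => L1 θ - L2 θ, c1.sub c2, fun θ => by rw [Complex.exp_sub, e1, e2, hqs]⟩
    have hsχc : Continuous fun θ => ((s * χ θ : ℝ) : ℂ) := Complex.continuous_ofReal.comp (continuous_const.mul hχc)
    refine HasLog.of_near hlog3 (hqH.1.add (hsχc.mul hNH.1)) (hqH.1.add (continuous_const.mul hNH.1)) fun θ => ?_
    rcases le_or_gt (‖x' θ - x θ‖) (δ / 2) with h1 | h1
    · rw [hχn θ h1, mul_one, sub_self, norm_zero]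
      have := hlog3.ne θ
      rw [hχn θ h1, mul_one] at this
      exact norm_pos_iff.2 this
    · have h2 := hq1 θ h1.le
      have h3 : ∀ r : ℝ, 0 ≤ r → r ≤ s → ‖(r : ℂ) * N θ‖ ≤ c0 / 4 := fun r hr hrs => by
        rw [norm_mul, Complex.norm_real, Real.norm_of_nonneg hr]
        exact (mul_le_mul hrs (hNC θ) (norm_nonneg _) hs.le).trans hsC.le
      have h4 := h3 (s * χ θ) (mul_nonneg hs.le (hχ0 θ)) (by nlinarith [hχ1 θ])
      have h5 := h3 (s - s * χ θ) (by nlinarith [hχ1 θ]) (by nlinarith [hχ0 θ])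
      have e : q θ + s * N θ - (q θ + (s * χ θ : ℝ) * N θ) = ((s - s * χ θ : ℝ) : ℂ) * N θ := by push_cast; ring
      rw [e]
      have h6 : ‖q θ‖ ≤ ‖q θ + (s * χ θ : ℝ) * N θ‖ + ‖((s * χ θ : ℝ) : ℂ) * N θ‖ := by
        have := norm_sub_le (q θ + (s * χ θ : ℝ) * N θ) (((s * χ θ : ℝ) : ℂ) * N θ)
        rwa [add_sub_cancel_right] at this
      linarith)
  intro θ
  by_contra hne
  have := h.fib.linconv (zt_circ θ) (h.ne θ) (by rw [h.lev]; exact h.gR) (w1 := x' θ) (by rw [h.lev]; exact hle θ) hne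
  have h1 := hq' θ
  rw [hq] at h1
  simp only at h1
  rw [dot_psi] at h1
  rcases mul_eq_zero.1 h1 with h2 | h2
  · exact h.c_ne θ (inv_eq_zero.1 h2)
  · rw [← neg_sub, dot_neg, neg_eq_zero] at h2; exact this h2

end Extr

theorem T1_unif {n : ℕ} {a : ℝ → VV n} {τ0 : ℝ} (ha : ContinuousAt a τ0) {ε : ℝ} (hε : 0 < ε) :
    ∀ᶠ τ in nhds τ0, ∀ θ, ‖T1 n (a τ) θ - T1 n (a τ0) θ‖ ≤ ε := by
  have h1 : ContinuousAt (fun τ => T1 n (a τ)) τ0 := ((T1 n).continuous.continuousAt).comp ha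
  filter_upwards [Metric.continuousAt_iff'.1 h1 ε hε] with τ hτ θ
  rw [dist_eq_norm] at hτ
  exact ((T1 n (a τ) - T1 n (a τ0)).norm_coe_le_norm θ).trans hτ.le

theorem psi_persist {n : ℕ} (P φ φ0 : TT → Fin n → ℂ) (hd : ∀ θ, dot (P θ) (φ0 θ) ≠ 0)
    (hH : ∀ i, InH fun θ => P θ i / dot (P θ) (φ0 θ)) (hφ : ∀ i, InH fun θ => φ θ i) {C ε : ℝ} (_hC : 0 < C)
    (hb : ∀ θ, ‖(fun i => P θ i / dot (P θ) (φ0 θ))‖ ≤ C) (hε : ∀ θ, ‖φ0 θ - φ θ‖ ≤ ε) (hs : n * C * ε < 1) :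
    ∀ i, InH fun θ => P θ i / dot (P θ) (φ θ) := by
  intro i
  set Pt : TT → Fin n → ℂ := fun θ i => P θ i / dot (P θ) (φ0 θ) with hPt
  have hPs : ∀ θ, Pt θ = (dot (P θ) (φ0 θ))⁻¹ • P θ := fun θ => by ext i; simp [hPt, div_eq_inv_mul]
  have hD : InH fun θ => dot (Pt θ) (φ θ) := InH.dot hH hφ
  have h1 : ∀ θ, ‖1 - dot (Pt θ) (φ θ)‖ ≤ n * C * ε := fun θ => by
    have e : 1 - dot (Pt θ) (φ θ) = dot (Pt θ) (φ0 θ - φ θ) := by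
      rw [dot_sub]; congr 1
      rw [hPs, smul_dot, inv_mul_cancel₀ (hd θ)]
    rw [e]
    refine (norm_dot_le _ _).trans ?_
    have := hb θ
    exact mul_le_mul (mul_le_mul_of_nonneg_left this (by positivity)) (hε θ) (norm_nonneg _) (by positivity)
  have h2 := hD.inv_near hs h1
  have e : (fun θ => P θ i / dot (P θ) (φ θ)) = fun θ => Pt θ i * (dot (Pt θ) (φ θ))⁻¹ := by
    ext θ
    have := hd θ
    rw [hPs, smul_dot, Pi.smul_apply, smul_eq_mul, mul_inv, inv_inv, div_eq_mul_inv]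
    field_simp
  rw [e]
  exact (hH i).mul h2

theorem PH_bound {n : ℕ} {G : ℝ × (ℂ × (Fin n → ℂ)) → ℝ} {Q : ℂ → Fin n → ℂ} {R τ0 γ0 : ℝ} {x0 : TT → Fin n → ℂ}
    (h : Extr (fun p => G (τ0, p)) Q R x0 γ0) (hG : ∀ θ, ContDiffAt ℝ 6 G (τ0, zt θ, x0 θ))
    {a : ℝ → VV n} (ha : ContinuousAt a τ0) (ha0 : ∀ θ, T1 n (a τ0) θ = x0 θ) :
    ∃ C > 0, ∀ᶠ τ in nhds τ0, ∀ θ, ‖(fun i => PH G (τ, zt θ, T1 n (a τ) θ) i / dot (PH G (τ, zt θ, T1 n (a τ) θ)) (x0 θ - Q (zt θ)))‖ < C := by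
  obtain ⟨C, hC, hb⟩ := bddTT h.psic
  refine ⟨C + 1, by positivity, ?_⟩
  refine ev_unif ha (h.xc.sub h.Qc) (Pr := fun q => ‖(fun i => PH G (q.1, q.2.1, q.2.2.1) i / dot (PH G (q.1, q.2.1, q.2.2.1)) q.2.2.2)‖ < C + 1) fun θ => ?_
  rw [ha0]
  have hP : PH G (τ0, zt θ, x0 θ) = pv (fun p => G (τ0, p)) (zt θ) (x0 θ) := PH_eq ((hG θ).differentiableAt (by norm_num))
  have hc : ContinuousAt (fun q : ℝ × ℂ × (Fin n → ℂ) × (Fin n → ℂ) => (q.1, q.2.1, q.2.2.1)) (τ0, zt θ, x0 θ, x0 θ - Q (zt θ)) := by fun_prop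
  have c2 : ContinuousAt (fun q : ℝ × ℂ × (Fin n → ℂ) × (Fin n → ℂ) => PH G (q.1, q.2.1, q.2.2.1)) (τ0, zt θ, x0 θ, x0 θ - Q (zt θ)) :=
    ContinuousAt.comp (g := PH G) (f := fun q : ℝ × ℂ × (Fin n → ℂ) × (Fin n → ℂ) => (q.1, q.2.1, q.2.2.1)) (x := (τ0, zt θ, x0 θ, x0 θ - Q (zt θ))) (PH_cd (hG θ)).continuousAt hc
  have c3 : ContinuousAt (fun q : ℝ × ℂ × (Fin n → ℂ) × (Fin n → ℂ) => dot (PH G (q.1, q.2.1, q.2.2.1)) q.2.2.2) (τ0, zt θ, x0 θ, x0 θ - Q (zt θ)) :=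
    ContinuousAt.comp (g := fun p : (Fin n → ℂ) × (Fin n → ℂ) => dot p.1 p.2) (f := fun q : ℝ × ℂ × (Fin n → ℂ) × (Fin n → ℂ) => (PH G (q.1, q.2.1, q.2.2.1), q.2.2.2)) (x := (τ0, zt θ, x0 θ, x0 θ - Q (zt θ)))
      continuous_dot.continuousAt (c2.prodMk (by fun_prop))
  have c4 : ContinuousAt (fun q : ℝ × ℂ × (Fin n → ℂ) × (Fin n → ℂ) => (fun i => PH G (q.1, q.2.1, q.2.2.1) i / dot (PH G (q.1, q.2.1, q.2.2.1)) q.2.2.2)) (τ0, zt θ, x0 θ, x0 θ - Q (zt θ)) := by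
    rw [continuousAt_pi]
    intro i
    refine (continuousAt_pi.1 c2 i).div c3 ?_
    simp only [hP]
    exact h.c_ne θ
  refine c4.norm.eventually_lt continuousAt_const ?_
  simp only [hP]
  exact (hb θ).trans_lt (by linarith)

theorem persist {n : ℕ} {G : ℝ × (ℂ × (Fin n → ℂ)) → ℝ} {Qf : ℝ → ℂ → Fin n → ℂ} {Rf : ℝ → ℝ} {τ0 γ0 : ℝ} {x0 : TT → Fin n → ℂ}
    (h : Extr (fun p => G (τ0, p)) (Qf τ0) (Rf τ0) x0 γ0) (hG : ∀ θ, ContDiffAt ℝ 6 G (τ0, zt θ, x0 θ))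
    (hQ : ∀ θ, ContDiffAt ℝ 2 (Qf τ0) (zt θ))
    (hFib : ∀ᶠ τ in nhds τ0, Fib (fun p => G (τ, p)) (Qf τ) (Rf τ) ∧ (∀ i, InH fun θ => Qf τ (zt θ) i) ∧ 1 < Rf τ)
    (hQu : ∀ ε > 0, ∀ᶠ τ in nhds τ0, ∀ θ, ‖Qf τ (zt θ) - Qf τ0 (zt θ)‖ ≤ ε)
    (hG0 : ∀ θ, (0 : Fin n → ℂ) ≠ Qf τ0 (zt θ) → ContinuousAt (fun τ => G (τ, zt θ, 0)) τ0) :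
    ∃ a : ℝ → VV n, ∃ t : ℝ → ℝ, ContDiffAt ℝ 1 a τ0 ∧ ContDiffAt ℝ 1 t τ0 ∧
      ∀ᶠ τ in nhds τ0, Extr (fun p => G (τ, p)) (Qf τ) (Rf τ) (fun θ => T1 n (a τ) θ) (t τ) := by
  obtain ⟨a, t, ha, ht, ht0, ha0, hev⟩ := ift_main h hG hQ
  refine ⟨a, t, ha, ht, ?_⟩
  obtain ⟨C, hC, hCb⟩ := PH_bound h hG ha.continuousAt ha0
  set ε := 1 / (2 * (n * C + 1)) with hε
  have hεp : 0 < ε := by positivity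
  have hsm : n * C * ε < 1 := by
    rw [hε, mul_one_div, div_lt_one (by positivity)]; nlinarith [show 0 ≤ (n:ℝ) * C by positivity]
  have htpos : ∀ᶠ τ in nhds τ0, 0 < t τ := continuousAt_const.eventually_lt ht.continuousAt (by rw [ht0]; exact h.gpos)
  have htR : ∀ᶠ τ in nhds τ0, t τ < Rf τ := by
    by_contra hcon
    have hfr : ∃ᶠ τ in nhds τ0, Rf τ ≤ t τ := by
      simpa only [Filter.not_eventually, not_lt] using hcon
    -- zero is a competitor
    have hz : ∀ θ, x0 θ = 0 := by
      have h0 : ∀ θ, G (τ0, zt θ, 0) ≤ γ0 := fun θ => by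
        by_cases hq : (0 : Fin n → ℂ) = Qf τ0 (zt θ)
        · have := (h.fib.zero _ (zt_circ θ) 0).2 hq
          rw [this]; exact h.gpos.le
        · by_contra hc
          push Not at hc
          have e1 : ∀ᶠ τ in nhds τ0, t τ < G (τ, zt θ, 0) :=
            ht.continuousAt.eventually_lt (hG0 θ hq) (by rw [ht0]; exact hc)
          obtain ⟨τ, h1, h2, h3⟩ := (hfr.and_eventually (e1.and hFib)).exists
          have h4 := h3.1.g_lt (zt_circ θ) (x := 0) (by
            rw [show euclNorm (0 : Fin n → ℂ) = 0 by simp [euclNorm]]; exact h3.1.Rpos)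
          linarith
      intro θ
      exact (h.unique (x' := fun _ => 0) (fun i => InH.const 0) (fun i => mean_const 0) h0 θ).symm
    have hc : ContinuousAt (fun τ => euclNorm (T1 n (a τ) 0)) τ0 := by
      have h1 : ContinuousAt (fun τ => T1 n (a τ)) τ0 := ((T1 n).continuous.continuousAt).comp ha.continuousAt
      have h2 : ContinuousAt (fun τ => T1 n (a τ) 0) τ0 := (continuous_eval_const (F := C(TT, Fin n → ℂ)) (0:TT)).continuousAt.comp h1
      exact continuous_euclNorm.continuousAt.comp h2
    have e1 : ∀ᶠ τ in nhds τ0, euclNorm (T1 n (a τ) 0) < 1 := hc.eventually_lt continuousAt_const (by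
      rw [ha0, hz]; simp [euclNorm])
    obtain ⟨τ, h1, h2, h3, h4⟩ := (hfr.and_eventually (e1.and (hFib.and hev))).exists
    have h5 := h3.1.g_lt (zt_circ 0) (x := T1 n (a τ) 0) (h2.trans h3.2.2)
    simp only [h4.1] at h5
    linarith
  filter_upwards [hev, hCb, T1_unif ha.continuousAt (half_pos hεp), hQu _ (half_pos hεp), hFib, htpos, htR] with τ h1 h2 h3 h4 h5 h6 h7
  refine ⟨h5.1, h6, h7, T1_InH _, T1_mean _, h5.2.1, h1.1, ?_⟩
  have hP : ∀ θ, PH G (τ, zt θ, T1 n (a τ) θ) = pv (fun p => G (τ, p)) (zt θ) (T1 n (a τ) θ) := fun θ => PH_eq ((h1.2.1 θ).differentiableAt (by norm_num))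
  have := psi_persist (fun θ => PH G (τ, zt θ, T1 n (a τ) θ)) (fun θ => T1 n (a τ) θ - Qf τ (zt θ)) (fun θ => x0 θ - Qf τ0 (zt θ))
    h1.2.2.1 h1.2.2.2 (fun i => (T1_InH _ i).sub (h5.2.1 i)) hC (fun θ => (h2 θ).le) (ε := ε) (fun θ => by
      have e : x0 θ - Qf τ0 (zt θ) - (T1 n (a τ) θ - Qf τ (zt θ)) = (Qf τ (zt θ) - Qf τ0 (zt θ)) - (T1 n (a τ) θ - T1 n (a τ0) θ) := by
        rw [ha0]; abel
      rw [e]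
      refine (norm_sub_le _ _).trans ?_
      linarith [h3 θ, h4 θ]) hsm
  intro i
  have h8 := this i
  simp only [hP] at h8
  exact h8

/-- radial projection on the circle -/
def nz (z : ℂ) : ℂ := (‖z‖⁻¹ : ℝ) • z

theorem nz_circ {z : ℂ} (hz : z ≠ 0) : nz z ∈ Circ := by
  rw [Circ, mem_sphere_zero_iff_norm, nz, norm_smul, norm_inv, norm_norm, inv_mul_cancel₀ (norm_ne_zero_iff.2 hz)]

theorem nz_eq {z : ℂ} (hz : z ∈ Circ) : nz z = z := by
  rw [Circ, mem_sphere_zero_iff_norm] at hz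
  simp [nz, hz]

theorem nz_cd {z : ℂ} (hz : z ≠ 0) : ContDiffAt ℝ 6 nz z :=
  ((contDiffAt_norm ℝ hz).inv (norm_ne_zero_iff.2 hz)).smul contDiffAt_id

def Gm {n : ℕ} (ρ : ℝ → ℂ → (Fin n → ℂ) → ℝ) (m : ℕ) : ℝ × (ℂ × (Fin n → ℂ)) → ℝ := fun q =>
  ρ q.1 (nz q.2.1) (fun j => q.2.2 j / nz q.2.1 ^ m)

def Qm {n : ℕ} (S : ℝ → ℂ → Fin n → ℂ) (m : ℕ) : ℝ → ℂ → Fin n → ℂ := fun τ z j => nz z ^ m * S τ (nz z) j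

/-- the substitution -/
def sb {n : ℕ} (m : ℕ) : ℂ × (Fin n → ℂ) → ℂ × (Fin n → ℂ) := fun p => (nz p.1, fun j => p.2 j / nz p.1 ^ m)

theorem sb_cd {n : ℕ} (m : ℕ) {p : ℂ × (Fin n → ℂ)} (hp : p.1 ≠ 0) : ContDiffAt ℝ 6 (sb m) p := by
  have h1 : ContDiffAt ℝ 6 (fun p : ℂ × (Fin n → ℂ) => nz p.1) p :=
    ContDiffAt.comp (g := nz) (f := fun p : ℂ × (Fin n → ℂ) => p.1) p (nz_cd hp) contDiffAt_fst
  refine h1.prodMk ?_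
  rw [contDiffAt_pi]
  intro j
  have h2 : ContDiffAt ℝ 6 (fun p : ℂ × (Fin n → ℂ) => (nz p.1 ^ m)⁻¹) p :=
    (h1.pow m).inv (pow_ne_zero _ (circ_ne (nz_circ hp)))
  have h3 : ContDiffAt ℝ 6 (fun p : ℂ × (Fin n → ℂ) => p.2 j) p := by fun_prop
  exact (h3.mul h2).congr_of_eventuallyEq (Eventually.of_forall fun p => div_eq_mul_inv _ _)

theorem sb_iff {n : ℕ} {m : ℕ} {p : ℂ × (Fin n → ℂ)} (hp : p.1 ≠ 0) {s : Fin n → ℂ} :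
    (sb m p).2 = s ↔ p.2 = fun j => nz p.1 ^ m * s j := by
  have h := pow_ne_zero m (circ_ne (nz_circ hp))
  constructor
  · rintro rfl; ext j; simp only [sb]; field_simp
  · intro e; ext j; simp only [sb, e]; field_simp

/-- second derivatives of slices -/
theorem slice2 {n : ℕ} {f : (Fin n → ℂ) → ℝ} {g : ℂ × (Fin n → ℂ) → ℝ} {z c : ℂ} (hfg : ∀ w, f w = g (z, c • w)) {w : Fin n → ℂ}
    (hg : ContDiffAt ℝ 6 g (z, c • w)) :
    (∀ v, fderiv ℝ f w v = dg g z (c • w) (c • v)) ∧ ∀ v, iteratedFDeriv ℝ 2 f w ![v, v] = d2 g z (c • w) (c • v) (c • v) := by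
  set Lc : (Fin n → ℂ) →L[ℝ] ℂ × (Fin n → ℂ) := (ContinuousLinearMap.inr ℝ ℂ (Fin n → ℂ)) ∘L ((c • ContinuousLinearMap.id ℂ (Fin n → ℂ)).restrictScalars ℝ) with hLc
  have hLv : ∀ v, Lc v = (0, c • v) := fun v => by simp [hLc]
  have hin : ∀ w, HasFDerivAt (fun w : Fin n → ℂ => (z, c • w)) Lc w := fun w => by
    have h1 : HasFDerivAt (fun w => (z, (0 : Fin n → ℂ)) + Lc w) Lc w := Lc.hasFDerivAt.const_add _
    refine h1.congr_of_eventuallyEq (Eventually.of_forall fun y => ?_)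
    simp [hLv]
  have hf' : f = fun w => g (z, c • w) := funext hfg
  have hev : ∀ᶠ y in nhds w, ContDiffAt ℝ 6 g (z, c • y) :=
    (hin w).continuousAt.eventually (hg.eventually (by simp))
  have hd : ∀ᶠ y in nhds w, fderiv ℝ f y = (fderiv ℝ g (z, c • y)) ∘L Lc := by
    filter_upwards [hev] with y hy
    rw [hf']
    exact (((hy.differentiableAt (by norm_num)).hasFDerivAt).comp y (hin y)).fderiv
  refine ⟨fun v => ?_, fun v => ?_⟩
  · rw [hd.self_of_nhds, ContinuousLinearMap.comp_apply, hLv]; rfl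
  · rw [iteratedFDeriv_two_apply]
    have h1 : HasFDerivAt (fderiv ℝ g) (fderiv ℝ (fderiv ℝ g) (z, c • w)) (z, c • w) :=
      ((hg.fderiv_right (m := 5) (by norm_num)).differentiableAt (by norm_num)).hasFDerivAt
    have h2 := h1.comp w (hin w)
    have h3 : HasFDerivAt (fun y => (fderiv ℝ g (z, c • y)) ∘L Lc) (((ContinuousLinearMap.compL ℝ (Fin n → ℂ) (ℂ × (Fin n → ℂ)) ℝ).flip Lc) ∘L ((fderiv ℝ (fderiv ℝ g) (z, c • w)) ∘L Lc)) w :=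
      ((ContinuousLinearMap.compL ℝ (Fin n → ℂ) (ℂ × (Fin n → ℂ)) ℝ).flip Lc).hasFDerivAt.comp w h2
    have h4 : fderiv ℝ (fderiv ℝ f) w = _ := (h3.congr_of_eventuallyEq hd).fderiv
    rw [h4]
    simp [hLv, d2]

theorem euclNorm_smul {n : ℕ} (c : ℂ) (x : Fin n → ℂ) : euclNorm (c • x) = ‖c‖ * euclNorm x := by
  rw [euclNorm_eq, euclNorm_eq, WithLp.toLp_smul, norm_smul]

theorem fib_of {n : ℕ} {ρ : ℂ → (Fin n → ℂ) → ℝ} {R : ℝ} {S : ℂ → Fin n → ℂ} (h : Cond3 n ρ R S) (m : ℕ) :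
    Fib (fun p => ρ (nz p.1) (fun j => p.2 j / nz p.1 ^ m)) (fun z j => nz z ^ m * S (nz z) j) R := by
  set g : ℂ × (Fin n → ℂ) → ℝ := fun p => ρ (nz p.1) (fun j => p.2 j / nz p.1 ^ m) with hg
  set Q : ℂ → Fin n → ℂ := fun z j => nz z ^ m * S (nz z) j with hQ
  have hnzc : ContinuousOn nz {0}ᶜ := fun z hz => (nz_cd hz).continuousAt.continuousWithinAt
  have hgc : ∀ z ∈ Circ, ∀ x, g (z, x) = ρ z ((z ^ m)⁻¹ • x) := fun z hz x => by
    simp only [hg, nz_eq hz]; congr 1; ext j; simp [div_eq_inv_mul]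
  have hQc : ∀ z ∈ Circ, Q z = z ^ m • S z := fun z hz => by ext j; simp [hQ, nz_eq hz]
  have hzm : ∀ z ∈ Circ, z ^ m ≠ 0 := fun z hz => pow_ne_zero m (circ_ne hz)
  have hcn : ∀ z ∈ Circ, ‖z ^ m‖ = 1 := fun z hz => by
    rw [Circ, mem_sphere_zero_iff_norm] at hz; rw [norm_pow, hz, one_pow]
  have hcn' : ∀ z ∈ Circ, ‖(z ^ m)⁻¹‖ = 1 := fun z hz => by rw [norm_inv, hcn z hz, inv_one]
  have hsm : ContDiffOn ℝ 6 g (Ud Q) := by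
    have := h.smooth.comp (f := sb m) (s := Ud Q) (fun p hp => (sb_cd m hp.1).contDiffWithinAt) (fun p hp => by
      refine ⟨nz_circ hp.1, fun h0 => hp.2 ?_⟩
      exact (sb_iff hp.1).1 ((h.Szero _ (nz_circ hp.1) _).1 h0))
    exact this
  have hcont : ContinuousOn g {p | p.1 ≠ 0} :=
    h.cont.comp (f := sb m) (fun p hp => (sb_cd m hp).continuousAt.continuousWithinAt) (fun p hp => nz_circ hp)
  have hQcont : ContinuousOn Q {0}ᶜ := by
    rw [continuousOn_pi]
    intro j
    have h1 : ContinuousOn (fun z => S (nz z)) {0}ᶜ := h.Scont.comp hnzc fun z hz => nz_circ hz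
    exact (hnzc.pow m).mul ((continuous_apply j).comp_continuousOn h1)
  have hzero : ∀ z ∈ Circ, ∀ x, g (z, x) = 0 ↔ x = Q z := fun z hz x => by
    rw [hgc z hz, h.Szero z hz, hQc z hz, inv_smul_eq_iff₀ (hzm z hz)]
  have hUo : IsOpen (Ud Q) := by
    have : Ud Q = {p | p.1 ≠ 0} ∩ (fun p : ℂ × (Fin n → ℂ) => p.2 - Q p.1) ⁻¹' {0}ᶜ := by
      ext p; simp [Ud, sub_eq_zero]
    rw [this]
    exact (continuousOn_snd.sub (hQcont.comp continuousOn_fst fun p hp => hp)).isOpen_inter_preimage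
      (isOpen_ne.preimage continuous_fst) isOpen_compl_singleton
  have hcda : ∀ z ∈ Circ, ∀ x, x ≠ Q z → ContDiffAt ℝ 6 g (z, x) := fun z hz x hx =>
    hsm.contDiffAt (hUo.mem_nhds ⟨circ_ne hz, hx⟩)
  have hfg : ∀ z ∈ Circ, ∀ w, ρ z w = g (z, z ^ m • w) := fun z hz w => by
    rw [hgc z hz, inv_smul_smul₀ (hzm z hz)]
  have hsl : ∀ z ∈ Circ, ∀ x, x ≠ Q z → (∀ v, fderiv ℝ (ρ z) ((z ^ m)⁻¹ • x) v = dg g z x (z ^ m • v)) ∧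
      ∀ v, iteratedFDeriv ℝ 2 (ρ z) ((z ^ m)⁻¹ • x) ![v, v] = d2 g z x (z ^ m • v) (z ^ m • v) := fun z hz x hx => by
    have e : z ^ m • (z ^ m)⁻¹ • x = x := smul_inv_smul₀ (hzm z hz) x
    have := slice2 (hfg z hz) (w := (z ^ m)⁻¹ • x) (by rw [e]; exact hcda z hz x hx)
    rwa [e] at this
  have hpos : ∀ z ∈ Circ, ∀ x, x ≠ Q z → 0 < ρ z ((z ^ m)⁻¹ • x) := fun z hz x hx => by
    refine lt_of_le_of_ne (h.nonneg z hz _) fun h0 => hx ((hzero z hz x).1 ?_)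
    rw [hgc z hz]; exact h0.symm
  refine ⟨hQcont, hsm, hcont, fun z hz x => ?_, hzero, fun z hz x hx hR => ?_, fun z hz x hx u hu h1 h2 => ?_, by linarith [h.hR], fun z hz x => ?_, fun z hz x hx => ?_, fun z hz => ?_⟩
  · rw [hgc z hz]; exact h.nonneg z hz _
  · have h1 := h.grad_ne z hz ((z ^ m)⁻¹ • x) (hpos z hz x hx) (by rw [← hgc z hz]; exact hR)
    by_contra hc
    push Not at hc
    refine h1 (ContinuousLinearMap.ext fun v => ?_)
    rw [(hsl z hz x hx).1, hc]; rfl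
  · set v := (z ^ m)⁻¹ • u with hv
    have hvu : z ^ m • v = u := smul_inv_smul₀ (hzm z hz) u
    have hIvu : z ^ m • (Complex.I • v) = Complex.I • u := by rw [smul_comm, hvu]
    have d1 : fderiv ℝ (ρ z) ((z ^ m)⁻¹ • x) v = 0 := by rw [(hsl z hz x hx).1, hvu, h1]
    have d3 : fderiv ℝ (ρ z) ((z ^ m)⁻¹ • x) (Complex.I • v) = 0 := by rw [(hsl z hz x hx).1, hIvu, h2]
    obtain ⟨K0, hK0, hK⟩ := h.hypo {(z, (z ^ m)⁻¹ • x)} (by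
      rw [Set.singleton_subset_iff]
      exact ⟨hz, (hpos z hz x hx).ne'⟩) isCompact_singleton
    have := hK _ (Set.mem_singleton _) v (by
      have h3 := lin_dot (fderiv ℝ (ρ z) ((z ^ m)⁻¹ • x)).toLinearMap v
      rw [ContinuousLinearMap.coe_coe, d1, d3] at h3
      have h4 : ∑ j, v j * wderiv (ρ z) ((z ^ m)⁻¹ • x) j = (1 / 2) * dot (fun j => ((fderiv ℝ (ρ z) ((z ^ m)⁻¹ • x) (Pi.single j 1) : ℝ) : ℂ) - Complex.I * ((fderiv ℝ (ρ z) ((z ^ m)⁻¹ • x) (Pi.single j Complex.I) : ℝ) : ℂ)) v := by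
        rw [dot, Finset.mul_sum]
        refine Finset.sum_congr rfl fun j _ => ?_
        rw [wderiv]; ring
      simp only
      rw [h4, h3]; simp)
    rw [(hsl z hz x hx).2, hvu] at this
    refine lt_of_lt_of_le ?_ this
    have : 0 < euclNorm v := by
      refine lt_of_lt_of_le (norm_pos_iff.2 ?_) (norm_le_euclNorm v)
      exact smul_ne_zero (inv_ne_zero (hzm z hz)) hu
    positivity
  · rw [hgc z hz, h.levelR z hz, euclNorm_smul, hcn' z hz, one_mul]
  · rw [hgc z hz]; exact h.aboveR z hz _ (by rwa [euclNorm_smul, hcn' z hz, one_mul])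
  · rw [hQc z hz, euclNorm_smul, hcn z hz, one_mul]; exact h.Ssmall z hz

section
variable {n : ℕ} {ρ : ℝ → ℂ → (Fin n → ℂ) → ℝ} {S : ℝ → ℂ → Fin n → ℂ} {a b : ℝ} (m : ℕ)

theorem Qm_on (hSsm : ContDiffOn ℝ 6 (fun p : ℝ × ℂ => S p.1 p.2) {p : ℝ × ℂ | p.1 ∈ Set.Ioo a b ∧ p.2 ∈ Circ}) :
    ContDiffOn ℝ 6 (fun p : ℝ × ℂ => Qm S m p.1 p.2) {p : ℝ × ℂ | p.1 ∈ Set.Ioo a b ∧ p.2 ≠ 0} := by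
  have hnz : ContDiffOn ℝ 6 (fun p : ℝ × ℂ => nz p.2) {p : ℝ × ℂ | p.1 ∈ Set.Ioo a b ∧ p.2 ≠ 0} := fun p hp =>
    (ContDiffAt.comp (g := nz) (f := fun p : ℝ × ℂ => p.2) p (nz_cd hp.2) contDiffAt_snd).contDiffWithinAt
  have h1 : ContDiffOn ℝ 6 (fun p : ℝ × ℂ => S p.1 (nz p.2)) {p : ℝ × ℂ | p.1 ∈ Set.Ioo a b ∧ p.2 ≠ 0} :=
    hSsm.comp (f := fun p : ℝ × ℂ => (p.1, nz p.2)) (contDiffOn_fst.prodMk hnz) fun p hp => ⟨hp.1, nz_circ hp.2⟩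
  rw [contDiffOn_pi]
  intro j
  exact (hnz.pow m).mul (contDiffOn_pi.1 h1 j)

theorem isOpen_TZ : IsOpen {p : ℝ × ℂ | p.1 ∈ Set.Ioo a b ∧ p.2 ≠ 0} :=
  (isOpen_Ioo.preimage continuous_fst).inter (isOpen_ne.preimage continuous_snd)

theorem Qm_cd (hSsm : ContDiffOn ℝ 6 (fun p : ℝ × ℂ => S p.1 p.2) {p : ℝ × ℂ | p.1 ∈ Set.Ioo a b ∧ p.2 ∈ Circ})
    {τ : ℝ} (hτ : τ ∈ Set.Ioo a b) {z : ℂ} (hz : z ≠ 0) : ContDiffAt ℝ 6 (fun p : ℝ × ℂ => Qm S m p.1 p.2) (τ, z) :=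
  (Qm_on m hSsm).contDiffAt (isOpen_TZ.mem_nhds ⟨hτ, hz⟩)

theorem Gm_cd (hSsm : ContDiffOn ℝ 6 (fun p : ℝ × ℂ => S p.1 p.2) {p : ℝ × ℂ | p.1 ∈ Set.Ioo a b ∧ p.2 ∈ Circ})
    (hsm : ContDiffOn ℝ 6 (fun p : ℝ × ℂ × (Fin n → ℂ) => ρ p.1 p.2.1 p.2.2)
      {p : ℝ × ℂ × (Fin n → ℂ) | p.1 ∈ Set.Ioo a b ∧ p.2.1 ∈ Circ ∧ ρ p.1 p.2.1 p.2.2 ≠ 0})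
    (hcond : ∀ τ ∈ Set.Ioo a b, ∃ R : ℝ, Cond3 n (ρ τ) R (S τ))
    {τ : ℝ} (hτ : τ ∈ Set.Ioo a b) {z : ℂ} (hz : z ≠ 0) {x : Fin n → ℂ} (hx : x ≠ Qm S m τ z) :
    ContDiffAt ℝ 6 (Gm ρ m) (τ, z, x) := by
  set O : Set (ℝ × ℂ × (Fin n → ℂ)) := {q | (q.1 ∈ Set.Ioo a b ∧ q.2.1 ≠ 0) ∧ q.2.2 ≠ Qm S m q.1 q.2.1} with hO
  have hOo : IsOpen O := by
    have : O = {q : ℝ × ℂ × (Fin n → ℂ) | q.1 ∈ Set.Ioo a b ∧ q.2.1 ≠ 0} ∩ (fun q : ℝ × ℂ × (Fin n → ℂ) => q.2.2 - Qm S m q.1 q.2.1) ⁻¹' {0}ᶜ := by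
      ext p; simp [hO, sub_eq_zero]
    rw [this]
    have hc : ContinuousOn (fun q : ℝ × ℂ × (Fin n → ℂ) => Qm S m q.1 q.2.1) {q : ℝ × ℂ × (Fin n → ℂ) | q.1 ∈ Set.Ioo a b ∧ q.2.1 ≠ 0} :=
      (Qm_on m hSsm).continuousOn.comp (f := fun q : ℝ × ℂ × (Fin n → ℂ) => (q.1, q.2.1)) (by fun_prop) fun q hq => hq
    refine ContinuousOn.isOpen_inter_preimage (ContinuousOn.sub (by fun_prop) hc) ?_ isOpen_compl_singleton
    exact isOpen_TZ.preimage (f := fun q : ℝ × ℂ × (Fin n → ℂ) => (q.1, q.2.1)) (by fun_prop)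
  have hG : ContDiffOn ℝ 6 (Gm ρ m) O := by
    refine hsm.comp (f := fun q : ℝ × ℂ × (Fin n → ℂ) => (q.1, sb m q.2)) ?_ ?_
    · intro q hq
      refine ContDiffAt.contDiffWithinAt (contDiffAt_fst.prodMk ?_)
      exact ContDiffAt.comp (g := sb m) (f := fun q : ℝ × ℂ × (Fin n → ℂ) => q.2) q (sb_cd m hq.1.2) contDiffAt_snd
    · intro q hq
      refine ⟨hq.1.1, nz_circ hq.1.2, fun h0 => hq.2 ?_⟩
      obtain ⟨R, hR⟩ := hcond q.1 hq.1.1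
      exact (sb_iff hq.1.2).1 ((hR.Szero _ (nz_circ hq.1.2) _).1 h0)
  exact hG.contDiffAt (hOo.mem_nhds ⟨⟨hτ, hz⟩, hx⟩)

theorem Qm_unif (hSsm : ContDiffOn ℝ 6 (fun p : ℝ × ℂ => S p.1 p.2) {p : ℝ × ℂ | p.1 ∈ Set.Ioo a b ∧ p.2 ∈ Circ})
    {τ : ℝ} (hτ : τ ∈ Set.Ioo a b) {ε : ℝ} (hε : 0 < ε) : ∀ᶠ τ' in nhds τ, ∀ θ, ‖Qm S m τ' (zt θ) - Qm S m τ (zt θ)‖ ≤ ε := by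
  have := (isCompact_univ (X := TT)).eventually_forall_of_forall_eventually (x₀ := τ) (P := fun τ' θ => ‖Qm S m τ' (zt θ) - Qm S m τ (zt θ)‖ ≤ ε) (fun θ _ => ?_)
  · filter_upwards [this] with τ' h θ using h θ (mem_univ _)
  have c1 : ContinuousAt (fun p : ℝ × TT => Qm S m p.1 (zt p.2)) (τ, θ) :=
    ContinuousAt.comp (g := fun p : ℝ × ℂ => Qm S m p.1 p.2) (f := fun p : ℝ × TT => (p.1, zt p.2)) (x := (τ, θ)) (Qm_cd m hSsm hτ (zt_ne θ)).continuousAt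
      (continuous_fst.prodMk (zt_cont.comp continuous_snd)).continuousAt
  have c2 : ContinuousAt (fun p : ℝ × TT => Qm S m τ (zt p.2)) (τ, θ) :=
    ContinuousAt.comp (g := fun p : ℝ × ℂ => Qm S m p.1 p.2) (f := fun p : ℝ × TT => (τ, zt p.2)) (x := (τ, θ)) (Qm_cd m hSsm hτ (zt_ne θ)).continuousAt
      (continuous_const.prodMk (zt_cont.comp continuous_snd)).continuousAt
  have := (c1.sub c2).norm.eventually_lt (continuousAt_const (y := ε)) (by simpa using hε)
  exact this.mono fun p hp => hp.le

theorem Qm_cd1 (hSsm : ContDiffOn ℝ 6 (fun p : ℝ × ℂ => S p.1 p.2) {p : ℝ × ℂ | p.1 ∈ Set.Ioo a b ∧ p.2 ∈ Circ})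
    {τ : ℝ} (hτ : τ ∈ Set.Ioo a b) (θ : TT) : ContDiffAt ℝ 2 (Qm S m τ) (zt θ) := by
  have := ContDiffAt.comp (g := fun p : ℝ × ℂ => Qm S m p.1 p.2) (f := fun z : ℂ => (τ, z)) (zt θ) (Qm_cd m hSsm hτ (zt_ne θ)) (by fun_prop)
  exact this.of_le (by norm_num)

theorem Gm_c0 (hSsm : ContDiffOn ℝ 6 (fun p : ℝ × ℂ => S p.1 p.2) {p : ℝ × ℂ | p.1 ∈ Set.Ioo a b ∧ p.2 ∈ Circ})
    (hsm : ContDiffOn ℝ 6 (fun p : ℝ × ℂ × (Fin n → ℂ) => ρ p.1 p.2.1 p.2.2)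
      {p : ℝ × ℂ × (Fin n → ℂ) | p.1 ∈ Set.Ioo a b ∧ p.2.1 ∈ Circ ∧ ρ p.1 p.2.1 p.2.2 ≠ 0})
    (hcond : ∀ τ ∈ Set.Ioo a b, ∃ R : ℝ, Cond3 n (ρ τ) R (S τ))
    {τ : ℝ} (hτ : τ ∈ Set.Ioo a b) (θ : TT) (hx : (0 : Fin n → ℂ) ≠ Qm S m τ (zt θ)) :
    ContinuousAt (fun τ' => Gm ρ m (τ', zt θ, 0)) τ :=
  ContinuousAt.comp (g := Gm ρ m) (f := fun τ' : ℝ => (τ', zt θ, (0 : Fin n → ℂ))) (x := τ) (Gm_cd m hSsm hsm hcond hτ (zt_ne θ) hx).continuousAt (by fun_prop)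

end

theorem bdry_of_memA {n : ℕ} {f : ℂ → Fin n → ℂ} (hf : MemAV f) : IsBdryVal f f := by
  refine Eventually.of_forall fun θ => ?_
  have hw : ‖Complex.exp (θ * Complex.I)‖ = 1 := by simp [Complex.norm_exp]
  set w := Complex.exp (θ * Complex.I)
  rw [tendsto_pi_nhds]
  intro j
  have hmem : w ∈ Disk := by simp [Disk, hw]
  have h1 := (hf j).1 w hmem
  refine h1.tendsto.comp (tendsto_nhdsWithin_iff.2 ⟨?_, ?_⟩)
  · have : Tendsto (fun r : ℝ => (r : ℂ) * w) (nhds 1) (nhds (((1 : ℝ) : ℂ) * w)) :=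
      Continuous.tendsto (by fun_prop) 1
    rw [Complex.ofReal_one, one_mul] at this
    exact this.mono_left nhdsWithin_le_nhds
  · have : ∀ᶠ r : ℝ in nhdsWithin 1 (Set.Iio 1), 0 < r := nhdsWithin_le_nhds (lt_mem_nhds one_pos)
    filter_upwards [this, self_mem_nhdsWithin] with r h0 h1
    rw [Disk, mem_closedBall_zero_iff, norm_mul, hw, mul_one, Complex.norm_real, Real.norm_eq_abs, abs_of_pos h0]
    exact le_of_lt h1

theorem memHinf_of_memA {n : ℕ} {f : ℂ → Fin n → ℂ} (hf : MemAV f) : MemHinfV f := by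
  intro j
  refine ⟨(hf j).2, ?_⟩
  obtain ⟨M, hM⟩ := (isCompact_closedBall (0 : ℂ) 1).exists_bound_of_continuousOn (hf j).1
  exact ⟨M, fun z hz => hM z (ball_subset_closedBall hz)⟩

theorem exp_circ (θ : ℝ) : Complex.exp (θ * Complex.I) ∈ Circ := by
  simp [Circ, Complex.norm_exp]

theorem gamma_le_delta {n : ℕ} {ρ : ℂ → (Fin n → ℂ) → ℝ} (h0 : ∀ z ∈ Circ, ∀ w, 0 ≤ ρ z w) (hd : 0 < deltaRho ρ) :
    gammaRho ρ ≤ deltaRho ρ := by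
  have hne : {c : ℝ | ∃ f : ℂ → Fin n → ℂ, MemAV f ∧ ∀ z ∈ Circ, ρ z (f z) ≤ c}.Nonempty := by
    rw [Set.nonempty_iff_ne_empty]
    intro h
    rw [deltaRho, h, Real.sInf_empty] at hd
    exact lt_irrefl _ hd
  refine le_csInf hne ?_
  rintro c ⟨f, hf, hc⟩
  refine csInf_le ⟨0, ?_⟩ ⟨f, f, memHinf_of_memA hf, bdry_of_memA hf, Eventually.of_forall fun θ => hc _ (exp_circ θ)⟩
  rintro c ⟨f, fb, -, -, hc⟩
  have : NeBot (ae (volume.restrict (Set.Ioc (0:ℝ) (2 * Real.pi)))) := by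
    rw [ae_neBot]
    intro h
    rw [Measure.restrict_eq_zero, Real.volume_Ioc] at h
    have := Real.pi_pos
    simp at h
    linarith
  obtain ⟨θ, hθ⟩ := hc.exists
  exact (h0 _ (exp_circ θ) _).trans hθ

theorem delta_le {n : ℕ} {ρ : ℂ → (Fin n → ℂ) → ℝ} (h0 : ∀ z ∈ Circ, ∀ w, 0 ≤ ρ z w) {f : ℂ → Fin n → ℂ} (hf : MemAV f)
    {c : ℝ} (hc : ∀ z ∈ Circ, ρ z (f z) ≤ c) : deltaRho ρ ≤ c := by
  refine csInf_le ⟨0, ?_⟩ ⟨f, hf, hc⟩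
  rintro c ⟨f, -, hc⟩
  exact (h0 1 (by simp [Circ]) _).trans (hc 1 (by simp [Circ]))

theorem delta_nonneg {n : ℕ} {ρ : ℂ → (Fin n → ℂ) → ℝ} (h0 : ∀ z ∈ Circ, ∀ w, 0 ≤ ρ z w) : 0 ≤ deltaRho ρ := by
  refine Real.sInf_nonneg ?_
  rintro c ⟨f, -, hc⟩
  exact (h0 1 (by simp [Circ]) _).trans (hc 1 (by simp [Circ]))

theorem MemA.dslope {f : ℂ → ℂ} (hf : MemA f) : MemA (dslope f 0) := by
  have hd : DifferentiableOn ℂ (_root_.dslope f 0) (ball (0:ℂ) 1) :=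
    (Complex.differentiableOn_dslope (isOpen_ball.mem_nhds (by simp))).2 hf.2
  refine ⟨?_, hd⟩
  exact (continuousOn_dslope (closedBall_mem_nhds 0 one_pos)).2
    ⟨hf.1, hf.2.differentiableAt (isOpen_ball.mem_nhds (by simp))⟩

section
variable {n : ℕ} {ρ : ℂ → (Fin n → ℂ) → ℝ} {S : ℂ → Fin n → ℂ} {R : ℝ} {m : ℕ}

theorem extr_at (hc : Cond3 n ρ R S) (hm : 1 ≤ m) (hlt : deltaRho (rhoShift ρ m) < deltaRho ρ)
    (hleast : ∀ k : ℕ, 0 < k → k < m → ¬ deltaRho (rhoShift ρ k) < deltaRho ρ)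
    (hSm : BoundaryAnalytic (fun z => fun j => z ^ m * S z j))
    {H : ℂ → Fin n → ℂ} (hH : MemHinfV H ∧ ContinuousOn H Disk ∧ ∀ z ∈ Circ, ρ z (H z) ≤ gammaRho ρ) :
    Extr (fun p => ρ (nz p.1) (fun j => p.2 j / nz p.1 ^ m)) (fun z j => nz z ^ m * S (nz z) j) R
      (fun θ j => zt θ ^ m * H (zt θ) j) (gammaRho ρ) := by
  have hf := fib_of hc m
  have hs0 : ∀ k, ∀ z ∈ Circ, ∀ w, 0 ≤ rhoShift ρ k z w := fun k z hz w => hc.nonneg z hz _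
  have hHA : MemAV H := fun j => ⟨(continuousOn_pi.1 hH.2.1) j, (hH.1 j).1⟩
  have hd0 : 0 < deltaRho ρ := (delta_nonneg (hs0 m)).trans_lt hlt
  have hdg : deltaRho ρ ≤ gammaRho ρ := delta_le hc.nonneg hHA hH.2.2
  have hgd := gamma_le_delta hc.nonneg hd0
  have hγ : 0 < gammaRho ρ := hd0.trans_le hdg
  have hds : deltaRho ρ ≤ deltaRho (rhoShift ρ (m - 1)) := by
    rcases Nat.lt_or_ge 1 m with h | h
    · exact not_lt.1 (hleast (m - 1) (by omega) (by omega))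
    · have : m - 1 = 0 := by omega
      rw [this]
      have : rhoShift ρ 0 = ρ := by ext z w; simp [rhoShift]
      rw [this]
  set g : ℂ × (Fin n → ℂ) → ℝ := fun p => ρ (nz p.1) (fun j => p.2 j / nz p.1 ^ m) with hg
  set X : ℂ → Fin n → ℂ := fun z j => z ^ m * H z j with hX
  have hXA : MemAV X := fun j => (MemA.pow m).mul (hHA j)
  have hX0 : X 0 = 0 := by ext j; simp [hX, show m ≠ 0 by omega]
  have hle : ∀ z ∈ Circ, g (z, X z) ≤ gammaRho ρ := by
    intro z hz
    have h1 := hH.2.2 z hz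
    have : g (z, X z) = ρ z (H z) := by
      simp only [hg, hX, nz_eq hz]
      congr 1; ext j
      exact mul_div_cancel_left₀ _ (pow_ne_zero m (circ_ne hz))
    rw [this]; exact h1
  have hmin : ∀ Y : ℂ → Fin n → ℂ, MemAV Y → Y 0 = 0 → ∀ t, (∀ z ∈ Circ, g (z, Y z) ≤ t) → gammaRho ρ ≤ t := by
    intro Y hY hY0 t ht
    refine hgd.trans (hds.trans ?_)
    refine delta_le (hs0 _) (f := fun z j => dslope (fun z => Y z j) 0 z) (fun j => (hY j).dslope) ?_
    intro z hz
    refine le_trans (le_of_eq ?_) (ht z hz)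
    simp only [hg, rhoShift, nz_eq hz]
    congr 1; ext j
    have hz0 := circ_ne hz
    rw [dslope_of_ne _ hz0, slope_def_field]
    simp only [hY0, Pi.zero_apply, sub_zero]
    rw [div_div, ← pow_succ']
    congr 2; omega
  have hγR : gammaRho ρ < R := by
    have hcg : ContinuousOn (fun z => g (z, (0 : Fin n → ℂ))) Circ :=
      hf.cont.comp (f := fun z : ℂ => (z, (0 : Fin n → ℂ))) (by fun_prop) fun z hz => circ_ne hz
    obtain ⟨z1, hz1, hmx⟩ := (isCompact_sphere (0 : ℂ) 1).exists_isMaxOn (f := fun z => g (z, (0 : Fin n → ℂ))) ⟨1, by simp⟩ hcg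
    refine (hmin (fun _ => 0) (fun j => MemA.const 0) rfl (g (z1, 0)) fun z hz => hmx hz).trans_lt (hf.g_lt hz1 ?_)
    simpa [euclNorm] using hf.Rpos
  obtain ⟨Qa, hQa, hQQ⟩ := hSm
  have hQQ' : ∀ z ∈ Circ, Qa z = (fun z j => nz z ^ m * S (nz z) j : ℂ → Fin n → ℂ) z := by
    intro z hz
    rw [hQQ z hz]; simp only [nz_eq hz]
  obtain ⟨hlev, hpsi⟩ := hf.necessity (by have := hc.hn; omega) hXA hX0 hγ hγR hQa hQQ' hle hmin
  exact
    { fib := hf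
      gpos := hγ
      gR := hγR
      xH := fun i => (hXA i).inH
      x0 := fun i => by
        have := (hXA i).mean
        rw [show X 0 i = 0 by rw [hX0]; rfl] at this
        exact this
      QH := fun i => by
        have := (hQa i).inH
        have h2 : (fun θ => Qa (zt θ) i) = fun θ => nz (zt θ) ^ m * S (nz (zt θ)) i := by
          ext θ; rw [hQQ' _ (zt_circ θ)]
        rw [h2] at this
        exact this
      lev := hlev
      psiH := hpsi }

end

/-- weights of the coefficient map -/
def wgt (m : ℕ) (k : ℤ) : ℂ :=
  if 1 ≤ k + m then (Real.sqrt (1 + (k:ℝ)^2) : ℂ) * (Complex.I * ((k + m : ℤ) : ℂ))⁻¹ else 0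

theorem wgt_bd (m : ℕ) (k : ℤ) : ‖wgt m k‖ ≤ m + 2 := by
  unfold wgt
  split_ifs with h
  · have h1 : (1 : ℝ) ≤ ((k + m : ℤ) : ℝ) := by exact_mod_cast h
    rw [norm_mul, norm_inv, norm_mul, Complex.norm_I, one_mul, Complex.norm_real, Complex.norm_intCast, abs_of_pos (by linarith),
      Real.norm_eq_abs, abs_of_nonneg (Real.sqrt_nonneg _), ← div_eq_mul_inv, div_le_iff₀ (by linarith)]
    have h2 : Real.sqrt (1 + (k:ℝ)^2) ≤ 1 + |(k:ℝ)| := by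
      rw [Real.sqrt_le_left (by positivity)]
      nlinarith [abs_nonneg (k:ℝ), sq_abs (k:ℝ)]
    have h3 : |(k:ℝ)| ≤ ((k + m : ℤ) : ℝ) + m := by
      push_cast at h1 ⊢
      have : (0:ℝ) ≤ m := Nat.cast_nonneg m
      rw [abs_le]; constructor <;> linarith
    have : (0:ℝ) ≤ m := Nat.cast_nonneg m
    nlinarith
  · simp; positivity

/-- the coefficient map -/
def Phi {n : ℕ} (m : ℕ) (j : Fin n) : VV n →L[ℂ] Seq2 :=
  lpMul (fun k : ℤ => (j, (k + m - 1).toNat)) (wgt m) (m + 2) (wgt_bd m) (by positivity) (by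
    intro k k' h h' he
    have h1 : 1 ≤ k + m := by by_contra hh; exact h (by simp [wgt, hh])
    have h2 : 1 ≤ k' + m := by by_contra hh; exact h' (by simp [wgt, hh])
    simp only [Prod.mk.injEq, true_and] at he
    omega)

theorem rep_Phi {n : ℕ} (m : ℕ) (a : VV n) (H : ℂ → Fin n → ℂ) (h : ∀ θ j, zt θ ^ m * H (zt θ) j = T1 n a θ j) (j : Fin n) :
    RepOf (Phi m j a) fun z => H z j := by
  intro k
  have h1 : bCoeff (fun z => H z j) k = fcC j (k + m) (T1 n a) := by
    rw [bCoeff_eq, fcC_apply]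
    have : (fun θ => T1 n a θ j) = fun θ => zt θ ^ (m : ℤ) * H (zt θ) j := by
      ext θ; rw [← h θ j, zpow_natCast]
    rw [this, fc_zt_mul (fun θ => H (zt θ) j)]
    congr 1; ring
  have h2 : (Phi m j a : ∀ _ : ℤ, ℂ) k = wgt m k * a (j, (k + m - 1).toNat) := lpMul_apply _ _ _ _ _ _ _ _
  rw [h1, h2]
  by_cases hk : 1 ≤ k + m
  · obtain ⟨l, hl⟩ : ∃ l : ℕ, k + m = l + 1 := ⟨(k + m - 1).toNat, by omega⟩
    rw [wgt, if_pos hk, hl, fc_T1, show ((l : ℤ) + 1 - 1).toNat = l by omega]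
    push_cast; ring
  · rw [fc_T1_zero _ _ _ (by omega), wgt, if_neg hk]; simp

theorem rep_unique {a b : Seq2} {f : ℂ → ℂ} (ha : RepOf a f) (hb : RepOf b f) : a = b := by
  ext k; rw [ha k, hb k]

theorem main_local {n : ℕ} (ρ : ℝ → ℂ → (Fin n → ℂ) → ℝ) (S : ℝ → ℂ → Fin n → ℂ)
    (a b : ℝ)
    (hsm : ContDiffOn ℝ 6 (fun p : ℝ × ℂ × (Fin n → ℂ) => ρ p.1 p.2.1 p.2.2)
      {p : ℝ × ℂ × (Fin n → ℂ) | p.1 ∈ Set.Ioo a b ∧ p.2.1 ∈ Circ ∧ ρ p.1 p.2.1 p.2.2 ≠ 0})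
    (hSsm : ContDiffOn ℝ 6 (fun p : ℝ × ℂ => S p.1 p.2)
      {p : ℝ × ℂ | p.1 ∈ Set.Ioo a b ∧ p.2 ∈ Circ})
    (hcond : ∀ τ ∈ Set.Ioo a b, ∃ R : ℝ, Cond3 n (ρ τ) R (S τ))
    (m : ℕ) (hm : 1 ≤ m)
    (hlt : ∀ τ ∈ Set.Ioo a b, deltaRho (rhoShift (ρ τ) m) < deltaRho (ρ τ))
    (hleast : ∀ τ ∈ Set.Ioo a b, ∀ k : ℕ, 0 < k → k < m →
      ¬ deltaRho (rhoShift (ρ τ) k) < deltaRho (ρ τ))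
    (hSm : ∀ τ ∈ Set.Ioo a b, BoundaryAnalytic (fun z => fun j => z ^ m * S τ z j))
    (H : ℝ → ℂ → Fin n → ℂ)
    (hH : ∀ τ ∈ Set.Ioo a b, MemHinfV (H τ) ∧ ContinuousOn (H τ) Disk ∧
      ∀ z ∈ Circ, ρ τ z (H τ z) ≤ gammaRho (ρ τ)) (τ0 : ℝ) (hτ0 : τ0 ∈ Set.Ioo a b) :
    ∃ A : ℝ → VV n, ContDiffAt ℝ 1 A τ0 ∧ ContDiffAt ℝ 1 (fun τ => gammaRho (ρ τ)) τ0 ∧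
      ∀ᶠ τ in nhds τ0, ∀ j, RepOf (Phi m j (A τ)) fun z => H τ z j := by
  set Rf : ℝ → ℝ := fun τ => if h : τ ∈ Set.Ioo a b then (hcond τ h).choose else 0 with hRf
  have hR : ∀ τ ∈ Set.Ioo a b, Cond3 n (ρ τ) (Rf τ) (S τ) := by
    intro τ hτ
    simp only [hRf, dif_pos hτ]
    exact (hcond τ hτ).choose_spec
  have hE : ∀ τ ∈ Set.Ioo a b, Extr (fun p => Gm ρ m (τ, p)) (Qm S m τ) (Rf τ) (fun θ j => zt θ ^ m * H τ (zt θ) j) (gammaRho (ρ τ)) :=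
    fun τ hτ => extr_at (hR τ hτ) hm (hlt τ hτ) (hleast τ hτ) (hSm τ hτ) (hH τ hτ)
  have hI : ∀ᶠ τ in nhds τ0, τ ∈ Set.Ioo a b := isOpen_Ioo.mem_nhds hτ0
  have hE0 := hE τ0 hτ0
  obtain ⟨A, t, hA, ht, hAt⟩ := persist (G := Gm ρ m) (Qf := Qm S m) (Rf := Rf) hE0
    (fun θ => Gm_cd m hSsm hsm hcond hτ0 (zt_ne θ) (fun h => by
      have h1 := hE0.lev θ
      have h2 := (hE0.fib.zero _ (zt_circ θ) _).2 h
      have h3 := hE0.gpos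
      rw [h2] at h1
      exact h3.ne h1))
    (fun θ => Qm_cd1 m hSsm hτ0 θ)
    (hI.mono fun τ hτ => ⟨(hE τ hτ).fib, (hE τ hτ).QH, (hR τ hτ).hR⟩)
    (fun ε hε => Qm_unif m hSsm hτ0 hε)
    (fun θ h => Gm_c0 m hSsm hsm hcond hτ0 θ h)
  have hkey : ∀ᶠ τ in nhds τ0, (∀ θ j, zt θ ^ m * H τ (zt θ) j = T1 n (A τ) θ j) ∧ gammaRho (ρ τ) = t τ := by
    filter_upwards [hI, hAt] with τ hτ h1
    have h2 := hE τ hτ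
    have h3 : ∀ θ, (fun j => zt θ ^ m * H τ (zt θ) j) = T1 n (A τ) θ := by
      rcases le_total (gammaRho (ρ τ)) (t τ) with hle | hle
      · exact h1.unique h2.xH h2.x0 fun θ => (h2.lev θ).le.trans hle
      · intro θ
        exact (h2.unique h1.xH h1.x0 (fun θ => (h1.lev θ).le.trans hle) θ).symm
    refine ⟨fun θ j => congrFun (h3 θ) j, ?_⟩
    have h4 := h2.lev 0
    have h5 := h1.lev 0
    rw [h3 0] at h4
    exact h4.symm.trans h5
  refine ⟨A, hA, ht.congr_of_eventuallyEq (hkey.mono fun τ h => h.2), hkey.mono fun τ h j => rep_Phi m (A τ) (H τ) h.1 j⟩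

/-- Theorem 4 (smooth dependence on a parameter). -/
theorem statement7 {n : ℕ} (ρ : ℝ → ℂ → (Fin n → ℂ) → ℝ) (S : ℝ → ℂ → Fin n → ℂ)
    (a b : ℝ)
    (hsm : ContDiffOn ℝ 6 (fun p : ℝ × ℂ × (Fin n → ℂ) => ρ p.1 p.2.1 p.2.2)
      {p : ℝ × ℂ × (Fin n → ℂ) | p.1 ∈ Set.Ioo a b ∧ p.2.1 ∈ Circ ∧ ρ p.1 p.2.1 p.2.2 ≠ 0})
    (hSsm : ContDiffOn ℝ 6 (fun p : ℝ × ℂ => S p.1 p.2)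
      {p : ℝ × ℂ | p.1 ∈ Set.Ioo a b ∧ p.2 ∈ Circ})
    (hcond : ∀ τ ∈ Set.Ioo a b, ∃ R : ℝ, Cond3 n (ρ τ) R (S τ))
    (m : ℕ) (hm : 1 ≤ m)
    (hlt : ∀ τ ∈ Set.Ioo a b, deltaRho (rhoShift (ρ τ) m) < deltaRho (ρ τ))
    (hleast : ∀ τ ∈ Set.Ioo a b, ∀ k : ℕ, 0 < k → k < m →
      ¬ deltaRho (rhoShift (ρ τ) k) < deltaRho (ρ τ))
    (hSm : ∀ τ ∈ Set.Ioo a b, BoundaryAnalytic (fun z => fun j => z ^ m * S τ z j))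
    (hSm1 : ∀ τ ∈ Set.Ioo a b, ¬ BoundaryAnalytic (fun z => fun j => z ^ (m-1) * S τ z j))
    (H : ℝ → ℂ → Fin n → ℂ)
    (hH : ∀ τ ∈ Set.Ioo a b, MemHinfV (H τ) ∧ ContinuousOn (H τ) Disk ∧
      ∀ z ∈ Circ, ρ τ z (H τ z) ≤ gammaRho (ρ τ)) :
    (∃ Hc : ℝ → Fin n → Seq2, ContDiffOn ℝ 1 Hc (Set.Ioo a b) ∧
      ∀ τ ∈ Set.Ioo a b, ∀ j, RepOf (Hc τ j) fun z => H τ z j) ∧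
    ContDiffOn ℝ 1 (fun τ => gammaRho (ρ τ)) (Set.Ioo a b) := by
  have hloc := main_local ρ S a b hsm hSsm hcond m hm hlt hleast hSm H hH
  refine ⟨?_, fun τ hτ => (hloc τ hτ).choose_spec.2.1.contDiffWithinAt⟩
  set Hc : ℝ → Fin n → Seq2 := fun τ j => if h : τ ∈ Set.Ioo a b then Phi m j ((hloc τ h).choose τ) else 0 with hHc
  have hrep : ∀ τ ∈ Set.Ioo a b, ∀ j, RepOf (Hc τ j) fun z => H τ z j := by
    intro τ hτ j
    simp only [hHc, dif_pos hτ]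
    exact (hloc τ hτ).choose_spec.2.2.self_of_nhds j
  refine ⟨Hc, fun τ0 hτ0 => ContDiffAt.contDiffWithinAt ?_, hrep⟩
  obtain ⟨A, hA, -, hAr⟩ := hloc τ0 hτ0
  rw [contDiffAt_pi]
  intro j
  have h1 : ContDiffAt ℝ 1 (fun τ => ((Phi m j).restrictScalars ℝ) (A τ)) τ0 :=
    ContDiffAt.continuousLinearMap_comp _ hA
  refine h1.congr_of_eventuallyEq ?_
  filter_upwards [hAr, isOpen_Ioo.mem_nhds hτ0] with τ h hτ
  exact rep_unique (hrep τ hτ j) (h j)
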